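/- For every integer r ≥ 4, let H_{2r}^{M_2^r} denote the expansion of the r-uniform matching M_2^r of size two. There exist constants N_0 and c = c(r) > 0 such that for all integers n ≥ N_0 and all integers t with 0 ≤ t ≤ c·n, one has EX(n,(t+1)H_{2r}^{M_2^r}) = { K_t^r ⋈ S_r(n−t) }. -/

import Mathlib

open Filter

namespace DensityCH

/-- An `r`-uniform hypergraph with vertices in `ℕ`:
a finite vertex set together with a set of `r`-element edges. -/
structure HGraph (r : ℕ) where
  verts : Finset ℕ
  edges : Finset (Finset ℕ)
  edges_sub : ∀ e ∈ edges, e ⊆ verts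
  edges_card : ∀ e ∈ edges, e.card = r

namespace HGraph

/-- Build an `r`-graph from a vertex set and a set of candidate edges,
keeping exactly the well-formed candidates. -/
def ofEdges (r : ℕ) (V : Finset ℕ) (E : Finset (Finset ℕ)) : HGraph r where
  verts := V
  edges := E.filter fun e => e ⊆ V ∧ e.card = r
  edges_sub := fun e he => ((Finset.mem_filter.mp he).2).1
  edges_card := fun e he => ((Finset.mem_filter.mp he).2).2

variable {r : ℕ}

/-- `H` contains a copy of `F`, i.e. a subgraph isomorphic to `F`. -/
def IsCopyIn (F H : HGraph r) : Prop :=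
  ∃ f : ℕ → ℕ, Set.InjOn f ↑F.verts ∧ (∀ v ∈ F.verts, f v ∈ H.verts) ∧
    ∀ e ∈ F.edges, e.image f ∈ H.edges

/-- The subgraph of `H` induced on `S`. -/
def induce (H : HGraph r) (S : Finset ℕ) : HGraph r :=
  ofEdges r (H.verts ∩ S) (H.edges.filter fun e => e ⊆ S)

/-- Delete a vertex from `H`. -/
def deleteVert (H : HGraph r) (v : ℕ) : HGraph r :=
  ofEdges r (H.verts.erase v) (H.edges.filter fun e => v ∉ e)

/-- The degree of a vertex. -/
def deg (H : HGraph r) (v : ℕ) : ℕ := (H.edges.filter fun e => v ∈ e).card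

/-- The maximum degree `Δ(H)`. -/
def maxDeg (H : HGraph r) : ℕ := H.verts.sup H.deg

/-- The minimum degree `δ(H)`. -/
def minDeg (H : HGraph r) : ℕ :=
  if h : H.verts.Nonempty then H.verts.inf' h H.deg else 0

/-- The average degree `d(H) = r·|E(H)|/|V(H)|`. -/
noncomputable def avgDeg (H : HGraph r) : ℝ :=
  (r : ℝ) * (H.edges.card : ℝ) / (H.verts.card : ℝ)

/-- `H` contains `k` pairwise vertex-disjoint copies of `F`, i.e. `ν(F,H) ≥ k`. -/
def HasMatching (F H : HGraph r) (k : ℕ) : Prop :=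
  ∃ S : Fin k → Finset ℕ,
    (∀ i, S i ⊆ H.verts ∧ (S i).card = F.verts.card) ∧
    (∀ i j, i ≠ j → Disjoint (S i) (S j)) ∧
    ∀ i, F.IsCopyIn (H.induce (S i))

/-- Isomorphism of hypergraphs. -/
def Iso (G H : HGraph r) : Prop :=
  ∃ f : ℕ → ℕ, Set.BijOn f ↑G.verts ↑H.verts ∧
    ∀ e ∈ Finset.powersetCard r G.verts, (e ∈ G.edges ↔ e.image f ∈ H.edges)

/-- The join `G ⋈ H`: all edges of `G`, all edges of `H`, and all `r`-sets meeting
both vertex sets. -/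
def join (G H : HGraph r) : HGraph r :=
  ofEdges r (G.verts ∪ H.verts)
    (G.edges ∪ H.edges ∪ ((Finset.powersetCard r (G.verts ∪ H.verts)).filter
      fun e => (e ∩ G.verts).Nonempty ∧ (e ∩ H.verts).Nonempty))

end HGraph

/-- The complete `r`-graph on a vertex set `S`. -/
def completeOn (r : ℕ) (S : Finset ℕ) : HGraph r :=
  HGraph.ofEdges r S (Finset.powersetCard r S)

/-- The `r`-graph on `V` with no edges. -/
def emptyOn (r : ℕ) (V : Finset ℕ) : HGraph r := HGraph.ofEdges r V ∅

/-- The Turán number `ex(n,F)`. -/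
noncomputable def exN (r n : ℕ) (F : HGraph r) : ℕ :=
  sSup {m | ∃ H : HGraph r, H.verts.card = n ∧ ¬ F.IsCopyIn H ∧ H.edges.card = m}

/-- `d(n,F) = r·ex(n,F)/n`. -/
noncomputable def dN (r n : ℕ) (F : HGraph r) : ℝ := (r : ℝ) * (exN r n F : ℝ) / (n : ℝ)

/-- `δ(n,F) = ex(n,F) − ex(n−1,F)` (as a real number). -/
noncomputable def deltaN (r n : ℕ) (F : HGraph r) : ℝ := (exN r n F : ℝ) - (exN r (n-1) F : ℝ)

/-- `x` is the Turán density `π(F)`, i.e. the limit of `ex(n,F)/C(n,r)`. -/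
def HasTuranDensity (r : ℕ) (F : HGraph r) (x : ℝ) : Prop :=
  Tendsto (fun n : ℕ => (exN r n F : ℝ) / (n.choose r : ℝ)) atTop (nhds x)

/-- `ex(n,(t+1)F)`: the maximum number of edges of an `n`-vertex `r`-graph with no
`t+1` pairwise vertex-disjoint copies of `F`. -/
noncomputable def exMatchN (r n t : ℕ) (F : HGraph r) : ℕ :=
  sSup {m | ∃ H : HGraph r, H.verts.card = n ∧ ¬ F.HasMatching H (t+1) ∧ H.edges.card = m}

/-- `H ∈ EX(n,F)`. -/
def IsExtremalFree (r n : ℕ) (F H : HGraph r) : Prop :=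
  H.verts.card = n ∧ ¬ F.IsCopyIn H ∧ H.edges.card = exN r n F

/-- `H ∈ EX(n,(t+1)F)`. -/
def IsExtremalMatchingFree (r n t : ℕ) (F H : HGraph r) : Prop :=
  H.verts.card = n ∧ ¬ F.HasMatching H (t+1) ∧ H.edges.card = exMatchN r n t F

/-- `F` is `(f1, f2)`-bounded at `n`. -/
def BoundedAt (r n : ℕ) (F : HGraph r) (f1 f2 : ℝ) : Prop :=
  ∀ H : HGraph r, H.verts.card = n → ¬ F.IsCopyIn H →
    dN r n F - f1 ≤ H.avgDeg → (H.maxDeg : ℝ) ≤ dN r n F + f2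

/-- `ex(·,F)` is `g`-smooth at `n`: `|δ(n,F) − d(n−1,F)| ≤ g(n)`. -/
def SmoothAt (r n : ℕ) (F : HGraph r) (g : ℝ) : Prop :=
  |deltaN r n F - dN r (n-1) F| ≤ g

/-- The collection `H 0, …, H t` (on a common vertex set) has a rainbow `F`-matching. -/
def HasRainbowMatching (r t : ℕ) (F : HGraph r) (H : Fin (t+1) → HGraph r) : Prop :=
  ∃ S : Fin (t+1) → Finset ℕ,
    (∀ i, S i ⊆ (H i).verts ∧ (S i).card = F.verts.card) ∧
    (∀ i j, i ≠ j → Disjoint (S i) (S j)) ∧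
    ∀ i, F.IsCopyIn ((H i).induce (S i))

/-!  Patterns -/

/-- An `r`-uniform pattern: a finite index set together with a collection of
`r`-multisets on it. -/
structure Pattern (r : ℕ) where
  idx : Finset ℕ
  mE : Finset (Multiset ℕ)
  card_eq : ∀ s ∈ mE, Multiset.card s = r
  mem_idx : ∀ s ∈ mE, ∀ i ∈ s, i ∈ idx

namespace Pattern

variable {r : ℕ}

/-- The pattern `P − i`. -/
def erase (P : Pattern r) (i : ℕ) : Pattern r where
  idx := P.idx.erase i
  mE := P.mE.filter fun s => i ∉ s
  card_eq := fun s hs => P.card_eq s (Finset.mem_filter.mp hs).1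
  mem_idx := by
    intro s hs j hj
    have h1 := Finset.mem_filter.mp hs
    refine Finset.mem_erase.mpr ⟨?_, P.mem_idx s h1.1 j hj⟩
    rintro rfl
    exact h1.2 hj

/-- `H` is a `P`-construction: a blowup of the pattern `P`. -/
def IsConstruction (P : Pattern r) (H : HGraph r) : Prop :=
  ∃ part : ℕ → ℕ, (∀ v ∈ H.verts, part v ∈ P.idx) ∧
    ∀ e : Finset ℕ, e ∈ H.edges ↔ (e ⊆ H.verts ∧ e.card = r ∧ Multiset.map part e.val ∈ P.mE)

/-- `H` is a `P`-subconstruction: a subgraph of a `P`-construction. -/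
def IsSubconstruction (P : Pattern r) (H : HGraph r) : Prop :=
  ∃ G : HGraph r, P.IsConstruction G ∧ H.verts ⊆ G.verts ∧ H.edges ⊆ G.edges

end Pattern

/-- `Λ(P,n)`: the maximum number of edges of an `n`-vertex `P`-construction. -/
noncomputable def patEx (r : ℕ) (P : Pattern r) (n : ℕ) : ℕ :=
  sSup {m | ∃ H : HGraph r, P.IsConstruction H ∧ H.verts.card = n ∧ H.edges.card = m}

/-- The Lagrangian `λ(P) = lim Λ(P,n)/C(n,r)`. -/
noncomputable def patLagrangian (r : ℕ) (P : Pattern r) : ℝ :=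
  limUnder atTop fun n : ℕ => (patEx r P n : ℝ) / (n.choose r : ℝ)

/-- The pattern `P` is minimal: `λ(P−i) < λ(P)` for all `i`. -/
def Pattern.Minimal {r : ℕ} (P : Pattern r) : Prop :=
  ∀ i ∈ P.idx, patLagrangian r (P.erase i) < patLagrangian r P

/-- `(F,P)` is a Turán pair. -/
def IsTuranPair (r : ℕ) (F : HGraph r) (P : Pattern r) : Prop :=
  (∀ H : HGraph r, P.IsConstruction H → ¬ F.IsCopyIn H) ∧
  (∀ H : HGraph r, ¬ F.IsCopyIn H → H.edges.card = exN r H.verts.card F →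
    P.IsConstruction H)

/-- `F` is edge-stable with respect to `P` (with Turán density `π`). -/
def EdgeStable (r : ℕ) (F : HGraph r) (P : Pattern r) (π : ℝ) : Prop :=
  ∀ δ : ℝ, 0 < δ → ∃ N₀ : ℕ, ∃ ζ : ℝ, 0 < ζ ∧
    ∀ H : HGraph r, N₀ ≤ H.verts.card → ¬ F.IsCopyIn H →
      (π - ζ) * (H.verts.card.choose r : ℝ) ≤ (H.edges.card : ℝ) →
      ∃ H' : HGraph r, H'.verts ⊆ H.verts ∧ H'.edges ⊆ H.edges ∧
        (π - δ) * (H.verts.card.choose r : ℝ) ≤ (H'.edges.card : ℝ) ∧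
        P.IsSubconstruction H'

/-- `F` is weakly vertex-extendable with respect to `P` (with Turán density `π`). -/
def WeaklyVertexExtendable (r : ℕ) (F : HGraph r) (P : Pattern r) (π : ℝ) : Prop :=
  ∀ δ : ℝ, 0 < δ → ∃ N₀ : ℕ, ∃ ζ : ℝ, 0 < ζ ∧
    ∀ H : HGraph r, N₀ ≤ H.verts.card → ¬ F.IsCopyIn H →
      (π - ζ) * (((H.verts.card - 1).choose (r-1) : ℕ) : ℝ) ≤ (H.minDeg : ℝ) →
      ∀ v ∈ H.verts, P.IsSubconstruction (H.deleteVert v) →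
        (H.deg v : ℝ) ≤ (π + δ) * (((H.verts.card - 1).choose (r-1) : ℕ) : ℝ)

/-- `F` is degree-stable with respect to `P` (with Turán density `π`). -/
def DegreeStable (r : ℕ) (F : HGraph r) (P : Pattern r) (π : ℝ) : Prop :=
  ∃ ζ : ℝ, 0 < ζ ∧ ∃ N₀ : ℕ,
    ∀ H : HGraph r, N₀ ≤ H.verts.card → ¬ F.IsCopyIn H →
      (π - ζ) * (((H.verts.card - 1).choose (r-1) : ℕ) : ℝ) ≤ (H.minDeg : ℝ) →
      P.IsSubconstruction H

/-!  Concrete constructions -/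

/-- The generalized Turán graph `T_r(·,ℓ)` on vertex set `V` (parts are residue
classes mod `ℓ`; on an interval these are balanced). -/
def turanOn (r ℓ : ℕ) (V : Finset ℕ) : HGraph r :=
  HGraph.ofEdges r V ((Finset.powersetCard r V).filter
    fun e => ∀ u ∈ e, ∀ v ∈ e, u % ℓ = v % ℓ → u = v)

/-- The `r`-graph on `V₁ ∪ V₂` whose edges are all `r`-sets meeting both parts. -/
def crossOn (r : ℕ) (V₁ V₂ : Finset ℕ) : HGraph r :=
  HGraph.ofEdges r (V₁ ∪ V₂) ((Finset.powersetCard r (V₁ ∪ V₂)).filter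
    fun e => (e ∩ V₁).Nonempty ∧ (e ∩ V₂).Nonempty)

/-- The `r`-graph on `V₁ ∪ V₂` whose edges are all `r`-sets meeting `V₁` in an odd
number of vertices. -/
def oddCross (r : ℕ) (V₁ V₂ : Finset ℕ) : HGraph r :=
  HGraph.ofEdges r (V₁ ∪ V₂) ((Finset.powersetCard r (V₁ ∪ V₂)).filter
    fun e => Odd (e ∩ V₁).card)

/-- The Fano plane. -/
def fano : HGraph 3 :=
  HGraph.ofEdges 3 (Finset.Icc 1 7)
    {({1,2,3} : Finset ℕ), {3,4,5}, {5,6,1}, {1,7,4}, {2,7,5}, {3,7,6}, {2,4,6}}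

/-- The generalized triangle `𝕋_r`, with edges `{1,…,r}`, `{1,…,r−1,r+1}` and
`{r,…,2r−1}`. -/
def genTri (r : ℕ) : HGraph r :=
  HGraph.ofEdges r (Finset.Icc 1 (2*r - 1))
    {Finset.Icc 1 r, Finset.Icc 1 (r-1) ∪ {r+1}, Finset.Icc r (2*r - 1)}

/-- `G` is a blowup of the `r`-graph `W` (viewing `W` as a pattern). -/
def IsBlowupOf {r : ℕ} (W G : HGraph r) : Prop :=
  ∃ part : ℕ → ℕ, (∀ v ∈ G.verts, part v ∈ W.verts) ∧
    ∀ e : Finset ℕ, e ∈ G.edges ↔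
      (e ⊆ G.verts ∧ e.card = r ∧ ∃ f ∈ W.edges, Multiset.map part e.val = f.val)

/-- The expansion `H^F` of an `r`-graph `F`: for every pair of vertices not covered
by an edge of `F`, add an edge consisting of this pair plus `r−2` new vertices,
these sets of new vertices being pairwise disjoint. -/
def HGraph.expansion {r : ℕ} (F : HGraph r) : HGraph r :=
  HGraph.ofEdges r
    (F.verts ∪ (((F.verts ×ˢ F.verts).filter fun p =>
        p.1 < p.2 ∧ ∀ e ∈ F.edges, ¬ (p.1 ∈ e ∧ p.2 ∈ e)).biUnion fun p =>
      (Finset.range (r-2)).image fun s =>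
        (F.verts.sup id + 1) + (p.1 * (F.verts.sup id + 1) + p.2) * r + s))
    (F.edges ∪ (((F.verts ×ˢ F.verts).filter fun p =>
        p.1 < p.2 ∧ ∀ e ∈ F.edges, ¬ (p.1 ∈ e ∧ p.2 ∈ e)).image fun p =>
      insert p.1 (insert p.2 ((Finset.range (r-2)).image fun s =>
        (F.verts.sup id + 1) + (p.1 * (F.verts.sup id + 1) + p.2) * r + s))))

/-- A `2`-graph is a tree on `k` vertices: `k` vertices, `k−1` edges, connected. -/
def IsTreeGraph (k : ℕ) (T : HGraph 2) : Prop :=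
  T.verts.card = k ∧ T.edges.card = k - 1 ∧
  ∀ S : Finset ℕ, S ⊆ T.verts → S.Nonempty → S ≠ T.verts →
    ∃ e ∈ T.edges, (e ∩ S).Nonempty ∧ (e \ S).Nonempty

/-- `T` satisfies the Erdős–Sós property for `k`: every graph with average degree
greater than `k−2` contains `T`. -/
def ErdosSos (k : ℕ) (T : HGraph 2) : Prop :=
  ∀ G : HGraph 2, ((k : ℝ) - 2) * (G.verts.card : ℝ) < 2 * (G.edges.card : ℝ) →
    T.IsCopyIn G

/-- The `(r−2)`-expansion `Exp(T)` of a `2`-graph `T`: enlarge every edge by one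
common fixed set of `r−2` new vertices. -/
def expTree (r : ℕ) (T : HGraph 2) : HGraph r :=
  HGraph.ofEdges r
    (T.verts ∪ ((Finset.range (r-2)).image fun s => T.verts.sup id + 1 + s))
    (T.edges.image fun e =>
      e ∪ ((Finset.range (r-2)).image fun s => T.verts.sup id + 1 + s))

/-- The chromatic number of a `2`-graph. -/
noncomputable def chrom (F : HGraph 2) : ℕ :=
  sInf {k | ∃ c : ℕ → ℕ, (∀ v ∈ F.verts, c v < k) ∧
    ∀ e ∈ F.edges, ∀ u ∈ e, ∀ v ∈ e, u ≠ v → c u ≠ c v}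

/-- A graph is edge-critical if deleting some edge lowers its chromatic number. -/
def EdgeCritical (F : HGraph 2) : Prop :=
  ∃ e ∈ F.edges, chrom (HGraph.ofEdges 2 F.verts (F.edges.erase e)) < chrom F

/-- `H` is semibipartite: the vertex set splits into `V₁ ∪ V₂` so that every edge
has exactly one vertex in `V₁`. -/
def Semibipartite (r : ℕ) (H : HGraph r) : Prop :=
  ∃ V₁ ⊆ H.verts, ∀ e ∈ H.edges, (e ∩ V₁).card = 1

/-- `H` is a `K_ℓ^r`-subconstruction, i.e. an `ℓ`-partite `r`-graph. -/
def IsKlSub (r ℓ : ℕ) (H : HGraph r) : Prop :=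
  ∃ f : ℕ → ℕ, (∀ v ∈ H.verts, f v < ℓ) ∧
    ∀ e ∈ H.edges, ∀ u ∈ e, ∀ v ∈ e, f u = f v → u = v

/-- The Lagrangian `λ(W)` of an `r`-graph `W`, viewing `W` as a pattern. -/
noncomputable def hgLagrangian (r : ℕ) (W : HGraph r) : ℝ :=
  limUnder atTop fun n : ℕ =>
    ((sSup {m | ∃ G : HGraph r, IsBlowupOf W G ∧ G.verts.card = n ∧ G.edges.card = m} : ℕ) : ℝ)
      / (n.choose r : ℝ)

/-- The `r`-graph `B(r,ℓ+1)`. -/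
def BGraph (r ℓ : ℕ) : HGraph r :=
  HGraph.ofEdges r (Finset.Icc 1 (ℓ+1))
    (insert (Finset.Icc 1 r)
      ((Finset.powersetCard r (Finset.Icc 2 (ℓ+1))).filter
        fun e => (e ∩ Finset.Icc 2 r).card ≤ 1))

/-- The `r`-uniform matching of size two, `M_2^r`. -/
def matching2 (r : ℕ) : HGraph r :=
  HGraph.ofEdges r (Finset.Icc 1 (2*r)) {Finset.Icc 1 r, Finset.Icc (r+1) (2*r)}

/-- The expanded triangle `𝓒_3^{2r}`. -/
def expandedTriangle (r : ℕ) : HGraph (2*r) :=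
  HGraph.ofEdges (2*r) (Finset.Icc 1 (3*r))
    {Finset.Icc 1 (2*r), Finset.Icc (r+1) (3*r), Finset.Icc 1 r ∪ Finset.Icc (2*r+1) (3*r)}

/-- The `4`-graph `𝔽_{4,3}`. -/
def F43 : HGraph 4 :=
  HGraph.ofEdges 4 (Finset.Icc 1 7)
    {({1,2,3,4} : Finset ℕ), {1,2,3,5}, {1,2,3,6}, {1,2,3,7}, {4,5,6,7}}

/-- The `3`-graph `𝔽_{3,2}`. -/
def F32 : HGraph 3 :=
  HGraph.ofEdges 3 (Finset.Icc 1 5)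
    {({1,2,3} : Finset ℕ), {1,2,4}, {1,2,5}, {3,4,5}}

/-- `H` contains pairwise vertex-disjoint copies of `F i`, `ts i` many of each. -/
def HasMixedMatching (r k : ℕ) (F : Fin k → HGraph r) (ts : Fin k → ℕ)
    (H : HGraph r) : Prop :=
  ∃ S : (i : Fin k) → Fin (ts i) → Finset ℕ,
    (∀ i j, S i j ⊆ H.verts ∧ (S i j).card = (F i).verts.card) ∧
    (∀ p q : Σ i : Fin k, Fin (ts i), p ≠ q → Disjoint (S p.1 p.2) (S q.1 q.2)) ∧
    ∀ i j, (F i).IsCopyIn (H.induce (S i j))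

/-- `ex(n, ⊔ᵢ tᵢ Fᵢ)`. -/
noncomputable def exMixedN (r k : ℕ) (F : Fin k → HGraph r) (ts : Fin k → ℕ)
    (n : ℕ) : ℕ :=
  sSup {m | ∃ H : HGraph r, H.verts.card = n ∧ ¬ HasMixedMatching r k F ts H ∧
    H.edges.card = m}

/-- `ex(n, {F₁,…,F_k})`. -/
noncomputable def exFamN (r k : ℕ) (F : Fin k → HGraph r) (n : ℕ) : ℕ :=
  sSup {m | ∃ H : HGraph r, H.verts.card = n ∧ (∀ i, ¬ (F i).IsCopyIn H) ∧
    H.edges.card = m}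


set_option linter.unusedVariables false

/-! ### Part 1: an Erdős–Ko–Rado theorem for Lagrangians -/

noncomputable def mu (r : ℕ) (x : ℕ → ℝ) (d : ℝ) (T : Finset ℕ) : ℝ :=
  (r.descFactorial T.card : ℝ) * d ^ (r - T.card) * ∏ i ∈ T, x i

noncomputable def mass (r : ℕ) (x : ℕ → ℝ) (d : ℝ) (A : Finset (Finset ℕ)) : ℝ :=
  ∑ T ∈ A, mu r x d T

def Inter (A : Finset (Finset ℕ)) : Prop := ∀ S ∈ A, ∀ T ∈ A, (S ∩ T).Nonempty

lemma mu_nonneg {r : ℕ} {x : ℕ → ℝ} {d : ℝ} {T : Finset ℕ} (hd : 0 ≤ d)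
    (hx : ∀ i ∈ T, 0 ≤ x i) : 0 ≤ mu r x d T := by
  unfold mu
  have := Finset.prod_nonneg hx
  positivity

def StableAt (K : Finset ℕ) (m : ℕ) (A : Finset (Finset ℕ)) : Prop :=
  ∀ T ∈ A, m ∈ T → ∀ i ∈ K, i ∉ T → insert i (T.erase m) ∈ A

lemma shift_once {r : ℕ} {x : ℕ → ℝ} {d : ℝ} {K : Finset ℕ} (hd : 0 ≤ d)
    (hx : ∀ i ∈ K, 0 ≤ x i) {m : ℕ} (hmK : m ∈ K) (hmin : ∀ i ∈ K, x m ≤ x i)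
    (A : Finset (Finset ℕ)) (hA : A ⊆ K.powerset) (hI : Inter A)
    (T₀ : Finset ℕ) (hT₀ : T₀ ∈ A) (hmT₀ : m ∈ T₀) (i : ℕ) (hiK : i ∈ K) (hiT₀ : i ∉ T₀)
    (hn : insert i (T₀.erase m) ∉ A) :
    ∃ A' ⊆ K.powerset, Inter A' ∧ mass r x d A ≤ mass r x d A' ∧
      (A'.filter (fun T => m ∈ T)).card < (A.filter (fun T => m ∈ T)).card := by
  classical
  have him : i ≠ m := fun h => hiT₀ (h ▸ hmT₀)
  set s : Finset ℕ → Finset ℕ := fun T =>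
    if m ∈ T ∧ i ∉ T ∧ insert i (T.erase m) ∉ A then insert i (T.erase m) else T with hs
  have smove : ∀ T, (m ∈ T ∧ i ∉ T ∧ insert i (T.erase m) ∉ A) → s T = insert i (T.erase m) := by
    intro T h; simp only [hs]; rw [if_pos h]
  have sstay : ∀ T, ¬(m ∈ T ∧ i ∉ T ∧ insert i (T.erase m) ∉ A) → s T = T := by
    intro T h; simp only [hs]; rw [if_neg h]
  have hinj : Set.InjOn s (A : Set (Finset ℕ)) := by
    intro S hS T hT h
    by_cases h1 : (m ∈ S ∧ i ∉ S ∧ insert i (S.erase m) ∉ A) <;>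
      by_cases h2 : (m ∈ T ∧ i ∉ T ∧ insert i (T.erase m) ∉ A)
    · rw [smove S h1, smove T h2] at h
      ext a
      have := Finset.ext_iff.mp h a
      simp only [Finset.mem_insert, Finset.mem_erase] at this
      by_cases ham : a = m
      · subst ham; exact ⟨fun _ => h2.1, fun _ => h1.1⟩
      · by_cases hai : a = i
        · subst hai; exact ⟨fun h => absurd h h1.2.1, fun h => absurd h h2.2.1⟩
        · tauto
    · rw [smove S h1, sstay T h2] at h
      exact absurd (h ▸ hT) h1.2.2
    · rw [sstay S h1, smove T h2] at h
      exact absurd (h ▸ hS) h2.2.2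
    · rwa [sstay S h1, sstay T h2] at h
  refine ⟨A.image s, ?_, ?_, ?_, ?_⟩
  · intro T hT
    obtain ⟨S, hS, rfl⟩ := Finset.mem_image.mp hT
    have hSK := Finset.mem_powerset.mp (hA hS)
    by_cases h1 : (m ∈ S ∧ i ∉ S ∧ insert i (S.erase m) ∉ A)
    · rw [smove S h1, Finset.mem_powerset]
      exact Finset.insert_subset hiK ((Finset.erase_subset _ _).trans hSK)
    · rw [sstay S h1]; exact hA hS
  · have key : ∀ S ∈ A, ∀ T ∈ A, (m ∈ S ∧ i ∉ S ∧ insert i (S.erase m) ∉ A) →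
        ¬ (m ∈ T ∧ i ∉ T ∧ insert i (T.erase m) ∉ A) → (insert i (S.erase m) ∩ T).Nonempty := by
      intro S hS T hT h1 h2
      by_cases hiT : i ∈ T
      · exact ⟨i, by simp [hiT]⟩
      by_cases hmT : m ∈ T
      · have : insert i (T.erase m) ∈ A := by tauto
        obtain ⟨z, hz⟩ := hI S hS _ this
        simp only [Finset.mem_inter, Finset.mem_insert, Finset.mem_erase] at hz
        have hzi : z ≠ i := fun h => h1.2.1 (h ▸ hz.1)
        refine ⟨z, ?_⟩
        simp only [Finset.mem_inter, Finset.mem_insert, Finset.mem_erase]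
        tauto
      · obtain ⟨z, hz⟩ := hI S hS _ hT
        simp only [Finset.mem_inter] at hz
        have : z ≠ m := fun h => hmT (h ▸ hz.2)
        refine ⟨z, ?_⟩
        simp only [Finset.mem_inter, Finset.mem_insert, Finset.mem_erase]
        tauto
    intro S' hS' T' hT'
    obtain ⟨S, hS, rfl⟩ := Finset.mem_image.mp hS'
    obtain ⟨T, hT, rfl⟩ := Finset.mem_image.mp hT'
    by_cases h1 : (m ∈ S ∧ i ∉ S ∧ insert i (S.erase m) ∉ A) <;>
      by_cases h2 : (m ∈ T ∧ i ∉ T ∧ insert i (T.erase m) ∉ A)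
    · rw [smove S h1, smove T h2]; exact ⟨i, by simp⟩
    · rw [smove S h1, sstay T h2]; exact key S hS T hT h1 h2
    · rw [sstay S h1, smove T h2, Finset.inter_comm]; exact key T hT S hS h2 h1
    · rw [sstay S h1, sstay T h2]; exact hI S hS T hT
  · unfold mass
    rw [Finset.sum_image (fun a ha b hb h => hinj ha hb h)]
    refine Finset.sum_le_sum fun S hS => ?_
    have hSK := Finset.mem_powerset.mp (hA hS)
    by_cases h1 : (m ∈ S ∧ i ∉ S ∧ insert i (S.erase m) ∉ A)
    · rw [smove S h1]
      have hie : i ∉ S.erase m := fun h => h1.2.1 (Finset.mem_of_mem_erase h)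
      have hc : (insert i (S.erase m)).card = S.card := by
        rw [Finset.card_insert_of_notMem hie, Finset.card_erase_of_mem h1.1]
        have := Finset.card_pos.mpr ⟨m, h1.1⟩
        omega
      unfold mu
      rw [hc, Finset.prod_insert hie, ← Finset.mul_prod_erase S x h1.1]
      have hp : 0 ≤ ∏ j ∈ S.erase m, x j :=
        Finset.prod_nonneg fun j hj => hx j (hSK (Finset.mem_of_mem_erase hj))
      have := hmin i hiK
      gcongr
    · rw [sstay S h1]
  · have hsub : (A.image s).filter (fun T => m ∈ T) ⊆ (A.filter (fun T => m ∈ T)).erase T₀ := by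
      intro T hT
      obtain ⟨hT1, hmT⟩ := Finset.mem_filter.mp hT
      obtain ⟨S, hS, rfl⟩ := Finset.mem_image.mp hT1
      by_cases h1 : (m ∈ S ∧ i ∉ S ∧ insert i (S.erase m) ∉ A)
      · rw [smove S h1] at hmT
        simp [him.symm] at hmT
      · rw [sstay S h1] at hmT ⊢
        refine Finset.mem_erase.mpr ⟨?_, Finset.mem_filter.mpr ⟨hS, hmT⟩⟩
        rintro rfl
        exact h1 ⟨hmT₀, hiT₀, hn⟩
    have hmem : T₀ ∈ A.filter (fun T => m ∈ T) := Finset.mem_filter.mpr ⟨hT₀, hmT₀⟩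
    exact lt_of_le_of_lt (Finset.card_le_card hsub) (Finset.card_erase_lt_of_mem hmem)

lemma shift_lemma {r : ℕ} {x : ℕ → ℝ} {d : ℝ} {K : Finset ℕ} (hd : 0 ≤ d)
    (hx : ∀ i ∈ K, 0 ≤ x i) {m : ℕ} (hmK : m ∈ K) (hmin : ∀ i ∈ K, x m ≤ x i) (N : ℕ) :
    ∀ (A : Finset (Finset ℕ)), (A.filter (fun T => m ∈ T)).card ≤ N → A ⊆ K.powerset → Inter A →
    ∃ A' ⊆ K.powerset, Inter A' ∧ mass r x d A ≤ mass r x d A' ∧ StableAt K m A' := by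
  induction N with
  | zero =>
    intro A hc hA hI
    refine ⟨A, hA, hI, le_rfl, ?_⟩
    intro T hT hmT
    have : T ∈ A.filter (fun T => m ∈ T) := Finset.mem_filter.mpr ⟨hT, hmT⟩
    have := Finset.card_pos.mpr ⟨T, this⟩
    omega
  | succ N ih =>
    intro A hc hA hI
    by_cases hst : StableAt K m A
    · exact ⟨A, hA, hI, le_rfl, hst⟩
    · unfold StableAt at hst
      push Not at hst
      obtain ⟨T₀, hT₀, hmT₀, i, hiK, hiT₀, hn⟩ := hst
      obtain ⟨A', h1, h2, h3, h4⟩ :=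
        shift_once (r := r) hd hx hmK hmin A hA hI T₀ hT₀ hmT₀ i hiK hiT₀ hn
      obtain ⟨A'', g1, g2, g3, g4⟩ := ih A' (by omega) h1 h2
      exact ⟨A'', g1, g2, h3.trans g3, g4⟩

/-! theta inequalities -/

lemma three_term (u p : ℝ) (hu : 0 ≤ u) (hp : 0 ≤ p) (n : ℕ) :
    u ^ n * (u ^ 2 + (n + 2) * u * p + (n + 2) * (n + 1) / 2 * p ^ 2) ≤ (u + p) ^ (n + 2) := by
  induction n with
  | zero => simp; nlinarith
  | succ n ih =>
    have h1 := mul_le_mul_of_nonneg_left ih (add_nonneg hu hp)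
    have e : (u + p) ^ (n + 1 + 2) = (u + p) * (u + p) ^ (n + 2) := by ring
    rw [e]
    refine le_trans ?_ h1
    have hun : 0 ≤ u ^ n := by positivity
    have : (u + p) * (u ^ n * (u ^ 2 + (n + 2) * u * p + (n + 2) * (n + 1) / 2 * p ^ 2)) -
      u ^ (n + 1) * (u ^ 2 + (((n + 1 : ℕ) : ℝ) + 2) * u * p + (((n + 1 : ℕ) : ℝ) + 2) * (((n + 1 : ℕ) : ℝ) + 1) / 2 * p ^ 2)
       = u ^ n * ((n + 2) * (n + 1) / 2 * p ^ 3) := by push_cast; ring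
    have : 0 ≤ u ^ n * (((n:ℝ) + 2) * (n + 1) / 2 * p ^ 3) := by positivity
    linarith

noncomputable def theta (d x : ℝ) (j : ℕ) : ℝ := j * d ^ (j - 1) * x / (d + x) ^ j

lemma theta_nonneg {d x : ℝ} (hd : 0 ≤ d) (hx : 0 ≤ x) (j : ℕ) : 0 ≤ theta d x j := by
  unfold theta; positivity

lemma theta_half {d x : ℝ} (hd : 0 ≤ d) (hx : 0 ≤ x) (h : 0 < d + x) (n : ℕ) :
    theta d x (n + 2) ≤ 1 / 2 := by
  unfold theta
  rw [div_le_iff₀ (by positivity)]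
  have h3 := three_term d x hd hx n
  have hun : 0 ≤ d ^ n := by positivity
  have : 0 ≤ d ^ n * (d ^ 2 - (n + 2) * d * x + ((n:ℝ) + 2) * (n + 1) / 2 * x ^ 2) := by
    apply mul_nonneg hun
    have hn : (0:ℝ) ≤ n := by positivity
    nlinarith [sq_nonneg (2 * d - (n + 2) * x), mul_nonneg hn (sq_nonneg x), mul_nonneg (mul_nonneg hn hn) (sq_nonneg x)]
  have e : n + 2 - 1 = n + 1 := rfl
  rw [e]; push_cast
  have : d ^ (n + 1) = d ^ n * d := by ring
  rw [this]
  nlinarith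

lemma theta_one {d x : ℝ} (j : ℕ) (hj : j = 1) : theta d x j = x / (d + x) := by
  subst hj; simp [theta]

lemma theta_le_one {d x : ℝ} (hd : 0 ≤ d) (hx : 0 ≤ x) (h : 0 < d + x) (j : ℕ) :
    theta d x j ≤ 1 := by
  rcases j with _ | _ | n
  · simp [theta]
  · rw [theta_one _ rfl, div_le_one h]; linarith
  · linarith [theta_half hd hx h n]

lemma theta_1_3 {d x : ℝ} (hd : 0 ≤ d) (hx : 0 ≤ x) (h : 0 < d + x) (n : ℕ) :
    theta d x 1 + theta d x (n + 3) ≤ 1 := by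
  rw [theta_one _ rfl]
  unfold theta
  have h3 := three_term d x hd hx n
  have hn : (0:ℝ) ≤ n := by positivity
  have key : (n + 3) * d ^ (n + 1) * x ≤ (d + x) ^ (n + 2) := by
    refine le_trans ?_ h3
    have hun : 0 ≤ d ^ n := by positivity
    have : 0 ≤ d ^ n * (d ^ 2 - d * x + ((n:ℝ) + 2) * (n + 1) / 2 * x ^ 2) := by
      apply mul_nonneg hun
      nlinarith [sq_nonneg (d - x), sq_nonneg x, sq_nonneg d,mul_nonneg hn (sq_nonneg x), mul_nonneg (mul_nonneg hn hn) (sq_nonneg x)]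
    have e : d ^ (n + 1) = d ^ n * d := by ring
    rw [e]; nlinarith
  have e : n + 3 - 1 = n + 2 := rfl
  rw [e]
  have : x / (d + x) = 1 - d / (d + x) := by field_simp; ring
  rw [this]
  have : (((n + 3 : ℕ) : ℝ)) * d ^ (n + 2) * x / (d + x) ^ (n + 3) ≤ d / (d + x) := by
    rw [div_le_div_iff₀ (by positivity) h]
    have := mul_le_mul_of_nonneg_left key (mul_nonneg hd h.le)
    push_cast
    calc _ = d * (d + x) * ((n + 3) * d ^ (n + 1) * x) := by ring
      _ ≤ _ := this
      _ = _ := by ring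
  linarith

lemma theta_pair {d x : ℝ} (hd : 0 ≤ d) (hx : 0 ≤ x) (h : 0 < d + x) (j k : ℕ)
    (hjk : x ≤ d ∨ ¬ ((j = 1 ∧ k = 1) ∨ (j = 1 ∧ k = 2) ∨ (j = 2 ∧ k = 1))) :
    theta d x j + theta d x k ≤ 1 := by
  have t0 : theta d x 0 = 0 := by simp [theta]
  have t11 : x ≤ d → theta d x 1 + theta d x 1 ≤ 1 := by
    intro hxd
    rw [theta_one _ rfl, ← add_div, div_le_one h]; linarith
  have t12 : x ≤ d → theta d x 1 + theta d x 2 ≤ 1 := by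
    intro hxd
    rw [theta_one _ rfl]; unfold theta
    rw [div_add_div _ _ h.ne' (by positivity), div_le_one (by positivity)]
    push_cast
    have : 0 ≤ (d + x) * d * (d - x) := by
      apply mul_nonneg (by positivity); linarith
    simp only [Nat.add_one_sub_one, pow_one]
    nlinarith
  rcases j with _ | _ | j <;> rcases k with _ | _ | k
  · rw [t0]; norm_num
  · rw [t0, zero_add]; exact theta_le_one hd hx h _
  · rw [t0, zero_add]; exact theta_le_one hd hx h _
  · rw [t0, add_zero]; exact theta_le_one hd hx h _
  · rcases hjk with h' | h'
    · exact t11 h'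
    · exact absurd (Or.inl ⟨rfl, rfl⟩) h'
  · rcases k with _ | k
    · rcases hjk with h' | h'
      · exact t12 h'
      · exact absurd (Or.inr (Or.inl ⟨rfl, rfl⟩)) h'
    · exact theta_1_3 hd hx h k
  · rw [t0, add_zero]; exact theta_le_one hd hx h _
  · rcases j with _ | k
    · rcases hjk with h' | h'
      · rw [add_comm]; exact t12 h'
      · exact absurd (Or.inr (Or.inr ⟨rfl, rfl⟩)) h'
    · rw [add_comm]; exact theta_1_3 hd hx h k
  · linarith [theta_half hd hx h j, theta_half hd hx h k]

lemma mu_insert {r : ℕ} {x : ℕ → ℝ} {d : ℝ} {m : ℕ} {S : Finset ℕ} (hd : 0 ≤ d) (hx : 0 ≤ x m)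
    (hm : m ∉ S) :
    mu r x d (insert m S) = theta d (x m) (r - S.card) * mu r x (d + x m) S := by
  unfold mu theta
  rw [Finset.card_insert_of_notMem hm, Finset.prod_insert hm, Nat.descFactorial_succ]
  rcases eq_or_lt_of_le (add_nonneg hd hx) with h | h
  · have hx0 : x m = 0 := by linarith
    rw [hx0]; simp
  · have e : r - (S.card + 1) = r - S.card - 1 := by omega
    rw [e]
    have : (d + x m) ^ (r - S.card) ≠ 0 := by positivity
    field_simp
    push_cast
    ring

lemma mu_A {r : ℕ} {x : ℕ → ℝ} {d : ℝ} {m : ℕ} {S : Finset ℕ} (hd : 0 ≤ d) (hx : 0 ≤ x m)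
    (hm : m ∉ S) (hS : ∀ i ∈ S, 0 ≤ x i) :
    mu r x d S + mu r x d (insert m S) ≤ mu r x (d + x m) S := by
  unfold mu
  rw [Finset.card_insert_of_notMem hm, Finset.prod_insert hm, Nat.descFactorial_succ]
  have hp := Finset.prod_nonneg hS
  have e : r - (S.card + 1) = r - S.card - 1 := by omega
  rw [e]
  set j := r - S.card
  have key : d ^ j + j * d ^ (j - 1) * x m ≤ (d + x m) ^ j := by
    have := pow_add_mul_le_add_pow (b := x m) hd (by linarith) j
    linarith
  push_cast
  have h2 := mul_le_mul_of_nonneg_left key (mul_nonneg (Nat.cast_nonneg (α := ℝ) (r.descFactorial S.card)) hp)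
  linarith

lemma step_lemma {r : ℕ} {x : ℕ → ℝ} {d : ℝ} {K : Finset ℕ} (hd : 0 ≤ d)
    (hx : ∀ i ∈ K, 0 ≤ x i) {m : ℕ} (hmK : m ∈ K) (hK : 2 ≤ K.card)
    (hc : x m ≤ d ∨ (K.card + 1 ≠ 2 * r ∧ K.card + 2 ≠ 2 * r))
    (A : Finset (Finset ℕ)) (hA : A ⊆ K.powerset) (hI : Inter A) (hst : StableAt K m A) :
    ∃ A' ⊆ (K.erase m).powerset, Inter A' ∧ mass r x d A ≤ mass r x (d + x m) A' := by
  classical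
  have hxm := hx m hmK
  set L := K.erase m with hL
  have hLc : L.card + 1 = K.card := by
    rw [hL, Finset.card_erase_of_mem hmK]; omega
  have hmL : m ∉ L := Finset.notMem_erase _ _
  have hLne : L.Nonempty := Finset.card_pos.mp (by omega)
  obtain ⟨i0, hi0⟩ := hLne
  set P := L.powerset with hP
  have mP : ∀ {S}, S ∈ P → m ∉ S := fun hS h => hmL (Finset.mem_powerset.mp hS h)
  have xP : ∀ {S}, S ∈ P → ∀ i ∈ S, 0 ≤ x i := fun hS i h =>
    hx i (Finset.mem_of_mem_erase (Finset.mem_powerset.mp hS h))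
  set nw : Finset ℕ → ℝ := fun S => mu r x (d + x m) S with hnw
  set od : Finset ℕ → ℝ := fun S => mu r x d (insert m S) with hod
  have nwnn : ∀ S ∈ P, 0 ≤ nw S := fun S hS => mu_nonneg (by linarith) (xP hS)
  have odnn : ∀ S ∈ P, 0 ≤ od S := fun S hS => mu_nonneg hd (by
    intro i hi
    rcases Finset.mem_insert.mp hi with rfl | hi
    · exact hxm
    · exact xP hS i hi)
  set A0 := P.filter (fun S => S ∈ A) with hA0
  set B := P.filter (fun S => S ∉ A ∧ insert m S ∈ A) with hB
  set W : Finset ℕ → Prop := fun S =>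
    L \ S ∈ B → (nw (L \ S) < nw S ∨ (nw (L \ S) = nw S ∧ i0 ∈ S)) with hW
  set Bs := B.filter W with hBs
  have BP : ∀ {S}, S ∈ B → S ∈ P := fun h => (Finset.mem_filter.mp h).1
  have CC : ∀ {S}, S ∈ P → L \ (L \ S) = S := by
    intro S hS
    rw [Finset.sdiff_sdiff_eq_self (Finset.mem_powerset.mp hS)]
  have disj : ∀ S ∈ B, ∀ T ∈ B, ¬ (S ∩ T).Nonempty → T = L \ S := by
    intro S hS T hT hne
    rw [Finset.not_nonempty_iff_eq_empty] at hne
    by_contra hTS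
    have hSL := Finset.mem_powerset.mp (BP hS)
    have hTL := Finset.mem_powerset.mp (BP hT)
    have : ∃ i ∈ L, i ∉ S ∧ i ∉ T := by
      by_contra hcon
      push Not at hcon
      apply hTS
      ext a
      rw [Finset.mem_sdiff]
      constructor
      · intro ha
        refine ⟨hTL ha, fun haS => ?_⟩
        have : a ∈ S ∩ T := Finset.mem_inter.mpr ⟨haS, ha⟩
        rw [hne] at this; simp at this
      · intro ha; exact hcon a ha.1 ha.2
    obtain ⟨i, hiL, hiS, hiT⟩ := this
    have him : i ≠ m := fun h => hmL (h ▸ hiL)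
    have h1 := hst (insert m S) (Finset.mem_filter.mp hS).2.2 (Finset.mem_insert_self _ _) i
      (Finset.mem_of_mem_erase hiL) (by simp [him, hiS])
    rw [Finset.erase_insert (mP (BP hS))] at h1
    obtain ⟨z, hz⟩ := hI _ h1 _ (Finset.mem_filter.mp hT).2.2
    simp only [Finset.mem_inter, Finset.mem_insert] at hz
    rcases hz with ⟨hz1 | hz1, hz2 | hz2⟩
    · exact him (hz1 ▸ hz2)
    · exact hiT (hz1 ▸ hz2)
    · exact mP (BP hS) (hz2 ▸ hz1)
    · have : z ∈ S ∩ T := Finset.mem_inter.mpr ⟨hz1, hz2⟩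
      rw [hne] at this; simp at this
  refine ⟨A0 ∪ Bs, ?_, ?_, ?_⟩
  · apply Finset.union_subset (Finset.filter_subset _ _)
    exact (Finset.filter_subset _ _).trans (Finset.filter_subset _ _)
  · have AB : ∀ S ∈ A0, ∀ T ∈ Bs, (S ∩ T).Nonempty := by
      intro S hS T hT
      have hTB := (Finset.mem_filter.mp hT).1
      obtain ⟨z, hz⟩ := hI S (Finset.mem_filter.mp hS).2 _ (Finset.mem_filter.mp hTB).2.2
      simp only [Finset.mem_inter, Finset.mem_insert] at hz
      have : z ≠ m := fun h => mP (Finset.mem_filter.mp hS).1 (h ▸ hz.1)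
      exact ⟨z, Finset.mem_inter.mpr ⟨hz.1, by tauto⟩⟩
    intro S hS T hT
    rcases Finset.mem_union.mp hS with hS | hS <;> rcases Finset.mem_union.mp hT with hT | hT
    · exact hI S (Finset.mem_filter.mp hS).2 T (Finset.mem_filter.mp hT).2
    · exact AB S hS T hT
    · rw [Finset.inter_comm]; exact AB T hT S hS
    · by_contra hne
      obtain ⟨hSB, hSW⟩ := Finset.mem_filter.mp hS
      obtain ⟨hTB, hTW⟩ := Finset.mem_filter.mp hT
      have hTS := disj S hSB T hTB hne
      have hST : L \ T = S := by rw [hTS, CC (BP hSB)]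
      simp only [hW] at hSW hTW
      rw [hST] at hTW
      rw [← hTS] at hSW
      rcases hSW hTB with h1 | h1 <;> rcases hTW hSB with h2 | h2
      · linarith
      · linarith [h2.1]
      · linarith [h1.1]
      · exact hne ⟨i0, Finset.mem_inter.mpr ⟨h1.2, h2.2⟩⟩
  · -- mass inequality
    have hdisj : Disjoint A0 Bs := by
      rw [Finset.disjoint_left]
      intro S hS hS'
      exact (Finset.mem_filter.mp (Finset.mem_filter.mp hS').1).2.1 (Finset.mem_filter.mp hS).2
    have hKi : K = insert m L := (Finset.insert_erase hmK).symm
    have hmassA : mass r x d A = ∑ S ∈ P, ((if S ∈ A then mu r x d S else 0) +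
        (if insert m S ∈ A then od S else 0)) := by
      unfold mass
      have : A = K.powerset.filter (fun T => T ∈ A) := by
        ext T; simp only [Finset.mem_filter]
        exact ⟨fun h => ⟨hA h, h⟩, fun h => h.2⟩
      conv_lhs => rw [this]
      rw [Finset.sum_filter, hKi, Finset.sum_powerset_insert hmL, Finset.sum_add_distrib]
    have hsum1 : mass r x d A ≤ ∑ S ∈ A0, nw S + ∑ S ∈ B, od S := by
      rw [hmassA, hA0, hB, Finset.sum_filter, Finset.sum_filter, ← Finset.sum_add_distrib]
      refine Finset.sum_le_sum fun S hS => ?_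
      have h1 := mu_A (r := r) hd hxm (mP hS) (xP hS)
      have h2 : 0 ≤ od S := odnn S hS
      have h3 : 0 ≤ mu r x d S := mu_nonneg hd (xP hS)
      by_cases hSA : S ∈ A <;> by_cases hmSA : insert m S ∈ A <;> simp [hSA, hmSA]
      · exact h1
      · have : mu r x d S ≤ nw S := by simp only [hnw]; linarith
        exact this
    have hodth : ∀ S ∈ P, od S = theta d (x m) (r - S.card) * nw S := fun S hS =>
      mu_insert hd hxm (mP hS)
    have hsum2 : ∑ S ∈ B, od S ≤ ∑ S ∈ Bs, nw S := by
      have hBsB : Bs ⊆ B := Finset.filter_subset _ _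
      rw [← Finset.sum_sdiff hBsB]
      have hCmap : ∀ S ∈ B \ Bs, L \ S ∈ B ∧ L \ S ∈ Bs := by
        intro S hS
        obtain ⟨hSB, hSn⟩ := Finset.mem_sdiff.mp hS
        have hnW : ¬ W S := fun h => hSn (Finset.mem_filter.mpr ⟨hSB, h⟩)
        simp only [hW] at hnW
        push Not at hnW
        obtain ⟨hC, h1, h2⟩ := hnW
        refine ⟨hC, Finset.mem_filter.mpr ⟨hC, ?_⟩⟩
        intro _
        rw [CC (BP hSB)]
        rcases lt_or_eq_of_le h1 with h | h
        · left; exact h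
        · right; exact ⟨h, Finset.mem_sdiff.mpr ⟨hi0, h2 h.symm⟩⟩
      have h1 : ∑ S ∈ B \ Bs, od S ≤ ∑ S ∈ Bs, (if L \ S ∈ B then od (L \ S) else 0) := by
        rw [← Finset.sum_filter]
        calc ∑ S ∈ B \ Bs, od S = ∑ S ∈ (B \ Bs).image (fun S => L \ S), od (L \ S) := by
              rw [Finset.sum_image]
              · refine Finset.sum_congr rfl fun S hS => ?_
                rw [CC (BP (Finset.mem_sdiff.mp hS).1)]
              · intro S hS T hT h
                have := congrArg (fun Y => L \ Y) h
                simp only at this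
                rwa [CC (BP (Finset.mem_sdiff.mp hS).1), CC (BP (Finset.mem_sdiff.mp hT).1)] at this
          _ ≤ _ := by
              apply Finset.sum_le_sum_of_subset_of_nonneg
              · intro T hT
                obtain ⟨S, hS, rfl⟩ := Finset.mem_image.mp hT
                refine Finset.mem_filter.mpr ⟨(hCmap S hS).2, ?_⟩
                rw [CC (BP (Finset.mem_sdiff.mp hS).1)]
                exact (Finset.mem_sdiff.mp hS).1
              · intro S hS _
                exact odnn _ (BP (Finset.mem_filter.mp hS).2)
      refine le_trans (add_le_add_left h1 _) ?_
      rw [← Finset.sum_add_distrib]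
      refine Finset.sum_le_sum fun S hS => ?_
      obtain ⟨hSB, hSW⟩ := Finset.mem_filter.mp hS
      rcases eq_or_lt_of_le (add_nonneg hd hxm) with h0 | h0
      · have hx0 : x m = 0 := by linarith
        have ho : ∀ S ∈ P, od S = 0 := by
          intro S hS
          rw [hodth S hS]; simp [theta, hx0]
        rw [ho S (BP hSB)]
        have := nwnn S (BP hSB)
        split_ifs with h
        · rw [ho _ (BP h)]; linarith
        · linarith
      split_ifs with hC
      · have hle : nw (L \ S) ≤ nw S := by
          rcases hSW hC with h | h
          · exact h.le
          · exact h.1.le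
        rw [hodth S (BP hSB), hodth _ (BP hC)]
        have hcard : (L \ S).card + S.card = L.card :=
          Finset.card_sdiff_add_card_eq_card (Finset.mem_powerset.mp (BP hSB))
        have htp := theta_pair hd hxm h0 (r - (L \ S).card) (r - S.card) (by
          rcases hc with h | h
          · left; exact h
          · right; omega)
        have hn := nwnn S (BP hSB)
        have ht1 := theta_nonneg hd hxm (r - (L \ S).card)
        have := mul_le_mul_of_nonneg_left hle ht1
        nlinarith
      · rw [zero_add, hodth S (BP hSB)]
        exact mul_le_of_le_one_left (nwnn S (BP hSB)) (theta_le_one hd hxm h0 _)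
    unfold mass
    rw [Finset.sum_union hdisj]
    unfold mass at hsum1
    linarith

noncomputable def esy (x : ℕ → ℝ) (K : Finset ℕ) (k : ℕ) : ℝ :=
  ∑ T ∈ K.powersetCard k, ∏ i ∈ T, x i

lemma esy_nonneg {x : ℕ → ℝ} {K : Finset ℕ} (hx : ∀ i ∈ K, 0 ≤ x i) (k : ℕ) : 0 ≤ esy x K k :=
  Finset.sum_nonneg fun T hT => Finset.prod_nonneg fun i hi =>
    hx i ((Finset.mem_powersetCard.mp hT).1 hi)

lemma esy_insert {x : ℕ → ℝ} {K : Finset ℕ} {j : ℕ} (hj : j ∉ K) (k : ℕ) :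
    esy x (insert j K) (k + 1) = esy x K (k + 1) + x j * esy x K k := by
  classical
  unfold esy
  rw [Finset.powersetCard_succ_insert hj, Finset.sum_union, Finset.sum_image, Finset.mul_sum]
  · congr 1
    refine Finset.sum_congr rfl fun T hT => ?_
    rw [Finset.prod_insert (fun h => hj ((Finset.mem_powersetCard.mp hT).1 h))]
  · intro S hS T hT h
    have hS' : j ∉ S := fun h => hj ((Finset.mem_powersetCard.mp hS).1 h)
    have hT' : j ∉ T := fun h => hj ((Finset.mem_powersetCard.mp hT).1 h)
    have := congrArg (fun Y => Finset.erase Y j) h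
    simpa [Finset.erase_insert, hS', hT'] using this
  · rw [Finset.disjoint_left]
    intro T hT hT'
    obtain ⟨S, _, rfl⟩ := Finset.mem_image.mp hT'
    exact hj ((Finset.mem_powersetCard.mp hT).1 (Finset.mem_insert_self _ _))

lemma esy_erase_sum {x : ℕ → ℝ} {K : Finset ℕ} (k : ℕ) :
    ∑ i ∈ K, x i * esy x (K.erase i) k = (k + 1) * esy x K (k + 1) := by
  classical
  have h1 : ∀ i ∈ K, x i * esy x (K.erase i) k =
      ∑ T ∈ K.powersetCard (k + 1), if i ∈ T then ∏ j ∈ T, x j else 0 := by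
    intro i hi
    rw [← Finset.sum_filter]
    unfold esy
    rw [Finset.mul_sum]
    refine Finset.sum_bij' (fun T _ => insert i T) (fun T _ => T.erase i) ?_ ?_ ?_ ?_ ?_
    · intro T hT
      obtain ⟨h1, h2⟩ := Finset.mem_powersetCard.mp hT
      have hiT : i ∉ T := fun h => by simpa using h1 h
      simp only [Finset.mem_filter, Finset.mem_powersetCard, Finset.mem_insert_self, and_true]
      refine ⟨Finset.insert_subset hi (h1.trans (Finset.erase_subset _ _)), ?_⟩
      rw [Finset.card_insert_of_notMem hiT, h2]
    · intro T hT
      simp only [Finset.mem_filter, Finset.mem_powersetCard] at hT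
      rw [Finset.mem_powersetCard]
      refine ⟨Finset.erase_subset_erase _ hT.1.1, ?_⟩
      rw [Finset.card_erase_of_mem hT.2]; omega
    · intro T hT
      obtain ⟨h1, h2⟩ := Finset.mem_powersetCard.mp hT
      have hiT : i ∉ T := fun h => by simpa using h1 h
      exact Finset.erase_insert hiT
    · intro T hT
      simp only [Finset.mem_filter] at hT
      exact Finset.insert_erase hT.2
    · intro T hT
      obtain ⟨h1, h2⟩ := Finset.mem_powersetCard.mp hT
      have hiT : i ∉ T := fun h => by simpa using h1 h
      rw [Finset.prod_insert hiT]
  rw [Finset.sum_congr rfl h1, Finset.sum_comm]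
  unfold esy
  rw [Finset.mul_sum]
  refine Finset.sum_congr rfl fun T hT => ?_
  obtain ⟨h1, h2⟩ := Finset.mem_powersetCard.mp hT
  rw [← Finset.sum_filter, Finset.filter_mem_eq_inter, Finset.inter_eq_right.mpr h1]
  rw [Finset.sum_const, h2]; simp

lemma esy_erase_sum' {x : ℕ → ℝ} {K : Finset ℕ} (k : ℕ) :
    ∑ i ∈ K, esy x (K.erase i) k = ((K.card : ℝ) - k) * esy x K k := by
  classical
  have h1 : ∀ i ∈ K, esy x (K.erase i) k =
      ∑ T ∈ K.powersetCard k, if i ∉ T then ∏ j ∈ T, x j else 0 := by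
    intro i hi
    rw [← Finset.sum_filter]
    unfold esy
    apply Finset.sum_congr _ (fun _ _ => rfl)
    ext T
    simp only [Finset.mem_powersetCard, Finset.mem_filter, Finset.subset_erase]
    tauto
  rw [Finset.sum_congr rfl h1, Finset.sum_comm]
  unfold esy
  rw [Finset.mul_sum]
  refine Finset.sum_congr rfl fun T hT => ?_
  obtain ⟨h1, h2⟩ := Finset.mem_powersetCard.mp hT
  rw [← Finset.sum_filter, Finset.sum_const, ← h2]
  have : K.filter (fun i => i ∉ T) = K \ T := by ext; simp
  rw [this, Finset.card_sdiff_of_subset h1, nsmul_eq_mul, Nat.cast_sub (Finset.card_le_card h1)]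

lemma esy_cheb {x : ℕ → ℝ} {K : Finset ℕ} (hx : ∀ i ∈ K, 0 ≤ x i) (k : ℕ) :
    (K.card : ℝ) * ((k + 1) * esy x K (k + 1)) ≤
      (∑ i ∈ K, x i) * (((K.card : ℝ) - k) * esy x K k) := by
  classical
  rw [← esy_erase_sum, ← esy_erase_sum']
  apply AntivaryOn.card_mul_sum_le_sum_mul_sum
  intro i hi j hj hij
  by_contra hcon
  push Not at hcon
  have hij' : i ≠ j := fun h => by subst h; exact lt_irrefl _ hij
  rcases k with _ | k
  · simp [esy] at hij
  have e1 : K.erase i = insert j ((K.erase i).erase j) :=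
    (Finset.insert_erase (Finset.mem_erase.mpr ⟨hij'.symm, hj⟩)).symm
  have e2 : K.erase j = insert i ((K.erase i).erase j) := by
    rw [Finset.erase_right_comm]
    exact (Finset.insert_erase (Finset.mem_erase.mpr ⟨hij', hi⟩)).symm
  have hjn : j ∉ (K.erase i).erase j := Finset.notMem_erase _ _
  have hin : i ∉ (K.erase i).erase j := by simp
  simp only at hij
  rw [e1, e2, esy_insert hjn, esy_insert hin] at hij
  have hn : 0 ≤ esy x ((K.erase i).erase j) k := esy_nonneg (fun a ha => hx a (by
    simp only [Finset.mem_erase] at ha; exact ha.2.2)) k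
  nlinarith

noncomputable def pk (m k : ℕ) : ℝ := ∏ i ∈ Finset.range k, (1 - (i : ℝ) / m)

lemma pk_nonneg {m k : ℕ} (h : k ≤ m) : 0 ≤ pk m k := by
  apply Finset.prod_nonneg
  intro i hi
  have hi' := Finset.mem_range.mp hi
  have : (i : ℝ) / m ≤ 1 := by
    apply div_le_one_of_le₀ _ (by positivity)
    exact_mod_cast (by omega : i ≤ m)
  linarith

lemma esy_mac {x : ℕ → ℝ} {K : Finset ℕ} (hx : ∀ i ∈ K, 0 ≤ x i) (hK : 0 < K.card) (k : ℕ)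
    (hk : k ≤ K.card) :
    (k.factorial : ℝ) * esy x K k ≤ pk K.card k * (∑ i ∈ K, x i) ^ k := by
  induction k with
  | zero => simp [esy, pk]
  | succ k ih =>
    have ih := ih (by omega)
    have hc := esy_cheb hx k
    have hm : (0:ℝ) < K.card := by exact_mod_cast hK
    have hs : 0 ≤ ∑ i ∈ K, x i := Finset.sum_nonneg hx
    have hkm : (k:ℝ) / K.card ≤ 1 := by
      apply div_le_one_of_le₀ _ (by positivity)
      exact_mod_cast (by omega : k ≤ K.card)
    have h2 : (k + 1) * esy x K (k + 1) ≤ (∑ i ∈ K, x i) * ((1 - (k:ℝ) / K.card) * esy x K k) := by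
      have e : (1 - (k:ℝ) / K.card) = ((K.card : ℝ) - k) / K.card := by field_simp
      rw [e, div_mul_eq_mul_div, mul_div_assoc', le_div_iff₀ hm]
      linarith
    have h3 := mul_le_mul_of_nonneg_left ih (mul_nonneg hs (sub_nonneg.mpr hkm))
    have h4 := mul_le_mul_of_nonneg_left h2 (Nat.cast_nonneg (α := ℝ) k.factorial)
    rw [Nat.factorial_succ]
    have e2 : pk K.card (k + 1) = pk K.card k * (1 - (k:ℝ) / K.card) := by
      unfold pk; rw [Finset.prod_range_succ]
    rw [e2, pow_succ]
    push_cast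
    nlinarith

lemma mass_le_all {r : ℕ} {x : ℕ → ℝ} {d : ℝ} {K : Finset ℕ} (hd : 0 ≤ d)
    (hx : ∀ i ∈ K, 0 ≤ x i) (A : Finset (Finset ℕ)) (hA : A ⊆ K.powerset) :
    mass r x d A ≤ mass r x d K.powerset :=
  Finset.sum_le_sum_of_subset_of_nonneg hA fun T hT _ =>
    mu_nonneg hd fun i hi => hx i (Finset.mem_powerset.mp hT hi)

lemma mass_all {r : ℕ} {x : ℕ → ℝ} {d : ℝ} {K : Finset ℕ} (hrK : r ≤ K.card) :
    mass r x d K.powerset =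
      ∑ k ∈ Finset.range (r + 1), (r.descFactorial k : ℝ) * d ^ (r - k) * esy x K k := by
  unfold mass
  rw [Finset.sum_powerset]
  have h1 : ∀ k, ∑ T ∈ K.powersetCard k, mu r x d T =
      (r.descFactorial k : ℝ) * d ^ (r - k) * esy x K k := by
    intro k
    unfold esy
    rw [Finset.mul_sum]
    refine Finset.sum_congr rfl fun T hT => ?_
    unfold mu
    rw [(Finset.mem_powersetCard.mp hT).2]
  rw [Finset.sum_congr rfl fun k _ => h1 k]
  symm
  apply Finset.sum_subset
  · intro k hk; simp only [Finset.mem_range] at *; omega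
  · intro k hk hk'
    simp only [Finset.mem_range] at *
    rw [Nat.descFactorial_of_lt (by omega)]; simp

lemma term_sum {r : ℕ} {x : ℕ → ℝ} {d : ℝ} {K : Finset ℕ} (hd : 0 ≤ d)
    (hx : ∀ i ∈ K, 0 ≤ x i) (hsum : ∑ i ∈ K, x i + d = 1) (hrK : r ≤ K.card) (hK : 0 < K.card) :
    mass r x d K.powerset ≤
      ∑ k ∈ Finset.range (r + 1), (r.choose k : ℝ) * d ^ (r - k) * ((1 - d) ^ k * pk K.card k) := by
  rw [mass_all hrK]
  refine Finset.sum_le_sum fun k hk => ?_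
  have hk' : k ≤ K.card := by have := Finset.mem_range.mp hk; omega
  have hm := esy_mac hx hK k hk'
  have hs : ∑ i ∈ K, x i = 1 - d := by linarith
  rw [hs] at hm
  rw [Nat.descFactorial_eq_factorial_mul_choose]
  push_cast
  have hc : (0:ℝ) ≤ (r.choose k : ℝ) * d ^ (r - k) := by positivity
  have := mul_le_mul_of_nonneg_left hm hc
  linarith

lemma pk_mono {m r : ℕ} (hrm : r ≤ m) (hr : 1 ≤ r) (k j : ℕ) (h : k + j ≤ r) :
    (((m : ℝ) - r + 1) / m) ^ j * pk m k ≤ pk m (k + j) := by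
  induction j with
  | zero => simp
  | succ j ih =>
    have ih := ih (by omega)
    have hm : (0:ℝ) < m := by exact_mod_cast (by omega : 0 < m)
    have e : pk m (k + (j + 1)) = pk m (k + j) * (1 - ((k + j : ℕ):ℝ) / m) := by
      unfold pk; rw [← add_assoc, Finset.prod_range_succ]
    rw [e, pow_succ]
    have h1 : ((m : ℝ) - r + 1) / m ≤ 1 - ((k + j : ℕ):ℝ) / m := by
      rw [div_le_iff₀ hm, sub_mul, div_mul_cancel₀ _ hm.ne']
      have : ((k + j : ℕ):ℝ) + 1 ≤ r := by exact_mod_cast (by omega : k + j + 1 ≤ r)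
      linarith
    have h0 : 0 ≤ ((m : ℝ) - r + 1) / m := by
      have : (r:ℝ) ≤ m := by exact_mod_cast hrm
      apply div_nonneg _ hm.le; linarith
    have h2 := pk_nonneg (m := m) (k := k + j) (by omega)
    calc _ = (((m : ℝ) - r + 1) / m) ^ j * pk m k * (((m : ℝ) - r + 1) / m) := by ring
      _ ≤ pk m (k + j) * (((m : ℝ) - r + 1) / m) := by gcongr
      _ ≤ _ := by gcongr

lemma term_gen {r : ℕ} {x : ℕ → ℝ} {d : ℝ} {K : Finset ℕ} (hr : 1 ≤ r) (hd : 0 ≤ d)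
    (hx : ∀ i ∈ K, 0 ≤ x i) (hsum : ∑ i ∈ K, x i + d = 1) (hrK : r ≤ K.card) :
    mass r x d K.powerset ≤
      pk K.card r * (1 - d + d * ((K.card : ℝ) / (K.card - r + 1))) ^ r := by
  have hK : 0 < K.card := by omega
  refine (term_sum hd hx hsum hrK hK).trans ?_
  rw [add_pow, Finset.mul_sum]
  refine Finset.sum_le_sum fun k hk => ?_
  have hk' : k ≤ r := by have := Finset.mem_range.mp hk; omega
  have hm := pk_mono hrK hr k (r - k) (by omega)
  rw [Nat.add_sub_cancel' hk'] at hm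
  have h1d : 0 ≤ 1 - d := by
    have := Finset.sum_nonneg hx; linarith
  have hmr : (0:ℝ) < (K.card : ℝ) - r + 1 := by
    have : (r:ℝ) ≤ K.card := by exact_mod_cast hrK
    linarith
  have hm0 : (0:ℝ) < K.card := by exact_mod_cast hK
  set q := (K.card : ℝ) / (K.card - r + 1) with hq
  have hq0 : 0 < q := by positivity
  have hqi : ((K.card : ℝ) - r + 1) / K.card = q⁻¹ := by rw [hq, inv_div]
  rw [hqi, inv_pow, inv_mul_le_iff₀ (by positivity)] at hm
  have hc : (0:ℝ) ≤ (r.choose k : ℝ) * d ^ (r - k) * (1 - d) ^ k := by positivity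
  have := mul_le_mul_of_nonneg_left hm hc
  rw [mul_pow]
  linarith

lemma pk_le {m r : ℕ} (hr : 1 ≤ r) (hrm : r ≤ m) (hm2 : m ≤ 2 * r) :
    pk m r ≤ (3 / 4) ^ (r - 1) := by
  obtain ⟨n, rfl⟩ : ∃ n, r = n + 1 := ⟨r - 1, by omega⟩
  have hm : (0:ℝ) < m := by exact_mod_cast (by omega : 0 < m)
  have e : pk m (n + 1) = ∏ i ∈ Finset.range n, (1 - ((i + 1 : ℕ) : ℝ) / m) := by
    unfold pk; rw [Finset.prod_range_succ']; simp
  have hnn := pk_nonneg hrm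
  simp only [Nat.add_sub_cancel]
  have hsq : pk m (n + 1) ^ 2 ≤ ((3 / 4) ^ n) ^ 2 := by
    have e2 : pk m (n + 1) = ∏ i ∈ Finset.range n, (1 - ((n - 1 - i + 1 : ℕ) : ℝ) / m) := by
      rw [e, Finset.prod_range_reflect (fun i => (1 - ((i + 1 : ℕ) : ℝ) / m)) n]
    have : pk m (n + 1) ^ 2 = ∏ i ∈ Finset.range n,
        ((1 - ((i + 1 : ℕ) : ℝ) / m) * (1 - ((n - 1 - i + 1 : ℕ) : ℝ) / m)) := by
      rw [Finset.prod_mul_distrib, ← e, ← e2]; ring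
    rw [this, ← pow_mul, mul_comm n 2, pow_mul]
    calc _ ≤ ∏ i ∈ Finset.range n, ((3 / 4 : ℝ) ^ 2) := by
          apply Finset.prod_le_prod
          · intro i hi
            have hi' := Finset.mem_range.mp hi
            apply mul_nonneg
            · rw [sub_nonneg]; apply div_le_one_of_le₀ _ hm.le
              exact_mod_cast (by omega : i + 1 ≤ m)
            · rw [sub_nonneg]; apply div_le_one_of_le₀ _ hm.le
              exact_mod_cast (by omega : n - 1 - i + 1 ≤ m)
          · intro i hi
            have hi' := Finset.mem_range.mp hi
            have hab : ((i + 1 : ℕ) : ℝ) / m + ((n - 1 - i + 1 : ℕ) : ℝ) / m ≥ 1 / 2 := by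
              rw [← add_div, ge_iff_le, div_le_div_iff₀ (by norm_num) hm]
              have : m ≤ (i + 1 + (n - 1 - i + 1)) * 2 := by omega
              have : (m:ℝ) ≤ ((i + 1 + (n - 1 - i + 1)) * 2 : ℕ) := by exact_mod_cast this
              push_cast at *; linarith
            have h0 : ((i + 1 : ℕ) : ℝ) / m ≤ 1 := by
              apply div_le_one_of_le₀ _ hm.le
              exact_mod_cast (by omega : i + 1 ≤ m)
            have h1 : ((n - 1 - i + 1 : ℕ) : ℝ) / m ≤ 1 := by
              apply div_le_one_of_le₀ _ hm.le
              exact_mod_cast (by omega : n - 1 - i + 1 ≤ m)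
            set a := ((i + 1 : ℕ) : ℝ) / m
            set b := ((n - 1 - i + 1 : ℕ) : ℝ) / m
            nlinarith [sq_nonneg (a - b)]
      _ = _ := by simp
  exact le_of_sq_le_sq hsq (by positivity)

noncomputable def pir (r : ℕ) : ℝ := (1 - 1 / (r : ℝ)) ^ (r - 1)

lemma poly7 (d:ℝ) (h0:0≤d) (h1: d ≤ 1/8) : d^4*(1-840)+4*d^3*(1-d)+6*d^2*(1-d)^2*(6/7)+4*d*(1-d)^3*(30/49)+(1-d)^4*(120/343) ≤ 0.415 := by
  nlinarith [mul_nonneg h0 (sub_nonneg.2 h1), sq_nonneg (d^2-1/196), sq_nonneg (d-1/14), mul_nonneg h0 (sq_nonneg (d-1/14)), sq_nonneg (d^2 - d/14), mul_nonneg h0 (mul_nonneg h0 (sub_nonneg.2 h1))]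

lemma poly6 (d:ℝ) (h0:0≤d) (h1: d ≤ 1/7) : d^4*(1-240)+4*d^3*(1-d)+6*d^2*(1-d)^2*(5/6)+4*d*(1-d)^3*(5/9)+(1-d)^4*(5/18) ≤ 0.415 := by
  nlinarith [mul_nonneg h0 (sub_nonneg.2 h1), sq_nonneg (d^2-1/100), sq_nonneg (d-1/10), mul_nonneg h0 (sq_nonneg (d-1/10)), sq_nonneg (d^2 - d/10), mul_nonneg h0 (mul_nonneg h0 (sub_nonneg.2 h1))]

lemma pc_sub (K : Finset ℕ) (k : ℕ) : K.powersetCard k ⊆ K.powerset := fun T hT =>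
  Finset.mem_powerset.mpr (Finset.mem_powersetCard.mp hT).1

/-- the members of an intersecting family are at most half of a complement closed family -/
lemma half_missing {K : Finset ℕ} (A C : Finset (Finset ℕ)) (hC : C ⊆ K.powerset)
    (hcl : ∀ S ∈ C, K \ S ∈ C) (hI : Inter A) : C.card ≤ 2 * (C.filter (fun S => S ∉ A)).card := by
  classical
  have h1 : (C.filter (fun S => S ∈ A)).card ≤ (C.filter (fun S => S ∉ A)).card := by
    apply Finset.card_le_card_of_injOn (fun S => K \ S)
    · intro S hS
      have hS := Finset.mem_filter.mp hS
      refine Finset.mem_coe.mpr (Finset.mem_filter.mpr ⟨hcl S hS.1, fun h => ?_⟩)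
      obtain ⟨z, hz⟩ := hI S hS.2 _ h
      simp at hz
    · intro S hS T hT h
      have hS := Finset.mem_powerset.mp (hC (Finset.mem_filter.mp hS).1)
      have hT := Finset.mem_powerset.mp (hC (Finset.mem_filter.mp hT).1)
      have := congrArg (fun Y => K \ Y) h
      simpa [Finset.sdiff_sdiff_eq_self, hS, hT] using this
  have h2 := Finset.card_filter_add_card_filter_not (s := C) (fun S => S ∈ A)
  omega

lemma mu_ge4 {x : ℕ → ℝ} {d : ℝ} {T : Finset ℕ} (hd : 0 ≤ d)
    (hx : ∀ i ∈ T, d ≤ x i) (hT : T.card = 3 ∨ T.card = 4) : 24 * d ^ 4 ≤ mu 4 x d T := by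
  have hp : d ^ T.card ≤ ∏ i ∈ T, x i := by
    rw [← Finset.prod_const]
    exact Finset.prod_le_prod (fun i _ => hd) hx
  unfold mu
  rcases hT with h | h <;> rw [h] at hp ⊢
  · have e : Nat.descFactorial 4 3 = 24 := by decide
    rw [e]; norm_num
    have := mul_le_mul_of_nonneg_left hp hd
    nlinarith
  · have e : Nat.descFactorial 4 4 = 24 := by decide
    rw [e]; norm_num
    linarith

lemma term4 {x : ℕ → ℝ} {d : ℝ} {K : Finset ℕ} (hd : 0 ≤ d)
    (hx : ∀ i ∈ K, d ≤ x i) (hsum : ∑ i ∈ K, x i + d = 1)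
    (hK : K.card = 7 ∨ K.card = 6) (A : Finset (Finset ℕ)) (hA : A ⊆ K.powerset) (hI : Inter A) :
    mass 4 x d A ≤ 0.415 := by
  classical
  have hx0 : ∀ i ∈ K, 0 ≤ x i := fun i hi => hd.trans (hx i hi)
  have hdK : ((K.card : ℝ) + 1) * d ≤ 1 := by
    have : (K.card : ℝ) * d ≤ ∑ i ∈ K, x i := by
      have := Finset.card_nsmul_le_sum K x d hx
      simpa using this
    linarith
  have main : ∀ C : Finset (Finset ℕ), C ⊆ K.powerset → (∀ S ∈ C, K \ S ∈ C) →
      (∀ S ∈ C, S.card = 3 ∨ S.card = 4) →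
      mass 4 x d A ≤ mass 4 x d K.powerset - (C.card / 2 : ℝ) * (24 * d ^ 4) := by
    intro C hC hcl hcard
    have h1 := half_missing A C hC hcl hI
    set N := C.filter (fun S => S ∉ A)
    have hdisj : Disjoint A N := by
      rw [Finset.disjoint_left]; intro S hS hS'
      exact (Finset.mem_filter.mp hS').2 hS
    have hsub : A ∪ N ⊆ K.powerset := Finset.union_subset hA ((Finset.filter_subset _ _).trans hC)
    have h2 := mass_le_all (r := 4) hd hx0 _ hsub
    have h3 : mass 4 x d (A ∪ N) = mass 4 x d A + mass 4 x d N := Finset.sum_union hdisj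
    have h4 : (N.card : ℝ) * (24 * d ^ 4) ≤ mass 4 x d N := by
      have := Finset.card_nsmul_le_sum N (mu 4 x d) (24 * d ^ 4) (fun S hS => by
        have hSC := (Finset.mem_filter.mp hS).1
        exact mu_ge4 hd (fun i hi => hx i (Finset.mem_powerset.mp (hC hSC) hi)) (hcard S hSC))
      simpa [mass] using this
    have h5 : (C.card / 2 : ℝ) ≤ N.card := by
      have : (C.card : ℝ) ≤ 2 * N.card := by exact_mod_cast h1
      linarith
    have : (C.card / 2 : ℝ) * (24 * d ^ 4) ≤ (N.card : ℝ) * (24 * d ^ 4) := by gcongr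
    linarith
  have ht := term_sum (r := 4) hd hx0 hsum (by omega) (by omega)
  rcases hK with hK | hK
  · have hC := main (K.powersetCard 3 ∪ K.powersetCard 4) (by
      apply Finset.union_subset <;> exact pc_sub _ _) (by
      intro S hS
      simp only [Finset.mem_union, Finset.mem_powersetCard] at hS ⊢
      have hsub : S ⊆ K := by tauto
      have := Finset.card_sdiff_add_card_eq_card hsub
      have := Finset.sdiff_subset (s := K) (t := S)
      rcases hS with h | h
      · right; exact ⟨this, by omega⟩
      · left; exact ⟨this, by omega⟩) (by
      intro S hS
      simp only [Finset.mem_union, Finset.mem_powersetCard] at hS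
      tauto)
    have hcc : (K.powersetCard 3 ∪ K.powersetCard 4).card = 70 := by
      rw [Finset.card_union_of_disjoint, Finset.card_powersetCard, Finset.card_powersetCard, hK]
      · decide
      · rw [Finset.disjoint_left]; intro S h1 h2
        rw [Finset.mem_powersetCard] at h1 h2; omega
    rw [hcc] at hC
    rw [hK] at ht hdK
    have h0 := poly7 d hd (by norm_num at hdK; linarith)
    simp only [Finset.sum_range_succ, Finset.sum_range_zero, pk, Finset.prod_range_succ, Finset.prod_range_zero] at ht
    have c1 : Nat.choose 4 2 = 6 := by decide
    have c2 : Nat.choose 4 3 = 4 := by decide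
    norm_num [c1, c2] at ht hC
    linarith
  · have hC := main (K.powersetCard 3) (pc_sub _ _) (by
      intro S hS
      simp only [Finset.mem_powersetCard] at hS ⊢
      have := Finset.card_sdiff_add_card_eq_card hS.1
      exact ⟨Finset.sdiff_subset, by omega⟩) (by
      intro S hS
      simp only [Finset.mem_powersetCard] at hS
      tauto)
    have hcc : (K.powersetCard 3).card = 20 := by
      rw [Finset.card_powersetCard, hK]
      decide
    rw [hcc] at hC
    rw [hK] at ht hdK
    have h0 := poly6 d hd (by norm_num at hdK; linarith)
    simp only [Finset.sum_range_succ, Finset.sum_range_zero, pk, Finset.prod_range_succ, Finset.prod_range_zero] at ht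
    have c1 : Nat.choose 4 2 = 6 := by decide
    have c2 : Nat.choose 4 3 = 4 := by decide
    norm_num [c1, c2] at ht hC
    linarith

lemma pir_ge_exp {r : ℕ} (hr : 2 ≤ r) : Real.exp (-1) ≤ pir r := by
  obtain ⟨n, rfl⟩ : ∃ n, r = n + 2 := ⟨r - 2, by omega⟩
  unfold pir
  have e : n + 2 - 1 = n + 1 := rfl
  rw [e]
  have hn : (0:ℝ) < (n:ℝ) + 1 := by positivity
  have h1 : (1 - 1 / ((n + 2 : ℕ) : ℝ)) = (1 + 1 / ((n:ℝ) + 1))⁻¹ := by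
    push_cast; field_simp; ring
  rw [h1, Real.exp_neg, inv_pow]
  apply inv_anti₀ (by positivity)
  have h2 : 1 + 1 / ((n:ℝ) + 1) ≤ Real.exp (1 / ((n:ℝ) + 1)) := by
    have := Real.add_one_le_exp (1 / ((n:ℝ) + 1)); linarith
  calc _ ≤ Real.exp (1 / ((n:ℝ) + 1)) ^ (n + 1) := by gcongr
    _ = Real.exp 1 := by
      rw [← Real.exp_nat_mul]; congr 1; push_cast; field_simp

lemma terminal {r : ℕ} (hr : 4 ≤ r) : ∃ c < pir r, ∀ (x : ℕ → ℝ) (d : ℝ) (K : Finset ℕ), 0 ≤ d →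
    (∀ i ∈ K, d ≤ x i) → (∑ i ∈ K, x i + d = 1) → (K.card + 1 = 2 * r ∨ K.card + 2 = 2 * r) →
    ∀ A ⊆ K.powerset, Inter A → mass r x d A ≤ c := by
  have hdK : ∀ (x : ℕ → ℝ) (d : ℝ) (K : Finset ℕ), 
    (∀ i ∈ K, d ≤ x i) → (∑ i ∈ K, x i + d = 1) → ((K.card : ℝ) + 1) * d ≤ 1 := by
    intro x d K hx hsum
    have : (K.card : ℝ) * d ≤ ∑ i ∈ K, x i := by
      have := Finset.card_nsmul_le_sum K x d hx
      simpa using this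
    linarith
  have gen : ∀ (x : ℕ → ℝ) (d : ℝ) (K : Finset ℕ), 0 ≤ d →
    (∀ i ∈ K, d ≤ x i) → (∑ i ∈ K, x i + d = 1) → r ≤ K.card → ∀ A ⊆ K.powerset,
    mass r x d A ≤ pk K.card r * (1 + 1 / ((K.card : ℝ) + 1) * (((r : ℝ) - 1) / (K.card - r + 1))) ^ r := by
    intro x d K hd hx hsum hrK A hA
    have hx0 : ∀ i ∈ K, 0 ≤ x i := fun i hi => hd.trans (hx i hi)
    refine (mass_le_all hd hx0 A hA).trans ((term_gen (by omega) hd hx0 hsum hrK).trans ?_)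
    have hmr : (0:ℝ) < (K.card : ℝ) - r + 1 := by
      have : (r:ℝ) ≤ K.card := by exact_mod_cast hrK
      linarith
    have e : 1 - d + d * ((K.card : ℝ) / (K.card - r + 1)) = 1 + d * (((r : ℝ) - 1) / (K.card - r + 1)) := by
      field_simp; ring
    rw [e]
    have hdd : d ≤ 1 / ((K.card : ℝ) + 1) := by
      rw [le_div_iff₀ (by positivity)]; linarith [hdK x d K hx hsum]
    have h1r : (0:ℝ) ≤ (r:ℝ) - 1 := by
      have : (1:ℝ) ≤ r := by exact_mod_cast (by omega : 1 ≤ r)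
      linarith
    have := pk_nonneg hrK
    gcongr
  rcases Nat.lt_or_ge 6 r with h7 | h6
  · refine ⟨(3/4)^6 * 2, ?_, ?_⟩
    · refine lt_of_lt_of_le ?_ (pir_ge_exp (by omega))
      rw [Real.exp_neg, lt_inv_comm₀ (by norm_num) (Real.exp_pos _)]
      exact Real.exp_one_lt_d9.trans (by norm_num)
    · intro x d K hd hx hsum hK A hA hI
      refine (gen x d K hd hx hsum (by omega) A hA).trans ?_
      have hrR : (7:ℝ) ≤ r := by exact_mod_cast h7
      have h1 : pk K.card r ≤ (3/4)^6 := (pk_le (by omega) (by omega) (by omega)).trans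
        (pow_le_pow_of_le_one (by norm_num) (by norm_num) (by omega))
      have hKR : (2:ℝ) * r - 2 ≤ K.card := by
        have : 2 * r ≤ K.card + 2 := by omega
        have : ((2 * r : ℕ):ℝ) ≤ ((K.card + 2 : ℕ) : ℝ) := by exact_mod_cast this
        push_cast at this; linarith
      have hfr : ((r : ℝ) - 1) / (K.card - r + 1) ≤ 1 := by
        apply div_le_one_of_le₀ <;> linarith
      have h0 : 1 / ((K.card : ℝ) + 1) * (((r : ℝ) - 1) / (K.card - r + 1)) ≤ 1 / (2 * (r:ℝ) - 1) := by
        calc _ ≤ 1 / ((K.card : ℝ) + 1) * 1 := by gcongr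
          _ = 1 / ((K.card : ℝ) + 1) := mul_one _
          _ ≤ _ := by
            apply one_div_le_one_div_of_le <;> linarith
      have h2 : (1 + 1 / ((K.card : ℝ) + 1) * (((r : ℝ) - 1) / (K.card - r + 1))) ^ r ≤ 2 := by
        have hnn : 0 ≤ 1 / ((K.card : ℝ) + 1) * (((r : ℝ) - 1) / (K.card - r + 1)) := by
          apply mul_nonneg (by positivity)
          apply div_nonneg <;> linarith
        have hle : 1 + 1 / ((K.card : ℝ) + 1) * (((r : ℝ) - 1) / (K.card - r + 1)) ≤ Real.exp (1 / (2 * (r:ℝ) - 1)) := by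
          have := Real.add_one_le_exp (1 / (2 * (r:ℝ) - 1)); linarith
        calc _ ≤ Real.exp (1 / (2 * (r:ℝ) - 1)) ^ r := by gcongr
          _ = Real.exp (r * (1 / (2 * (r:ℝ) - 1))) := by rw [← Real.exp_nat_mul]
          _ ≤ Real.exp (Real.log 2) := by
            apply Real.exp_le_exp.mpr
            have := Real.log_two_gt_d9
            have : (r:ℝ) * (1 / (2 * (r:ℝ) - 1)) ≤ 0.6 := by
              rw [mul_one_div, div_le_iff₀ (by linarith)]; linarith
            linarith
          _ = 2 := Real.exp_log (by norm_num)
      have h3 := pk_nonneg (m := K.card) (k := r) (by omega)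
      calc _ ≤ pk K.card r * 2 := by gcongr
        _ ≤ _ := by gcongr
  · interval_cases r
    · refine ⟨0.415, by norm_num [pir], ?_⟩
      intro x d K hd hx hsum hK A hA hI
      exact term4 hd hx hsum (by omega) A hA hI
    · refine ⟨0.4, by norm_num [pir], ?_⟩
      intro x d K hd hx hsum hK A hA hI
      refine (gen x d K hd hx hsum (by omega) A hA).trans ?_
      have : K.card = 9 ∨ K.card = 8 := by omega
      rcases this with h | h <;> rw [h] <;>
        norm_num [pk, Finset.prod_range_succ]
    · refine ⟨0.4, by norm_num [pir], ?_⟩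
      intro x d K hd hx hsum hK A hA hI
      refine (gen x d K hd hx hsum (by omega) A hA).trans ?_
      have : K.card = 11 ∨ K.card = 10 := by omega
      rcases this with h | h <;> rw [h] <;>
        norm_num [pk, Finset.prod_range_succ]

noncomputable def gr (r : ℕ) (y : ℝ) : ℝ := r * y * (1 - y) ^ (r - 1)

theorem L0 {r : ℕ} (hr : 4 ≤ r) : ∃ c < pir r, ∀ (n : ℕ) (x : ℕ → ℝ) (d : ℝ) (K : Finset ℕ),
    K.card = n + 1 → 0 ≤ d → (∀ i ∈ K, 0 ≤ x i) → (∑ i ∈ K, x i + d = 1) →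
    ∀ A ⊆ K.powerset, Inter A → ∃ i ∈ K, mass r x d A ≤ max (gr r (x i)) c := by
  obtain ⟨c, hc, hterm⟩ := terminal hr
  refine ⟨c, hc, ?_⟩
  intro n
  induction n with
  | zero =>
    intro x d K hK hd hx hsum A hA hI
    obtain ⟨i, rfl⟩ := Finset.card_eq_one.mp hK
    refine ⟨i, by simp, le_max_of_le_left ?_⟩
    have hsub : A ⊆ {{i}} := by
      intro T hT
      have h1 := Finset.mem_powerset.mp (hA hT)
      rcases Finset.subset_singleton_iff.mp h1 with h | h
      · obtain ⟨z, hz⟩ := hI T hT T hT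
        simp [h] at hz
      · simp [h]
    have h2 : mass r x d A ≤ mass r x d {{i}} := by
      apply Finset.sum_le_sum_of_subset_of_nonneg hsub
      intro T hT _
      apply mu_nonneg hd
      intro j hj
      simp at hT; subst hT
      exact hx j hj
    refine h2.trans (le_of_eq ?_)
    simp at hsum
    have : d = 1 - x i := by linarith
    simp [mass, mu, gr, this]; ring
  | succ n ih =>
    intro x d K hK hd hx hsum A hA hI
    have hKne : K.Nonempty := Finset.card_pos.mp (by omega)
    obtain ⟨m, hm, hmin⟩ := Finset.exists_min_image K x hKne
    by_cases hcase : x m ≤ d ∨ (K.card + 1 ≠ 2 * r ∧ K.card + 2 ≠ 2 * r)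
    · obtain ⟨A', h1, h2, h3, h4⟩ := shift_lemma (r := r) hd hx hm hmin _ A le_rfl hA hI
      obtain ⟨A'', g1, g2, g3⟩ := step_lemma (r := r) hd hx hm (by omega) hcase A' h1 h2 h4
      obtain ⟨i, hi, hle⟩ := ih x (d + x m) (K.erase m) (by rw [Finset.card_erase_of_mem hm]; omega)
        (by linarith [hx m hm]) (fun i hi => hx i (Finset.mem_of_mem_erase hi))
        (by rw [← Finset.add_sum_erase K x hm] at hsum; linarith) A'' g1 g2
      exact ⟨i, Finset.mem_of_mem_erase hi, (h3.trans g3).trans hle⟩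
    · refine ⟨m, hm, le_max_of_le_right ?_⟩
      push Not at hcase
      refine hterm x d K hd (fun i hi => hcase.1.le.trans (hmin i hi)) hsum ?_ A hA hI
      by_cases h : K.card + 1 = 2 * r
      · left; exact h
      · right; exact hcase.2 h

lemma phi_le_one (n : ℕ) (h : ℝ) (hh : -1 ≤ h) : (1 + h) ^ n * (1 - n * h) ≤ 1 := by
  induction n with
  | zero => simp
  | succ n ih =>
    have e : (1 + h) ^ (n + 1) * (1 - ((n + 1 : ℕ):ℝ) * h) =
      (1 + h) ^ n * (1 - n * h) - (n + 1) * h ^ 2 * (1 + h) ^ n := by push_cast; ring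
    have : 0 ≤ (n + 1) * h ^ 2 * (1 + h) ^ n := by
      have : 0 ≤ 1 + h := by linarith
      positivity
    linarith

lemma phi_le_sq (n : ℕ) (h : ℝ) (hh : 0 ≤ h) : (1 + h) ^ n * (1 - n * h) ≤ 1 - n * h ^ 2 := by
  induction n with
  | zero => simp
  | succ n ih =>
    have e : (1 + h) ^ (n + 1) * (1 - ((n + 1 : ℕ):ℝ) * h) =
      (1 + h) ^ n * (1 - n * h) - (n + 1) * h ^ 2 * (1 + h) ^ n := by push_cast; ring
    have h1 : 1 ≤ (1 + h) ^ n := one_le_pow₀ (by linarith)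
    have h2 : 0 ≤ ((n:ℝ) + 1) * h ^ 2 := by positivity
    have : h ^ 2 ≤ (n + 1) * h ^ 2 * (1 + h) ^ n := by
      have hn : (0:ℝ) ≤ n * h ^ 2 := by positivity
      nlinarith
    push_cast at *
    linarith

lemma pir_pos {r : ℕ} (hr : 2 ≤ r) : 0 < pir r := by
  unfold pir
  have : (1:ℝ) < r := by exact_mod_cast hr
  have : 1 / (r:ℝ) < 1 := by rw [div_lt_one (by linarith)]; exact this
  apply pow_pos; linarith

lemma gr_phi {r : ℕ} (hr : 2 ≤ r) (y : ℝ) : gr r y = pir r *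
    ((1 + (1 - r * y) / ((r - 1 : ℕ) : ℝ)) ^ (r - 1) * (1 - (r - 1 : ℕ) * ((1 - r * y) / ((r - 1 : ℕ):ℝ)))) := by
  obtain ⟨n, rfl⟩ : ∃ n, r = n + 1 := ⟨r - 1, by omega⟩
  simp only [Nat.add_sub_cancel]
  have hn : (0:ℝ) < n := by exact_mod_cast (by omega : 0 < n)
  unfold gr pir
  simp only [Nat.add_sub_cancel]
  rw [mul_div_cancel₀ _ hn.ne', ← mul_assoc, ← mul_pow]
  have e : (1 - 1 / ((n + 1 : ℕ) : ℝ)) * (1 + (1 - ((n + 1 : ℕ) : ℝ) * y) / n) = 1 - y := by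
    push_cast; field_simp; ring
  rw [e]; ring

lemma gr_le {r : ℕ} (hr : 2 ≤ r) (y : ℝ) (h1 : y ≤ 1) : gr r y ≤ pir r := by
  rw [gr_phi hr]
  have hn : (0:ℝ) < ((r - 1 : ℕ) : ℝ) := by exact_mod_cast (by omega : 0 < r - 1)
  have hrr : (r:ℝ) = ((r - 1 : ℕ) : ℝ) + 1 := by
    rw [Nat.cast_sub (by omega)]; simp
  have hr0 : (0:ℝ) < r := by linarith
  have := phi_le_one (r - 1) ((1 - r * y) / ((r - 1 : ℕ) : ℝ)) (by
    rw [le_div_iff₀ hn]; nlinarith)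
  have := mul_le_mul_of_nonneg_left this (pir_pos hr).le
  linarith

lemma gr_le_sq {r : ℕ} (hr : 2 ≤ r) (y : ℝ) (h1 : r * y ≤ 1) :
    gr r y ≤ pir r * (1 - ((1 - r * y) / ((r - 1 : ℕ) : ℝ)) ^ 2) := by
  rw [gr_phi hr]
  have hn : (1:ℝ) ≤ ((r - 1 : ℕ) : ℝ) := by exact_mod_cast (by omega : 1 ≤ r - 1)
  have := phi_le_sq (r - 1) ((1 - r * y) / ((r - 1 : ℕ) : ℝ)) (by
    apply div_nonneg <;> linarith)
  apply mul_le_mul_of_nonneg_left _ (pir_pos hr).le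
  nlinarith [sq_nonneg ((1 - r * y) / ((r - 1 : ℕ) : ℝ))]

lemma gr_lower {r : ℕ} (hr : 2 ≤ r) (s : ℝ) (hs : 0 ≤ s) (hs1 : r * s ≤ 1) :
    pir r * (1 - r ^ 2 * s ^ 2) ≤ gr r (1 / r - s) := by
  obtain ⟨n, rfl⟩ : ∃ n, r = n + 1 := ⟨r - 1, by omega⟩
  have hn : (0:ℝ) < n := by exact_mod_cast (by omega : 0 < n)
  rw [gr_phi hr]
  have hp := (pir_pos hr).le
  simp only [Nat.add_sub_cancel]
  have e : (1 - ((n + 1 : ℕ) : ℝ) * (1 / ((n + 1 : ℕ) : ℝ) - s)) = (n + 1) * s := by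
    push_cast; field_simp; ring
  rw [e]
  have hb := one_add_mul_le_pow (a := (n + 1) * s / (n:ℝ)) (le_trans (by norm_num) (by positivity : (0:ℝ) ≤ (n + 1) * s / (n:ℝ))) n
  rw [mul_div_cancel₀ _ hn.ne'] at hb
  rw [mul_div_cancel₀ _ hn.ne']
  push_cast at *
  apply mul_le_mul_of_nonneg_left _ hp
  have := mul_le_mul_of_nonneg_right hb (by linarith : 0 ≤ 1 - ((n:ℝ) + 1) * s)
  nlinarith

noncomputable def wt (r : ℕ) (x : ℕ → ℝ) (A : Finset (Finset ℕ)) : ℝ :=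
  (r.factorial : ℝ) * ∑ e ∈ A, ∏ i ∈ e, x i

lemma wt_eq_mass {r : ℕ} {x : ℕ → ℝ} {K : Finset ℕ} {A : Finset (Finset ℕ)}
    (hA : A ⊆ K.powersetCard r) : wt r x A = mass r x 0 A := by
  unfold wt mass
  rw [Finset.mul_sum]
  refine Finset.sum_congr rfl fun e he => ?_
  have := (Finset.mem_powersetCard.mp (hA he)).2
  unfold mu
  rw [this]; simp [Nat.descFactorial_self]

theorem L1 {r : ℕ} (hr : 4 ≤ r) (x : ℕ → ℝ) (K : Finset ℕ) (hx : ∀ i ∈ K, 0 ≤ x i)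
    (hsum : ∑ i ∈ K, x i = 1) (A : Finset (Finset ℕ)) (hA : A ⊆ K.powersetCard r) (hI : Inter A) :
    wt r x A ≤ pir r := by
  obtain ⟨c, hc, h⟩ := L0 hr
  have hK : 0 < K.card := by
    rw [Finset.card_pos]
    by_contra hne
    rw [Finset.not_nonempty_iff_eq_empty] at hne
    simp [hne] at hsum
  obtain ⟨i, hi, hle⟩ := h (K.card - 1) x 0 K (by omega) le_rfl hx (by simpa using hsum) A
    (hA.trans (pc_sub _ _)) hI
  rw [wt_eq_mass hA]
  refine hle.trans (max_le (gr_le (by omega) _ ?_) hc.le)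
  rw [← hsum]
  exact Finset.single_le_sum hx hi

lemma L2_arith {r : ℕ} (hr : 2 ≤ r) {a s ε κ A' B' : ℝ} (hA : 0 ≤ A') (hB : 0 ≤ B') (ha : a ≤ 1)
    (hs : 0 < s) (hs1 : r * s ≤ 1) (has : 1 / r - s / 2 ≤ a)
    (h1 : ∀ t, 0 ≤ t → t ≤ 1 → gr r t * A' + (1 - t) ^ r * B' ≤ pir r)
    (h2 : pir r - ε ≤ gr r a * A' + (1 - a) ^ r * B')
    (hsk : 4 * (pir r * r ^ 2) * s ≤ κ) (hek : 4 * ε ≤ κ * s) : (1 - a) ^ r * B' ≤ κ := by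
  have hp := pir_pos hr
  have hr0 : (0:ℝ) < r := by exact_mod_cast (by omega : 0 < r)
  have hr1 : 1 / (r:ℝ) ≤ 1 := by
    rw [div_le_one hr0]; exact_mod_cast (by omega : 1 ≤ r)
  have hA1 : A' ≤ 1 := by
    have := h1 (1 / r) (by positivity) hr1
    have e := gr_lower hr 0 le_rfl (by simp)
    simp at e
    have h3 : 0 ≤ (1 - 1 / (r:ℝ)) ^ r * B' := by
      apply mul_nonneg _ hB; apply pow_nonneg; linarith
    simp at this h3
    nlinarith
  have hst : s ≤ 1 / r := by rw [le_div_iff₀ hr0]; linarith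
  have ht := h1 (1 / r - s) (by linarith) (by linarith)
  have hlow := gr_lower hr s hs.le hs1
  have hga := gr_le hr a ha
  set v := 1 - a with hv
  have hv0 : 0 ≤ v := by linarith
  have hbern := pow_add_mul_le_add_pow (a := v) (b := (a - (1 / r - s))) hv0 (by linarith) r
  have e : v + (a - (1 / r - s)) = 1 - (1 / r - s) := by rw [hv]; ring
  rw [e] at hbern
  have hvv : v ^ r * (s / 2) ≤ r * v ^ (r - 1) * (a - (1 / r - s)) := by
    have h3 : v ^ r ≤ r * v ^ (r - 1) := by
      have : v ^ r = v * v ^ (r - 1) := by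
        rw [← pow_succ']; congr 1; omega
      rw [this]
      apply mul_le_mul_of_nonneg_right _ (by positivity)
      have h4 : (1:ℝ) ≤ r := by exact_mod_cast (by omega : 1 ≤ r)
      have : 0 ≤ 1 / (r:ℝ) := by positivity
      have h2r : 1 / (r:ℝ) - s / 2 ≥ 0 := by linarith
      linarith
    have h5 : 0 ≤ (r:ℝ) * v ^ (r - 1) := by positivity
    have : s / 2 ≤ a - (1 / r - s) := by linarith
    calc _ ≤ r * v ^ (r - 1) * (s / 2) := by gcongr
      _ ≤ _ := by gcongr
  have k1 := mul_le_mul_of_nonneg_right (le_trans (add_le_add_right hvv _) hbern) hB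
  have k2 := mul_le_mul_of_nonneg_right hlow hA
  have k3 := mul_le_mul_of_nonneg_right hga hA
  have hC : 0 ≤ pir r * (r ^ 2 * s ^ 2) := by positivity
  have k4 : pir r * (r ^ 2 * s ^ 2) * A' ≤ pir r * (r ^ 2 * s ^ 2) := mul_le_of_le_one_right hC hA1
  have k5 : v ^ r * B' * (s / 2) ≤ pir r * (r ^ 2 * s ^ 2) + ε := by nlinarith
  have k6 : pir r * (r ^ 2 * s ^ 2) ≤ κ * s / 4 := by nlinarith
  have : v ^ r * B' * (s / 2) ≤ κ * (s / 2) := by linarith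
  exact le_of_mul_le_mul_right this (by positivity)

theorem L2 {r : ℕ} (hr : 4 ≤ r) (κ : ℝ) (hκ : 0 < κ) : ∃ ε > 0, ∀ (x : ℕ → ℝ) (K : Finset ℕ),
    (∀ i ∈ K, 0 ≤ x i) → (∑ i ∈ K, x i = 1) → ∀ A ⊆ K.powersetCard r, Inter A →
    pir r - ε ≤ wt r x A → ∃ i ∈ K, wt r x (A.filter (fun e => i ∉ e)) ≤ κ := by
  classical
  obtain ⟨c, hc, h⟩ := L0 hr
  have hp := pir_pos (by omega : 2 ≤ r)
  have hr0 : (0:ℝ) < r := by exact_mod_cast (by omega : 0 < r)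
  have hrm : (0:ℝ) < ((r - 1 : ℕ) : ℝ) := by exact_mod_cast (by omega : 0 < r - 1)
  set s : ℝ := min (1 / r) (κ / (4 * (pir r * r ^ 2))) with hs
  have hs0 : 0 < s := by rw [hs]; positivity
  have hs1 : r * s ≤ 1 := by
    have : s ≤ 1 / r := min_le_left _ _
    rw [le_div_iff₀ hr0] at this; linarith
  have hs2 : 4 * (pir r * r ^ 2) * s ≤ κ := by
    have : s ≤ κ / (4 * (pir r * r ^ 2)) := min_le_right _ _
    rw [le_div_iff₀ (by positivity)] at this; linarith
  set h0 : ℝ := r * (s / 2) / ((r - 1 : ℕ) : ℝ) with hh0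
  have hh00 : 0 < h0 := by rw [hh0]; positivity
  refine ⟨min (min ((pir r - c) / 2) (pir r * h0 ^ 2 / 2)) (min (κ * s / 4) (pir r / 2)), ?_, ?_⟩
  · have : 0 < pir r - c := by linarith
    positivity
  intro x K hx hsum A hA hI hge
  set ε := min (min ((pir r - c) / 2) (pir r * h0 ^ 2 / 2)) (min (κ * s / 4) (pir r / 2)) with hε
  have e1 : ε ≤ (pir r - c) / 2 := (min_le_left _ _).trans (min_le_left _ _)
  have e2 : ε ≤ pir r * h0 ^ 2 / 2 := (min_le_left _ _).trans (min_le_right _ _)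
  have e3 : ε ≤ κ * s / 4 := (min_le_right _ _).trans (min_le_left _ _)
  have e4 : ε ≤ pir r / 2 := (min_le_right _ _).trans (min_le_right _ _)
  have hK : 0 < K.card := by
    rw [Finset.card_pos]
    by_contra hne
    rw [Finset.not_nonempty_iff_eq_empty] at hne
    simp [hne] at hsum
  obtain ⟨i, hi, hle⟩ := h (K.card - 1) x 0 K (by omega) le_rfl hx (by simpa using hsum) A
    (hA.trans (pc_sub _ _)) hI
  rw [← wt_eq_mass hA] at hle
  refine ⟨i, hi, ?_⟩
  have hg : pir r - ε ≤ gr r (x i) := by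
    rcases le_max_iff.mp (hge.trans hle) with h | h
    · exact h
    · linarith
  have ha1 : x i ≤ 1 := by rw [← hsum]; exact Finset.single_le_sum hx hi
  have has : 1 / r - s / 2 ≤ x i := by
    by_contra hcon
    push Not at hcon
    have hry : r * x i ≤ 1 - r * (s / 2) := by
      have := mul_le_mul_of_nonneg_left hcon.le hr0.le
      rw [mul_sub, mul_one_div_cancel hr0.ne'] at this; exact this
    have h5 := gr_le_sq (by omega : 2 ≤ r) (x i) (by
      have : 0 ≤ r * (s / 2) := by positivity
      linarith)
    have h6 : h0 ≤ (1 - r * x i) / ((r - 1 : ℕ) : ℝ) := by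
      rw [hh0]; gcongr; linarith
    have h7 : h0 ^ 2 ≤ ((1 - r * x i) / ((r - 1 : ℕ) : ℝ)) ^ 2 := by gcongr
    have h8 := mul_le_mul_of_nonneg_left h7 hp.le
    have h9 : 0 < pir r * h0 ^ 2 := by positivity
    nlinarith
  have ha : x i < 1 := by
    rcases lt_or_eq_of_le ha1 with h | h
    · exact h
    · exfalso
      rw [h] at hg
      have : gr r 1 = 0 := by
        unfold gr; simp; omega
      linarith
  set v := 1 - x i with hv
  have hv0 : 0 < v := by linarith
  set A1 := A.filter (fun e => i ∈ e) with hA1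
  set A2 := A.filter (fun e => i ∉ e) with hA2
  set SA := (r.factorial : ℝ) * ∑ e ∈ A1, ∏ j ∈ e.erase i, x j with hSA
  have hSA0 : 0 ≤ SA := by
    apply mul_nonneg (by positivity)
    refine Finset.sum_nonneg fun e he => Finset.prod_nonneg fun j hj => ?_
    have := (Finset.mem_powersetCard.mp (hA (Finset.mem_filter.mp he).1)).1
    exact hx j (this (Finset.mem_of_mem_erase hj))
  have hSB0 : 0 ≤ wt r x A2 := by
    apply mul_nonneg (by positivity)
    refine Finset.sum_nonneg fun e he => Finset.prod_nonneg fun j hj => ?_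
    have := (Finset.mem_powersetCard.mp (hA (Finset.mem_filter.mp he).1)).1
    exact hx j (this hj)
  have hgen : ∀ t lam : ℝ, wt r (fun j => if j = i then t else x j * lam) A =
      t * lam ^ (r - 1) * SA + lam ^ r * wt r x A2 := by
    intro t lam
    unfold wt
    rw [← Finset.sum_filter_add_sum_filter_not A (fun e => i ∈ e), mul_add]
    congr 1
    · rw [hSA, ← mul_assoc, mul_comm (t * lam ^ (r - 1)), mul_assoc]
      congr 1
      rw [Finset.mul_sum]
      refine Finset.sum_congr rfl fun e he => ?_
      have hie := (Finset.mem_filter.mp he).2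
      have hec := (Finset.mem_powersetCard.mp (hA (Finset.mem_filter.mp he).1)).2
      rw [← Finset.mul_prod_erase e _ hie]
      simp only [if_true]
      rw [mul_assoc]; congr 1
      have : ∏ j ∈ e.erase i, (if j = i then t else x j * lam) = ∏ j ∈ e.erase i, (x j * lam) := by
        refine Finset.prod_congr rfl fun j hj => ?_
        rw [if_neg (Finset.ne_of_mem_erase hj)]
      rw [this, Finset.prod_mul_distrib, Finset.prod_const, Finset.card_erase_of_mem hie, hec]
      ring
    · rw [← mul_assoc, mul_comm (lam ^ r), mul_assoc]
      congr 1
      rw [Finset.mul_sum]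
      refine Finset.sum_congr rfl fun e he => ?_
      have hie := (Finset.mem_filter.mp he).2
      have hec := (Finset.mem_powersetCard.mp (hA (Finset.mem_filter.mp he).1)).2
      have : ∏ j ∈ e, (if j = i then t else x j * lam) = ∏ j ∈ e, (x j * lam) := by
        refine Finset.prod_congr rfl fun j hj => ?_
        rw [if_neg (fun h : j = i => hie (by rw [← h]; exact hj))]
      rw [this, Finset.prod_mul_distrib, Finset.prod_const, hec]
      ring
  have hq : wt r x A = x i * SA + wt r x A2 := by
    have := hgen (x i) 1
    simp only [one_pow, mul_one, one_mul] at this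
    rw [← this]
    congr 1
    funext j
    split_ifs with h
    · rw [h]
    · rfl
  have hrw : r = (r - 1) + 1 := by omega
  have final := L2_arith (r := r) (by omega) (a := x i) (s := s) (ε := ε) (κ := κ)
    (A' := SA / (r * v ^ (r - 1))) (B' := wt r x A2 / v ^ r) (by positivity) (by positivity)
    ha1 hs0 hs1 has ?_ ?_ hs2 (by linarith)
  · rw [mul_div_cancel₀] at final
    · exact final
    · positivity
  · intro t ht0 ht1
    have hh := L1 hr (fun j => if j = i then t else x j * ((1 - t) / v)) K ?_ ?_ A hA hI
    · rw [hgen] at hh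
      convert hh using 1
      unfold gr
      rw [div_pow, div_pow]
      field_simp
    · intro j hj
      split_ifs
      · exact ht0
      · have := hx j hj
        have : 0 ≤ 1 - t := by linarith
        positivity
    · rw [← Finset.add_sum_erase K _ hi]
      simp only [if_true]
      have : ∑ j ∈ K.erase i, (if j = i then t else x j * ((1 - t) / v)) =
          ∑ j ∈ K.erase i, (x j * ((1 - t) / v)) := by
        refine Finset.sum_congr rfl fun j hj => ?_
        rw [if_neg (Finset.ne_of_mem_erase hj)]
      rw [this, ← Finset.sum_mul]
      have h3 : ∑ j ∈ K.erase i, x j = v := by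
        rw [← Finset.add_sum_erase K x hi] at hsum; linarith
      rw [h3]; field_simp; ring
  · rw [hq] at hge
    convert hge using 1
    unfold gr
    rw [← hv]
    field_simp

/-- The forbidden graph. -/
def FF (r : ℕ) : HGraph r := (matching2 r).expansion

/-- codes of the new vertices -/
def code (r p q s : ℕ) : ℕ := (2 * r + 1) + (p * (2 * r + 1) + q) * r + s

theorem m2_verts (r : ℕ) : (matching2 r).verts = Finset.Icc 1 (2*r) := rfl

theorem m2_edges {r : ℕ} (e : Finset ℕ) : e ∈ (matching2 r).edges ↔
    e = Finset.Icc 1 r ∨ e = Finset.Icc (r+1) (2*r) := by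
  unfold matching2 HGraph.ofEdges
  simp only [Finset.mem_filter, Finset.mem_insert, Finset.mem_singleton]
  constructor
  · exact fun h => h.1
  · intro h
    refine ⟨h, ?_, ?_⟩
    · rcases h with rfl | rfl
      · exact Finset.Icc_subset_Icc le_rfl (by omega)
      · exact Finset.Icc_subset_Icc (by omega) (by omega)
    · rcases h with rfl | rfl
      · simp
      · simp; omega

theorem m2_sup {r : ℕ} (hr : 4 ≤ r) : (matching2 r).verts.sup id = 2 * r := by
  rw [m2_verts]
  apply le_antisymm
  · apply Finset.sup_le
    intro b hb
    exact (Finset.mem_Icc.mp hb).2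
  · exact Finset.le_sup (f := id) (b := 2 * r) (Finset.mem_Icc.mpr ⟨by omega, le_rfl⟩)

theorem m2_pairs {r : ℕ} (hr : 4 ≤ r) (p : ℕ × ℕ) :
    p ∈ (((matching2 r).verts ×ˢ (matching2 r).verts).filter fun p =>
        p.1 < p.2 ∧ ∀ e ∈ (matching2 r).edges, ¬ (p.1 ∈ e ∧ p.2 ∈ e)) ↔
    (1 ≤ p.1 ∧ p.1 ≤ r) ∧ (r + 1 ≤ p.2 ∧ p.2 ≤ 2 * r) := by
  rw [Finset.mem_filter, Finset.mem_product, m2_verts]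
  simp only [Finset.mem_Icc, m2_edges]
  constructor
  · rintro ⟨⟨h1, h2⟩, h3, h4⟩
    have a := h4 _ (Or.inl rfl)
    have b := h4 _ (Or.inr rfl)
    simp only [Finset.mem_Icc] at a b
    omega
  · rintro ⟨h1, h2⟩
    refine ⟨⟨by omega, by omega⟩, by omega, ?_⟩
    rintro e (rfl | rfl)
    · simp only [Finset.mem_Icc]; omega
    · simp only [Finset.mem_Icc]; omega

theorem FF_verts {r : ℕ} (hr : 4 ≤ r) (v : ℕ) : v ∈ (FF r).verts ↔
    (1 ≤ v ∧ v ≤ 2 * r) ∨ ∃ p q s, (1 ≤ p ∧ p ≤ r) ∧ (r + 1 ≤ q ∧ q ≤ 2 * r) ∧ s < r - 2 ∧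
      v = code r p q s := by
  unfold FF HGraph.expansion
  simp only [HGraph.ofEdges, Finset.mem_union, Finset.mem_biUnion, m2_pairs hr, m2_sup hr,
    Finset.mem_image, Finset.mem_range, code, Prod.exists]
  rw [m2_verts, Finset.mem_Icc]
  constructor
  · rintro (h | ⟨p, q, ⟨h1, h2⟩, s, hs, h⟩)
    · exact Or.inl h
    · exact Or.inr ⟨p, q, s, h1, h2, hs, h.symm⟩
  · rintro (h | ⟨p, q, s, h1, h2, hs, h⟩)
    · exact Or.inl h
    · exact Or.inr ⟨p, q, ⟨h1, h2⟩, s, hs, h.symm⟩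

/-- the covering edges of `FF` -/
def cedge (r p q : ℕ) : Finset ℕ :=
  insert p (insert q ((Finset.range (r-2)).image fun s => code r p q s))

theorem code_inj {r : ℕ} (p q : ℕ) : Function.Injective (fun s => code r p q s) := by
  intro a b h
  simp only [code] at h
  omega

theorem cedge_card {r p q : ℕ} (hr : 4 ≤ r) (hp : 1 ≤ p ∧ p ≤ r) (hq : r + 1 ≤ q ∧ q ≤ 2 * r) :
    (cedge r p q).card = r := by
  have h : ∀ x ≤ 2 * r, x ∉ ((Finset.range (r-2)).image fun s => code r p q s) := by
    intro x hx h
    obtain ⟨s, _, h⟩ := Finset.mem_image.mp h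
    unfold code at h
    have : 0 ≤ (p * (2 * r + 1) + q) * r := Nat.zero_le _
    omega
  unfold cedge
  rw [Finset.card_insert_of_notMem, Finset.card_insert_of_notMem (h q hq.2),
    Finset.card_image_of_injective _ (code_inj p q), Finset.card_range]
  · omega
  · rw [Finset.mem_insert, not_or]
    exact ⟨by omega, h p (by omega)⟩

theorem FF_edges {r : ℕ} (hr : 4 ≤ r) (e : Finset ℕ) : e ∈ (FF r).edges ↔
    e = Finset.Icc 1 r ∨ e = Finset.Icc (r+1) (2*r) ∨
      ∃ p q, (1 ≤ p ∧ p ≤ r) ∧ (r + 1 ≤ q ∧ q ≤ 2 * r) ∧ e = cedge r p q := by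
  have key : e ∈ (FF r).edges ↔ (e = Finset.Icc 1 r ∨ e = Finset.Icc (r+1) (2*r) ∨
      ∃ p q, (1 ≤ p ∧ p ≤ r) ∧ (r + 1 ≤ q ∧ q ≤ 2 * r) ∧ e = cedge r p q) ∧
      e ⊆ (FF r).verts ∧ e.card = r := by
    unfold FF HGraph.expansion
    simp only [HGraph.ofEdges, Finset.mem_filter, Finset.mem_union, Finset.mem_image, m2_edges]
    apply and_congr_left
    intro _
    rw [or_assoc]
    apply or_congr Iff.rfl
    apply or_congr Iff.rfl
    constructor
    · rintro ⟨p, hp, h⟩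
      have hp' := (m2_pairs hr p).mp (Finset.mem_filter.mpr (by simpa only [m2_edges] using hp))
      refine ⟨p.1, p.2, hp'.1, hp'.2, ?_⟩
      rw [← h, m2_sup hr]
      rfl
    · rintro ⟨p, q, hp, hq, h⟩
      refine ⟨(p, q), by
        simpa only [m2_edges] using Finset.mem_filter.mp ((m2_pairs hr (p, q)).mpr ⟨hp, hq⟩), ?_⟩
      rw [h, m2_sup hr]
      rfl
  rw [key]
  constructor
  · exact fun h => h.1
  · intro h
    refine ⟨h, ?_, ?_⟩
    · intro x hx
      rw [FF_verts hr]
      rcases h with rfl | rfl | ⟨p, q, hp, hq, rfl⟩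
      · have := Finset.mem_Icc.mp hx
        left; omega
      · have := Finset.mem_Icc.mp hx
        left; omega
      · simp only [cedge, Finset.mem_insert, Finset.mem_image, Finset.mem_range] at hx
        rcases hx with rfl | rfl | ⟨s, hs, rfl⟩
        · left; omega
        · left; omega
        · right; exact ⟨p, q, s, hp, hq, hs, rfl⟩
    · rcases h with rfl | rfl | ⟨p, q, hp, hq, rfl⟩
      · simp
      · simp; omega
      · exact cedge_card hr hp hq

theorem copy_struct {r : ℕ} (hr : 4 ≤ r) {H : HGraph r} (h : (FF r).IsCopyIn H) :
    ∃ e1 ∈ H.edges, ∃ e2 ∈ H.edges, Disjoint e1 e2 ∧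
      ∀ x ∈ e1, ∀ y ∈ e2, ∃ e ∈ H.edges, x ∈ e ∧ y ∈ e := by
  obtain ⟨f, hf, hv, he⟩ := h
  refine ⟨_, he _ ((FF_edges hr _).mpr (Or.inl rfl)), _,
    he _ ((FF_edges hr _).mpr (Or.inr (Or.inl rfl))), ?_, ?_⟩
  · rw [Finset.disjoint_left]
    intro a ha hb
    obtain ⟨x, hx, rfl⟩ := Finset.mem_image.mp ha
    obtain ⟨y, hy, hxy⟩ := Finset.mem_image.mp hb
    rw [Finset.mem_Icc] at hx hy
    have := hf ((FF_verts hr _).mpr (Or.inl (by omega))) ((FF_verts hr _).mpr (Or.inl (by omega))) hxy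
    omega
  · intro a ha b hb
    obtain ⟨x, hx, rfl⟩ := Finset.mem_image.mp ha
    obtain ⟨y, hy, rfl⟩ := Finset.mem_image.mp hb
    rw [Finset.mem_Icc] at hx hy
    refine ⟨_, he _ ((FF_edges hr _).mpr (Or.inr (Or.inr ⟨x, y, hx, hy, rfl⟩))), ?_, ?_⟩
    · exact Finset.mem_image_of_mem _ (by simp [cedge])
    · exact Finset.mem_image_of_mem _ (by simp [cedge])

theorem semibip_free {r : ℕ} (hr : 4 ≤ r) {H : HGraph r} (h : Semibipartite r H) :
    ¬ (FF r).IsCopyIn H := by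
  intro hc
  obtain ⟨V1, _, hV⟩ := h
  obtain ⟨e1, h1, e2, h2, hd, hcov⟩ := copy_struct hr hc
  obtain ⟨x, hx⟩ := Finset.card_eq_one.mp (hV e1 h1)
  obtain ⟨y, hy⟩ := Finset.card_eq_one.mp (hV e2 h2)
  have hx' : x ∈ e1 ∩ V1 := by rw [hx]; simp
  have hy' : y ∈ e2 ∩ V1 := by rw [hy]; simp
  rw [Finset.mem_inter] at hx' hy'
  obtain ⟨e, he, hxe, hye⟩ := hcov x hx'.1 y hy'.1
  obtain ⟨z, hz⟩ := Finset.card_eq_one.mp (hV e he)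
  have a : x ∈ e ∩ V1 := Finset.mem_inter.mpr ⟨hxe, hx'.2⟩
  have b : y ∈ e ∩ V1 := Finset.mem_inter.mpr ⟨hye, hy'.2⟩
  rw [hz, Finset.mem_singleton] at a b
  subst a; subst b
  exact Finset.disjoint_left.mp hd hx'.1 hy'.1

/-- 𝒦-freeness -/
def KF {r : ℕ} (H : HGraph r) : Prop :=
  ∀ e1 ∈ H.edges, ∀ e2 ∈ H.edges, Disjoint e1 e2 →
    ∃ x ∈ e1, ∃ y ∈ e2, ∀ e ∈ H.edges, ¬ (x ∈ e ∧ y ∈ e)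

theorem KF_free {r : ℕ} (hr : 4 ≤ r) {H : HGraph r} (h : KF H) : ¬ (FF r).IsCopyIn H := by
  intro hc
  obtain ⟨e1, h1, e2, h2, hd, hcov⟩ := copy_struct hr hc
  obtain ⟨x, hx, y, hy, hxy⟩ := h e1 h1 e2 h2 hd
  obtain ⟨e, he, hh⟩ := hcov x hx y hy
  exact hxy e he hh

theorem exists_enum (S T : Finset ℕ) (h : S.card = T.card) :
    ∃ g : ℕ → ℕ, Set.InjOn g S ∧ S.image g = T := by
  let φ := Finset.equivOfCardEq h
  refine ⟨fun x => if hx : x ∈ S then (φ ⟨x, hx⟩ : ℕ) else 0, ?_, ?_⟩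
  · intro a ha b hb hab
    have ha' : a ∈ S := ha
    have hb' : b ∈ S := hb
    simp only [ha', hb', dif_pos] at hab
    have := φ.injective (Subtype.ext hab)
    exact congrArg Subtype.val this
  · ext y
    simp only [Finset.mem_image]
    constructor
    · rintro ⟨x, hx, rfl⟩
      simp only [hx, dif_pos]
      exact (φ ⟨x, hx⟩).2
    · intro hy
      refine ⟨(φ.symm ⟨y, hy⟩ : ℕ), (φ.symm ⟨y, hy⟩).2, ?_⟩
      simp

theorem emb0 {r : ℕ} (hr : 4 ≤ r) {H : HGraph r} {e1 e2 : Finset ℕ} (h1 : e1 ∈ H.edges)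
    (h2 : e2 ∈ H.edges) (hd : Disjoint e1 e2) (E : ℕ → ℕ → Finset ℕ)
    (hE : ∀ x ∈ e1, ∀ y ∈ e2, E x y ∈ H.edges ∧ x ∈ E x y ∧ y ∈ E x y ∧
      ∀ z ∈ E x y, z ∈ e1 ∪ e2 → z = x ∨ z = y)
    (hE2 : ∀ x ∈ e1, ∀ y ∈ e2, ∀ x' ∈ e1, ∀ y' ∈ e2, (x, y) ≠ (x', y') →
      ∀ z ∈ E x y, z ∈ E x' y' → z ∈ e1 ∪ e2) : (FF r).IsCopyIn H := by
  obtain ⟨a, ha, ha'⟩ := exists_enum (Finset.Icc 1 r) e1 (by rw [H.edges_card _ h1]; simp)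
  obtain ⟨b, hb, hb'⟩ := exists_enum (Finset.Icc (r+1) (2*r)) e2
    (by rw [H.edges_card _ h2]; simp; omega)
  have hR : ∀ x ∈ e1, ∀ y ∈ e2, ∃ g : ℕ → ℕ, Set.InjOn g (Finset.range (r-2)) ∧
      (Finset.range (r-2)).image g = E x y \ {x, y} := by
    intro x hx y hy
    apply exists_enum
    have hxy : x ≠ y := fun h => Finset.disjoint_left.mp hd hx (h ▸ hy)
    obtain ⟨q1, q2, q3, q4⟩ := hE x hx y hy
    rw [Finset.card_sdiff_of_subset, H.edges_card _ q1, Finset.card_pair hxy, Finset.card_range]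
    intro z hz
    rcases Finset.mem_insert.mp hz with rfl | hz
    · exact q2
    · rw [Finset.mem_singleton.mp hz]; exact q3
  choose! g hg hg' using hR
  let dq : ℕ → ℕ := fun v => (v - (2*r+1)) / r
  let f : ℕ → ℕ := fun v => if v ≤ r then a v else if v ≤ 2 * r then b v else
    g (a (dq v / (2*r+1))) (b (dq v % (2*r+1))) ((v - (2*r+1)) % r)
  have fa : ∀ v, 1 ≤ v → v ≤ r → f v = a v := fun v _ h => if_pos h
  have fb : ∀ v, r + 1 ≤ v → v ≤ 2 * r → f v = b v := fun v h h' => by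
    simp only [f]; rw [if_neg (by omega), if_pos h']
  have dec : ∀ p q s, q ≤ 2 * r → s < r - 2 → 2 * r < code r p q s ∧
      dq (code r p q s) / (2*r+1) = p ∧ dq (code r p q s) % (2*r+1) = q ∧
      (code r p q s - (2*r+1)) % r = s := by
    intro p q s hq hs
    have e0 : code r p q s - (2*r+1) = s + r * (p * (2 * r + 1) + q) := by
      unfold code
      rw [mul_comm r]
      omega
    have e1 : dq (code r p q s) = q + (2*r+1) * p := by
      simp only [dq]
      rw [e0, Nat.add_mul_div_left _ _ (by omega), Nat.div_eq_of_lt (by omega)]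
      ring
    refine ⟨by unfold code; have := Nat.zero_le ((p * (2 * r + 1) + q) * r); omega, ?_, ?_, ?_⟩
    · rw [e1, Nat.add_mul_div_left _ _ (by omega), Nat.div_eq_of_lt (by omega)]; omega
    · rw [e1, Nat.add_mul_mod_self_left, Nat.mod_eq_of_lt (by omega)]
    · rw [e0, Nat.add_mul_mod_self_left, Nat.mod_eq_of_lt (by omega)]
  have fc : ∀ p q s, q ≤ 2 * r → s < r - 2 → f (code r p q s) = g (a p) (b q) s := by
    intro p q s hq hs
    obtain ⟨d1, d2, d3, d4⟩ := dec p q s hq hs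
    simp only [f]
    rw [if_neg (by omega), if_neg (by omega), d2, d3, d4]
  have am : ∀ p, 1 ≤ p → p ≤ r → a p ∈ e1 := fun p h h' => by
    rw [← ha']; exact Finset.mem_image_of_mem _ (Finset.mem_Icc.mpr ⟨h, h'⟩)
  have bm : ∀ p, r + 1 ≤ p → p ≤ 2 * r → b p ∈ e2 := fun p h h' => by
    rw [← hb']; exact Finset.mem_image_of_mem _ (Finset.mem_Icc.mpr ⟨h, h'⟩)
  have gm : ∀ p q s, (1 ≤ p ∧ p ≤ r) → (r + 1 ≤ q ∧ q ≤ 2 * r) → s < r - 2 →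
      g (a p) (b q) s ∈ E (a p) (b q) ∧ g (a p) (b q) s ∉ e1 ∪ e2 := by
    intro p q s hp hq hs
    have : g (a p) (b q) s ∈ E (a p) (b q) \ {a p, b q} := by
      rw [← hg' _ (am p hp.1 hp.2) _ (bm q hq.1 hq.2)]
      exact Finset.mem_image_of_mem _ (Finset.mem_range.mpr hs)
    rw [Finset.mem_sdiff, Finset.mem_insert, Finset.mem_singleton] at this
    refine ⟨this.1, fun h => this.2 ?_⟩
    exact (hE _ (am p hp.1 hp.2) _ (bm q hq.1 hq.2)).2.2.2 _ this.1 h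
  have img1 : (Finset.Icc 1 r).image f = e1 := by
    rw [← ha']
    refine Finset.image_congr fun v hv => ?_
    have := Finset.mem_Icc.mp hv
    exact fa v this.1 this.2
  have img2 : (Finset.Icc (r+1) (2*r)).image f = e2 := by
    rw [← hb']
    refine Finset.image_congr fun v hv => ?_
    have := Finset.mem_Icc.mp hv
    exact fb v this.1 this.2
  have img3 : ∀ p q, (1 ≤ p ∧ p ≤ r) → (r + 1 ≤ q ∧ q ≤ 2 * r) →
      (cedge r p q).image f = E (a p) (b q) := by
    intro p q hp hq
    unfold cedge
    rw [Finset.image_insert, Finset.image_insert, Finset.image_image]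
    have : (Finset.range (r-2)).image (f ∘ fun s => code r p q s) =
        (Finset.range (r-2)).image (g (a p) (b q)) := by
      refine Finset.image_congr fun s hs => ?_
      exact fc p q s hq.2 (Finset.mem_range.mp hs)
    rw [this, hg' _ (am p hp.1 hp.2) _ (bm q hq.1 hq.2), fa p hp.1 hp.2, fb q hq.1 hq.2]
    obtain ⟨q1, q2, q3, q4⟩ := hE _ (am p hp.1 hp.2) _ (bm q hq.1 hq.2)
    ext z
    simp only [Finset.mem_insert, Finset.mem_sdiff, Finset.mem_singleton]
    constructor
    · rintro (rfl | rfl | h)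
      · exact q2
      · exact q3
      · exact h.1
    · intro h; tauto
  have hedge : ∀ e ∈ (FF r).edges, e.image f ∈ H.edges := by
    intro e he
    rcases (FF_edges hr e).mp he with rfl | rfl | ⟨p, q, hp, hq, rfl⟩
    · rw [img1]; exact h1
    · rw [img2]; exact h2
    · rw [img3 p q hp hq]; exact (hE _ (am p hp.1 hp.2) _ (bm q hq.1 hq.2)).1
  have f1 : ∀ v, 1 ≤ v → v ≤ r → f v ∈ e1 := fun v h h' => by rw [fa v h h']; exact am v h h'
  have f2 : ∀ v, r + 1 ≤ v → v ≤ 2 * r → f v ∈ e2 := fun v h h' => by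
    rw [fb v h h']; exact bm v h h'
  have f12 : ∀ v, 1 ≤ v → v ≤ 2 * r → f v ∈ e1 ∪ e2 := by
    intro v h h'
    rw [Finset.mem_union]
    by_cases hv : v ≤ r
    · exact Or.inl (f1 v h hv)
    · exact Or.inr (f2 v (by omega) h')
  refine ⟨f, ?_, ?_, hedge⟩
  · intro v hv w hw hvw
    rcases (FF_verts hr v).mp hv with hv | ⟨p, q, s, hp, hq, hs, rfl⟩
    · rcases (FF_verts hr w).mp hw with hw | ⟨p', q', s', hp', hq', hs', rfl⟩
      · by_cases hv1 : v ≤ r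
        · by_cases hw1 : w ≤ r
          · rw [fa v hv.1 hv1, fa w hw.1 hw1] at hvw
            exact ha (Finset.mem_Icc.mpr ⟨hv.1, hv1⟩) (Finset.mem_Icc.mpr ⟨hw.1, hw1⟩) hvw
          · exact absurd (hvw ▸ f2 w (by omega) hw.2) (Finset.disjoint_left.mp hd (f1 v hv.1 hv1))
        · by_cases hw1 : w ≤ r
          · exact absurd (hvw ▸ f2 v (by omega) hv.2) (Finset.disjoint_left.mp hd (f1 w hw.1 hw1))
          · rw [fb v (by omega) hv.2, fb w (by omega) hw.2] at hvw
            exact hb (Finset.mem_coe.mpr (Finset.mem_Icc.mpr ⟨by omega, hv.2⟩))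
              (Finset.mem_coe.mpr (Finset.mem_Icc.mpr ⟨by omega, hw.2⟩)) hvw
      · rw [fc p' q' s' hq'.2 hs'] at hvw
        exact absurd (hvw ▸ f12 v hv.1 hv.2) (gm p' q' s' hp' hq' hs').2
    · rw [fc p q s hq.2 hs] at hvw
      rcases (FF_verts hr w).mp hw with hw | ⟨p', q', s', hp', hq', hs', rfl⟩
      · exact absurd (hvw ▸ f12 w hw.1 hw.2) (gm p q s hp hq hs).2
      · rw [fc p' q' s' hq'.2 hs'] at hvw
        by_cases hpq : (p, q) = (p', q')
        · obtain ⟨rfl, rfl⟩ := Prod.mk.inj hpq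
          have := hg _ (am p hp.1 hp.2) _ (bm q hq.1 hq.2)
            (Finset.mem_coe.mpr (Finset.mem_range.mpr hs))
            (Finset.mem_coe.mpr (Finset.mem_range.mpr hs')) hvw
          rw [this]
        · exfalso
          apply (gm p q s hp hq hs).2
          refine hE2 _ (am p hp.1 hp.2) _ (bm q hq.1 hq.2) _ (am p' hp'.1 hp'.2) _
            (bm q' hq'.1 hq'.2) ?_ _ (gm p q s hp hq hs).1 ?_
          · intro h
            obtain ⟨x1, x2⟩ := Prod.mk.inj h
            apply hpq
            rw [ha (Finset.mem_coe.mpr (Finset.mem_Icc.mpr hp))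
              (Finset.mem_coe.mpr (Finset.mem_Icc.mpr hp')) x1,
              hb (Finset.mem_coe.mpr (Finset.mem_Icc.mpr hq))
              (Finset.mem_coe.mpr (Finset.mem_Icc.mpr hq')) x2]
          · rw [hvw]; exact (gm p' q' s' hp' hq' hs').1
  · intro v hv
    have : ∃ e ∈ (FF r).edges, v ∈ e := by
      rcases (FF_verts hr v).mp hv with hv | ⟨p, q, s, hp, hq, hs, rfl⟩
      · by_cases hv1 : v ≤ r
        · exact ⟨_, (FF_edges hr _).mpr (Or.inl rfl), Finset.mem_Icc.mpr ⟨hv.1, hv1⟩⟩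
        · exact ⟨_, (FF_edges hr _).mpr (Or.inr (Or.inl rfl)),
            Finset.mem_Icc.mpr ⟨by omega, hv.2⟩⟩
      · refine ⟨_, (FF_edges hr _).mpr (Or.inr (Or.inr ⟨p, q, hp, hq, rfl⟩)), ?_⟩
        simp only [cedge, Finset.mem_insert, Finset.mem_image, Finset.mem_range]
        exact Or.inr (Or.inr ⟨s, hs, rfl⟩)
    obtain ⟨e, he, hve⟩ := this
    exact H.edges_sub _ (hedge e he) (Finset.mem_image_of_mem _ hve)

/-- `u,v` are covered by an edge robustly. -/
def Cov {r : ℕ} (H : HGraph r) (M : ℕ) (u v : ℕ) : Prop :=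
  ∀ Z : Finset ℕ, Z.card ≤ M → ∃ e ∈ H.edges, u ∈ e ∧ v ∈ e ∧ ∀ z ∈ e, z ∈ Z → z = u ∨ z = v

theorem Cov.symm {r : ℕ} {H : HGraph r} {M u v : ℕ} (h : Cov H M u v) : Cov H M v u := by
  intro Z hZ
  obtain ⟨e, he, h1, h2, h3⟩ := h Z hZ
  exact ⟨e, he, h2, h1, fun z hz hz' => (h3 z hz hz').symm⟩

def CM (r : ℕ) : ℕ := 3 * r + r ^ 3

theorem greedyE {ι : Type*} [DecidableEq ι] {r : ℕ} {H : HGraph r} {M : ℕ} (u v : ι → ℕ)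
    (Z0 : Finset ℕ) (P : Finset ι) (hP : Z0.card + r * P.card ≤ M)
    (hc : ∀ p ∈ P, Cov H M (u p) (v p)) (hu : ∀ p ∈ P, u p ∈ Z0) (hv : ∀ p ∈ P, v p ∈ Z0) :
    ∃ E : ι → Finset ℕ, (∀ p ∈ P, E p ∈ H.edges ∧ u p ∈ E p ∧ v p ∈ E p ∧
      ∀ z ∈ E p, z ∈ Z0 → z = u p ∨ z = v p) ∧
      ∀ p ∈ P, ∀ p' ∈ P, p ≠ p' → ∀ z ∈ E p, z ∈ E p' → z ∈ Z0 := by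
  induction P using Finset.induction_on with
  | empty => exact ⟨fun _ => ∅, by simp, by simp⟩
  | insert a s ha ih =>
    rw [Finset.card_insert_of_notMem ha] at hP
    obtain ⟨E, h1, h2⟩ := ih (by nlinarith) (fun p hp => hc p (Finset.mem_insert_of_mem hp))
      (fun p hp => hu p (Finset.mem_insert_of_mem hp))
      (fun p hp => hv p (Finset.mem_insert_of_mem hp))
    have hcard : (Z0 ∪ s.biUnion E).card ≤ M := by
      refine (Finset.card_union_le _ _).trans ?_
      have : (s.biUnion E).card ≤ s.card * r := by
        refine Finset.card_biUnion_le_card_mul _ _ _ fun p hp => ?_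
        exact (H.edges_card _ (h1 p hp).1).le
      nlinarith
    obtain ⟨e, he, k1, k2, k3⟩ := hc a (Finset.mem_insert_self _ _) _ hcard
    have hne : ∀ p ∈ s, p ≠ a := fun p hp h => ha (h ▸ hp)
    have key : ∀ p ∈ s, ∀ z ∈ e, z ∈ E p → z ∈ Z0 := by
      intro p hp z hz hz'
      rcases k3 z hz (Finset.mem_union_right _ (Finset.mem_biUnion.mpr ⟨p, hp, hz'⟩)) with h | h
      · rw [h]; exact hu a (Finset.mem_insert_self _ _)
      · rw [h]; exact hv a (Finset.mem_insert_self _ _)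
    refine ⟨Function.update E a e, ?_, ?_⟩
    · intro p hp
      rcases Finset.mem_insert.mp hp with rfl | hp
      · rw [Function.update_self]
        exact ⟨he, k1, k2, fun z hz hz' => k3 z hz (Finset.mem_union_left _ hz')⟩
      · rw [Function.update_of_ne (hne p hp)]
        exact h1 p hp
    · intro p hp0 p' hp0' hpp
      rcases Finset.mem_insert.mp hp0 with rfl | hp
      · rcases Finset.mem_insert.mp hp0' with rfl | hp'
        · exact absurd rfl hpp
        · rw [Function.update_self, Function.update_of_ne (hne p' hp')]
          exact key p' hp'
      · rcases Finset.mem_insert.mp hp0' with rfl | hp'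
        · rw [Function.update_self, Function.update_of_ne (hne p hp)]
          exact fun z hz hz' => key p hp z hz' hz
        · rw [Function.update_of_ne (hne p hp), Function.update_of_ne (hne p' hp')]
          exact h2 p hp p' hp' hpp

theorem emb {r : ℕ} (hr : 4 ≤ r) {H : HGraph r} {e1 e2 f : Finset ℕ} (h1 : e1 ∈ H.edges)
    (h2 : e2 ∈ H.edges) (hd : Disjoint e1 e2) {u0 w0 : ℕ} (hu0 : u0 ∈ e1) (hw0 : w0 ∈ e2)
    (hf : f ∈ H.edges) (huf : u0 ∈ f) (hwf : w0 ∈ f)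
    (hff : ∀ z ∈ f, z ∈ e1 ∪ e2 → z = u0 ∨ z = w0)
    (hc : ∀ x ∈ e1, ∀ y ∈ e2, (x, y) ≠ (u0, w0) → Cov H (CM r) x y) :
    (FF r).IsCopyIn H := by
  have hZ : (e1 ∪ e2 ∪ f).card + r * ((e1 ×ˢ e2).erase (u0, w0)).card ≤ CM r := by
    have a1 := Finset.card_union_le (e1 ∪ e2) f
    have a2 := Finset.card_union_le e1 e2
    have a3 := Finset.card_erase_le (s := e1 ×ˢ e2) (a := (u0, w0))
    rw [Finset.card_product] at a3
    rw [H.edges_card _ h1, H.edges_card _ h2] at a2 a3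
    rw [H.edges_card _ hf] at a1
    unfold CM
    have : r * ((e1 ×ˢ e2).erase (u0, w0)).card ≤ r * (r * r) := Nat.mul_le_mul_left _ a3
    have e : r ^ 3 = r * (r * r) := by ring
    omega
  obtain ⟨E, k1, k2⟩ := greedyE (H := H) (fun p : ℕ × ℕ => p.1) (fun p => p.2) (e1 ∪ e2 ∪ f)
    ((e1 ×ˢ e2).erase (u0, w0)) hZ
    (by
      rintro ⟨x, y⟩ hp
      obtain ⟨q1, q2⟩ := Finset.mem_erase.mp hp
      rw [Finset.mem_product] at q2
      exact hc x q2.1 y q2.2 q1)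
    (by
      rintro ⟨x, y⟩ hp
      obtain ⟨q1, q2⟩ := Finset.mem_erase.mp hp
      rw [Finset.mem_product] at q2
      exact Finset.mem_union_left _ (Finset.mem_union_left _ q2.1))
    (by
      rintro ⟨x, y⟩ hp
      obtain ⟨q1, q2⟩ := Finset.mem_erase.mp hp
      rw [Finset.mem_product] at q2
      exact Finset.mem_union_left _ (Finset.mem_union_right _ q2.2))
  have hm : ∀ x ∈ e1, ∀ y ∈ e2, (x, y) ≠ (u0, w0) → (x, y) ∈ (e1 ×ˢ e2).erase (u0, w0) :=
    fun x hx y hy h => Finset.mem_erase.mpr ⟨h, Finset.mem_product.mpr ⟨hx, hy⟩⟩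
  refine emb0 hr h1 h2 hd (fun x y => if (x, y) = (u0, w0) then f else E (x, y)) ?_ ?_
  · intro x hx y hy
    by_cases h : (x, y) = (u0, w0)
    · simp only [if_pos h]
      obtain ⟨rfl, rfl⟩ := Prod.mk.inj h
      exact ⟨hf, huf, hwf, hff⟩
    · simp only [if_neg h]
      obtain ⟨q1, q2, q3, q4⟩ := k1 _ (hm x hx y hy h)
      exact ⟨q1, q2, q3, fun z hz hz' => q4 z hz (Finset.mem_union_left _ hz')⟩
  · intro x hx y hy x' hx' y' hy' hne z hz hz'
    have aux : ∀ x ∈ e1, ∀ y ∈ e2, (x, y) ≠ (u0, w0) → ∀ z ∈ E (x, y), z ∈ e1 ∪ e2 ∪ f →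
        z ∈ e1 ∪ e2 := by
      intro x hx y hy h z hz hz'
      rcases (k1 _ (hm x hx y hy h)).2.2.2 z hz hz' with h | h
      · rw [h]; exact Finset.mem_union_left _ hx
      · rw [h]; exact Finset.mem_union_right _ hy
    by_cases h : (x, y) = (u0, w0)
    · by_cases h' : (x', y') = (u0, w0)
      · exact absurd (h.trans h'.symm) hne
      · simp only [if_pos h] at hz
        simp only [if_neg h'] at hz'
        exact aux x' hx' y' hy' h' z hz' (Finset.mem_union_right _ hz)
    · simp only [if_neg h] at hz
      by_cases h' : (x', y') = (u0, w0)
      · simp only [if_pos h'] at hz'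
        exact aux x hx y hy h z hz (Finset.mem_union_right _ hz')
      · simp only [if_neg h'] at hz'
        exact aux x hx y hy h z hz (k2 _ (hm x hx y hy h) _ (hm x' hx' y' hy' h') hne z hz hz')

theorem emb_all {r : ℕ} (hr : 4 ≤ r) {H : HGraph r} {e1 e2 : Finset ℕ} (h1 : e1 ∈ H.edges)
    (h2 : e2 ∈ H.edges) (hd : Disjoint e1 e2)
    (hc : ∀ x ∈ e1, ∀ y ∈ e2, Cov H (CM r) x y) : (FF r).IsCopyIn H := by
  obtain ⟨u0, hu0⟩ : e1.Nonempty := by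
    rw [← Finset.card_pos, H.edges_card _ h1]; omega
  obtain ⟨w0, hw0⟩ : e2.Nonempty := by
    rw [← Finset.card_pos, H.edges_card _ h2]; omega
  obtain ⟨f, hf, q1, q2, q3⟩ := hc u0 hu0 w0 hw0 (e1 ∪ e2) (by
    have a2 := Finset.card_union_le e1 e2
    rw [H.edges_card _ h1, H.edges_card _ h2] at a2
    unfold CM
    omega)
  exact emb hr h1 h2 hd hu0 hw0 hf q1 q2 q3 (fun x hx y hy _ => hc x hx y hy)

/-- number of `r`-subsets containing `A` -/
theorem cnt (V A : Finset ℕ) (r : ℕ) (B : Finset (Finset ℕ))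
    (hB : ∀ e ∈ B, e ⊆ V ∧ e.card = r ∧ A ⊆ e) :
    B.card ≤ V.card.choose (r - A.card) := by
  rw [← Finset.card_powersetCard]
  refine Finset.card_le_card_of_injOn (fun e => e \ A) ?_ ?_
  · intro e he
    obtain ⟨h1, h2, h3⟩ := hB e he
    refine Finset.mem_coe.mpr (Finset.mem_powersetCard.mpr ⟨Finset.sdiff_subset.trans h1, ?_⟩)
    rw [Finset.card_sdiff_of_subset h3, h2]
  · intro e he f hf h
    have a := (hB e he).2.2
    have b := (hB f hf).2.2
    have h' : e \ A = f \ A := h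
    rw [← Finset.sdiff_union_of_subset a, ← Finset.sdiff_union_of_subset b, h']

theorem choose_le_pow' (n k : ℕ) : n.choose k ≤ n ^ k := Nat.choose_le_pow n k

theorem notCov_codeg {r : ℕ} (hr : 4 ≤ r) {H : HGraph r} {M u v : ℕ} (huv : u ≠ v)
    (h : ¬ Cov H M u v) :
    (H.edges.filter fun e => u ∈ e ∧ v ∈ e).card ≤ M * H.verts.card ^ (r - 3) := by
  unfold Cov at h
  push Not at h
  obtain ⟨Z, hZ, h⟩ := h
  have hsub : (H.edges.filter fun e => u ∈ e ∧ v ∈ e) ⊆ (Z \ {u, v}).biUnion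
      (fun z => H.edges.filter fun e => u ∈ e ∧ v ∈ e ∧ z ∈ e) := by
    intro e he
    obtain ⟨he, hu, hv⟩ := Finset.mem_filter.mp he
    obtain ⟨z, hz, hzZ, hzu, hzv⟩ := h e he hu hv
    refine Finset.mem_biUnion.mpr ⟨z, ?_, Finset.mem_filter.mpr ⟨he, hu, hv, hz⟩⟩
    simp [hzZ, hzu, hzv]
  refine (Finset.card_le_card hsub).trans ?_
  refine (Finset.card_biUnion_le_card_mul _ _ (H.verts.card ^ (r - 3)) ?_).trans ?_
  · intro z hz
    simp only [Finset.mem_sdiff, Finset.mem_insert, Finset.mem_singleton, not_or] at hz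
    have hc : ({u, v, z} : Finset ℕ).card = 3 := by
      rw [Finset.card_eq_three]
      exact ⟨u, v, z, huv, fun h => hz.2.1 h.symm, fun h => hz.2.2 h.symm, rfl⟩
    rw [← hc]
    refine (cnt H.verts {u, v, z} r _ ?_).trans (choose_le_pow' _ _)
    intro e he
    obtain ⟨he, hu, hv, hz⟩ := Finset.mem_filter.mp he
    refine ⟨H.edges_sub _ he, H.edges_card _ he, ?_⟩
    intro x hx
    simp only [Finset.mem_insert, Finset.mem_singleton] at hx
    rcases hx with rfl | rfl | rfl <;> assumption
  · exact Nat.mul_le_mul_right _ ((Finset.card_le_card Finset.sdiff_subset).trans hZ)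

/-- restrict edges -/
def subH {r : ℕ} (H : HGraph r) (B : Finset (Finset ℕ)) : HGraph r where
  verts := H.verts
  edges := H.edges ∩ B
  edges_sub := fun e he => H.edges_sub e (Finset.mem_inter.mp he).1
  edges_card := fun e he => H.edges_card e (Finset.mem_inter.mp he).1

/-- all pairs of `e` are robustly covered -/
def AllCov {r : ℕ} (H : HGraph r) (e : Finset ℕ) : Prop :=
  ∀ u ∈ e, ∀ v ∈ e, u ≠ v → Cov H (CM r) u v

open Classical in
theorem cleaning {r : ℕ} (hr : 4 ≤ r) (H : HGraph r) (hF : ¬ (FF r).IsCopyIn H) :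
    ∃ H' : HGraph r, H'.verts = H.verts ∧ H'.edges ⊆ H.edges ∧ KF H' ∧
      H.edges.card ≤ H'.edges.card + CM r * H.verts.card ^ (r - 1) := by
  let B := H.edges.filter fun e => AllCov H e
  refine ⟨subH H B, rfl, Finset.inter_subset_left, ?_, ?_⟩
  · intro e1 h1 e2 h2 hd
    by_contra hcon
    push Not at hcon
    apply hF
    refine emb_all hr (Finset.mem_inter.mp h1).1 (Finset.mem_inter.mp h2).1 hd ?_
    intro x hx y hy
    obtain ⟨e, he, hxe, hye⟩ := hcon x hx y hy
    exact (Finset.mem_filter.mp (Finset.mem_inter.mp he).2).2 x hxe y hye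
      (fun h => Finset.disjoint_left.mp hd hx (h ▸ hy))
  · have hsub : H.edges \ (subH H B).edges ⊆
        ((H.verts ×ˢ H.verts).filter fun p => p.1 ≠ p.2 ∧ ¬ Cov H (CM r) p.1 p.2).biUnion
          (fun p => H.edges.filter fun e => p.1 ∈ e ∧ p.2 ∈ e) := by
      intro e he
      obtain ⟨he, hn⟩ := Finset.mem_sdiff.mp he
      have : ¬ AllCov H e := by
        intro h
        exact hn (Finset.mem_inter.mpr ⟨he, Finset.mem_filter.mpr ⟨he, h⟩⟩)
      unfold AllCov at this
      push Not at this
      obtain ⟨u, hu, v, hv, huv, hc⟩ := this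
      refine Finset.mem_biUnion.mpr ⟨(u, v), ?_, Finset.mem_filter.mpr ⟨he, hu, hv⟩⟩
      refine Finset.mem_filter.mpr ⟨Finset.mem_product.mpr
        ⟨H.edges_sub e he hu, H.edges_sub e he hv⟩, huv, hc⟩
    have h1 := Finset.card_le_card hsub
    have h2 := Finset.card_biUnion_le_card_mul
      ((H.verts ×ˢ H.verts).filter fun p => p.1 ≠ p.2 ∧ ¬ Cov H (CM r) p.1 p.2)
      (fun p => H.edges.filter fun e => p.1 ∈ e ∧ p.2 ∈ e) (CM r * H.verts.card ^ (r - 3))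
      (fun p hp => notCov_codeg hr (Finset.mem_filter.mp hp).2.1 (Finset.mem_filter.mp hp).2.2)
    have h3 : ((H.verts ×ˢ H.verts).filter fun p => p.1 ≠ p.2 ∧ ¬ Cov H (CM r) p.1 p.2).card ≤
        H.verts.card * H.verts.card := by
      rw [← Finset.card_product]; exact Finset.card_filter_le _ _
    have h4 : H.verts.card ^ (r-1) = H.verts.card * H.verts.card * H.verts.card ^ (r - 3) := by
      have : r - 1 = (r - 3) + 2 := by omega
      rw [this, pow_add]; ring
    have h5 := Nat.mul_le_mul_right (CM r * H.verts.card ^ (r - 3)) h3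
    have h6 := Finset.card_sdiff_add_card_eq_card
      (show (subH H B).edges ⊆ H.edges from Finset.inter_subset_left)
    have h7 : H.verts.card * H.verts.card * (CM r * H.verts.card ^ (r - 3)) =
      CM r * H.verts.card ^ (r-1) := by rw [h4]; ring
    omega

/-- link of a vertex -/
def lnk {r : ℕ} (H : HGraph r) (a : ℕ) : Finset (Finset ℕ) :=
  (H.edges.filter fun e => a ∈ e).image fun e => e.erase a

theorem mem_lnk {r : ℕ} {H : HGraph r} {a : ℕ} {f : Finset ℕ} :
    f ∈ lnk H a ↔ a ∉ f ∧ insert a f ∈ H.edges := by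
  unfold lnk
  rw [Finset.mem_image]
  constructor
  · rintro ⟨e, he, rfl⟩
    obtain ⟨he, ha⟩ := Finset.mem_filter.mp he
    refine ⟨Finset.notMem_erase _ _, ?_⟩
    rw [Finset.insert_erase ha]; exact he
  · rintro ⟨h1, h2⟩
    exact ⟨insert a f, Finset.mem_filter.mpr ⟨h2, Finset.mem_insert_self _ _⟩,
      Finset.erase_insert h1⟩

/-- adjacency (being covered) -/
def Adj {r : ℕ} (H : HGraph r) (u v : ℕ) : Prop := ∃ e ∈ H.edges, u ∈ e ∧ v ∈ e

theorem twin_nonadj {r : ℕ} {H : HGraph r} {u v : ℕ} (huv : u ≠ v) (h : lnk H u = lnk H v) :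
    ¬ Adj H u v := by
  rintro ⟨e, he, hu, hv⟩
  have : e.erase u ∈ lnk H u := mem_lnk.mpr ⟨Finset.notMem_erase _ _, by
    rw [Finset.insert_erase hu]; exact he⟩
  rw [h] at this
  exact (mem_lnk.mp this).1 (Finset.mem_erase.mpr ⟨huv.symm, hv⟩)

/-- replace `v` by `u` -/
def rp (u v : ℕ) (e : Finset ℕ) : Finset ℕ := insert u (e.erase v)

/-- make `v` a clone of `u` -/
def clone {r : ℕ} (H : HGraph r) (u v : ℕ) : HGraph r where
  verts := H.verts
  edges := (Finset.powersetCard r H.verts).filter fun e =>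
    (v ∉ e ∧ e ∈ H.edges) ∨ (v ∈ e ∧ u ∉ e ∧ rp u v e ∈ H.edges)
  edges_sub := fun e he => (Finset.mem_powersetCard.mp (Finset.mem_filter.mp he).1).1
  edges_card := fun e he => (Finset.mem_powersetCard.mp (Finset.mem_filter.mp he).1).2

theorem mem_clone {r : ℕ} {H : HGraph r} {u v : ℕ} (hv : v ∈ H.verts) (huv : u ≠ v) {e : Finset ℕ} :
    e ∈ (clone H u v).edges ↔
    (v ∉ e ∧ e ∈ H.edges) ∨ (v ∈ e ∧ u ∉ e ∧ rp u v e ∈ H.edges) := by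
  unfold clone
  simp only [Finset.mem_filter, Finset.mem_powersetCard]
  constructor
  · exact fun h => h.2
  · intro h
    refine ⟨?_, h⟩
    rcases h with h | ⟨h1, h2, h3⟩
    · exact ⟨H.edges_sub _ h.2, H.edges_card _ h.2⟩
    · constructor
      · intro x hx
        by_cases hxv : x = v
        · rw [hxv]; exact hv
        · exact H.edges_sub _ h3 (Finset.mem_insert_of_mem (Finset.mem_erase.mpr ⟨hxv, hx⟩))
      · have := H.edges_card _ h3
        unfold rp at this
        rw [Finset.card_insert_of_notMem (fun h => h2 (Finset.mem_of_mem_erase h)),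
          Finset.card_erase_add_one h1] at this
        exact this

theorem clone_KF {r : ℕ} {H : HGraph r} {u v : ℕ} (hv : v ∈ H.verts) (huv : u ≠ v)
    (hK : KF H) : KF (clone H u v) := by
  let ψ : ℕ → ℕ := fun x => if x = v then u else x
  have key : ∀ e ∈ (clone H u v).edges, ∃ e' ∈ H.edges, (∀ x ∈ e, ψ x ∈ e') ∧
      (∀ y ∈ e', ∃ x ∈ e, ψ x = y) := by
    intro e he
    rcases (mem_clone hv huv).mp he with h | ⟨h1, h2, h3⟩
    · have : ∀ x ∈ e, ψ x = x := fun x hx => if_neg (fun h' : x = v => h.1 (h' ▸ hx))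
      refine ⟨e, h.2, ?_, ?_⟩
      · intro x hx; rw [this x hx]; exact hx
      · exact fun x hx => ⟨x, hx, this x hx⟩
    · refine ⟨_, h3, ?_, ?_⟩
      · intro x hx
        by_cases hxv : x = v
        · simp only [ψ, if_pos hxv, rp, Finset.mem_insert_self]
        · simp only [ψ, if_neg hxv, rp]
          exact Finset.mem_insert_of_mem (Finset.mem_erase.mpr ⟨hxv, hx⟩)
      · intro y hy
        rcases Finset.mem_insert.mp hy with rfl | hy
        · exact ⟨v, h1, if_pos rfl⟩
        · obtain ⟨a, b⟩ := Finset.mem_erase.mp hy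
          exact ⟨y, b, if_neg a⟩
  have nad : ∀ e ∈ (clone H u v).edges, ¬ (u ∈ e ∧ v ∈ e) := by
    rintro e he ⟨h1, h2⟩
    rcases (mem_clone hv huv).mp he with h | ⟨k1, k2, k3⟩
    · exact h.1 h2
    · exact k2 h1
  intro e1 h1 e2 h2 hd
  obtain ⟨e1', h1', a1, b1⟩ := key e1 h1
  obtain ⟨e2', h2', a2, b2⟩ := key e2 h2
  by_cases hd' : Disjoint e1' e2'
  · obtain ⟨x, hx, y, hy, hxy⟩ := hK e1' h1' e2' h2' hd'
    obtain ⟨x', hx', rfl⟩ := b1 x hx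
    obtain ⟨y', hy', rfl⟩ := b2 y hy
    refine ⟨x', hx', y', hy', ?_⟩
    rintro e he ⟨q1, q2⟩
    obtain ⟨e', he', c, _⟩ := key e he
    exact hxy e' he' ⟨c _ q1, c _ q2⟩
  · rw [Finset.not_disjoint_iff] at hd'
    obtain ⟨z, hz1, hz2⟩ := hd'
    obtain ⟨x, hx, hxz⟩ := b1 z hz1
    obtain ⟨y, hy, hyz⟩ := b2 z hz2
    have hne : x ≠ y := fun h => Finset.disjoint_left.mp hd hx (h ▸ hy)
    refine ⟨x, hx, y, hy, ?_⟩
    rintro e he ⟨q1, q2⟩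
    apply nad e he
    simp only [ψ] at hxz hyz
    split_ifs at hxz hyz with i1 i2 i3
    · exact absurd (i1.trans i2.symm) hne
    · rw [hxz, ← hyz]; exact ⟨q2, i1 ▸ q1⟩
    · rw [hyz, ← hxz]; exact ⟨q1, i3 ▸ q2⟩
    · exact absurd (hxz.trans hyz.symm) hne

theorem clone_edges_notin {r : ℕ} {H : HGraph r} {u v : ℕ} (hv : v ∈ H.verts) (huv : u ≠ v) :
    ((clone H u v).edges.filter fun e => v ∉ e) = H.edges.filter fun e => v ∉ e := by
  ext e
  rw [Finset.mem_filter, Finset.mem_filter, mem_clone hv huv]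
  tauto

theorem clone_deg {r : ℕ} {H : HGraph r} {u v : ℕ} (hv : v ∈ H.verts) (huv : u ≠ v)
    (hna : ¬ Adj H u v) : (clone H u v).deg v = H.deg u := by
  unfold HGraph.deg
  refine Finset.card_bij' (fun e _ => rp u v e) (fun e _ => rp v u e) ?_ ?_ ?_ ?_
  · intro e he
    obtain ⟨h1, h2⟩ := Finset.mem_filter.mp he
    rcases (mem_clone hv huv).mp h1 with h | ⟨k1, k2, k3⟩
    · exact absurd h2 h.1
    · exact Finset.mem_filter.mpr ⟨k3, Finset.mem_insert_self _ _⟩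
  · intro e he
    obtain ⟨h1, h2⟩ := Finset.mem_filter.mp he
    have hve : v ∉ e := fun h => hna ⟨e, h1, h2, h⟩
    refine Finset.mem_filter.mpr ⟨(mem_clone hv huv).mpr (Or.inr ⟨Finset.mem_insert_self _ _, ?_, ?_⟩),
      Finset.mem_insert_self _ _⟩
    · simp [rp, huv]
    · have : rp u v (rp v u e) = e := by
        unfold rp
        rw [Finset.erase_insert (fun h => hve (Finset.mem_of_mem_erase h)), Finset.insert_erase h2]
      rw [this]; exact h1
  · intro e he
    obtain ⟨h1, h2⟩ := Finset.mem_filter.mp he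
    rcases (mem_clone hv huv).mp h1 with h | ⟨k1, k2, k3⟩
    · exact absurd h2 h.1
    · unfold rp
      rw [Finset.erase_insert (fun h => k2 (Finset.mem_of_mem_erase h)), Finset.insert_erase h2]
  · intro e he
    obtain ⟨h1, h2⟩ := Finset.mem_filter.mp he
    have hve : v ∉ e := fun h => hna ⟨e, h1, h2, h⟩
    unfold rp
    rw [Finset.erase_insert (fun h => hve (Finset.mem_of_mem_erase h)), Finset.insert_erase h2]

theorem edges_split {r : ℕ} (H : HGraph r) (v : ℕ) :
    H.edges.card = H.deg v + (H.edges.filter fun e => v ∉ e).card := by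
  unfold HGraph.deg
  rw [Finset.card_filter_add_card_filter_not]

theorem clone_card {r : ℕ} {H : HGraph r} {u v : ℕ} (hv : v ∈ H.verts) (huv : u ≠ v)
    (hna : ¬ Adj H u v) : (clone H u v).edges.card + H.deg v = H.edges.card + H.deg u := by
  rw [edges_split _ v, edges_split H v, clone_deg hv huv hna, clone_edges_notin hv huv]
  omega

theorem mem_clone_lnk {r : ℕ} {H : HGraph r} {u v : ℕ} (hv : v ∈ H.verts) (huv : u ≠ v)
    (hna : ¬ Adj H u v) {a : ℕ} (hav : a ≠ v) {f : Finset ℕ} :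
    f ∈ lnk (clone H u v) a ↔ (v ∉ f ∧ f ∈ lnk H a) ∨
      (v ∈ f ∧ u ∉ f ∧ a ∉ f ∧ rp u v f ∈ lnk H a) := by
  rw [mem_lnk, mem_clone hv huv, mem_lnk, mem_lnk]
  have e1 : v ∈ insert a f ↔ v ∈ f := by simp [Ne.symm hav]
  have e2 : rp u v (insert a f) = insert a (rp u v f) := by
    unfold rp
    rw [Finset.erase_insert_of_ne hav, Finset.insert_comm]
  rw [e1, e2]
  by_cases hau : a = u
  · subst hau
    have : a ∈ rp a v f := Finset.mem_insert_self _ _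
    simp only [Finset.mem_insert, true_or, not_true, false_and, and_false, or_false, this]
    tauto
  · have e3 : u ∈ insert a f ↔ u ∈ f := by simp [Ne.symm hau]
    have e4 : v ∈ f → (a ∉ rp u v f ↔ a ∉ f) := by
      intro _; simp [rp, hau, hav]
    rw [e3]
    tauto

theorem clone_twin {r : ℕ} {H : HGraph r} {u v : ℕ} (hv : v ∈ H.verts) (huv : u ≠ v)
    (hna : ¬ Adj H u v) {a b : ℕ} (hav : a ≠ v) (hbv : b ≠ v) (h : lnk H a = lnk H b) :
    lnk (clone H u v) a = lnk (clone H u v) b := by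
  have half : ∀ a b, a ≠ v → b ≠ v → lnk H a = lnk H b → ∀ f, f ∈ lnk (clone H u v) a →
      f ∈ lnk (clone H u v) b := by
    intro a b hav hbv h f hf
    rw [mem_clone_lnk hv huv hna hav] at hf
    rw [mem_clone_lnk hv huv hna hbv, ← h]
    rcases hf with hf | ⟨h1, h2, h3, h4⟩
    · exact Or.inl hf
    · refine Or.inr ⟨h1, h2, ?_, h4⟩
      rw [h] at h4
      intro hb
      exact (mem_lnk.mp h4).1 (Finset.mem_insert_of_mem (Finset.mem_erase.mpr ⟨hbv, hb⟩))
  ext f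
  exact ⟨half a b hav hbv h f, half b a hbv hav h.symm f⟩

theorem clone_lnk_v {r : ℕ} {H : HGraph r} {u v : ℕ} (hv : v ∈ H.verts) (huv : u ≠ v)
    (hna : ¬ Adj H u v) : lnk (clone H u v) v = lnk (clone H u v) u := by
  ext f
  rw [mem_clone_lnk hv huv hna huv, mem_lnk, mem_clone hv huv, mem_lnk, mem_lnk]
  have h0 : v ∈ insert v f := Finset.mem_insert_self _ _
  have h1 : u ∈ insert v f ↔ u ∈ f := by simp [huv]
  rw [h1]
  have h2 : u ∈ rp u v f := Finset.mem_insert_self _ _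
  by_cases hvf : v ∈ f
  · tauto
  · have h3 : rp u v (insert v f) = insert u f := by
      unfold rp; rw [Finset.erase_insert hvf]
    rw [h3]
    tauto

/-- twin class -/
def tcl {r : ℕ} (H : HGraph r) (v : ℕ) : Finset ℕ := H.verts.filter fun b => lnk H b = lnk H v

/-- twin pairs -/
def tpairs {r : ℕ} (H : HGraph r) : Finset (ℕ × ℕ) :=
  (H.verts ×ˢ H.verts).filter fun p => lnk H p.1 = lnk H p.2

theorem tpairs_le {r : ℕ} (H : HGraph r) : (tpairs H).card ≤ H.verts.card ^ 2 := by
  rw [sq, ← Finset.card_product]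
  exact Finset.card_filter_le _ _

theorem clone_tpairs {r : ℕ} {H : HGraph r} {u v : ℕ} (hu : u ∈ H.verts) (hv : v ∈ H.verts)
    (huv : u ≠ v) (hna : ¬ Adj H u v) (hnt : lnk H u ≠ lnk H v)
    (hc : (tcl H v).card ≤ (tcl H u).card) : (tpairs H).card < (tpairs (clone H u v)).card := by
  let Q := (tpairs H).filter fun p => p.1 ≠ v ∧ p.2 ≠ v
  have h1 : (tpairs H).card ≤ Q.card + ((tcl H v).card + (tcl H v).card) := by
    have : tpairs H ⊆ Q ∪ (({v} ×ˢ tcl H v) ∪ (tcl H v ×ˢ {v})) := by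
      rintro ⟨a, b⟩ hp
      have hp' := hp
      unfold tpairs at hp'
      rw [Finset.mem_filter, Finset.mem_product] at hp'
      simp only [Finset.mem_union, Finset.mem_product, Finset.mem_singleton, Q, Finset.mem_filter,
        tcl]
      by_cases ha : a = v
      · right; left; subst ha; exact ⟨rfl, hp'.1.2, hp'.2.symm⟩
      · by_cases hb : b = v
        · right; right; subst hb; exact ⟨⟨hp'.1.1, hp'.2⟩, rfl⟩
        · left; exact ⟨hp, ha, hb⟩
    refine (Finset.card_le_card this).trans ((Finset.card_union_le _ _).trans ?_)
    refine Nat.add_le_add_left ((Finset.card_union_le _ _).trans ?_) _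
    rw [Finset.card_product, Finset.card_product]; simp
  have hvu : v ∉ tcl H u := by
    intro h
    exact hnt (Finset.mem_filter.mp h).2.symm
  have tw : ∀ b ∈ tcl H u, b ∈ H.verts ∧ b ≠ v ∧ lnk (clone H u v) b = lnk (clone H u v) v := by
    intro b hb
    have hbv : b ≠ v := fun h => hvu (h ▸ hb)
    obtain ⟨q1, q2⟩ := Finset.mem_filter.mp hb
    refine ⟨q1, hbv, ?_⟩
    rw [clone_lnk_v hv huv hna]
    exact clone_twin hv huv hna hbv huv q2
  have h2 : Q.card + (((tcl H u).card + (tcl H u).card) + 1) ≤ (tpairs (clone H u v)).card := by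
    have : Q ∪ ((({v} ×ˢ tcl H u) ∪ (tcl H u ×ˢ {v})) ∪ {(v, v)}) ⊆ tpairs (clone H u v) := by
      rintro ⟨a, b⟩ hp
      unfold tpairs
      rw [Finset.mem_filter, Finset.mem_product]
      simp only [Finset.mem_union, Finset.mem_product, Finset.mem_singleton, Q, Finset.mem_filter,
        tpairs] at hp
      rcases hp with ⟨⟨⟨q1, q2⟩, q3⟩, q4, q5⟩ | (⟨q1, q2⟩ | ⟨q1, q2⟩) | q
      · exact ⟨⟨q1, q2⟩, clone_twin hv huv hna q4 q5 q3⟩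
      · obtain ⟨w1, w2, w3⟩ := tw b q2
        subst q1
        exact ⟨⟨hv, w1⟩, w3.symm⟩
      · obtain ⟨w1, w2, w3⟩ := tw a q1
        subst q2
        exact ⟨⟨w1, hv⟩, w3⟩
      · obtain ⟨rfl, rfl⟩ := Prod.mk.inj q
        exact ⟨⟨hv, hv⟩, rfl⟩
    refine le_trans (le_of_eq ?_) (Finset.card_le_card this)
    rw [Finset.card_union_of_disjoint, Finset.card_union_of_disjoint, Finset.card_union_of_disjoint,
      Finset.card_product, Finset.card_product]
    · simp
    · rw [Finset.disjoint_left]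
      rintro ⟨a, b⟩ q1 q2
      simp only [Finset.mem_product, Finset.mem_singleton] at q1 q2
      exact (tw b q1.2).2.1 q2.2
    · rw [Finset.disjoint_left]
      rintro ⟨a, b⟩ q1 q2
      simp only [Finset.mem_union, Finset.mem_product, Finset.mem_singleton] at q1 q2
      obtain ⟨rfl, rfl⟩ := Prod.mk.inj q2
      rcases q1 with q1 | q1
      · exact hvu q1.2
      · exact hvu q1.1
    · rw [Finset.disjoint_left]
      rintro ⟨a, b⟩ q1 q2
      simp only [Finset.mem_union, Finset.mem_product, Finset.mem_singleton, Q,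
        Finset.mem_filter] at q1 q2
      rcases q2 with (q2 | q2) | q2
      · exact q1.2.1 q2.1
      · exact q1.2.2 q2.2
      · exact q1.2.1 (Prod.mk.inj q2).1
  omega

theorem edges_le {r : ℕ} (H : HGraph r) : H.edges.card ≤ H.verts.card.choose r := by
  rw [← Finset.card_powersetCard]
  refine Finset.card_le_card fun e he => ?_
  exact Finset.mem_powersetCard.mpr ⟨H.edges_sub _ he, H.edges_card _ he⟩

theorem zykov {r : ℕ} (V : Finset ℕ) (Pr : HGraph r → Prop)
    (base : ∀ H : HGraph r, H.verts = V → KF H →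
      (∀ u ∈ V, ∀ v ∈ V, ¬ Adj H u v → lnk H u = lnk H v) → Pr H)
    (step : ∀ (H : HGraph r) (u v : ℕ), H.verts = V → KF H → u ∈ V → v ∈ V → u ≠ v →
      KF (clone H u v) → H.edges.card ≤ (clone H u v).edges.card → Pr (clone H u v) → Pr H) :
    ∀ H : HGraph r, H.verts = V → KF H → Pr H := by
  let Φ : HGraph r → ℕ := fun H => H.edges.card * (V.card ^ 2 + 1) + (tpairs H).card
  let Bd := V.card.choose r * (V.card ^ 2 + 1) + V.card ^ 2
  have hB : ∀ H : HGraph r, H.verts = V → Φ H ≤ Bd := by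
    intro H hH
    have a := edges_le H
    have b := tpairs_le H
    rw [hH] at a b
    exact Nat.add_le_add (Nat.mul_le_mul_right _ a) b
  have main : ∀ m : ℕ, ∀ H : HGraph r, H.verts = V → KF H → Bd - Φ H = m → Pr H := by
    intro m
    induction m using Nat.strong_induction_on with
    | _ m ih =>
      intro H hH hK hm
      by_cases hall : ∀ u ∈ V, ∀ v ∈ V, ¬ Adj H u v → lnk H u = lnk H v
      · exact base H hH hK hall
      · push Not at hall
        obtain ⟨u0, hu0, v0, hv0, hna0, hnt0⟩ := hall
        have fin : ∀ u ∈ V, ∀ v ∈ V, ¬ Adj H u v → lnk H u ≠ lnk H v →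
            (H.deg v < H.deg u ∨ (H.deg v = H.deg u ∧ (tcl H v).card ≤ (tcl H u).card)) → Pr H := by
          intro u hu v hv hna hnt hle
          have huv : u ≠ v := fun h => hnt (by rw [h])
          have hv' : v ∈ H.verts := hH ▸ hv
          have hu' : u ∈ H.verts := hH ▸ hu
          have hcard := clone_card hv' huv hna
          have hKF := clone_KF hv' huv hK
          have hΦ : Φ H < Φ (clone H u v) := by
            simp only [Φ]
            rcases hle with h | ⟨h1, h2⟩
            · have b := tpairs_le H
              rw [hH] at b
              have : H.edges.card + 1 ≤ (clone H u v).edges.card := by omega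
              nlinarith
            · have : H.edges.card = (clone H u v).edges.card := by omega
              rw [this]
              have := clone_tpairs hu' hv' huv hna hnt h2
              omega
          have hb := hB (clone H u v) hH
          refine step H u v hH hK hu hv huv hKF (by omega) ?_
          exact ih (Bd - Φ (clone H u v)) (by omega) _ hH hKF rfl
        by_cases hc : H.deg v0 < H.deg u0 ∨
          (H.deg v0 = H.deg u0 ∧ (tcl H v0).card ≤ (tcl H u0).card)
        · exact fin u0 hu0 v0 hv0 hna0 hnt0 hc
        · refine fin v0 hv0 u0 hu0 ?_ hnt0.symm ?_
          · rintro ⟨e, he, h1, h2⟩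
            exact hna0 ⟨e, he, h2, h1⟩
          · omega
  intro H hH hK
  exact main _ H hH hK rfl

theorem zbase {r : ℕ} (hr : 4 ≤ r) (H : HGraph r) (hK : KF H)
    (hall : ∀ u ∈ H.verts, ∀ v ∈ H.verts, ¬ Adj H u v → lnk H u = lnk H v)
    (hn : 0 < H.verts.card) :
    ∃ (rep : ℕ → ℕ) (K : Finset ℕ) (x : ℕ → ℝ), (∀ i ∈ K, 0 ≤ x i) ∧ ∑ i ∈ K, x i = 1 ∧
      H.edges.image (fun e => e.image rep) ⊆ K.powersetCard r ∧
      Inter (H.edges.image (fun e => e.image rep)) ∧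
      (∀ e ∈ H.edges, Set.InjOn rep e) ∧ 
      (∀ B ⊆ H.edges, (r.factorial : ℝ) * B.card ≤
        (H.verts.card : ℝ) ^ r * wt r x (B.image (fun e => e.image rep))) := by
  let rep : ℕ → ℕ := fun a => if h : ∃ b ∈ H.verts, lnk H b = lnk H a then h.choose else 0
  have rep1 : ∀ a ∈ H.verts, rep a ∈ H.verts ∧ lnk H (rep a) = lnk H a := by
    intro a ha
    have h : ∃ b ∈ H.verts, lnk H b = lnk H a := ⟨a, ha, rfl⟩
    simp only [rep, dif_pos h]
    exact h.choose_spec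
  have rep2 : ∀ a b, lnk H a = lnk H b → rep a = rep b := by
    intro a b h
    simp only [rep, h]
  have rinj : ∀ e ∈ H.edges, Set.InjOn rep e := by
    intro e he a ha b hb hab
    by_contra hne
    have h1 := (rep1 a (H.edges_sub _ he ha)).2
    have h2 := (rep1 b (H.edges_sub _ he hb)).2
    rw [hab, h2] at h1
    exact twin_nonadj hne h1.symm ⟨e, he, ha, hb⟩
  let K := H.verts.image rep
  let C : ℕ → Finset ℕ := fun i => H.verts.filter fun b => rep b = i
  refine ⟨rep, K, fun i => ((C i).card : ℝ) / H.verts.card, ?_, ?_, ?_, ?_, rinj, ?_⟩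
  · intro i _; positivity
  · rw [← Finset.sum_div]
    have := Finset.card_eq_sum_card_image rep H.verts
    rw [div_eq_one_iff_eq (by positivity)]
    rw [this]
    push_cast
    rfl
  · intro f hf
    obtain ⟨e, he, rfl⟩ := Finset.mem_image.mp hf
    refine Finset.mem_powersetCard.mpr ⟨Finset.image_subset_image (H.edges_sub _ he), ?_⟩
    rw [Finset.card_image_of_injOn (rinj e he), H.edges_card _ he]
  · intro S hS T hT
    obtain ⟨e1, he1, rfl⟩ := Finset.mem_image.mp hS
    obtain ⟨e2, he2, rfl⟩ := Finset.mem_image.mp hT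
    rw [← Finset.not_disjoint_iff_nonempty_inter]
    intro hd
    have hd' : Disjoint e1 e2 := by
      rw [Finset.disjoint_left]
      intro z h1 h2
      exact Finset.disjoint_left.mp hd (Finset.mem_image_of_mem rep h1)
        (Finset.mem_image_of_mem rep h2)
    obtain ⟨x, hx, y, hy, hxy⟩ := hK e1 he1 e2 he2 hd'
    have : rep x = rep y := by
      apply rep2
      apply hall x (H.edges_sub _ he1 hx) y (H.edges_sub _ he2 hy)
      rintro ⟨e, he, h⟩
      exact hxy e he h
    exact Finset.disjoint_left.mp hd (Finset.mem_image_of_mem rep hx)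
        (this ▸ Finset.mem_image_of_mem rep hy)
  · intro B hB
    have h1 : B.card ≤ ∑ f ∈ B.image (fun e => e.image rep), ∏ i ∈ f, (C i).card := by
      rw [Finset.card_eq_sum_card_image (fun e => e.image rep) B]
      refine Finset.sum_le_sum fun f hf => ?_
      rw [← Finset.card_pi]
      refine (Finset.card_le_card (t := (f.pi C).image (fun g => f.attach.image
        (fun i => g i.1 i.2))) ?_).trans Finset.card_image_le
      intro e he
      obtain ⟨heB, hef⟩ := Finset.mem_filter.mp he
      have hs : ∀ i ∈ f, ∃ a ∈ e, rep a = i := by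
        intro i hi
        have hef' : e.image rep = f := hef
        rw [← hef'] at hi
        exact Finset.mem_image.mp hi
      choose s hs1 hs2 using hs
      refine Finset.mem_image.mpr ⟨s, ?_, ?_⟩
      · rw [Finset.mem_pi]
        intro i hi
        exact Finset.mem_filter.mpr ⟨H.edges_sub _ (hB heB) (hs1 i hi), hs2 i hi⟩
      · ext a
        simp only [Finset.mem_image, Finset.mem_attach, true_and, Subtype.exists]
        constructor
        · rintro ⟨i, hi, rfl⟩; exact hs1 i hi
        · intro ha
          have hi : rep a ∈ f := by
            have hef' : e.image rep = f := hef
            rw [← hef']; exact Finset.mem_image_of_mem _ ha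
          exact ⟨rep a, hi, rinj e (hB heB) (hs1 _ hi) ha (hs2 _ hi)⟩
    have h2 : (H.verts.card : ℝ) ^ r * wt r (fun i => ((C i).card : ℝ) / H.verts.card)
        (B.image (fun e => e.image rep)) = r.factorial *
        ∑ f ∈ B.image (fun e => e.image rep), ∏ i ∈ f, ((C i).card : ℝ) := by
      unfold wt
      rw [mul_left_comm]
      congr 1
      rw [Finset.mul_sum]
      refine Finset.sum_congr rfl fun f hf => ?_
      obtain ⟨e, he, rfl⟩ := Finset.mem_image.mp hf
      rw [Finset.prod_div_distrib, Finset.prod_const,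
        Finset.card_image_of_injOn (rinj e (hB he)), H.edges_card _ (hB he)]
      exact mul_div_cancel₀ _ (pow_ne_zero _ (Nat.cast_ne_zero.mpr hn.ne'))
    rw [h2]
    have : (B.card : ℝ) ≤ ∑ f ∈ B.image (fun e => e.image rep), ∏ i ∈ f, ((C i).card : ℝ) := by
      exact_mod_cast h1
    exact mul_le_mul_of_nonneg_left this (by positivity)

theorem edges_zero {r : ℕ} (hr : 4 ≤ r) (H : HGraph r) (h : H.verts.card = 0) :
    H.edges.card = 0 := by
  have := edges_le H
  rw [h, Nat.choose_eq_zero_of_lt (by omega)] at this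
  omega

/-- density bound for 𝒦-free graphs -/
theorem T0 {r : ℕ} (hr : 4 ≤ r) (H : HGraph r) (hK : KF H) :
    (r.factorial : ℝ) * H.edges.card ≤ pir r * (H.verts.card : ℝ) ^ r := by
  refine zykov H.verts (fun G => (r.factorial : ℝ) * G.edges.card ≤ pir r * (G.verts.card : ℝ) ^ r)
    ?_ ?_ H rfl hK
  · intro G hG hK hall
    rcases Nat.eq_zero_or_pos G.verts.card with h | h
    · have := edges_zero hr G h
      rw [this, h]
      have := pir_pos (r := r) (by omega)
      simp
      positivity
    · rw [← hG] at hall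
      obtain ⟨rep, K, x, h1, h2, h3, h4, h5, h6⟩ := zbase hr G hK hall h
      have := L1 hr x K h1 h2 _ h3 h4
      have h7 := h6 _ (Finset.Subset.refl _)
      refine h7.trans ?_
      rw [mul_comm]
      exact mul_le_mul_of_nonneg_right this (by positivity)
  · intro G u v hG hK hu hv huv hK' hle h
    refine le_trans ?_ h
    have : (G.edges.card : ℝ) ≤ (clone G u v).edges.card := by exact_mod_cast hle
    exact mul_le_mul_of_nonneg_left this (by positivity)

/-- bad edges with respect to `V1` -/
def bad {r : ℕ} (H : HGraph r) (V1 : Finset ℕ) : Finset (Finset ℕ) :=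
  H.edges.filter fun e => (e ∩ V1).card ≠ 1

/-- stability in the base case of symmetrization -/
theorem stab_base {r : ℕ} (hr : 4 ≤ r) (κ : ℝ) (hκ : 0 < κ) : ∃ ε > 0, ∀ H : HGraph r, KF H →
    (∀ u ∈ H.verts, ∀ v ∈ H.verts, ¬ Adj H u v → lnk H u = lnk H v) →
    (pir r - ε) * (H.verts.card : ℝ) ^ r ≤ r.factorial * H.edges.card → 
    ∃ V1 ⊆ H.verts, (r.factorial : ℝ) * (bad H V1).card ≤ κ * (H.verts.card : ℝ) ^ r := by
  obtain ⟨ε, hε, hL⟩ := L2 hr κ hκ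
  refine ⟨ε, hε, ?_⟩
  intro H hK hall he
  rcases Nat.eq_zero_or_pos H.verts.card with h | h
  · refine ⟨∅, Finset.empty_subset _, ?_⟩
    have := edges_zero hr H h
    have h2 : (bad H ∅).card ≤ H.edges.card := Finset.card_filter_le _ _
    have h3 : (bad H ∅).card = 0 := by omega
    rw [h3]
    simp
    positivity
  · obtain ⟨rep, K, x, h1, h2, h3, h4, h5, h6⟩ := zbase hr H hK hall h
    have h7 := h6 _ (Finset.Subset.refl _)
    have hpos : (0:ℝ) < (H.verts.card : ℝ) ^ r := by positivity
    have h8 : pir r - ε ≤ wt r x (H.edges.image fun e => e.image rep) := by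
      have := he.trans h7
      rw [mul_comm] at this
      exact le_of_mul_le_mul_left this hpos
    obtain ⟨i, hi, hw⟩ := hL x K h1 h2 _ h3 h4 h8
    refine ⟨H.verts.filter fun b => rep b = i, Finset.filter_subset _ _, ?_⟩
    have h9 := h6 (bad H (H.verts.filter fun b => rep b = i)) (Finset.filter_subset _ _)
    refine h9.trans ?_
    rw [mul_comm]
    refine mul_le_mul_of_nonneg_right (le_trans ?_ hw) hpos.le
    unfold wt
    refine mul_le_mul_of_nonneg_left ?_ (by positivity)
    refine Finset.sum_le_sum_of_subset_of_nonneg ?_ ?_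
    · intro f hf
      obtain ⟨e, he, rfl⟩ := Finset.mem_image.mp hf
      obtain ⟨he1, he2⟩ := Finset.mem_filter.mp he
      refine Finset.mem_filter.mpr ⟨Finset.mem_image_of_mem (fun e => e.image rep) he1, ?_⟩
      intro hmem
      obtain ⟨a, ha, hai⟩ := Finset.mem_image.mp hmem
      apply he2
      rw [Finset.card_eq_one]
      refine ⟨a, ?_⟩
      ext b
      simp only [Finset.mem_inter, Finset.mem_filter, Finset.mem_singleton]
      constructor
      · rintro ⟨q1, q2, q3⟩
        exact h5 e he1 q1 ha (q3.trans hai.symm)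
      · rintro rfl
        exact ⟨ha, H.edges_sub _ he1 ha, hai⟩
    · intro f hf _
      have hfK := (Finset.mem_powersetCard.mp (h3 (Finset.mem_filter.mp hf).1)).1
      exact Finset.prod_nonneg fun j hj => h1 j (hfK hj)

theorem dcount (S : Finset (Finset ℕ)) (W : Finset ℕ) (k : ℕ) (hS : ∀ e ∈ S, e.card ≤ k) (c : ℝ)
    (hW : ∀ w ∈ W, c ≤ ((S.filter fun e => w ∈ e).card : ℝ)) :
    (W.card : ℝ) * c ≤ k * S.card := by
  have h1 : ∑ w ∈ W, ((S.filter fun e => w ∈ e).card : ℝ) = ∑ e ∈ S, ((W.filter fun w => w ∈ e).card : ℝ) := by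
    simp only [Finset.card_filter, Nat.cast_sum]
    rw [Finset.sum_comm]
  have h2 : (W.card : ℝ) * c ≤ ∑ w ∈ W, ((S.filter fun e => w ∈ e).card : ℝ) := by
    rw [← nsmul_eq_mul]
    exact Finset.card_nsmul_le_sum _ _ _ hW
  have h3 : ∑ e ∈ S, ((W.filter fun w => w ∈ e).card : ℝ) ≤ S.card • (k : ℝ) := by
    refine Finset.sum_le_card_nsmul _ _ _ fun e he => ?_
    have : (W.filter fun w => w ∈ e).card ≤ e.card :=
      Finset.card_le_card fun w hw => (Finset.mem_filter.mp hw).2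
    exact_mod_cast this.trans (hS e he)
  rw [nsmul_eq_mul] at h3
  linarith

/-- `k`-sets meeting `B` -/
theorem meet_count (V B : Finset ℕ) (k : ℕ) (S : Finset (Finset ℕ))
    (hS : ∀ e ∈ S, e ⊆ V ∧ e.card = k + 1) (hm : ∀ e ∈ S, ¬ Disjoint e B) :
    S.card ≤ B.card * V.card ^ k := by
  have hsub : S ⊆ B.biUnion (fun z => S.filter fun e => z ∈ e) := by
    intro e he
    obtain ⟨z, hz, hzB⟩ := Finset.not_disjoint_iff.mp (hm e he)
    exact Finset.mem_biUnion.mpr ⟨z, hzB, Finset.mem_filter.mpr ⟨he, hz⟩⟩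
  refine (Finset.card_le_card hsub).trans (Finset.card_biUnion_le_card_mul _ _ _ fun z hz => ?_)
  have := cnt V {z} (k+1) (S.filter fun e => z ∈ e) (fun e he => by
    obtain ⟨h1, h2⟩ := Finset.mem_filter.mp he
    exact ⟨(hS e h1).1, (hS e h1).2, Finset.singleton_subset_iff.mpr h2⟩)
  simp only [Finset.card_singleton, Nat.add_sub_cancel] at this
  exact this.trans (choose_le_pow' _ _)

theorem avoid (V B : Finset ℕ) (k : ℕ) (S : Finset (Finset ℕ))
    (hS : ∀ e ∈ S, e ⊆ V ∧ e.card = k + 1) (h : B.card * V.card ^ k < S.card) :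
    ∃ e ∈ S, Disjoint e B := by
  by_contra hcon
  push Not at hcon
  exact absurd (meet_count V B k S hS hcon) (by omega)

theorem chooseLB {m k r : ℕ} {y : ℝ} (hy : 0 ≤ y) (hk : k ≤ r) (hr : 0 < r) (hm : y + k ≤ m) :
    (y / r) ^ k ≤ (m.choose k : ℝ) := by
  have h1 : ((m + 1 - k : ℕ) ^ k : ℕ) ≤ m.descFactorial k := Nat.pow_sub_le_descFactorial m k
  have hkm : k ≤ m := by
    have : (k : ℝ) ≤ m := by linarith
    exact_mod_cast this
  have h2 := Nat.descFactorial_eq_factorial_mul_choose m k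
  have h3 : y ^ k ≤ (k.factorial : ℝ) * m.choose k := by
    have : (y:ℝ) ^ k ≤ ((m + 1 - k : ℕ) : ℝ) ^ k := by
      apply pow_le_pow_left₀ hy
      rw [Nat.cast_sub (by omega)]
      push_cast
      linarith
    refine this.trans ?_
    rw [h2] at h1
    exact_mod_cast h1
  have h4 : (k.factorial : ℝ) ≤ (r : ℝ) ^ k := by
    have : k.factorial ≤ k ^ k := Nat.factorial_le_pow k
    have h' : k ^ k ≤ r ^ k := Nat.pow_le_pow_left hk k
    exact_mod_cast this.trans h'
  rw [div_pow, div_le_iff₀ (by positivity)]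
  calc y ^ k ≤ (k.factorial : ℝ) * m.choose k := h3
    _ ≤ (r:ℝ) ^ k * m.choose k := mul_le_mul_of_nonneg_right h4 (by positivity)
    _ = _ := mul_comm _ _

theorem prodcount (P Q B V1 : Finset ℕ) (k : ℕ) (hP : P ⊆ V1) (hB : Disjoint B V1)
    (hQ : Disjoint Q V1) : ∃ S : Finset (Finset ℕ), S.card = P.card * (Q \ B).card.choose k ∧
      ∀ e ∈ S, ∃ a ∈ P, ∃ D ⊆ Q, Disjoint D B ∧ e = insert a (B ∪ D) ∧ e.card = 1 + B.card + k ∧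
        (e ∩ V1).card = 1 := by
  have hdV : ∀ D ∈ (Q \ B).powersetCard k, Disjoint (B ∪ D) V1 := by
    intro D hD
    have := (Finset.mem_powersetCard.mp hD).1
    rw [Finset.disjoint_union_left]
    exact ⟨hB, Finset.disjoint_of_subset_left (this.trans Finset.sdiff_subset) hQ⟩
  have hinter : ∀ a ∈ P, ∀ D ∈ (Q \ B).powersetCard k, insert a (B ∪ D) ∩ V1 = {a} := by
    intro a ha D hD
    rw [Finset.insert_inter_of_mem (hP ha), Finset.disjoint_iff_inter_eq_empty.mp (hdV D hD)]
    rfl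
  refine ⟨(P ×ˢ (Q \ B).powersetCard k).image fun p => insert p.1 (B ∪ p.2), ?_, ?_⟩
  · rw [Finset.card_image_of_injOn, Finset.card_product, Finset.card_powersetCard]
    rintro ⟨a, D⟩ h1 ⟨a', D'⟩ h2 h
    have h1' := Finset.mem_product.mp (Finset.mem_coe.mp h1)
    have h2' := Finset.mem_product.mp (Finset.mem_coe.mp h2)
    have h' : insert a (B ∪ D) = insert a' (B ∪ D') := h
    have i1 := hinter a h1'.1 D h1'.2
    have i2 := hinter a' h2'.1 D' h2'.2
    rw [h', i2] at i1
    have haa : a' = a := Finset.singleton_inj.mp i1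
    subst haa
    have key : ∀ D ∈ (Q \ B).powersetCard k, (insert a' (B ∪ D)).erase a' \ B = D := by
      intro D hD
      rw [Finset.erase_insert (fun hh => Finset.disjoint_left.mp (hdV D hD) hh (hP h1'.1)),
        Finset.union_sdiff_left]
      refine Finset.sdiff_eq_self_of_disjoint ?_
      rw [Finset.disjoint_left]
      intro z hz hzB
      exact (Finset.mem_sdiff.mp ((Finset.mem_powersetCard.mp hD).1 hz)).2 hzB
    have := key D h1'.2
    rw [h', key D' h2'.2] at this
    rw [this]
  · intro e he
    obtain ⟨⟨a, D⟩, hp, rfl⟩ := Finset.mem_image.mp he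
    obtain ⟨ha, hD⟩ := Finset.mem_product.mp hp
    obtain ⟨hD1, hD2⟩ := Finset.mem_powersetCard.mp hD
    have hDB : Disjoint D B := by
      rw [Finset.disjoint_left]
      intro z hz hzB
      exact (Finset.mem_sdiff.mp (hD1 hz)).2 hzB
    refine ⟨a, ha, D, hD1.trans Finset.sdiff_subset, hDB, rfl, ?_, ?_⟩
    · have : a ∉ B ∪ D := fun hh => Finset.disjoint_left.mp (hdV D hD) hh (hP ha)
      simp only
      rw [Finset.card_insert_of_notMem this, Finset.card_union_of_disjoint hDB.symm]
      have hD2' : D.card = k := hD2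
      omega
    · simp only
      rw [hinter a ha D hD]; rfl

/-- good sets -/
def goodS {r : ℕ} (H : HGraph r) (V1 : Finset ℕ) : Finset (Finset ℕ) :=
  (H.verts.powersetCard r).filter fun e => (e ∩ V1).card = 1

/-- missing good sets -/
def missS {r : ℕ} (H : HGraph r) (V1 : Finset ℕ) : Finset (Finset ℕ) := goodS H V1 \ H.edges

def missv {r : ℕ} (H : HGraph r) (V1 : Finset ℕ) (v : ℕ) : Finset (Finset ℕ) :=
  (missS H V1).filter fun e => v ∈ e

noncomputable def bt (r : ℕ) : ℝ := (1 / (4 * (r:ℝ))) ^ r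

theorem bt_pos {r : ℕ} (hr : 4 ≤ r) : 0 < bt r := by
  have : (0:ℝ) < r := by exact_mod_cast (by omega : 0 < r)
  unfold bt; positivity

theorem bt_le {r k : ℕ} (hr : 4 ≤ r) (hk : k ≤ r) : bt r ≤ (1 / (4 * (r:ℝ))) ^ k := by
  have : (4:ℝ) ≤ r := by exact_mod_cast hr
  unfold bt
  apply pow_le_pow_of_le_one (by positivity) _ hk
  rw [div_le_one (by positivity)]; linarith

theorem bt_le_one {r : ℕ} (hr : 4 ≤ r) : bt r ≤ 1 := by
  have := bt_le hr (Nat.zero_le r)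
  simpa using this

/-- environment -/
structure Env {r : ℕ} (H : HGraph r) (V1 : Finset ℕ) (κ : ℝ) : Prop where
  sub : V1 ⊆ H.verts
  xlo : (H.verts.card : ℝ) / r - κ * H.verts.card ≤ V1.card
  xhi : (V1.card : ℝ) ≤ (H.verts.card : ℝ) / r + κ * H.verts.card
  miss : ((missS H V1).card : ℝ) ≤ bt r * κ ^ 2 / (2 * r ^ 2) * (H.verts.card : ℝ) ^ r
  hn : (CM r : ℝ) ≤ κ * (bt r / 2) * H.verts.card

theorem Env.mono {r : ℕ} (hr : 4 ≤ r) {H : HGraph r} {V1 : Finset ℕ} {κ κ' : ℝ} (h : Env H V1 κ)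
    (h0 : 0 ≤ κ) (hk : κ ≤ κ') : Env H V1 κ' := by
  have hb := bt_pos hr
  have hn : (0:ℝ) ≤ H.verts.card := by positivity
  refine ⟨h.sub, ?_, ?_, ?_, ?_⟩
  · have := h.xlo; nlinarith
  · have := h.xhi; nlinarith
  · refine h.miss.trans ?_
    have : κ ^ 2 ≤ κ' ^ 2 := pow_le_pow_left₀ h0 hk 2
    gcongr
  · refine h.hn.trans ?_
    gcongr

def okv {r : ℕ} (H : HGraph r) (V1 : Finset ℕ) (κ : ℝ) (v : ℕ) : Prop :=
  ((missv H V1 v).card : ℝ) ≤ bt r / (2 * r) * κ * (H.verts.card : ℝ) ^ (r - 1)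

open Classical in
noncomputable def nonok {r : ℕ} (H : HGraph r) (V1 : Finset ℕ) (κ : ℝ) : Finset ℕ :=
  H.verts.filter fun v => ¬ okv H V1 κ v

open Classical in
noncomputable def poor {r : ℕ} (H : HGraph r) (V1 : Finset ℕ) (u : ℕ) : Finset ℕ :=
  H.verts.filter fun w => w ≠ u ∧ ¬ (u ∈ V1 ∧ w ∈ V1) ∧ ¬ Cov H (CM r) u w

theorem mem_nonok {r : ℕ} {H : HGraph r} {V1 : Finset ℕ} {κ : ℝ} {v : ℕ} :
    v ∈ nonok H V1 κ ↔ v ∈ H.verts ∧ ¬ okv H V1 κ v := by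
  classical
  unfold nonok
  simp only [Finset.mem_filter]

theorem mem_poor {r : ℕ} {H : HGraph r} {V1 : Finset ℕ} {u w : ℕ} :
    w ∈ poor H V1 u ↔ w ∈ H.verts ∧ w ≠ u ∧ ¬ (u ∈ V1 ∧ w ∈ V1) ∧ ¬ Cov H (CM r) u w := by
  classical
  unfold poor
  simp only [Finset.mem_filter]

theorem notpoor {r : ℕ} {H : HGraph r} {V1 : Finset ℕ} {u w : ℕ} (hw : w ∈ H.verts) (h : w ≠ u)
    (h1 : ¬ (u ∈ V1 ∧ w ∈ V1)) (h2 : w ∉ poor H V1 u) : Cov H (CM r) u w := by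
  by_contra hc
  exact h2 (mem_poor.mpr ⟨hw, h, h1, hc⟩)

theorem Env.npos {r : ℕ} (hr : 4 ≤ r) {H : HGraph r} {V1 : Finset ℕ} {κ : ℝ} (h : Env H V1 κ)
    (h0 : 0 < κ) : (0:ℝ) < H.verts.card := by
  have hb := bt_pos hr
  have h1 := h.hn
  have h2 : (0:ℝ) < CM r := by
    have : 0 < CM r := by unfold CM; positivity
    exact_mod_cast this
  by_contra hc
  have : (H.verts.card : ℝ) = 0 := le_antisymm (not_lt.mp hc) (by positivity)
  rw [this] at h1
  linarith

theorem nonok_card {r : ℕ} (hr : 4 ≤ r) {H : HGraph r} {V1 : Finset ℕ} {κ : ℝ} (h : Env H V1 κ)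
    (h0 : 0 < κ) : ((nonok H V1 κ).card : ℝ) ≤ κ * H.verts.card := by
  have hb := bt_pos hr
  have hn := h.npos hr h0
  have hr0 : (0:ℝ) < r := by exact_mod_cast (by omega : 0 < r)
  have h1 := dcount (missS H V1) (nonok H V1 κ) r ?_ 
    (bt r / (2 * r) * κ * (H.verts.card : ℝ) ^ (r - 1)) ?_
  · have h2 := h.miss
    have h3 : (H.verts.card : ℝ) ^ r = H.verts.card * (H.verts.card : ℝ) ^ (r - 1) := by
      rw [← pow_succ']; congr 1; omega
    have h4 : (r:ℝ) * (missS H V1).card ≤ r * (bt r * κ ^ 2 / (2 * r ^ 2) * (H.verts.card : ℝ) ^ r) :=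
      mul_le_mul_of_nonneg_left h2 hr0.le
    have h5 : r * (bt r * κ ^ 2 / (2 * r ^ 2) * (H.verts.card : ℝ) ^ r) =
        (κ * H.verts.card) * (bt r / (2 * r) * κ * (H.verts.card : ℝ) ^ (r - 1)) := by
      rw [h3]; field_simp
    rw [h5] at h4
    exact le_of_mul_le_mul_right (h1.trans h4) (by positivity)
  · intro e he
    have := (Finset.mem_filter.mp (Finset.mem_sdiff.mp he).1).1
    exact (Finset.mem_powersetCard.mp this).2.le
  · intro w hw
    have := (mem_nonok.mp hw).2
    unfold okv at this
    push Not at this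
    exact this.le

theorem Env.V2lo {r : ℕ} (hr : 4 ≤ r) {H : HGraph r} {V1 : Finset ℕ} {κ : ℝ} (h : Env H V1 κ)
    (h0 : 0 < κ) (h1 : κ ≤ 1 / (2 * r)) : (H.verts.card : ℝ) / 2 ≤ (H.verts \ V1).card ∧ 
    (H.verts.card : ℝ) / (2 * r) ≤ V1.card ∧ (r : ℝ) + 2 ≤ (H.verts.card : ℝ) / 4 := by
  have hr0 : (4:ℝ) ≤ r := by exact_mod_cast hr
  have hb := bt_pos hr
  have hb1 := bt_le_one hr
  have hn := h.npos hr h0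
  have hκ : κ * H.verts.card ≤ (H.verts.card : ℝ) / (2 * r) := by
    calc κ * H.verts.card ≤ 1 / (2 * r) * H.verts.card := by gcongr
      _ = _ := by field_simp
  have e1 : (H.verts.card : ℝ) / r = 2 * ((H.verts.card : ℝ) / (2 * r)) := by field_simp
  have e2 : (H.verts.card : ℝ) / (2 * r) ≤ (H.verts.card : ℝ) / 8 := by
    apply div_le_div_of_nonneg_left hn.le (by norm_num); linarith
  have a1 := h.xlo
  have a2 := h.xhi
  have a3 := Finset.card_sdiff_add_card_eq_card h.sub
  have a3' : ((H.verts \ V1).card : ℝ) + V1.card = H.verts.card := by exact_mod_cast a3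
  refine ⟨by linarith, by linarith, ?_⟩
  have a4 := h.hn
  have a5 : (CM r : ℝ) = 3 * r + r ^ 3 := by unfold CM; push_cast; ring
  have a6 : κ * (bt r / 2) * H.verts.card ≤ 1 / 8 * (1 / 2) * H.verts.card := by
    have : κ ≤ 1 / 8 := h1.trans (by
      apply div_le_div_of_nonneg_left (by norm_num) (by norm_num); linarith)
    gcongr
  have a7 : (r:ℝ) ^ 3 ≥ 16 * r := by
    have h16 : (16:ℝ) ≤ r * r := by nlinarith
    have : (r:ℝ) ^ 3 = r * (r * r) := by ring
    rw [this]; nlinarith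
  nlinarith

theorem good_codeg {r : ℕ} (hr : 4 ≤ r) {H : HGraph r} {V1 : Finset ℕ} {κ : ℝ} (h : Env H V1 κ)
    (h0 : 0 < κ) (h1 : κ ≤ 1 / (2 * r)) {u w : ℕ} (hu : u ∈ H.verts) (hw : w ∈ H.verts) (huw : u ≠ w)
    (hnb : ¬ (u ∈ V1 ∧ w ∈ V1)) :
    bt r * (H.verts.card : ℝ) ^ (r - 2) ≤
      (((goodS H V1).filter fun e => u ∈ e ∧ w ∈ e).card : ℝ) := by
  obtain ⟨v1, v2, v3⟩ := h.V2lo hr h0 h1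
  have hn := h.npos hr h0
  have hr0 : (4:ℝ) ≤ r := by exact_mod_cast hr
  have hQ : Disjoint (H.verts \ V1) V1 := Finset.sdiff_disjoint
  have bnd : ∀ k, k ≤ r → (1 / (4 * (r:ℝ))) ^ k * (H.verts.card:ℝ) ^ k =
      ((H.verts.card : ℝ) / 4 / r) ^ k := by
    intro k hk
    rw [← mul_pow]; congr 1; field_simp
  have case1 : ∀ u w, u ∈ V1 → w ∈ H.verts → w ∉ V1 → 
      bt r * (H.verts.card : ℝ) ^ (r - 2) ≤
      (((goodS H V1).filter fun e => u ∈ e ∧ w ∈ e).card : ℝ) := by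
    intro u w hu hw hwV
    obtain ⟨S, hS1, hS2⟩ := prodcount {u} (H.verts \ V1) {w} V1 (r - 2)
      (Finset.singleton_subset_iff.mpr hu) (Finset.disjoint_singleton_left.mpr hwV) hQ
    have hsub : S ⊆ (goodS H V1).filter fun e => u ∈ e ∧ w ∈ e := by
      intro e he
      obtain ⟨a, ha, D, hD, hDB, hee, hc, hi⟩ := hS2 e he
      rw [Finset.mem_singleton] at ha
      subst ha
      refine Finset.mem_filter.mpr ⟨Finset.mem_filter.mpr ⟨Finset.mem_powersetCard.mpr ⟨?_, ?_⟩, hi⟩,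
        ?_, ?_⟩
      · rw [hee]
        refine Finset.insert_subset (h.sub hu) (Finset.union_subset ?_ (hD.trans Finset.sdiff_subset))
        exact Finset.singleton_subset_iff.mpr hw
      · rw [hc, Finset.card_singleton]; omega
      · rw [hee]; exact Finset.mem_insert_self _ _
      · rw [hee]; simp
    have h2 : (S.card : ℝ) ≤ _ := Nat.cast_le.mpr (Finset.card_le_card hsub)
    refine le_trans ?_ h2
    rw [hS1, Finset.card_singleton, one_mul]
    have h3 : (H.verts.card : ℝ) / 4 + (r - 2 : ℕ) ≤ (((H.verts \ V1) \ {w}).card : ℝ) := by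
      have := Finset.le_card_sdiff ({w} : Finset ℕ) (H.verts \ V1)
      rw [Finset.card_singleton] at this
      have h' : (H.verts \ V1).card ≤ ((H.verts \ V1) \ {w}).card + 1 := by omega
      have h'' : ((H.verts \ V1).card : ℝ) ≤ (((H.verts \ V1) \ {w}).card : ℝ) + 1 := by
        exact_mod_cast h'
      rw [Nat.cast_sub (by omega)]
      push_cast
      linarith
    refine le_trans ?_ (chooseLB (r := r) (by positivity) (by omega) (by omega) h3)
    rw [← bnd _ (by omega)]
    exact mul_le_mul_of_nonneg_right (bt_le hr (by omega)) (by positivity)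
  by_cases huV : u ∈ V1
  · exact case1 u w huV hw (fun h => hnb ⟨huV, h⟩)
  · by_cases hwV : w ∈ V1
    · have := case1 w u hwV hu huV
      refine this.trans (le_of_eq ?_)
      congr 2
      ext e; simp only [Finset.mem_filter]; tauto
    · obtain ⟨S, hS1, hS2⟩ := prodcount V1 (H.verts \ V1) {u, w} V1 (r - 3)
        (Finset.Subset.refl _) (by
          rw [Finset.disjoint_left]
          intro z hz
          simp only [Finset.mem_insert, Finset.mem_singleton] at hz
          rcases hz with rfl | rfl <;> assumption) hQ
      have hsub : S ⊆ (goodS H V1).filter fun e => u ∈ e ∧ w ∈ e := by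
        intro e he
        obtain ⟨a, ha, D, hD, hDB, hee, hc, hi⟩ := hS2 e he
        refine Finset.mem_filter.mpr ⟨Finset.mem_filter.mpr ⟨Finset.mem_powersetCard.mpr ⟨?_, ?_⟩, hi⟩,
          ?_, ?_⟩
        · rw [hee]
          refine Finset.insert_subset (h.sub ha)
            (Finset.union_subset ?_ (hD.trans Finset.sdiff_subset))
          intro z hz
          simp only [Finset.mem_insert, Finset.mem_singleton] at hz
          rcases hz with rfl | rfl <;> assumption
        · rw [hc, Finset.card_pair huw]; omega
        · rw [hee]; simp
        · rw [hee]; simp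
      have h2 : (S.card : ℝ) ≤ _ := Nat.cast_le.mpr (Finset.card_le_card hsub)
      refine le_trans ?_ h2
      rw [hS1]
      have h3 : (H.verts.card : ℝ) / 4 + (r - 3 : ℕ) ≤ (((H.verts \ V1) \ {u, w}).card : ℝ) := by
        have := Finset.le_card_sdiff ({u, w} : Finset ℕ) (H.verts \ V1)
        rw [Finset.card_pair huw] at this
        have h' : (H.verts \ V1).card ≤ ((H.verts \ V1) \ {u, w}).card + 2 := by omega
        have h'' : ((H.verts \ V1).card : ℝ) ≤ (((H.verts \ V1) \ {u, w}).card : ℝ) + 2 := by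
          exact_mod_cast h'
        rw [Nat.cast_sub (by omega)]
        push_cast
        linarith
      have h4 := chooseLB (r := r) (by positivity) (by omega) (by omega) h3
      rw [← bnd _ (by omega)] at h4
      push_cast
      have e1 : (H.verts.card : ℝ) ^ (r - 2) = H.verts.card * (H.verts.card : ℝ) ^ (r - 3) := by
        rw [← pow_succ']; congr 1; omega
      calc bt r * (H.verts.card : ℝ) ^ (r - 2) ≤ (1 / (4 * (r:ℝ))) ^ (r - 2) * (H.verts.card : ℝ) ^ (r - 2) :=
            mul_le_mul_of_nonneg_right (bt_le hr (by omega)) (by positivity)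
        _ = (H.verts.card / (4 * r)) * ((1 / (4 * (r:ℝ))) ^ (r - 3) * (H.verts.card : ℝ) ^ (r - 3)) := by
            have : r - 2 = (r - 3) + 1 := by omega
            rw [this, pow_succ, pow_succ]; ring
        _ ≤ V1.card * (((H.verts \ V1) \ {u, w}).card.choose (r - 3)) := by
            apply mul_le_mul _ h4 (by positivity) (by positivity)
            refine le_trans ?_ v2
            apply div_le_div_of_nonneg_left hn.le (by positivity); linarith

theorem poor_card {r : ℕ} (hr : 4 ≤ r) {H : HGraph r} {V1 : Finset ℕ} {κ : ℝ} (h : Env H V1 κ)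
    (h0 : 0 < κ) (h1 : κ ≤ 1 / (2 * r)) {u : ℕ} (hu : u ∈ H.verts) (hok : okv H V1 κ u) :
    ((poor H V1 u).card : ℝ) ≤ κ * H.verts.card := by
  have hb := bt_pos hr
  have hn := h.npos hr h0
  have hr0 : (4:ℝ) ≤ r := by exact_mod_cast hr
  have e1 : (H.verts.card : ℝ) ^ (r - 2) = H.verts.card * (H.verts.card : ℝ) ^ (r - 3) := by
    rw [← pow_succ']; congr 1; omega
  have e2 : (H.verts.card : ℝ) ^ (r - 1) = H.verts.card * (H.verts.card : ℝ) ^ (r - 2) := by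
    rw [← pow_succ']; congr 1; omega
  have hκ1 : κ ≤ 1 := h1.trans (by rw [div_le_one (by positivity)]; linarith)
  have hM : (CM r : ℝ) ≤ bt r / 2 * H.verts.card := by
    refine h.hn.trans ?_
    have : 0 ≤ bt r / 2 * H.verts.card := by positivity
    nlinarith
  have h2 := dcount (missv H V1 u) (poor H V1 u) r ?_ (bt r / 2 * (H.verts.card : ℝ) ^ (r - 2)) ?_
  · unfold okv at hok
    have h3 : (r:ℝ) * (missv H V1 u).card ≤ r * (bt r / (2 * r) * κ * (H.verts.card : ℝ) ^ (r - 1)) :=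
      mul_le_mul_of_nonneg_left hok (by positivity)
    have h4 : r * (bt r / (2 * r) * κ * (H.verts.card : ℝ) ^ (r - 1)) =
        (κ * H.verts.card) * (bt r / 2 * (H.verts.card : ℝ) ^ (r - 2)) := by
      rw [e2]; field_simp
    rw [h4] at h3
    exact le_of_mul_le_mul_right (h2.trans h3) (by positivity)
  · intro e he
    have := (Finset.mem_filter.mp (Finset.mem_sdiff.mp (Finset.mem_filter.mp he).1).1).1
    exact (Finset.mem_powersetCard.mp this).2.le
  · intro w hw
    obtain ⟨hw1, hw2, hw3, hw4⟩ := mem_poor.mp hw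
    have h3 := good_codeg hr h h0 h1 hu hw1 hw2.symm hw3
    have h4 := notCov_codeg hr hw2.symm hw4
    have h5 : ((goodS H V1).filter fun e => u ∈ e ∧ w ∈ e).card ≤
        ((missv H V1 u).filter fun e => w ∈ e).card + (H.edges.filter fun e => u ∈ e ∧ w ∈ e).card := by
      refine (Finset.card_le_card ?_).trans (Finset.card_union_le _ _)
      intro e he
      simp only [missv, missS, Finset.mem_union, Finset.mem_filter, Finset.mem_sdiff] at he ⊢
      tauto
    have h6 : (((goodS H V1).filter fun e => u ∈ e ∧ w ∈ e).card : ℝ) ≤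
        ((missv H V1 u).filter fun e => w ∈ e).card + CM r * (H.verts.card : ℝ) ^ (r - 3) := by
      exact_mod_cast h5.trans (Nat.add_le_add_left h4 _)
    have h7 : CM r * (H.verts.card : ℝ) ^ (r - 3) ≤ bt r / 2 * (H.verts.card : ℝ) ^ (r - 2) := by
      rw [e1, ← mul_assoc]
      exact mul_le_mul_of_nonneg_right hM (by positivity)
    linarith

theorem Env.rle {r : ℕ} (hr : 4 ≤ r) {H : HGraph r} {V1 : Finset ℕ} {κ : ℝ} (h : Env H V1 κ)
    (h0 : 0 < κ) : (CM r : ℝ) ≤ κ * H.verts.card ∧ (r:ℝ) ≤ κ * H.verts.card := by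
  have hb1 := bt_le_one hr
  have hb := bt_pos hr
  have hn := h.npos hr h0
  have h1 : (CM r : ℝ) ≤ κ * H.verts.card := by
    refine h.hn.trans ?_
    have : 0 ≤ κ * H.verts.card := by positivity
    nlinarith
  refine ⟨h1, le_trans ?_ h1⟩
  have : r ≤ CM r := by unfold CM; nlinarith [Nat.zero_le (r^3)]
  exact_mod_cast this

theorem link_avoid {r : ℕ} (hr : 4 ≤ r) {H : HGraph r} {V1 : Finset ℕ} {κ : ℝ} (h : Env H V1 κ)
    (h0 : 0 < κ) (h1 : κ ≤ 1 / (2 * r)) {u : ℕ} (hu : u ∈ V1) (hok : okv H V1 κ u)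
    (B : Finset ℕ) (hB : (B.card : ℝ) < bt r / 2 * H.verts.card) :
    ∃ Y ⊆ H.verts \ V1, insert u Y ∈ H.edges ∧ Disjoint Y B := by
  obtain ⟨v1, v2, v3⟩ := h.V2lo hr h0 h1
  have hb := bt_pos hr
  have hn := h.npos hr h0
  have hr0 : (4:ℝ) ≤ r := by exact_mod_cast hr
  let All := (H.verts \ V1).powersetCard (r - 1)
  let S := All.filter fun Y => insert u Y ∈ H.edges
  let T := All.filter fun Y => ¬ insert u Y ∈ H.edges
  have hun : ∀ Y ∈ All, u ∉ Y := by
    intro Y hY hh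
    exact (Finset.mem_sdiff.mp ((Finset.mem_powersetCard.mp hY).1 hh)).2 hu
  have hT : T.card ≤ (missv H V1 u).card := by
    refine Finset.card_le_card_of_injOn (fun Y => insert u Y) ?_ ?_
    · intro Y hY
      obtain ⟨hY1, hY2⟩ := Finset.mem_filter.mp (Finset.mem_coe.mp hY)
      obtain ⟨hY3, hY4⟩ := Finset.mem_powersetCard.mp hY1
      refine Finset.mem_coe.mpr (Finset.mem_filter.mpr ⟨Finset.mem_sdiff.mpr ⟨Finset.mem_filter.mpr
        ⟨Finset.mem_powersetCard.mpr ⟨?_, ?_⟩, ?_⟩, hY2⟩, Finset.mem_insert_self _ _⟩)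
      · exact Finset.insert_subset (h.sub hu) (hY3.trans Finset.sdiff_subset)
      · rw [Finset.card_insert_of_notMem (hun Y hY1), hY4]; omega
      · rw [Finset.insert_inter_of_mem hu, Finset.disjoint_iff_inter_eq_empty.mp
          (Finset.disjoint_of_subset_left hY3 Finset.sdiff_disjoint)]
        rfl
    · intro Y hY Y' hY' hh
      have a := hun Y (Finset.mem_filter.mp (Finset.mem_coe.mp hY)).1
      have b := hun Y' (Finset.mem_filter.mp (Finset.mem_coe.mp hY')).1
      have hh' : insert u Y = insert u Y' := hh
      rw [← Finset.erase_insert a, hh', Finset.erase_insert b]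
  have hST : S.card + T.card = All.card := Finset.card_filter_add_card_filter_not _
  have hAll : bt r * (H.verts.card : ℝ) ^ (r - 1) ≤ (All.card : ℝ) := by
    rw [Finset.card_powersetCard]
    have h3 : (H.verts.card : ℝ) / 4 + (r - 1 : ℕ) ≤ ((H.verts \ V1).card : ℝ) := by
      rw [Nat.cast_sub (by omega)]; push_cast; linarith
    refine le_trans ?_ (chooseLB (r := r) (by positivity) (by omega) (by omega) h3)
    have : ((H.verts.card : ℝ) / 4 / r) ^ (r - 1) = (1 / (4 * (r:ℝ))) ^ (r - 1) * (H.verts.card:ℝ) ^ (r - 1) := by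
      rw [← mul_pow]; congr 1; field_simp
    rw [this]
    exact mul_le_mul_of_nonneg_right (bt_le hr (by omega)) (by positivity)
  have e1 : (H.verts.card : ℝ) ^ (r - 1) = H.verts.card * (H.verts.card : ℝ) ^ (r - 2) := by
    rw [← pow_succ']; congr 1; omega
  have hS : (bt r / 2) * (H.verts.card : ℝ) ^ (r - 1) ≤ (S.card : ℝ) := by
    have a1 : ((S.card : ℝ)) + T.card = All.card := by exact_mod_cast hST
    have a2 : (T.card : ℝ) ≤ (missv H V1 u).card := by exact_mod_cast hT
    have a3 : bt r / (2 * r) * κ * (H.verts.card : ℝ) ^ (r - 1) ≤ bt r / 2 * (H.verts.card : ℝ) ^ (r - 1) := by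
      apply mul_le_mul_of_nonneg_right _ (by positivity)
      have : bt r / (2 * r) * κ = bt r / 2 * (κ / r) := by field_simp
      rw [this]
      have : κ / r ≤ 1 := by
        rw [div_le_one (by positivity)]
        refine h1.trans ?_
        rw [div_le_iff₀ (by positivity)]
        nlinarith
      nlinarith
    unfold okv at hok
    linarith
  obtain ⟨Y, hY, hYB⟩ := avoid H.verts B (r - 2) S (by
    intro e he
    obtain ⟨hY3, hY4⟩ := Finset.mem_powersetCard.mp (Finset.mem_filter.mp he).1
    exact ⟨hY3.trans Finset.sdiff_subset, by omega⟩) (by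
    have : (B.card : ℝ) * (H.verts.card : ℝ) ^ (r - 2) < S.card := by
      refine lt_of_lt_of_le ?_ hS
      rw [e1, ← mul_assoc]
      exact mul_lt_mul_of_pos_right hB (by positivity)
    exact_mod_cast this)
  obtain ⟨hY1, hY2⟩ := Finset.mem_filter.mp hY
  exact ⟨Y, (Finset.mem_powersetCard.mp hY1).1, hY2, hYB⟩

theorem LemA {r : ℕ} (hr : 4 ≤ r) {H : HGraph r} {V1 : Finset ℕ} {κ : ℝ} (h : Env H V1 κ)
    (h0 : 0 < κ) (h1 : κ ≤ 1 / (2 * r)) (h2 : κ ≤ bt r / (8 * r)) (hF : ¬ (FF r).IsCopyIn H)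
    {f : Finset ℕ} (hf : f ∈ H.edges) {u w : ℕ} (huf : u ∈ f) (hwf : w ∈ f) (huw : u ≠ w)
    (hu : u ∈ V1) (hw : w ∈ V1) (hou : okv H V1 κ u) (how : okv H V1 κ w) : False := by
  have hb := bt_pos hr
  have hn := h.npos hr h0
  have hr0 : (4:ℝ) ≤ r := by exact_mod_cast hr
  obtain ⟨hM, hrn⟩ := h.rle hr h0
  have hκn : (r + 2) * (κ * H.verts.card) < bt r / 2 * H.verts.card := by
    have : κ * (8 * r) ≤ bt r := by rwa [le_div_iff₀ (by positivity)] at h2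
    rw [← mul_assoc]
    apply mul_lt_mul_of_pos_right _ hn
    nlinarith
  have hfc : (f.card : ℝ) ≤ κ * H.verts.card := by rw [H.edges_card _ hf]; exact hrn
  have pu := poor_card hr h h0 h1 (h.sub hu) hou
  have pw := poor_card hr h h0 h1 (h.sub hw) how
  have pn := nonok_card hr h h0
  have kn : 0 < κ * H.verts.card := by positivity
  obtain ⟨Y, hYs, hYe, hYd⟩ := link_avoid hr h h0 h1 hu hou (f ∪ poor H V1 w ∪ nonok H V1 κ) (by
    have a1 := Finset.card_union_le (f ∪ poor H V1 w) (nonok H V1 κ)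
    have a2 := Finset.card_union_le f (poor H V1 w)
    have a3 : ((f ∪ poor H V1 w ∪ nonok H V1 κ).card : ℝ) ≤ f.card + (poor H V1 w).card + (nonok H V1 κ).card := by
      exact_mod_cast a1.trans (Nat.add_le_add_right a2 _)
    nlinarith)
  have huY : u ∉ Y := fun hh => (Finset.mem_sdiff.mp (hYs hh)).2 hu
  have hwY : w ∉ Y := fun hh => (Finset.mem_sdiff.mp (hYs hh)).2 hw
  have hYc : Y.card = r - 1 := by
    have := H.edges_card _ hYe
    rw [Finset.card_insert_of_notMem huY] at this
    omega
  have hYok : ∀ y ∈ Y, okv H V1 κ y := by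
    intro y hy
    by_contra hc
    exact Finset.disjoint_left.mp hYd hy (Finset.mem_union_right _
      (mem_nonok.mpr ⟨(Finset.mem_sdiff.mp (hYs hy)).1, hc⟩))
  obtain ⟨Z, hZs, hZe, hZd⟩ := link_avoid hr h h0 h1 hw how
    (f ∪ Y ∪ poor H V1 u ∪ Y.biUnion (poor H V1)) (by
    have a1 := Finset.card_union_le (f ∪ Y ∪ poor H V1 u) (Y.biUnion (poor H V1))
    have a2 := Finset.card_union_le (f ∪ Y) (poor H V1 u)
    have a3 := Finset.card_union_le f Y
    have a4 : ((Y.biUnion (poor H V1)).card : ℝ) ≤ (r - 1) * (κ * H.verts.card) := by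
      have b1 : ((Y.biUnion (poor H V1)).card : ℝ) ≤ ∑ y ∈ Y, ((poor H V1 y).card : ℝ) := by
        exact_mod_cast Finset.card_biUnion_le
      have b2 := Finset.sum_le_card_nsmul Y (fun y => ((poor H V1 y).card : ℝ)) (κ * H.verts.card)
        (fun y hy => poor_card hr h h0 h1 (Finset.mem_sdiff.mp (hYs hy)).1 (hYok y hy))
      rw [nsmul_eq_mul, hYc, Nat.cast_sub (by omega)] at b2
      push_cast at b2
      linarith
    have a5 : ((f ∪ Y ∪ poor H V1 u ∪ Y.biUnion (poor H V1)).card : ℝ) ≤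
        f.card + Y.card + (poor H V1 u).card + (Y.biUnion (poor H V1)).card := by
      exact_mod_cast a1.trans (Nat.add_le_add_right (a2.trans (Nat.add_le_add_right a3 _)) _)
    have a6 : (Y.card : ℝ) ≤ κ * H.verts.card := by
      rw [hYc, Nat.cast_sub (by omega)]; push_cast; linarith
    nlinarith)
  have huZ : u ∉ Z := fun hh => (Finset.mem_sdiff.mp (hZs hh)).2 hu
  have hwZ : w ∉ Z := fun hh => (Finset.mem_sdiff.mp (hZs hh)).2 hw
  simp only [Finset.disjoint_union_right] at hYd hZd
  obtain ⟨⟨hYf, hYw⟩, hYn⟩ := hYd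
  obtain ⟨⟨⟨hZf, hZY⟩, hZu⟩, hZb⟩ := hZd
  apply hF
  refine emb hr hYe hZe ?_ (Finset.mem_insert_self u Y) (Finset.mem_insert_self w Z) hf huf hwf ?_ ?_
  · rw [Finset.disjoint_insert_left, Finset.mem_insert, Finset.disjoint_insert_right]
    exact ⟨by tauto, hwY, hZY.symm⟩
  · intro z hz hz'
    simp only [Finset.mem_union, Finset.mem_insert] at hz'
    rcases hz' with (rfl | hz') | (rfl | hz')
    · exact Or.inl rfl
    · exact absurd hz (Finset.disjoint_left.mp hYf hz')
    · exact Or.inr rfl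
    · exact absurd hz (Finset.disjoint_left.mp hZf hz')
  · intro x hx y hy hxy
    rcases Finset.mem_insert.mp hx with rfl | hx'
    · rcases Finset.mem_insert.mp hy with rfl | hy'
      · exact absurd rfl hxy
      · have := Finset.mem_sdiff.mp (hZs hy')
        refine notpoor this.1 ?_ (fun hh => this.2 hh.2) (Finset.disjoint_left.mp hZu hy')
        rintro rfl; exact huZ hy'
    · have hxs := Finset.mem_sdiff.mp (hYs hx')
      rcases Finset.mem_insert.mp hy with rfl | hy'
      · apply Cov.symm
        refine notpoor hxs.1 ?_ (fun hh => hxs.2 hh.2) (Finset.disjoint_left.mp hYw hx')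
        rintro rfl; exact hwY hx'
      · have hys := Finset.mem_sdiff.mp (hZs hy')
        refine notpoor hys.1 ?_ (fun hh => hxs.2 hh.1) ?_
        · rintro rfl; exact Finset.disjoint_left.mp hZY hy' hx'
        · intro hh
          exact Finset.disjoint_left.mp hZb hy' (Finset.mem_biUnion.mpr ⟨x, hx', hh⟩)

theorem LemB {r : ℕ} (hr : 4 ≤ r) {H : HGraph r} {V1 : Finset ℕ} {κ β : ℝ} (h : Env H V1 κ)
    (h0 : 0 < κ) (h1 : κ ≤ 1 / (2 * r)) (h2 : κ ≤ β / (8 * r)) (h3 : κ ≤ (β / (4 * r)) ^ r)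
    (hF : ¬ (FF r).IsCopyIn H)
    {f : Finset ℕ} (hf : f ∈ H.edges) {v : ℕ} (hvf : v ∈ f)
    (hfV : ∀ z ∈ f, z ≠ v → z ∉ V1 ∧ okv H V1 κ z)
    (A1 A2 : Finset ℕ) (hA1 : A1 ⊆ V1) (hA2 : A2 ⊆ H.verts \ V1)
    (hC1 : ∀ z ∈ A1, z ≠ v → Cov H (CM r) v z) (hC2 : ∀ z ∈ A2, z ≠ v → Cov H (CM r) v z)
    (hc1 : β * H.verts.card ≤ A1.card) (hc2 : β * H.verts.card ≤ A2.card) : False := by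
  have hb := bt_pos hr
  have hb1 := bt_le_one hr
  have hn := h.npos hr h0
  have hr0 : (4:ℝ) ≤ r := by exact_mod_cast hr
  obtain ⟨hM, hrn⟩ := h.rle hr h0
  have hβ : κ * (8 * r) ≤ β := by rwa [le_div_iff₀ (by positivity)] at h2
  have hβ0 : 0 < β := lt_of_lt_of_le (by positivity) hβ
  let X := f ∪ (f.erase v).biUnion (poor H V1)
  have hfc : (f.card : ℝ) ≤ κ * H.verts.card := by rw [H.edges_card _ hf]; exact hrn
  have kn : 0 < κ * H.verts.card := by positivity
  have hX : (X.card : ℝ) ≤ r * (κ * H.verts.card) := by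
    have a1 := Finset.card_union_le f ((f.erase v).biUnion (poor H V1))
    have b1 : (((f.erase v).biUnion (poor H V1)).card : ℝ) ≤ ∑ y ∈ f.erase v, ((poor H V1 y).card : ℝ) := by
      exact_mod_cast Finset.card_biUnion_le
    have b2 := Finset.sum_le_card_nsmul (f.erase v) (fun y => ((poor H V1 y).card : ℝ)) (κ * H.verts.card)
      (fun y hy => poor_card hr h h0 h1 (H.edges_sub _ hf (Finset.mem_of_mem_erase hy))
        (hfV y (Finset.mem_of_mem_erase hy) (Finset.ne_of_mem_erase hy)).2)
    rw [nsmul_eq_mul, Finset.card_erase_of_mem hvf, H.edges_card _ hf, Nat.cast_sub (by omega)] at b2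
    push_cast at b2
    have a2 : (X.card : ℝ) ≤ f.card + ((f.erase v).biUnion (poor H V1)).card := by exact_mod_cast a1
    nlinarith
  have hsz : ∀ A : Finset ℕ, β * H.verts.card ≤ A.card → β * H.verts.card / 2 ≤ ((A \ X).card : ℝ) := by
    intro A hA
    have := Finset.le_card_sdiff X A
    have h' : (A.card : ℝ) ≤ (A \ X).card + X.card := by
      have : A.card ≤ (A \ X).card + X.card := by omega
      exact_mod_cast this
    have : r * (κ * H.verts.card) ≤ β * H.verts.card / 2 := by nlinarith
    linarith
  have s1 := hsz A1 hc1
  have s2 := hsz A2 hc2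
  obtain ⟨S, hS1, hS2⟩ := prodcount (A1 \ X) (A2 \ X) ∅ V1 (r - 1)
    (Finset.sdiff_subset.trans hA1) (Finset.disjoint_empty_left _)
    (Finset.disjoint_of_subset_left (Finset.sdiff_subset.trans hA2) Finset.sdiff_disjoint)
  have hSc : ((missS H V1).card : ℝ) < S.card := by
    rw [hS1, Finset.sdiff_empty]
    have h4 : β * H.verts.card / 4 + (r - 1 : ℕ) ≤ ((A2 \ X).card : ℝ) := by
      rw [Nat.cast_sub (by omega)]; push_cast
      have : κ * H.verts.card ≤ β * H.verts.card / 4 := by nlinarith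
      linarith
    have h5 := chooseLB (r := r) (by positivity) (by omega) (by omega) h4
    push_cast
    have e1 : ∀ x : ℝ, x ^ r = x * x ^ (r - 1) := by
      intro x; rw [← pow_succ']; congr 1; omega
    have h6 : (β * H.verts.card / 4 / r) ^ r ≤ (A1 \ X).card * (A2 \ X).card.choose (r - 1) := by
      rw [e1]
      apply mul_le_mul _ h5 (by positivity) (by positivity)
      refine le_trans ?_ s1
      have : β * H.verts.card / 4 / r ≤ β * H.verts.card / 4 := div_le_self (by positivity) (by linarith)
      have : 0 < β * H.verts.card := by positivity
      linarith
    refine lt_of_lt_of_le ?_ h6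
    have e2 : (β * H.verts.card / 4 / r) ^ r = (β / (4 * r)) ^ r * (H.verts.card : ℝ) ^ r := by
      rw [← mul_pow]; congr 1; field_simp
    rw [e2]
    refine lt_of_le_of_lt h.miss (lt_of_lt_of_le ?_ (mul_le_mul_of_nonneg_right h3 (by positivity)))
    apply mul_lt_mul_of_pos_right _ (by positivity)
    rw [div_lt_iff₀ (by positivity)]
    have hκ1 : κ ≤ 1 := h1.trans (by rw [div_le_one (by positivity)]; linarith)
    have : bt r * κ ^ 2 ≤ 1 * (1 * κ) := by
      apply mul_le_mul hb1 _ (by positivity) (by norm_num)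
      nlinarith
    nlinarith
  obtain ⟨e, heS, heM⟩ : ∃ e ∈ S, e ∉ missS H V1 := by
    by_contra hcon
    push Not at hcon
    have : (S.card : ℝ) ≤ (missS H V1).card := by exact_mod_cast Finset.card_le_card hcon
    linarith
  obtain ⟨a, ha, D, hD, -, hee, hec, hei⟩ := hS2 e heS
  have hemem : ∀ y ∈ e, (y ∈ A1 ∨ y ∈ A2) ∧ y ∉ X := by
    intro y hy
    rw [hee, Finset.empty_union, Finset.mem_insert] at hy
    rcases hy with rfl | hy
    · exact ⟨Or.inl (Finset.mem_sdiff.mp ha).1, (Finset.mem_sdiff.mp ha).2⟩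
    · exact ⟨Or.inr (Finset.mem_sdiff.mp (hD hy)).1, (Finset.mem_sdiff.mp (hD hy)).2⟩
  have heV : e ⊆ H.verts := by
    intro y hy
    rcases (hemem y hy).1 with q | q
    · exact h.sub (hA1 q)
    · exact (Finset.mem_sdiff.mp (hA2 q)).1
  have heH : e ∈ H.edges := by
    by_contra hcon
    exact heM (Finset.mem_sdiff.mpr ⟨Finset.mem_filter.mpr ⟨Finset.mem_powersetCard.mpr ⟨heV, by
      rw [hec, Finset.card_empty]; omega⟩, hei⟩, hcon⟩)
  apply hF
  refine emb_all hr hf heH ?_ ?_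
  · rw [Finset.disjoint_right]
    intro y hy hyf
    exact (hemem y hy).2 (Finset.mem_union_left _ hyf)
  · intro x hx y hy
    have hyf : y ∉ f := fun hyf => (hemem y hy).2 (Finset.mem_union_left _ hyf)
    have hyx : y ≠ x := by rintro rfl; exact hyf hx
    by_cases hxv : x = v
    · subst hxv
      rcases (hemem y hy).1 with q | q
      · exact hC1 y q hyx
      · exact hC2 y q hyx
    · refine notpoor (heV hy) hyx (fun hh => (hfV x hx hxv).1 hh.1) ?_
      intro hh
      exact (hemem y hy).2 (Finset.mem_union_right _ (Finset.mem_biUnion.mpr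
        ⟨x, Finset.mem_erase.mpr ⟨hxv, hx⟩, hh⟩))

theorem two_count {r : ℕ} (hr : 4 ≤ r) {H : HGraph r} {v : ℕ} (S : Finset (Finset ℕ)) (A : Finset ℕ)
    (hS : ∀ e ∈ S, e ∈ H.edges ∧ v ∈ e ∧ ∃ z ∈ e, z ≠ v ∧ z ∈ A) :
    S.card ≤ A.card * H.verts.card ^ (r - 2) := by
  have hsub : S ⊆ A.biUnion (fun z => S.filter fun e => z ∈ e ∧ z ≠ v) := by
    intro e he
    obtain ⟨h1, h2, z, hz, hzv, hzA⟩ := hS e he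
    exact Finset.mem_biUnion.mpr ⟨z, hzA, Finset.mem_filter.mpr ⟨he, hz, hzv⟩⟩
  refine (Finset.card_le_card hsub).trans (Finset.card_biUnion_le_card_mul _ _ _ fun z hz => ?_)
  by_cases hzv : z = v
  · subst hzv
    simp
  have := cnt H.verts {v, z} r (S.filter fun e => z ∈ e ∧ z ≠ v) (fun e he => by
    obtain ⟨h1, h2, h3⟩ := Finset.mem_filter.mp he
    obtain ⟨h4, h5, -⟩ := hS e h1
    refine ⟨H.edges_sub _ h4, H.edges_card _ h4, ?_⟩
    intro y hy
    simp only [Finset.mem_insert, Finset.mem_singleton] at hy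
    rcases hy with rfl | rfl <;> assumption)
  rw [Finset.card_pair (Ne.symm hzv)] at this
  exact this.trans (choose_le_pow' _ _)

theorem cov_count {r : ℕ} (hr : 4 ≤ r) {H : HGraph r} {v : ℕ} (S : Finset (Finset ℕ)) (A X : Finset ℕ)
    (hA : ∀ z ∈ X, z ≠ v → Cov H (CM r) v z → z ∈ A)
    (hS : ∀ e ∈ S, e ∈ H.edges ∧ v ∈ e ∧ ∃ z ∈ e, z ≠ v ∧ z ∈ X) :
    S.card ≤ A.card * H.verts.card ^ (r - 2) + CM r * H.verts.card ^ (r - 2) := by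
  classical
  let S1 := S.filter fun e => ∃ z ∈ e, z ≠ v ∧ z ∈ A
  let W := H.verts.filter fun z => z ≠ v ∧ ¬ Cov H (CM r) v z
  have hsub : S ⊆ S1 ∪ W.biUnion (fun z => H.edges.filter fun e => v ∈ e ∧ z ∈ e) := by
    intro e he
    obtain ⟨h1, h2, z, hz, hzv, hzX⟩ := hS e he
    by_cases hc : Cov H (CM r) v z
    · exact Finset.mem_union_left _ (Finset.mem_filter.mpr ⟨he, z, hz, hzv, hA z hzX hzv hc⟩)
    · refine Finset.mem_union_right _ (Finset.mem_biUnion.mpr ⟨z, ?_, ?_⟩)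
      · exact Finset.mem_filter.mpr ⟨H.edges_sub _ h1 hz, hzv, hc⟩
      · exact Finset.mem_filter.mpr ⟨h1, h2, hz⟩
  refine (Finset.card_le_card hsub).trans ((Finset.card_union_le _ _).trans (Nat.add_le_add ?_ ?_))
  · refine two_count hr (v := v) S1 A (fun e he => ?_)
    obtain ⟨h1, h2⟩ := Finset.mem_filter.mp he
    exact ⟨(hS e h1).1, (hS e h1).2.1, h2⟩
  · have := Finset.card_biUnion_le_card_mul W (fun z => H.edges.filter fun e => v ∈ e ∧ z ∈ e)
      (CM r * H.verts.card ^ (r - 3)) (fun z hz => by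
        obtain ⟨h1, h2, h3⟩ := Finset.mem_filter.mp hz
        exact notCov_codeg hr h2.symm h3)
    refine this.trans ?_
    have hW : W.card ≤ H.verts.card := Finset.card_filter_le _ _
    have e1 : H.verts.card ^ (r - 2) = H.verts.card * H.verts.card ^ (r - 3) := by
      rw [← pow_succ']; congr 1; omega
    rw [e1]
    calc W.card * (CM r * H.verts.card ^ (r - 3)) ≤ H.verts.card * (CM r * H.verts.card ^ (r - 3)) :=
          Nat.mul_le_mul_right _ hW
      _ = _ := by ring

/-- edges through `v` whose remainder has `j` vertices in `V1` -/
def aj {r : ℕ} (H : HGraph r) (V1 : Finset ℕ) (v j : ℕ) : Finset (Finset ℕ) :=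
  H.edges.filter fun e => v ∈ e ∧ ((e.erase v) ∩ V1).card = j

def a2 {r : ℕ} (H : HGraph r) (V1 : Finset ℕ) (v : ℕ) : Finset (Finset ℕ) :=
  H.edges.filter fun e => v ∈ e ∧ 2 ≤ ((e.erase v) ∩ V1).card

theorem core {r : ℕ} (hr : 4 ≤ r) (σ : ℝ) (hσ : 0 < σ) : ∃ κ : ℝ, 0 < κ ∧ κ ≤ 1 / (2 * r) ∧
    κ ≤ bt r / (8 * r) ∧ ∀ (H : HGraph r) (V1 : Finset ℕ), Env H V1 κ → ¬ (FF r).IsCopyIn H →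
      ∀ v ∈ H.verts, ((a2 H V1 v).card : ℝ) ≤ σ * (H.verts.card : ℝ) ^ (r - 1) ∧
        (((aj H V1 v 0).card : ℝ) ≤ σ * (H.verts.card : ℝ) ^ (r - 1) ∨
         ((aj H V1 v 1).card : ℝ) ≤ σ * (H.verts.card : ℝ) ^ (r - 1)) := by
  have hb := bt_pos hr
  have hr0 : (4:ℝ) ≤ r := by exact_mod_cast hr
  let κ := min (min (1 / (2 * (r:ℝ))) (bt r / (8 * r))) (min (σ / 2) (min ((σ / 2) / (8 * r)) (((σ / 2) / (4 * r)) ^ r)))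
  have k1 : κ ≤ 1 / (2 * (r:ℝ)) := (min_le_left _ _).trans (min_le_left _ _)
  have k2 : κ ≤ bt r / (8 * r) := (min_le_left _ _).trans (min_le_right _ _)
  have k3 : κ ≤ σ / 2 := (min_le_right _ _).trans (min_le_left _ _)
  have k4 : κ ≤ (σ / 2) / (8 * r) := (min_le_right _ _).trans ((min_le_right _ _).trans (min_le_left _ _))
  have k5 : κ ≤ ((σ / 2) / (4 * r)) ^ r := (min_le_right _ _).trans ((min_le_right _ _).trans (min_le_right _ _))
  have k0 : 0 < κ := by
    refine lt_min (lt_min ?_ ?_) (lt_min ?_ (lt_min ?_ ?_)) <;> positivity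
  clear_value κ
  refine ⟨κ, k0, k1, k2, ?_⟩
  intro H V1 h hF v hv
  classical
  have hn := h.npos hr k0
  have pn := nonok_card hr h k0
  obtain ⟨hM, hrn⟩ := h.rle hr k0
  have e1 : (H.verts.card : ℝ) ^ (r - 1) = H.verts.card * (H.verts.card : ℝ) ^ (r - 2) := by
    rw [← pow_succ']; congr 1; omega
  have hbad : ((nonok H V1 κ).card : ℝ) * (H.verts.card : ℝ) ^ (r - 2) ≤ σ / 2 * (H.verts.card : ℝ) ^ (r - 1) := by
    rw [e1, ← mul_assoc]
    apply mul_le_mul_of_nonneg_right _ (by positivity)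
    refine pn.trans ?_
    gcongr
  have hnp : 0 < (H.verts.card : ℝ) ^ (r - 1) := by positivity
  refine ⟨?_, ?_⟩
  · have := two_count hr (v := v) (a2 H V1 v) (nonok H V1 κ) (fun e he => by
      obtain ⟨he, hve, hc⟩ := Finset.mem_filter.mp he
      refine ⟨he, hve, ?_⟩
      obtain ⟨u, hu, w, hw, huw⟩ := Finset.one_lt_card.mp (by omega : 1 < ((e.erase v) ∩ V1).card)
      by_contra hcon
      push Not at hcon
      obtain ⟨hu1, hu2⟩ := Finset.mem_inter.mp hu
      obtain ⟨hw1, hw2⟩ := Finset.mem_inter.mp hw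
      obtain ⟨hu3, hu4⟩ := Finset.mem_erase.mp hu1
      obtain ⟨hw3, hw4⟩ := Finset.mem_erase.mp hw1
      refine LemA hr h k0 k1 k2 hF he hu4 hw4 huw hu2 hw2 ?_ ?_
      · by_contra hc; exact hcon u hu4 hu3 (mem_nonok.mpr ⟨h.sub hu2, hc⟩)
      · by_contra hc; exact hcon w hw4 hw3 (mem_nonok.mpr ⟨h.sub hw2, hc⟩))
    have h2 : ((a2 H V1 v).card : ℝ) ≤ (nonok H V1 κ).card * (H.verts.card : ℝ) ^ (r - 2) := by
      exact_mod_cast this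
    nlinarith
  · by_contra hcon
    push Not at hcon
    obtain ⟨c0, c1⟩ := hcon
    have hfe : ∃ f ∈ aj H V1 v 0, ∀ z ∈ f, z ≠ v → z ∉ nonok H V1 κ := by
      by_contra hcon
      push Not at hcon
      have := two_count hr (v := v) (aj H V1 v 0) (nonok H V1 κ) (fun e he => by
        obtain ⟨he', hve, hc⟩ := Finset.mem_filter.mp he
        exact ⟨he', hve, hcon e he⟩)
      have h2 : ((aj H V1 v 0).card : ℝ) ≤ (nonok H V1 κ).card * (H.verts.card : ℝ) ^ (r - 2) := by
        exact_mod_cast this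
      nlinarith
    obtain ⟨f, hf, hfn⟩ := hfe
    obtain ⟨hfH, hvf, hf0⟩ := Finset.mem_filter.mp hf
    have big : ∀ (S : Finset (Finset ℕ)) (X : Finset ℕ), 
        (∀ e ∈ S, e ∈ H.edges ∧ v ∈ e ∧ ∃ z ∈ e, z ≠ v ∧ z ∈ X) →
        σ * (H.verts.card : ℝ) ^ (r - 1) < S.card →
        σ / 2 * H.verts.card ≤ ((X.filter fun z => z ≠ v ∧ Cov H (CM r) v z).card : ℝ) := by
      intro S X hS hc
      have := cov_count hr (v := v) S (X.filter fun z => z ≠ v ∧ Cov H (CM r) v z) X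
        (fun z hz hzv hcz => Finset.mem_filter.mpr ⟨hz, hzv, hcz⟩) hS
      have h2 : (S.card : ℝ) ≤ ((X.filter fun z => z ≠ v ∧ Cov H (CM r) v z).card : ℝ) * (H.verts.card : ℝ) ^ (r - 2)
          + CM r * (H.verts.card : ℝ) ^ (r - 2) := by exact_mod_cast this
      have h3 := hc.trans_le h2
      rw [e1, ← mul_assoc, ← add_mul] at h3
      have h4 := lt_of_mul_lt_mul_right h3 (by positivity)
      have : κ * H.verts.card ≤ σ / 2 * H.verts.card := by gcongr
      linarith
    have b1 := big (aj H V1 v 1) V1 (fun e he => by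
      obtain ⟨he', hve, hc⟩ := Finset.mem_filter.mp he
      obtain ⟨z, hz⟩ := Finset.card_pos.mp (by omega : 0 < ((e.erase v) ∩ V1).card)
      obtain ⟨h1, h2⟩ := Finset.mem_inter.mp hz
      exact ⟨he', hve, z, Finset.mem_of_mem_erase h1, Finset.ne_of_mem_erase h1, h2⟩) c1
    have b0 := big (aj H V1 v 0) (H.verts \ V1) (fun e he => by
      obtain ⟨he', hve, hc⟩ := Finset.mem_filter.mp he
      obtain ⟨z, hz⟩ := Finset.card_pos.mp (by 
        rw [Finset.card_erase_of_mem hve, H.edges_card _ he']; omega : 0 < (e.erase v).card)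
      refine ⟨he', hve, z, Finset.mem_of_mem_erase hz, Finset.ne_of_mem_erase hz, 
        Finset.mem_sdiff.mpr ⟨H.edges_sub _ he' (Finset.mem_of_mem_erase hz), ?_⟩⟩
      intro hzV
      have : z ∈ (e.erase v) ∩ V1 := Finset.mem_inter.mpr ⟨hz, hzV⟩
      rw [Finset.card_eq_zero.mp hc] at this
      exact absurd this (Finset.notMem_empty z)) c0
    refine LemB hr h k0 k1 k4 k5 hF hfH hvf ?_ _ _ (Finset.filter_subset _ V1)
      (Finset.filter_subset _ (H.verts \ V1)) (fun z hz _ => (Finset.mem_filter.mp hz).2.2)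
      (fun z hz _ => (Finset.mem_filter.mp hz).2.2) b1 b0
    intro z hz hzv
    refine ⟨?_, ?_⟩
    · intro hzV
      have : z ∈ (f.erase v) ∩ V1 := Finset.mem_inter.mpr ⟨Finset.mem_erase.mpr ⟨hzv, hz⟩, hzV⟩
      rw [Finset.card_eq_zero.mp hf0] at this
      exact absurd this (Finset.notMem_empty z)
    · by_contra hc
      exact hfn z hz hzv (mem_nonok.mpr ⟨H.edges_sub _ hfH hz, hc⟩)

theorem phi_le_sq_all (n : ℕ) (h : ℝ) (hh : -1 ≤ h) :
    (1 + h) ^ (n + 1) * (1 - ((n + 1 : ℕ) : ℝ) * h) ≤ 1 - h ^ 2 := by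
  induction n with
  | zero => simp; nlinarith
  | succ n ih =>
    have e : (1 + h) ^ (n + 1 + 1) * (1 - ((n + 1 + 1 : ℕ):ℝ) * h) =
      (1 + h) ^ (n + 1) * (1 - ((n + 1 : ℕ) : ℝ) * h) - (n + 2) * h ^ 2 * (1 + h) ^ (n + 1) := by
      push_cast; ring
    have h1 : 0 ≤ (1 + h) ^ (n + 1) := pow_nonneg (by linarith) _
    have h2 : 0 ≤ ((n:ℝ) + 2) * h ^ 2 * (1 + h) ^ (n + 1) := by positivity
    linarith

theorem gr_sq_all {r : ℕ} (hr : 2 ≤ r) (y : ℝ) (h1 : y ≤ 1) :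
    gr r y ≤ pir r * (1 - ((1 - r * y) / ((r - 1 : ℕ) : ℝ)) ^ 2) := by
  rw [gr_phi hr]
  have hn : (0:ℝ) < ((r - 1 : ℕ) : ℝ) := by exact_mod_cast (by omega : 0 < r - 1)
  have hrr : (r:ℝ) = ((r - 1 : ℕ) : ℝ) + 1 := by
    rw [Nat.cast_sub (by omega)]; simp
  obtain ⟨m, hm⟩ : ∃ m, r - 1 = m + 1 := ⟨r - 2, by omega⟩
  have := phi_le_sq_all m ((1 - r * y) / ((r - 1 : ℕ) : ℝ)) (by
    rw [le_div_iff₀ hn]; nlinarith)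
  rw [← hm] at this
  exact mul_le_mul_of_nonneg_left this (pir_pos hr).le

theorem gr_near {r : ℕ} (hr : 2 ≤ r) {y κ : ℝ} (h1 : y ≤ 1) (hκ : 0 ≤ κ)
    (h : pir r - pir r * κ ^ 2 ≤ gr r y) : |y - 1 / r| ≤ κ := by
  have a := gr_sq_all hr y h1
  have hp := pir_pos hr
  have hn : (0:ℝ) < ((r - 1 : ℕ) : ℝ) := by exact_mod_cast (by omega : 0 < r - 1)
  have hrr : (r:ℝ) = ((r - 1 : ℕ) : ℝ) + 1 := by
    rw [Nat.cast_sub (by omega)]; simp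
  have hr0 : (0:ℝ) < r := by linarith
  have b : ((1 - r * y) / ((r - 1 : ℕ) : ℝ)) ^ 2 ≤ κ ^ 2 := by
    have : pir r * ((1 - r * y) / ((r - 1 : ℕ) : ℝ)) ^ 2 ≤ pir r * κ ^ 2 := by linarith
    exact le_of_mul_le_mul_left this hp
  have c := abs_le_of_sq_le_sq b hκ
  have d : |y - 1 / r| ≤ |(1 - r * y) / ((r - 1 : ℕ) : ℝ)| := by
    have : y - 1 / r = -((1 - r * y) / r) := by field_simp; ring
    rw [this, abs_neg, abs_div, abs_div, abs_of_pos hr0, abs_of_pos hn]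
    apply div_le_div_of_nonneg_left (abs_nonneg _) hn
    linarith
  exact d.trans c

theorem fact_choose_le (m k : ℕ) : (k.factorial : ℝ) * m.choose k ≤ (m : ℝ) ^ k := by
  have h2 := Nat.descFactorial_eq_factorial_mul_choose m k
  have h3 := Nat.descFactorial_le_pow m k
  rw [h2] at h3
  exact_mod_cast h3

/-- families through `v` with remainder in `V2` -/
theorem fam0 {r : ℕ} (hr : 4 ≤ r) {V V1 : Finset ℕ} {v : ℕ} (S : Finset (Finset ℕ))
    (hS : ∀ e ∈ S, e ⊆ V ∧ e.card = r ∧ v ∈ e ∧ ((e.erase v) ∩ V1).card = 0) :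
    S.card ≤ (V \ V1).card.choose (r - 1) := by
  rw [← Finset.card_powersetCard]
  refine Finset.card_le_card_of_injOn (fun e => e.erase v) ?_ ?_
  · intro e he
    obtain ⟨h1, h2, h3, h4⟩ := hS e he
    refine Finset.mem_coe.mpr (Finset.mem_powersetCard.mpr ⟨?_, by rw [Finset.card_erase_of_mem h3, h2]⟩)
    intro z hz
    refine Finset.mem_sdiff.mpr ⟨h1 (Finset.mem_of_mem_erase hz), fun hzV => ?_⟩
    have : z ∈ (e.erase v) ∩ V1 := Finset.mem_inter.mpr ⟨hz, hzV⟩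
    rw [Finset.card_eq_zero.mp h4] at this
    exact absurd this (Finset.notMem_empty z)
  · intro e he e' he' hh
    have hh' : e.erase v = e'.erase v := hh
    rw [← Finset.insert_erase (hS e he).2.2.1, hh', Finset.insert_erase (hS e' he').2.2.1]

/-- sets having exactly one vertex in `V1` -/
theorem famG {k : ℕ} {V V1 : Finset ℕ} (S : Finset (Finset ℕ))
    (hS : ∀ e ∈ S, e ⊆ V ∧ e.card = k + 1 ∧ (e ∩ V1).card = 1) :
    S.card ≤ V1.card * (V \ V1).card.choose k := by
  rw [← Finset.card_powersetCard, ← Finset.card_product]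
  have hsub : S ⊆ (V1 ×ˢ (V \ V1).powersetCard k).image fun p => insert p.1 p.2 := by
    intro e he
    obtain ⟨h1, h2, h3⟩ := hS e he
    obtain ⟨a, ha⟩ := Finset.card_eq_one.mp h3
    have hae : a ∈ e ∩ V1 := by rw [ha]; exact Finset.mem_singleton_self a
    obtain ⟨hae, haV⟩ := Finset.mem_inter.mp hae
    refine Finset.mem_image.mpr ⟨(a, e.erase a), Finset.mem_product.mpr ⟨haV,
      Finset.mem_powersetCard.mpr ⟨?_, ?_⟩⟩, Finset.insert_erase hae⟩
    · intro z hz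
      refine Finset.mem_sdiff.mpr ⟨h1 (Finset.mem_of_mem_erase hz), fun hzV => ?_⟩
      have : z ∈ e ∩ V1 := Finset.mem_inter.mpr ⟨Finset.mem_of_mem_erase hz, hzV⟩
      rw [ha, Finset.mem_singleton] at this
      exact Finset.ne_of_mem_erase hz this
    · simp only
      rw [Finset.card_erase_of_mem hae, h2]; rfl
  exact (Finset.card_le_card hsub).trans Finset.card_image_le

theorem fam1 {r : ℕ} (hr : 4 ≤ r) {V V1 : Finset ℕ} {v : ℕ} (S : Finset (Finset ℕ))
    (hS : ∀ e ∈ S, e ⊆ V ∧ e.card = r ∧ v ∈ e ∧ ((e.erase v) ∩ V1).card = 1) :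
    S.card ≤ V1.card * (V \ V1).card.choose (r - 2) := by
  have h : (S.image fun e => e.erase v).card = S.card := by
    apply Finset.card_image_of_injOn
    intro e he e' he' hh
    have hh' : e.erase v = e'.erase v := hh
    rw [← Finset.insert_erase (hS e he).2.2.1, hh', Finset.insert_erase (hS e' he').2.2.1]
  rw [← h]
  refine famG _ fun e he => ?_
  obtain ⟨e', he', rfl⟩ := Finset.mem_image.mp he
  obtain ⟨h1, h2, h3, h4⟩ := hS e' he'
  refine ⟨(Finset.erase_subset _ _).trans h1, ?_, h4⟩
  rw [Finset.card_erase_of_mem h3, h2]; omega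

theorem gooddeg {r : ℕ} (hr : 4 ≤ r) (τ : ℝ) (hτ : 0 < τ) : ∃ κ : ℝ, 0 < κ ∧
    ∀ (H : HGraph r) (V1 : Finset ℕ), Env H V1 κ → ∀ (v j : ℕ), j ≤ 1 → ∀ S : Finset (Finset ℕ),
    (∀ e ∈ S, e ⊆ H.verts ∧ e.card = r ∧ v ∈ e ∧ ((e.erase v) ∩ V1).card = j) →
    ((r - 1).factorial : ℝ) * S.card ≤ (pir r + τ) * (H.verts.card : ℝ) ^ (r - 1) := by
  have hr0 : (4:ℝ) ≤ r := by exact_mod_cast hr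
  have c1 : ∀ᶠ κ : ℝ in nhds 0, (1 - 1 / (r:ℝ) + κ) ^ (r - 1) < pir r + τ := by
    have : ContinuousAt (fun κ : ℝ => (1 - 1 / (r:ℝ) + κ) ^ (r - 1)) 0 := by fun_prop
    refine this.eventually_lt_const (u := pir r + τ) ?_
    simp only [add_zero]
    unfold pir; linarith
  have c2 : ∀ᶠ κ : ℝ in nhds 0, ((r:ℝ) - 1) * (1 / r + κ) * (1 - 1 / (r:ℝ) + κ) ^ (r - 2) < pir r + τ := by
    have : ContinuousAt (fun κ : ℝ => ((r:ℝ) - 1) * (1 / r + κ) * (1 - 1 / (r:ℝ) + κ) ^ (r - 2)) 0 := by fun_prop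
    refine this.eventually_lt_const (u := pir r + τ) ?_
    simp only [add_zero]
    have e : pir r = (1 - 1 / (r:ℝ)) * (1 - 1 / (r:ℝ)) ^ (r - 2) := by
      unfold pir; rw [← pow_succ']; congr 1; omega
    have e2 : ((r:ℝ) - 1) * (1 / r) = 1 - 1 / r := by field_simp
    rw [e2, e]; linarith
  obtain ⟨ε, hε, hb⟩ := Metric.eventually_nhds_iff.mp (c1.and c2)
  obtain ⟨q1, q2⟩ := hb (y := ε / 2) (by rw [dist_zero_right, Real.norm_eq_abs, abs_of_pos (by linarith)]; linarith)
  refine ⟨ε / 2, by linarith, ?_⟩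
  set κ := ε / 2
  have hκ : 0 < κ := by simp only [κ]; linarith
  intro H V1 h v j hj S hS
  have hn := h.npos hr hκ
  have a3 := Finset.card_sdiff_add_card_eq_card h.sub
  have a3' : ((H.verts \ V1).card : ℝ) + V1.card = H.verts.card := by exact_mod_cast a3
  have y1 : ((H.verts \ V1).card : ℝ) ≤ (1 - 1 / (r:ℝ) + κ) * H.verts.card := by
    have := h.xlo
    have e : (1 - 1 / (r:ℝ) + κ) * H.verts.card = H.verts.card - H.verts.card / r + κ * H.verts.card := by
      ring
    rw [e]; linarith
  have y2 : (V1.card : ℝ) ≤ (1 / r + κ) * H.verts.card := by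
    have := h.xhi
    have e : (1 / r + κ) * H.verts.card = (H.verts.card : ℝ) / r + κ * H.verts.card := by
      ring
    rw [e]; linarith
  have hnp : 0 < (H.verts.card : ℝ) ^ (r - 1) := by positivity
  have hq : 0 ≤ 1 - 1 / (r:ℝ) + κ := by
    have : 1 / (r:ℝ) ≤ 1 := by rw [div_le_one (by positivity)]; linarith
    linarith
  rcases Nat.le_one_iff_eq_zero_or_eq_one.mp hj with rfl | rfl
  · have := fam0 hr S hS
    have t : ((r - 1).factorial : ℝ) * S.card ≤ (r - 1).factorial * ((H.verts \ V1).card.choose (r - 1)) :=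
      mul_le_mul_of_nonneg_left (by exact_mod_cast this) (by positivity)
    refine t.trans ((fact_choose_le _ _).trans ?_)
    refine (pow_le_pow_left₀ (by positivity) y1 _).trans ?_
    rw [mul_pow]
    exact mul_le_mul_of_nonneg_right q1.le hnp.le
  · have := fam1 hr S hS
    have t : ((r - 1).factorial : ℝ) * S.card ≤ (r - 1).factorial * (V1.card * ((H.verts \ V1).card.choose (r - 2))) :=
      mul_le_mul_of_nonneg_left (by exact_mod_cast this) (by positivity)
    refine t.trans ?_
    have f : ((r - 1).factorial : ℝ) = (r - 1) * (r - 2).factorial := by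
      obtain ⟨m, rfl⟩ : ∃ m, r = m + 2 := ⟨r - 2, by omega⟩
      have : m + 2 - 1 = m + 1 := rfl
      have h2 : m + 2 - 2 = m := rfl
      rw [this, h2, Nat.factorial_succ]; push_cast; ring
    have e3 : (H.verts.card : ℝ) ^ (r - 1) = H.verts.card * (H.verts.card : ℝ) ^ (r - 2) := by
      rw [← pow_succ']; congr 1; omega
    calc ((r - 1).factorial : ℝ) * (V1.card * ((H.verts \ V1).card.choose (r - 2)))
        = (r - 1) * V1.card * ((r - 2).factorial * ((H.verts \ V1).card.choose (r - 2))) := by rw [f]; ring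
      _ ≤ (r - 1) * ((1 / r + κ) * H.verts.card) * ((1 - 1 / (r:ℝ) + κ) * H.verts.card) ^ (r - 2) := by
          apply mul_le_mul
          · apply mul_le_mul_of_nonneg_left y2; linarith
          · exact (fact_choose_le _ _).trans (pow_le_pow_left₀ (by positivity) y1 _)
          · positivity
          · apply mul_nonneg; linarith
            positivity
      _ = ((r:ℝ) - 1) * (1 / r + κ) * (1 - 1 / (r:ℝ) + κ) ^ (r - 2) * (H.verts.card : ℝ) ^ (r - 1) := by
          rw [mul_pow, e3]; ring
      _ ≤ _ := mul_le_mul_of_nonneg_right q2.le hnp.le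

theorem goodS_le {r : ℕ} (hr : 4 ≤ r) (V1 : Finset ℕ) {n x : ℕ} (hn : 0 < n) (hx : x ≤ n) :
    (r.factorial : ℝ) * (x * (n - x).choose (r - 1) : ℕ) ≤ gr r ((x:ℝ) / n) * (n:ℝ) ^ r := by
  have hn' : (0:ℝ) < n := by exact_mod_cast hn
  have f : (r.factorial : ℝ) = r * (r - 1).factorial := by
    obtain ⟨m, rfl⟩ : ∃ m, r = m + 1 := ⟨r - 1, by omega⟩
    rw [Nat.factorial_succ]; push_cast; simp only [Nat.add_sub_cancel]
  push_cast
  rw [f]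
  unfold gr
  have e3 : (n : ℝ) ^ r = n * (n : ℝ) ^ (r - 1) := by
    rw [← pow_succ']; congr 1; omega
  calc (r:ℝ) * (r - 1).factorial * (x * ((n - x).choose (r - 1) : ℝ))
      = r * x * ((r - 1).factorial * ((n - x).choose (r - 1) : ℝ)) := by ring
    _ ≤ r * x * ((n - x : ℕ) : ℝ) ^ (r - 1) := mul_le_mul_of_nonneg_left (fact_choose_le _ _) (by positivity)
    _ = r * x * ((1 - (x:ℝ) / n) * n) ^ (r - 1) := by
        rw [Nat.cast_sub hx]; congr 2; field_simp
    _ = _ := by rw [mul_pow, e3]; field_simp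

theorem env_of {r : ℕ} (hr : 4 ≤ r) (κ : ℝ) (hκ : 0 < κ) : ∃ ε : ℝ, 0 < ε ∧ ∃ N : ℕ, 0 < N ∧
    ∀ (H : HGraph r) (V1 : Finset ℕ), V1 ⊆ H.verts → N ≤ H.verts.card →
    (r.factorial : ℝ) * (bad H V1).card ≤ ε * (H.verts.card : ℝ) ^ r →
    (pir r - ε) * (H.verts.card : ℝ) ^ r ≤ r.factorial * H.edges.card → Env H V1 κ := by
  have hr0 : (4:ℝ) ≤ r := by exact_mod_cast hr
  have hb := bt_pos hr
  have hp := pir_pos (r := r) (by omega)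
  let ε := min (pir r * κ ^ 2 / 2) (bt r * κ ^ 2 / (2 * r ^ 2) / 2)
  have q1 : ε ≤ pir r * κ ^ 2 / 2 := min_le_left _ _
  have q2 : ε ≤ bt r * κ ^ 2 / (2 * r ^ 2) / 2 := min_le_right _ _
  have hε : 0 < ε := by refine lt_min ?_ ?_ <;> positivity
  clear_value ε
  obtain ⟨N, hN⟩ := exists_nat_ge ((CM r : ℝ) / (κ * (bt r / 2)))
  refine ⟨ε, hε, N + 1, by omega, ?_⟩
  intro H V1 hV hNn hbad he
  have hn0 : 0 < H.verts.card := by omega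
  have hn : (0:ℝ) < H.verts.card := by exact_mod_cast hn0
  have hxn : V1.card ≤ H.verts.card := Finset.card_le_card hV
  have hg : (goodS H V1).card ≤ V1.card * (H.verts.card - V1.card).choose (r - 1) := by
    have := famG (k := r - 1) (V := H.verts) (V1 := V1) (goodS H V1) (fun e he => by
      obtain ⟨h1, h2⟩ := Finset.mem_filter.mp he
      obtain ⟨h3, h4⟩ := Finset.mem_powersetCard.mp h1
      exact ⟨h3, by omega, h2⟩)
    rwa [Finset.card_sdiff_of_subset hV] at this
  have hg' := goodS_le hr V1 hn0 hxn
  have hg2 : (r.factorial : ℝ) * (goodS H V1).card ≤ gr r ((V1.card:ℝ) / H.verts.card) * (H.verts.card:ℝ) ^ r :=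
    (mul_le_mul_of_nonneg_left (by exact_mod_cast hg) (by positivity)).trans hg'
  have hsplit : H.edges.card + (missS H V1).card ≤ (bad H V1).card + (goodS H V1).card := by
    have h1 : H.edges.card = (H.edges.filter fun e => (e ∩ V1).card = 1).card + (bad H V1).card := by
      unfold bad
      rw [Finset.card_filter_add_card_filter_not]
    have h2 : (H.edges.filter fun e => (e ∩ V1).card = 1).card + (missS H V1).card ≤ (goodS H V1).card := by
      rw [← Finset.card_union_of_disjoint]
      · apply Finset.card_le_card
        intro e he
        rcases Finset.mem_union.mp he with he | he
        · obtain ⟨h3, h4⟩ := Finset.mem_filter.mp he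
          exact Finset.mem_filter.mpr ⟨Finset.mem_powersetCard.mpr ⟨H.edges_sub _ h3, H.edges_card _ h3⟩, h4⟩
        · exact (Finset.mem_sdiff.mp he).1
      · rw [Finset.disjoint_left]
        intro e he he'
        exact (Finset.mem_sdiff.mp he').2 (Finset.mem_filter.mp he).1
    omega
  have hs : (r.factorial : ℝ) * H.edges.card + r.factorial * (missS H V1).card ≤
      r.factorial * (bad H V1).card + r.factorial * (goodS H V1).card := by
    rw [← mul_add, ← mul_add]
    exact mul_le_mul_of_nonneg_left (by exact_mod_cast hsplit) (by positivity)
  have hy1 : (V1.card:ℝ) / H.verts.card ≤ 1 := by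
    rw [div_le_one hn]; exact_mod_cast hxn
  have hnp : 0 < (H.verts.card : ℝ) ^ r := by positivity
  have hgl := gr_le (r := r) (by omega) _ hy1
  have hm0 : 0 ≤ (r.factorial : ℝ) * (missS H V1).card := by positivity
  have hgr : pir r - pir r * κ ^ 2 ≤ gr r ((V1.card:ℝ) / H.verts.card) := by
    have : (pir r - pir r * κ ^ 2) * (H.verts.card : ℝ) ^ r ≤ gr r ((V1.card:ℝ) / H.verts.card) * (H.verts.card : ℝ) ^ r := by
      nlinarith
    exact le_of_mul_le_mul_right this hnp
  have hab := abs_le.mp (gr_near (r := r) (by omega) hy1 hκ.le hgr)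
  have ex : (V1.card:ℝ) / H.verts.card * H.verts.card = (V1.card : ℝ) := div_mul_cancel₀ _ hn.ne'
  have ex2 : (H.verts.card : ℝ) / r = 1 / r * H.verts.card := by ring
  refine ⟨hV, ?_, ?_, ?_, ?_⟩
  · have := mul_le_mul_of_nonneg_right (show 1 / (r:ℝ) - κ ≤ (V1.card:ℝ) / H.verts.card by linarith) hn.le
    rw [ex, sub_mul] at this
    rw [ex2]; exact this
  · have := mul_le_mul_of_nonneg_right (show (V1.card:ℝ) / H.verts.card ≤ 1 / (r:ℝ) + κ by linarith) hn.le
    rw [ex, add_mul] at this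
    rw [ex2]; exact this
  · have h1 : (1:ℝ) ≤ r.factorial := by exact_mod_cast Nat.factorial_pos r
    have h2 : ((missS H V1).card : ℝ) ≤ r.factorial * (missS H V1).card := by
      have : (0:ℝ) ≤ (missS H V1).card := by positivity
      nlinarith
    refine h2.trans ?_
    have h3 : gr r ((V1.card:ℝ) / H.verts.card) * (H.verts.card:ℝ) ^ r ≤ pir r * (H.verts.card:ℝ) ^ r :=
      mul_le_mul_of_nonneg_right hgl hnp.le
    have h4 : (2 * ε) * (H.verts.card:ℝ) ^ r ≤ bt r * κ ^ 2 / (2 * r ^ 2) * (H.verts.card:ℝ) ^ r :=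
      mul_le_mul_of_nonneg_right (by linarith) hnp.le
    linarith
  · rw [div_le_iff₀ (by positivity)] at hN
    have : (N:ℝ) ≤ H.verts.card := by exact_mod_cast (by omega : N ≤ H.verts.card)
    refine hN.trans ?_
    rw [mul_comm]
    gcongr

def Opt {r : ℕ} (H : HGraph r) (V1 : Finset ℕ) : Prop :=
  V1 ⊆ H.verts ∧ ∀ W ⊆ H.verts, (bad H V1).card ≤ (bad H W).card

theorem exists_opt {r : ℕ} (H : HGraph r) : ∃ V1, Opt H V1 := by
  obtain ⟨V1, h1, h2⟩ := Finset.exists_min_image H.verts.powerset (fun W => (bad H W).card)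
    ⟨∅, Finset.empty_mem_powerset _⟩
  exact ⟨V1, Finset.mem_powerset.mp h1, fun W hW => h2 W (Finset.mem_powerset.mpr hW)⟩

theorem mem_bad {r : ℕ} {H : HGraph r} {V1 e : Finset ℕ} :
    e ∈ bad H V1 ↔ e ∈ H.edges ∧ (e ∩ V1).card ≠ 1 := by
  unfold bad; exact Finset.mem_filter

theorem mem_aj {r : ℕ} {H : HGraph r} {V1 e : Finset ℕ} {v j : ℕ} :
    e ∈ aj H V1 v j ↔ e ∈ H.edges ∧ v ∈ e ∧ ((e.erase v) ∩ V1).card = j := by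
  unfold aj; exact Finset.mem_filter

theorem mem_a2 {r : ℕ} {H : HGraph r} {V1 e : Finset ℕ} {v : ℕ} :
    e ∈ a2 H V1 v ↔ e ∈ H.edges ∧ v ∈ e ∧ 2 ≤ ((e.erase v) ∩ V1).card := by
  unfold a2; exact Finset.mem_filter

theorem inter_notin {W e : Finset ℕ} {v : ℕ} (hv : v ∉ W) : (e.erase v) ∩ W = e ∩ W := by
  ext x; simp only [Finset.mem_inter, Finset.mem_erase]
  constructor
  · rintro ⟨⟨_, h⟩, h'⟩; exact ⟨h, h'⟩
  · rintro ⟨h, h'⟩; exact ⟨⟨fun hx => hv (hx ▸ h'), h⟩, h'⟩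

theorem inter_ins_notin {W e : Finset ℕ} {v : ℕ} (hv : v ∉ e) : e ∩ insert v W = e ∩ W := by
  ext x; simp only [Finset.mem_inter, Finset.mem_insert]
  constructor
  · rintro ⟨h, h' | h'⟩
    · exact absurd (h' ▸ h) hv
    · exact ⟨h, h'⟩
  · rintro ⟨h, h'⟩; exact ⟨h, Or.inr h'⟩

theorem erase_inter_ins {W e : Finset ℕ} {v : ℕ} : (e.erase v) ∩ insert v W = (e.erase v) ∩ W :=
  inter_ins_notin (Finset.notMem_erase v e)

theorem inter_in_card {W e : Finset ℕ} {v : ℕ} (hv : v ∈ W) (he : v ∈ e) :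
    (e ∩ W).card = ((e.erase v) ∩ W).card + 1 := by
  rw [← Finset.card_erase_add_one (Finset.mem_inter.mpr ⟨he, hv⟩)]
  congr 2
  ext x; simp only [Finset.mem_inter, Finset.mem_erase]; tauto

theorem bad_insert {r : ℕ} (H : HGraph r) {W : Finset ℕ} {v : ℕ} (hv : v ∉ W) :
    (bad H (insert v W)).card + (aj H W v 0).card = (bad H W).card + (aj H W v 1).card := by
  have key : ∀ e, v ∈ e → (e ∩ insert v W).card = ((e.erase v) ∩ W).card + 1 := fun e he => by
    rw [inter_in_card (Finset.mem_insert_self v W) he, erase_inter_ins]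
  rw [← Finset.card_union_of_disjoint, ← Finset.card_union_of_disjoint]
  · congr 1
    ext e
    simp only [Finset.mem_union, mem_bad, mem_aj]
    by_cases he : v ∈ e
    · have h1 := key e he
      have h2 : ((e.erase v) ∩ W).card = (e ∩ W).card := by rw [inter_notin hv]
      rw [h1, h2]
      by_cases hE : e ∈ H.edges
      · simp only [hE, he, true_and]; omega
      · simp [hE]
    · rw [inter_ins_notin he]; simp [he]
  · rw [Finset.disjoint_left]; intro e he he'
    rw [mem_bad] at he; rw [mem_aj] at he'
    rw [inter_notin hv] at he'; exact he.2 he'.2.2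
  · rw [Finset.disjoint_left]; intro e he he'
    rw [mem_bad] at he; rw [mem_aj] at he'
    have := key e he'.2.1
    rw [he'.2.2] at this; exact he.2 this

theorem aj_insert {r : ℕ} (H : HGraph r) {W : Finset ℕ} {v j : ℕ} :
    aj H (insert v W) v j = aj H W v j := by
  ext e; rw [mem_aj, mem_aj, erase_inter_ins]

theorem opt_in {r : ℕ} {H : HGraph r} {V1 : Finset ℕ} (h : Opt H V1) {v : ℕ} (hv : v ∈ V1) :
    (aj H V1 v 1).card ≤ (aj H V1 v 0).card := by
  have h1 := bad_insert H (Finset.notMem_erase v V1)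
  have h2 := aj_insert H (W := V1.erase v) (v := v) (j := 0)
  have h3 := aj_insert H (W := V1.erase v) (v := v) (j := 1)
  rw [Finset.insert_erase hv] at h1 h2 h3
  rw [← h2, ← h3] at h1
  have := h.2 (V1.erase v) ((Finset.erase_subset _ _).trans h.1)
  omega

theorem opt_out {r : ℕ} {H : HGraph r} {V1 : Finset ℕ} (h : Opt H V1) {v : ℕ} (hV : v ∈ H.verts)
    (hv : v ∉ V1) : (aj H V1 v 0).card ≤ (aj H V1 v 1).card := by
  have h1 := bad_insert H hv
  have := h.2 (insert v V1) (Finset.insert_subset hV h.1)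
  omega

theorem deg_le3 {r : ℕ} (H : HGraph r) (V1 : Finset ℕ) (v : ℕ) :
    H.deg v ≤ (aj H V1 v 0).card + (aj H V1 v 1).card + (a2 H V1 v).card := by
  unfold HGraph.deg
  refine le_trans (Finset.card_le_card ?_) ((Finset.card_union_le _ _).trans
    (Nat.add_le_add_right (Finset.card_union_le _ _) _))
  intro e he
  obtain ⟨h1, h2⟩ := Finset.mem_filter.mp he
  simp only [Finset.mem_union, mem_aj, mem_a2, h1, h2, true_and]
  omega

def full {r : ℕ} (H : HGraph r) (η : ℝ) (v : ℕ) : Prop :=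
  (pir r - η) * (H.verts.card : ℝ) ^ (r - 1) ≤ (r - 1).factorial * H.deg v

theorem mem_missv {r : ℕ} {H : HGraph r} {V1 e : Finset ℕ} {v : ℕ} :
    e ∈ missv H V1 v ↔ e ⊆ H.verts ∧ e.card = r ∧ (e ∩ V1).card = 1 ∧ e ∉ H.edges ∧ v ∈ e := by
  unfold missv missS goodS
  simp only [Finset.mem_filter, Finset.mem_sdiff, Finset.mem_powersetCard]
  tauto

theorem MLL {r : ℕ} (hr : 4 ≤ r) : ∃ η : ℝ, 0 < η ∧ ∃ κ : ℝ, 0 < κ ∧ ∀ (H : HGraph r) (V1 : Finset ℕ),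
    Env H V1 κ → ¬ (FF r).IsCopyIn H → Opt H V1 → ∀ e ∈ bad H V1, ∃ v ∈ e, ¬ full H η v := by
  have hr0 : (4:ℝ) ≤ r := by exact_mod_cast hr
  have hb := bt_pos hr
  obtain ⟨β, hβ⟩ : ∃ β : ℝ, β = 1 / (4 * r) := ⟨_, rfl⟩
  have hβ0 : 0 < β := by rw [hβ]; positivity
  obtain ⟨κs, k0, k1, k2, k3, k4⟩ : ∃ κs : ℝ, 0 < κs ∧ κs ≤ 1 / (4 * r) ∧ κs ≤ bt r / (8 * r) ∧
      κs ≤ β / (8 * r) ∧ κs ≤ (β / (4 * r)) ^ r := by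
    refine ⟨min (min (1 / (4 * r)) (bt r / (8 * r))) (min (β / (8 * r)) ((β / (4 * r)) ^ r)), ?_, ?_, ?_, ?_, ?_⟩
    · refine lt_min (lt_min ?_ ?_) (lt_min ?_ ?_) <;> positivity
    · exact (min_le_left _ _).trans (min_le_left _ _)
    · exact (min_le_left _ _).trans (min_le_right _ _)
    · exact (min_le_right _ _).trans (min_le_left _ _)
    · exact (min_le_right _ _).trans (min_le_right _ _)
  have k1' : κs ≤ 1 / (2 * r) := k1.trans (one_div_le_one_div_of_le (by positivity) (by linarith))
  let η := bt r * κs / (8 * r)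
  have hη : η = bt r * κs / (8 * r) := rfl
  have hη0 : 0 < η := by positivity
  clear_value η
  have hq : (1:ℝ) ≤ (r - 1).factorial := by exact_mod_cast Nat.factorial_pos _
  obtain ⟨κ1, c0, -, -, hcore⟩ := core hr (η / (r - 1).factorial) (by positivity)
  obtain ⟨κ2, d0, hgd⟩ := gooddeg hr η hη0
  refine ⟨η, hη0, min κs (min κ1 κ2), lt_min k0 (lt_min c0 d0), ?_⟩
  intro H V1 hE hF hO e he
  have hm0 : 0 ≤ min κs (min κ1 κ2) := (lt_min k0 (lt_min c0 d0)).le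
  have hEs : Env H V1 κs := hE.mono hr hm0 (min_le_left _ _)
  have hE1 : Env H V1 κ1 := hE.mono hr hm0 ((min_le_right _ _).trans (min_le_left _ _))
  have hE2 : Env H V1 κ2 := hE.mono hr hm0 ((min_le_right _ _).trans (min_le_right _ _))
  have hn := hEs.npos hr k0
  by_contra hcon
  push Not at hcon
  obtain ⟨heE, he1⟩ := mem_bad.mp he
  have hok : ∀ v ∈ e, okv H V1 κs v := by
    intro v hv
    have hvV := H.edges_sub e heE hv
    have hf := hcon v hv
    unfold full at hf
    obtain ⟨hc2, hc01⟩ := hcore H V1 hE1 hF v hvV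
    have h3 : (H.deg v : ℝ) ≤ (aj H V1 v 0).card + (aj H V1 v 1).card + (a2 H V1 v).card := by
      exact_mod_cast deg_le3 H V1 v
    unfold okv
    set N := (H.verts.card : ℝ) ^ (r - 1) with hN
    have hN0 : 0 < N := by positivity
    set q := ((r - 1).factorial : ℝ) with hqd
    have e1 : q * (η / q * N) = η * N := by field_simp
    have goal : ∀ j l : ℕ, q * ((missv H V1 v).card + (aj H V1 v j).card : ℝ) ≤ (pir r + η) * N →
        ((aj H V1 v l).card : ℝ) ≤ η / q * N →
        ((aj H V1 v 0).card : ℝ) + (aj H V1 v 1).card = (aj H V1 v j).card + (aj H V1 v l).card →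
        ((missv H V1 v).card : ℝ) ≤ bt r / (2 * r) * κs * N := by
      intro j l g1 g2 g3
      have m0 : (0:ℝ) ≤ (missv H V1 v).card := by positivity
      have s1 : q * (H.deg v : ℝ) ≤ q * ((aj H V1 v j).card + (aj H V1 v l).card + (a2 H V1 v).card) :=
        mul_le_mul_of_nonneg_left (by linarith) (by linarith)
      have s2 : q * ((aj H V1 v l).card : ℝ) ≤ η * N := by
        rw [← e1]; exact mul_le_mul_of_nonneg_left g2 (by linarith)
      have s3 : q * ((a2 H V1 v).card : ℝ) ≤ η * N := by
        rw [← e1]; exact mul_le_mul_of_nonneg_left hc2 (by linarith)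
      have s4 : ((missv H V1 v).card : ℝ) ≤ q * (missv H V1 v).card := by nlinarith
      have s5 : bt r / (2 * r) * κs * N = 4 * (η * N) := by rw [hη]; field_simp; ring
      rw [s5]
      nlinarith
    have S : ∀ j, j ≤ 1 → (∀ f ∈ missv H V1 v, ((f.erase v) ∩ V1).card = j) →
        q * ((missv H V1 v).card + (aj H V1 v j).card : ℝ) ≤ (pir r + η) * N := by
      intro j hj hm
      have := hgd H V1 hE2 v j hj (missv H V1 v ∪ aj H V1 v j) (by
        intro f hf
        rcases Finset.mem_union.mp hf with hf | hf
        · obtain ⟨a, b, c, d, e⟩ := mem_missv.mp hf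
          exact ⟨a, b, e, hm f hf⟩
        · obtain ⟨a, b, c⟩ := mem_aj.mp hf
          exact ⟨H.edges_sub _ a, H.edges_card _ a, b, c⟩)
      rw [Finset.card_union_of_disjoint] at this
      · push_cast at this; exact this
      · rw [Finset.disjoint_left]; intro f hf hf'
        exact (mem_missv.mp hf).2.2.2.1 (mem_aj.mp hf').1
    by_cases hv1 : v ∈ V1
    · refine goal 0 1 (S 0 (by omega) ?_) ?_ rfl
      · intro f hf
        obtain ⟨a, b, c, d, e⟩ := mem_missv.mp hf
        have := inter_in_card hv1 e; omega
      · have := opt_in hO hv1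
        have h' : ((aj H V1 v 1).card : ℝ) ≤ (aj H V1 v 0).card := by exact_mod_cast this
        rcases hc01 with h | h <;> linarith
    · refine goal 1 0 (S 1 le_rfl ?_) ?_ (add_comm _ _)
      · intro f hf
        obtain ⟨a, b, c, d, e⟩ := mem_missv.mp hf
        rw [inter_notin hv1]; exact c
      · have := opt_out hO hvV hv1
        have h' : ((aj H V1 v 0).card : ℝ) ≤ (aj H V1 v 1).card := by exact_mod_cast this
        rcases hc01 with h | h <;> linarith
  rcases Nat.lt_or_gt_of_ne he1 with h0 | h2
  · have h00 : e ∩ V1 = ∅ := Finset.card_eq_zero.mp (by omega)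
    have hno : ∀ z ∈ e, z ∉ V1 := fun z hz hz1 => by
      have : z ∈ e ∩ V1 := Finset.mem_inter.mpr ⟨hz, hz1⟩
      rw [h00] at this; simp at this
    have hne : e.Nonempty := by
      rw [← Finset.card_pos, H.edges_card e heE]; omega
    obtain ⟨v, hv⟩ := hne
    have hvV := H.edges_sub e heE hv
    have hpc := poor_card hr hEs k0 k1' hvV (hok v hv)
    obtain ⟨w1, w2, -⟩ := hEs.V2lo hr k0 k1'
    have hκn : κs * H.verts.card ≤ β * H.verts.card := by
      rw [hβ]; exact mul_le_mul_of_nonneg_right k1 hn.le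
    have hA : ∀ A : Finset ℕ, 2 * (β * H.verts.card) ≤ A.card → β * H.verts.card ≤ (A \ poor H V1 v).card := by
      intro A hA
      have : A.card ≤ (A \ poor H V1 v).card + (poor H V1 v).card := by
        have := Finset.le_card_sdiff (poor H V1 v) A; omega
      have : (A.card : ℝ) ≤ (A \ poor H V1 v).card + (poor H V1 v).card := by exact_mod_cast this
      linarith
    have hb2 : 2 * (β * H.verts.card) = (H.verts.card : ℝ) / (2 * r) := by rw [hβ]; field_simp; norm_num
    refine LemB hr hEs k0 k1' k3 k4 hF heE hv (fun z hz _ => ⟨hno z hz, hok z hz⟩)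
      (V1 \ poor H V1 v) ((H.verts \ V1) \ poor H V1 v) Finset.sdiff_subset Finset.sdiff_subset ?_ ?_ ?_ ?_
    · intro z hz hzv
      obtain ⟨a, b⟩ := Finset.mem_sdiff.mp hz
      exact notpoor (hO.1 a) hzv (fun h => hno v hv h.1) b
    · intro z hz hzv
      obtain ⟨a, b⟩ := Finset.mem_sdiff.mp hz
      exact notpoor (Finset.mem_sdiff.mp a).1 hzv (fun h => hno v hv h.1) b
    · apply hA; rw [hb2]; exact w2
    · apply hA; rw [hb2]; refine le_trans ?_ w1
      apply div_le_div_of_nonneg_left hn.le (by norm_num); linarith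
  · obtain ⟨u, hu, w, hw, huw⟩ := Finset.one_lt_card.mp h2
    obtain ⟨u1, u2⟩ := Finset.mem_inter.mp hu
    obtain ⟨w1, w2⟩ := Finset.mem_inter.mp hw
    exact LemA hr hEs k0 k1' k2 hF heE u1 w1 huw u2 w2 (hok u u1) (hok w w1)

theorem mem_induce {r : ℕ} {H : HGraph r} {S e : Finset ℕ} :
    e ∈ (H.induce S).edges ↔ e ∈ H.edges ∧ e ⊆ S := by
  unfold HGraph.induce HGraph.ofEdges
  simp only [Finset.mem_filter]
  constructor
  · rintro ⟨h, _⟩; exact h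
  · intro h
    exact ⟨h, Finset.subset_inter (H.edges_sub _ h.1) h.2, H.edges_card _ h.1⟩

theorem induce_verts {r : ℕ} (H : HGraph r) (S : Finset ℕ) : (H.induce S).verts = H.verts ∩ S := rfl

theorem KF_mono {r : ℕ} {G H : HGraph r} (h : G.edges ⊆ H.edges) (hK : KF H) : KF G := by
  intro e1 h1 e2 h2 hd
  obtain ⟨x, hx, y, hy, h3⟩ := hK e1 (h h1) e2 (h h2) hd
  exact ⟨x, hx, y, hy, fun e he => h3 e (h he)⟩

theorem copy_mono {r : ℕ} {F G H : HGraph r} (hV : G.verts ⊆ H.verts) (h : G.edges ⊆ H.edges)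
    (hc : F.IsCopyIn G) : F.IsCopyIn H := by
  obtain ⟨f, h1, h2, h3⟩ := hc
  exact ⟨f, h1, fun v hv => hV (h2 v hv), fun e he => h (h3 e he)⟩

theorem induce_edges_sub {r : ℕ} (H : HGraph r) (S : Finset ℕ) : (H.induce S).edges ⊆ H.edges :=
  fun e he => (mem_induce.mp he).1

theorem induce_verts_sub {r : ℕ} (H : HGraph r) (S : Finset ℕ) : (H.induce S).verts ⊆ H.verts :=
  Finset.inter_subset_left

theorem edges_remove {r : ℕ} (H : HGraph r) (Z : Finset ℕ) :
    H.edges.card ≤ (H.induce (H.verts \ Z)).edges.card + ∑ v ∈ Z, H.deg v := by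
  have : H.edges ⊆ (H.induce (H.verts \ Z)).edges ∪ Z.biUnion (fun v => H.edges.filter fun e => v ∈ e) := by
    intro e he
    rw [Finset.mem_union, mem_induce, Finset.mem_biUnion]
    by_cases h : ∃ v ∈ Z, v ∈ e
    · obtain ⟨v, h1, h2⟩ := h
      exact Or.inr ⟨v, h1, Finset.mem_filter.mpr ⟨he, h2⟩⟩
    · push Not at h
      exact Or.inl ⟨he, fun v hv => Finset.mem_sdiff.mpr ⟨H.edges_sub e he hv, fun hz => h v hz hv⟩⟩
  refine (Finset.card_le_card this).trans ((Finset.card_union_le _ _).trans ?_)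
  exact Nat.add_le_add_left Finset.card_biUnion_le _

theorem deg_le_choose {r : ℕ} (H : HGraph r) (v : ℕ) : H.deg v ≤ H.verts.card.choose (r - 1) := by
  have := cnt H.verts {v} r (H.edges.filter fun e => v ∈ e) (fun e he => by
    obtain ⟨h1, h2⟩ := Finset.mem_filter.mp he
    exact ⟨H.edges_sub e h1, H.edges_card e h1, Finset.singleton_subset_iff.mpr h2⟩)
  rw [Finset.card_singleton] at this
  exact this

theorem deg_le_pow {r : ℕ} (H : HGraph r) (v : ℕ) : (H.deg v : ℝ) ≤ (H.verts.card : ℝ) ^ (r - 1) := by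
  exact_mod_cast (deg_le_choose H v).trans (choose_le_pow' _ _)

theorem sum_deg {r : ℕ} (H : HGraph r) : ∑ v ∈ H.verts, H.deg v = r * H.edges.card := by
  have h := Finset.sum_card_bipartiteAbove_eq_sum_card_bipartiteBelow (s := H.verts) (t := H.edges)
    (fun (v : ℕ) (e : Finset ℕ) => v ∈ e)
  have h1 : ∑ v ∈ H.verts, H.deg v = ∑ a ∈ H.verts, (Finset.bipartiteAbove (fun (v : ℕ) (e : Finset ℕ) => v ∈ e) H.edges a).card := rfl
  rw [h1, h]
  have : ∀ e ∈ H.edges, (Finset.bipartiteBelow (fun (v : ℕ) (e : Finset ℕ) => v ∈ e) H.verts e).card = r := by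
    intro e he
    refine Eq.trans ?_ (H.edges_card e he)
    congr 1
    ext x
    simp only [Finset.bipartiteBelow, Finset.mem_filter]
    exact ⟨fun h => h.2, fun h => ⟨H.edges_sub e he h, h⟩⟩
  rw [Finset.sum_congr rfl this]
  simp [mul_comm]

theorem pow_upper (y : ℝ) (h0 : 0 ≤ y) (h1 : y ≤ 1) (k : ℕ) :
    (1 - y) ^ k ≤ 1 - k * y + (k:ℝ) ^ 2 * y ^ 2 := by
  induction k with
  | zero => simp
  | succ k ih =>
    rw [pow_succ]
    have h2 : (1 - y) ^ k * (1 - y) ≤ (1 - k * y + (k:ℝ) ^ 2 * y ^ 2) * (1 - y) :=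
      mul_le_mul_of_nonneg_right ih (by linarith)
    refine h2.trans ?_
    push_cast
    have : 0 ≤ (k:ℝ) ^ 2 * y ^ 3 := by positivity
    have : 0 ≤ (k:ℝ) * y ^ 2 := by positivity
    nlinarith [sq_nonneg y]

theorem pir_le_one {r : ℕ} (hr : 4 ≤ r) : pir r ≤ 1 := by
  unfold pir
  have hr0 : (4:ℝ) ≤ r := by exact_mod_cast hr
  apply pow_le_one₀
  · rw [sub_nonneg, div_le_one (by positivity)]; linarith
  · have : 0 < 1 / (r:ℝ) := by positivity
    linarith

theorem fact_r {r : ℕ} (hr : 4 ≤ r) : (r.factorial : ℝ) = r * (r - 1).factorial := by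
  obtain ⟨m, rfl⟩ : ∃ m, r = m + 1 := ⟨r - 1, by omega⟩
  rw [Nat.factorial_succ]; push_cast; rfl

theorem nf_count {r : ℕ} (hr : 4 ≤ r) {η γ : ℝ} (hη : 0 < η) (hγ : 0 < γ) (hγη : γ ≤ η / (4 * r))
    (H : HGraph r) (hK : KF H) (hn : 1 ≤ γ * H.verts.card) (Z : Finset ℕ) (hZ : Z ⊆ H.verts)
    (hnf : ∀ v ∈ Z, ¬ full H η v) (hc : γ * H.verts.card ≤ Z.card) :
    (r.factorial : ℝ) * H.edges.card ≤ (pir r - r * η * γ / 2) * (H.verts.card : ℝ) ^ r := by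
  have hr0 : (4:ℝ) ≤ r := by exact_mod_cast hr
  have hp := pir_pos (r := r) (by omega)
  have hp1 := pir_le_one hr
  obtain ⟨Z', hZ', hZc⟩ := Finset.exists_subset_card_eq (s := Z) (n := ⌈γ * H.verts.card⌉₊) (Nat.ceil_le.mpr hc)
  have hn0 : (0:ℝ) < H.verts.card := by
    rcases (Nat.cast_nonneg H.verts.card : (0:ℝ) ≤ _).lt_or_eq with h | h
    · exact h
    · rw [← h] at hn; norm_num at hn
  have z1 : γ * H.verts.card ≤ Z'.card := by rw [hZc]; exact Nat.le_ceil _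
  have z2 : (Z'.card : ℝ) ≤ 2 * (γ * H.verts.card) := by
    rw [hZc]; have := Nat.ceil_lt_add_one (show 0 ≤ γ * H.verts.card by positivity); linarith
  have hsub := hZ'.trans hZ
  have zle : Z'.card ≤ H.verts.card := Finset.card_le_card hsub
  obtain ⟨y, hy⟩ : ∃ y : ℝ, y = Z'.card / H.verts.card := ⟨_, rfl⟩
  have hyn : y * H.verts.card = Z'.card := by rw [hy]; exact div_mul_cancel₀ _ hn0.ne'
  have hy0 : 0 ≤ y := by rw [hy]; positivity
  have hy1 : y ≤ 1 := by rw [hy, div_le_one hn0]; exact_mod_cast zle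
  have y1 : γ ≤ y := by rw [← hyn] at z1; exact le_of_mul_le_mul_right z1 hn0
  have y2 : y ≤ 2 * γ := by rw [← hyn, ← mul_assoc] at z2; exact le_of_mul_le_mul_right z2 hn0
  have hrem : (H.edges.card : ℝ) ≤ (H.induce (H.verts \ Z')).edges.card + ∑ v ∈ Z', (H.deg v : ℝ) := by
    exact_mod_cast edges_remove H Z'
  have hT := T0 hr _ (KF_mono (induce_edges_sub H (H.verts \ Z')) hK)
  have hv : ((H.induce (H.verts \ Z')).verts.card : ℝ) = (1 - y) * H.verts.card := by
    rw [induce_verts, Finset.inter_eq_right.mpr Finset.sdiff_subset, Finset.card_sdiff_of_subset hsub,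
      Nat.cast_sub zle, ← hyn]; ring
  rw [hv, mul_pow] at hT
  have hs : ((r - 1).factorial : ℝ) * ∑ v ∈ Z', (H.deg v : ℝ) ≤ Z'.card * ((pir r - η) * (H.verts.card : ℝ) ^ (r - 1)) := by
    rw [Finset.mul_sum, ← nsmul_eq_mul]
    apply Finset.sum_le_card_nsmul
    intro v hv
    have := hnf v (hZ' hv)
    unfold full at this
    linarith
  have e3 : (H.verts.card : ℝ) ^ r = H.verts.card * (H.verts.card : ℝ) ^ (r - 1) := by
    rw [← pow_succ']; congr 1; omega
  have hs2 : (r.factorial : ℝ) * ∑ v ∈ Z', (H.deg v : ℝ) ≤ r * y * (pir r - η) * (H.verts.card : ℝ) ^ r := by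
    rw [fact_r hr, mul_assoc, e3]
    calc (r:ℝ) * (((r - 1).factorial : ℝ) * ∑ v ∈ Z', (H.deg v : ℝ)) ≤ r * (Z'.card * ((pir r - η) * (H.verts.card : ℝ) ^ (r - 1))) :=
          mul_le_mul_of_nonneg_left hs (by positivity)
      _ = _ := by rw [← hyn]; ring
  have hpw := pow_upper y hy0 hy1 r
  have hnp : 0 < (H.verts.card : ℝ) ^ r := by positivity
  have main : (r.factorial : ℝ) * H.edges.card ≤ (pir r * (1 - y) ^ r + r * y * (pir r - η)) * (H.verts.card : ℝ) ^ r := by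
    have : (r.factorial : ℝ) * H.edges.card ≤ r.factorial * ((H.induce (H.verts \ Z')).edges.card + ∑ v ∈ Z', (H.deg v : ℝ)) :=
      mul_le_mul_of_nonneg_left hrem (by positivity)
    rw [mul_add] at this
    linarith
  refine main.trans (mul_le_mul_of_nonneg_right ?_ hnp.le)
  have a1 : pir r * (1 - y) ^ r ≤ pir r * (1 - r * y + (r:ℝ) ^ 2 * y ^ 2) := mul_le_mul_of_nonneg_left hpw hp.le
  have a2 : pir r * ((r:ℝ) ^ 2 * y ^ 2) ≤ (r:ℝ) ^ 2 * y ^ 2 := by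
    have : 0 ≤ (r:ℝ) ^ 2 * y ^ 2 := by positivity
    exact mul_le_of_le_one_left this hp1
  have a3 : r * y ≤ η / 2 := by
    rw [le_div_iff₀ (by positivity)] at hγη
    have : r * y ≤ r * (2 * γ) := mul_le_mul_of_nonneg_left y2 (by positivity)
    linarith
  have a4 : (r:ℝ) ^ 2 * y ^ 2 ≤ r * y * (η / 2) := by
    have := mul_le_mul_of_nonneg_left a3 (show 0 ≤ r * y by positivity)
    calc (r:ℝ) ^ 2 * y ^ 2 = r * y * (r * y) := by ring
      _ ≤ _ := this
  have a5 : r * η * γ ≤ r * η * y := mul_le_mul_of_nonneg_left y1 (by positivity)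
  linarith

theorem bad_le_deg {r : ℕ} {G H : HGraph r} (V1 : Finset ℕ) {k : ℕ}
    (h : (H.edges \ G.edges).card ≤ k) : (bad H V1).card ≤ (bad G V1).card + k := by
  have : bad H V1 ⊆ bad G V1 ∪ (H.edges \ G.edges) := by
    intro e he
    obtain ⟨h1, h2⟩ := mem_bad.mp he
    by_cases hG : e ∈ G.edges
    · exact Finset.mem_union_left _ (mem_bad.mpr ⟨hG, h2⟩)
    · exact Finset.mem_union_right _ (Finset.mem_sdiff.mpr ⟨h1, hG⟩)
  refine (Finset.card_le_card this).trans ((Finset.card_union_le _ _).trans ?_)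
  omega

theorem big_n {c : ℝ} (d : ℝ) (hc : 0 < c) {r : ℕ} (hr : 4 ≤ r) : ∃ N : ℕ, ∀ n : ℕ, N ≤ n → d * (n:ℝ) ^ (r - 1) ≤ c * (n:ℝ) ^ r := by
  obtain ⟨N, hN⟩ := exists_nat_ge (d / c)
  refine ⟨N, fun n hn => ?_⟩
  have : (N:ℝ) ≤ n := by exact_mod_cast hn
  have e3 : (n : ℝ) ^ r = n * (n : ℝ) ^ (r - 1) := by
    rw [← pow_succ']; congr 1; omega
  rw [e3, ← mul_assoc]
  apply mul_le_mul_of_nonneg_right _ (by positivity)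
  rw [div_le_iff₀ hc] at hN
  nlinarith

open Classical in
theorem KFstab {r : ℕ} (hr : 4 ≤ r) (κ : ℝ) (hκ : 0 < κ) : ∃ ε : ℝ, 0 < ε ∧ ∃ N : ℕ, ∀ H : HGraph r, KF H →
    N ≤ H.verts.card → (pir r - ε) * (H.verts.card : ℝ) ^ r ≤ r.factorial * H.edges.card →
    ∃ V1 ⊆ H.verts, (r.factorial : ℝ) * (bad H V1).card ≤ κ * (H.verts.card : ℝ) ^ r := by
  have hr0 : (4:ℝ) ≤ r := by exact_mod_cast hr
  obtain ⟨η, hη, κM, hκM, hMLL⟩ := MLL hr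
  obtain ⟨εe, hεe, Ne, hNe, henv⟩ := env_of hr κM hκM
  obtain ⟨κ0, h0, h01, h02⟩ : ∃ κ0 : ℝ, 0 < κ0 ∧ κ0 ≤ κ ∧ κ0 ≤ εe :=
    ⟨min κ εe, lt_min hκ hεe, min_le_left _ _, min_le_right _ _⟩
  have hf : (0:ℝ) < r.factorial := by exact_mod_cast Nat.factorial_pos r
  obtain ⟨γ, g0, g1, g2⟩ : ∃ γ : ℝ, 0 < γ ∧ γ ≤ κ0 / (2 * r.factorial) ∧ γ ≤ η / (4 * r) :=
    ⟨min (κ0 / (2 * r.factorial)) (η / (4 * r)), lt_min (by positivity) (by positivity), min_le_left _ _, min_le_right _ _⟩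
  obtain ⟨εs, hεs, hst⟩ := stab_base hr (κ0 / 2) (by positivity)
  obtain ⟨ε, e0, e1, e2, e3⟩ : ∃ ε : ℝ, 0 < ε ∧ ε ≤ εs ∧ ε ≤ εe ∧ ε ≤ r * η * γ / 4 :=
    ⟨min εs (min εe (r * η * γ / 4)), lt_min hεs (lt_min hεe (by positivity)), min_le_left _ _,
      (min_le_right _ _).trans (min_le_left _ _), (min_le_right _ _).trans (min_le_right _ _)⟩
  obtain ⟨N1, hN1⟩ := exists_nat_ge (1 / γ)
  obtain ⟨N2, hN2⟩ := big_n (c := κ0 / 2) (r.factorial : ℝ) (by positivity) hr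
  refine ⟨ε, e0, max Ne (max N1 N2), ?_⟩
  intro H hK hn he
  have n1 : Ne ≤ H.verts.card := (le_max_left _ _).trans hn
  have n2 : N1 ≤ H.verts.card := (le_max_left _ _).trans ((le_max_right _ _).trans hn)
  have n3 : N2 ≤ H.verts.card := (le_max_right _ _).trans ((le_max_right _ _).trans hn)
  have hn0 : (0:ℝ) < H.verts.card := by exact_mod_cast (lt_of_lt_of_le hNe n1)
  have hgn : 1 ≤ γ * H.verts.card := by
    have : (N1:ℝ) ≤ H.verts.card := by exact_mod_cast n2
    rw [div_le_iff₀ g0] at hN1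
    nlinarith
  have hnp : 0 < (H.verts.card : ℝ) ^ r := by positivity
  have hbig := hN2 _ n3
  suffices h : ∃ V1 ⊆ H.verts, (r.factorial : ℝ) * (bad H V1).card ≤ κ0 / 2 * (H.verts.card : ℝ) ^ r by
    obtain ⟨V1, a, b⟩ := h
    exact ⟨V1, a, b.trans (mul_le_mul_of_nonneg_right (by linarith) hnp.le)⟩
  clear hn n2 n3
  revert he
  refine zykov H.verts (fun G => (pir r - ε) * (H.verts.card : ℝ) ^ r ≤ r.factorial * G.edges.card →
    ∃ V1 ⊆ H.verts, (r.factorial : ℝ) * (bad G V1).card ≤ κ0 / 2 * (H.verts.card : ℝ) ^ r) ?_ ?_ H rfl hK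
  · intro G hG hKG hall he
    rw [← hG] at hall he ⊢
    exact hst G hKG hall (le_trans (mul_le_mul_of_nonneg_right (by linarith) (by positivity)) he)
  · intro G u v hG hKG hu hv huv hKc hle hPr he
    have heR : (G.edges.card : ℝ) ≤ (clone G u v).edges.card := by exact_mod_cast hle
    obtain ⟨V1, hV1, hb1⟩ := hPr (he.trans (mul_le_mul_of_nonneg_left heR hf.le))
    have hd : (G.edges \ (clone G u v).edges).card ≤ G.deg v := by
      unfold HGraph.deg
      apply Finset.card_le_card
      intro e he
      obtain ⟨h1, h2⟩ := Finset.mem_sdiff.mp he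
      refine Finset.mem_filter.mpr ⟨h1, ?_⟩
      by_contra hve
      have h3 : e ∈ G.edges.filter fun e => v ∉ e := Finset.mem_filter.mpr ⟨h1, hve⟩
      rw [← clone_edges_notin (hG ▸ hv) huv] at h3
      exact h2 (Finset.mem_filter.mp h3).1
    have hb2 : ((bad G V1).card : ℝ) ≤ (bad (clone G u v) V1).card + G.deg v := by
      exact_mod_cast bad_le_deg V1 hd
    have hdp := deg_le_pow G v
    rw [hG] at hdp
    have hb3 : (r.factorial : ℝ) * (bad G V1).card ≤ κ0 * (H.verts.card : ℝ) ^ r := by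
      have : (r.factorial : ℝ) * (bad G V1).card ≤ r.factorial * ((bad (clone G u v) V1).card + (H.verts.card : ℝ) ^ (r - 1)) :=
        mul_le_mul_of_nonneg_left (by linarith) hf.le
      rw [mul_add] at this
      linarith
    obtain ⟨V2, hO⟩ := exists_opt G
    have hVV : V2 ⊆ H.verts := hG ▸ hO.1
    have hb4 : (r.factorial : ℝ) * (bad G V2).card ≤ κ0 * (H.verts.card : ℝ) ^ r := by
      have := hO.2 V1 (hG.symm ▸ hV1)
      have : ((bad G V2).card : ℝ) ≤ (bad G V1).card := by exact_mod_cast this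
      exact (mul_le_mul_of_nonneg_left this hf.le).trans hb3
    have hE : Env G V2 κM := by
      apply henv G V2 hO.1
      · rw [hG]; exact n1
      · rw [hG]; exact hb4.trans (mul_le_mul_of_nonneg_right h02 hnp.le)
      · rw [hG]; exact le_trans (mul_le_mul_of_nonneg_right (by linarith) hnp.le) he
    have hM := hMLL G V2 hE (KF_free hr hKG) hO
    refine ⟨V2, hVV, ?_⟩
    let Z := G.verts.filter fun v => ¬ full G η v
    have hz : (Z.card : ℝ) < γ * H.verts.card := by
      by_contra hc
      push Not at hc
      have := nf_count hr hη g0 g2 G hKG (by rw [hG]; exact hgn) Z (Finset.filter_subset _ _)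
        (fun v hv => (Finset.mem_filter.mp hv).2) (by rw [hG]; exact hc)
      rw [hG] at this
      have h5 := he.trans this
      have h6 := le_of_mul_le_mul_right h5 hnp
      have : 0 < r * η * γ := by positivity
      linarith
    have hb5 : (bad G V2).card ≤ Z.card * H.verts.card ^ (r - 1) := by
      have hsub : bad G V2 ⊆ Z.biUnion (fun v => G.edges.filter fun e => v ∈ e) := by
        intro e he
        obtain ⟨v, hv, hvf⟩ := hM e he
        have heE := (mem_bad.mp he).1
        exact Finset.mem_biUnion.mpr ⟨v, Finset.mem_filter.mpr ⟨G.edges_sub e heE hv, hvf⟩,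
          Finset.mem_filter.mpr ⟨heE, hv⟩⟩
      refine (Finset.card_le_card hsub).trans (Finset.card_biUnion_le_card_mul _ _ _ ?_)
      intro v hv
      have := (deg_le_choose G v).trans (choose_le_pow' _ _)
      rw [hG] at this; exact this
    have hb6 : ((bad G V2).card : ℝ) ≤ Z.card * (H.verts.card : ℝ) ^ (r - 1) := by exact_mod_cast hb5
    have e3 : (H.verts.card : ℝ) ^ r = H.verts.card * (H.verts.card : ℝ) ^ (r - 1) := by
      rw [← pow_succ']; congr 1; omega
    calc (r.factorial : ℝ) * (bad G V2).card ≤ r.factorial * ((γ * H.verts.card) * (H.verts.card : ℝ) ^ (r - 1)) := by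
          apply mul_le_mul_of_nonneg_left _ hf.le
          exact hb6.trans (mul_le_mul_of_nonneg_right hz.le (by positivity))
      _ = (r.factorial * γ) * (H.verts.card : ℝ) ^ r := by rw [e3]; ring
      _ ≤ _ := by
          apply mul_le_mul_of_nonneg_right _ hnp.le
          rw [le_div_iff₀ (by positivity)] at g1
          linarith

theorem Fup {r : ℕ} (hr : 4 ≤ r) (H : HGraph r) (hF : ¬ (FF r).IsCopyIn H) :
    (r.factorial : ℝ) * H.edges.card ≤ pir r * (H.verts.card : ℝ) ^ r + r.factorial * CM r * (H.verts.card : ℝ) ^ (r - 1) := by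
  obtain ⟨H', h1, h2, h3, h4⟩ := cleaning hr H hF
  have hT := T0 hr H' h3
  rw [h1] at hT
  have : (H.edges.card : ℝ) ≤ H'.edges.card + CM r * (H.verts.card : ℝ) ^ (r - 1) := by exact_mod_cast h4
  have := mul_le_mul_of_nonneg_left this (show (0:ℝ) ≤ r.factorial by positivity)
  rw [mul_add] at this
  linarith

theorem Fstab {r : ℕ} (hr : 4 ≤ r) (κ : ℝ) (hκ : 0 < κ) : ∃ ε : ℝ, 0 < ε ∧ ∃ N : ℕ, ∀ H : HGraph r,
    ¬ (FF r).IsCopyIn H →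
    N ≤ H.verts.card → (pir r - ε) * (H.verts.card : ℝ) ^ r ≤ r.factorial * H.edges.card →
    ∃ V1 ⊆ H.verts, (r.factorial : ℝ) * (bad H V1).card ≤ κ * (H.verts.card : ℝ) ^ r := by
  obtain ⟨ε, hε, N, hK⟩ := KFstab hr (κ / 2) (by positivity)
  have hf : (0:ℝ) < r.factorial := by exact_mod_cast Nat.factorial_pos r
  obtain ⟨N1, hN1⟩ := big_n (c := ε / 2) (r.factorial * CM r : ℝ) (by positivity) hr
  obtain ⟨N2, hN2⟩ := big_n (c := κ / 2) (r.factorial * CM r : ℝ) (by positivity) hr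
  refine ⟨ε / 2, by positivity, max N (max N1 N2), ?_⟩
  intro H hF hn he
  have n1 : N ≤ H.verts.card := (le_max_left _ _).trans hn
  have n2 := hN1 _ ((le_max_left _ _).trans ((le_max_right _ _).trans hn))
  have n3 := hN2 _ ((le_max_right _ _).trans ((le_max_right _ _).trans hn))
  obtain ⟨H', h1, h2, h3, h4⟩ := cleaning hr H hF
  have h4R : (H.edges.card : ℝ) ≤ H'.edges.card + CM r * (H.verts.card : ℝ) ^ (r - 1) := by exact_mod_cast h4
  have h5 := mul_le_mul_of_nonneg_left h4R hf.le
  rw [mul_add] at h5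
  obtain ⟨V1, a, b⟩ := hK H' h3 (by rw [h1]; exact n1) (by rw [h1]; linarith)
  rw [h1] at a b
  refine ⟨V1, a, ?_⟩
  have h6 : (H.edges \ H'.edges).card ≤ CM r * H.verts.card ^ (r - 1) := by
    rw [Finset.card_sdiff_of_subset h2]; omega
  have h7 : ((bad H V1).card : ℝ) ≤ (bad H' V1).card + CM r * (H.verts.card : ℝ) ^ (r - 1) := by
    exact_mod_cast bad_le_deg V1 h6
  have h8 := mul_le_mul_of_nonneg_left h7 hf.le
  rw [mul_add] at h8
  linarith

theorem Fenv {r : ℕ} (hr : 4 ≤ r) (κ : ℝ) (hκ : 0 < κ) : ∃ ε : ℝ, 0 < ε ∧ ∃ N : ℕ, ∀ H : HGraph r,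
    ¬ (FF r).IsCopyIn H →
    N ≤ H.verts.card → (pir r - ε) * (H.verts.card : ℝ) ^ r ≤ r.factorial * H.edges.card →
    ∃ V1, Opt H V1 ∧ Env H V1 κ := by
  obtain ⟨ε1, h1, N1, -, he⟩ := env_of hr κ hκ
  obtain ⟨ε2, h2, N2, hs⟩ := Fstab hr ε1 h1
  refine ⟨min ε1 ε2, lt_min h1 h2, max N1 N2, ?_⟩
  intro H hF hn hbig
  have hnp : 0 ≤ (H.verts.card : ℝ) ^ r := by positivity
  have b1 := le_trans (mul_le_mul_of_nonneg_right (show pir r - ε1 ≤ pir r - min ε1 ε2 by linarith [min_le_left ε1 ε2]) hnp) hbig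
  have b2 := le_trans (mul_le_mul_of_nonneg_right (show pir r - ε2 ≤ pir r - min ε1 ε2 by linarith [min_le_right ε1 ε2]) hnp) hbig
  obtain ⟨W, hW, hWb⟩ := hs H hF ((le_max_right _ _).trans hn) b2
  obtain ⟨V1, hO⟩ := exists_opt H
  refine ⟨V1, hO, he H V1 hO.1 ((le_max_left _ _).trans hn) ?_ b1⟩
  have : ((bad H V1).card : ℝ) ≤ (bad H W).card := by exact_mod_cast hO.2 W hW
  exact (mul_le_mul_of_nonneg_left this (by positivity)).trans hWb

theorem Dstab {r : ℕ} (hr : 4 ≤ r) : ∃ η : ℝ, 0 < η ∧ ∃ N : ℕ, ∀ H : HGraph r, ¬ (FF r).IsCopyIn H →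
    N ≤ H.verts.card → (∀ v ∈ H.verts, full H η v) → Semibipartite r H := by
  obtain ⟨η, hη, κ, hκ, hM⟩ := MLL hr
  obtain ⟨ε, hε, N, hE⟩ := Fenv hr κ hκ
  refine ⟨min η ε, lt_min hη hε, N, ?_⟩
  intro H hF hn hfull
  have hnp : 0 ≤ (H.verts.card : ℝ) ^ (r - 1) := by positivity
  have hbig : (pir r - ε) * (H.verts.card : ℝ) ^ r ≤ r.factorial * H.edges.card := by
    have h1 : ∑ v ∈ H.verts, (pir r - ε) * (H.verts.card : ℝ) ^ (r - 1) ≤ ∑ v ∈ H.verts, ((r - 1).factorial : ℝ) * H.deg v := by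
      apply Finset.sum_le_sum
      intro v hv
      have := hfull v hv
      unfold full at this
      exact le_trans (mul_le_mul_of_nonneg_right (by linarith [min_le_right η ε]) hnp) this
    rw [Finset.sum_const, ← Finset.mul_sum, nsmul_eq_mul] at h1
    have h2 : ∑ v ∈ H.verts, (H.deg v : ℝ) = r * H.edges.card := by exact_mod_cast sum_deg H
    rw [h2] at h1
    have e3 : (H.verts.card : ℝ) ^ r = H.verts.card * (H.verts.card : ℝ) ^ (r - 1) := by
      rw [← pow_succ']; congr 1; omega
    rw [fact_r hr, e3]
    linarith
  obtain ⟨V1, hO, hEn⟩ := hE H hF hn hbig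
  refine ⟨V1, hO.1, ?_⟩
  intro e he
  by_contra hc
  obtain ⟨v, hv, hnf⟩ := hM H V1 hEn hF hO e (mem_bad.mpr ⟨he, hc⟩)
  apply hnf
  have := hfull v (H.edges_sub e he hv)
  unfold full at this ⊢
  exact le_trans (mul_le_mul_of_nonneg_right (by linarith [min_le_left η ε]) hnp) this

theorem Bdeg {r : ℕ} (hr : 4 ≤ r) (δ : ℝ) (hδ : 0 < δ) : ∃ ε : ℝ, 0 < ε ∧ ∃ N : ℕ, ∀ H : HGraph r,
    ¬ (FF r).IsCopyIn H →
    N ≤ H.verts.card → (pir r - ε) * (H.verts.card : ℝ) ^ r ≤ r.factorial * H.edges.card →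
    ∀ v ∈ H.verts, ((r - 1).factorial : ℝ) * H.deg v ≤ (pir r + δ) * (H.verts.card : ℝ) ^ (r - 1) := by
  have hq : (0:ℝ) < (r - 1).factorial := by exact_mod_cast Nat.factorial_pos _
  obtain ⟨κ1, c0, -, -, hcore⟩ := core hr (δ / (4 * (r - 1).factorial)) (by positivity)
  obtain ⟨κ2, d0, hgd⟩ := gooddeg hr (δ / 2) (by positivity)
  obtain ⟨ε, hε, N, hE⟩ := Fenv hr (min κ1 κ2) (lt_min c0 d0)
  refine ⟨ε, hε, N, ?_⟩
  intro H hF hn hbig v hv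
  obtain ⟨V1, hO, hEn⟩ := hE H hF hn hbig
  have hm0 := (lt_min c0 d0).le
  have hE1 := hEn.mono hr hm0 (min_le_left _ _)
  have hE2 := hEn.mono hr hm0 (min_le_right _ _)
  obtain ⟨hc2, hc01⟩ := hcore H V1 hE1 hF v hv
  have h3 : (H.deg v : ℝ) ≤ (aj H V1 v 0).card + (aj H V1 v 1).card + (a2 H V1 v).card := by
    exact_mod_cast deg_le3 H V1 v
  have hg : ∀ j, j ≤ 1 → ((r - 1).factorial : ℝ) * (aj H V1 v j).card ≤ (pir r + δ / 2) * (H.verts.card : ℝ) ^ (r - 1) := by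
    intro j hj
    refine hgd H V1 hE2 v j hj _ ?_
    intro f hf
    obtain ⟨a, b, c⟩ := mem_aj.mp hf
    exact ⟨H.edges_sub _ a, H.edges_card _ a, b, c⟩
  have g0 := hg 0 (by omega)
  have g1 := hg 1 le_rfl
  have h4 := mul_le_mul_of_nonneg_left h3 hq.le
  rw [mul_add, mul_add] at h4
  have e1 : ((r - 1).factorial : ℝ) * (δ / (4 * (r - 1).factorial) * (H.verts.card : ℝ) ^ (r - 1)) = δ / 4 * (H.verts.card : ℝ) ^ (r - 1) := by
    field_simp
  have s2 := mul_le_mul_of_nonneg_left hc2 hq.le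
  rw [e1] at s2
  rcases hc01 with h | h
  · have s3 := mul_le_mul_of_nonneg_left h hq.le
    rw [e1] at s3
    linarith
  · have s3 := mul_le_mul_of_nonneg_left h hq.le
    rw [e1] at s3
    linarith

def Smax (r n : ℕ) : ℕ := (Finset.range (n + 1)).sup fun x => x * (n - x).choose (r - 1)

theorem le_Smax {r n x : ℕ} (hx : x ≤ n) : x * (n - x).choose (r - 1) ≤ Smax r n :=
  Finset.le_sup (f := fun x => x * (n - x).choose (r - 1)) (Finset.mem_range.mpr (by omega))

theorem Smax_att (r n : ℕ) : ∃ x ≤ n, Smax r n = x * (n - x).choose (r - 1) := by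
  obtain ⟨x, hx, h⟩ := Finset.exists_mem_eq_sup (Finset.range (n + 1)) ⟨0, by simp⟩
    (fun x => x * (n - x).choose (r - 1))
  exact ⟨x, by have := Finset.mem_range.mp hx; omega, h⟩

theorem sb_le {r : ℕ} (hr : 4 ≤ r) {H : HGraph r} (h : Semibipartite r H) :
    H.edges.card ≤ Smax r H.verts.card := by
  obtain ⟨V1, hV, hE⟩ := h
  have := famG (k := r - 1) (V := H.verts) (V1 := V1) H.edges (fun e he =>
    ⟨H.edges_sub e he, by rw [H.edges_card e he]; omega, hE e he⟩)
  rw [Finset.card_sdiff_of_subset hV] at this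
  exact this.trans (le_Smax (Finset.card_le_card hV))

theorem sb_ex {r : ℕ} (hr : 4 ≤ r) (V : Finset ℕ) : ∃ H : HGraph r, H.verts = V ∧ Semibipartite r H ∧
    H.edges.card = Smax r V.card := by
  obtain ⟨x, hx, hS⟩ := Smax_att r V.card
  obtain ⟨V1, hV, hc⟩ := Finset.exists_subset_card_eq hx
  obtain ⟨S, hS1, hS2⟩ := prodcount V1 (V \ V1) ∅ V1 (r - 1) (Finset.Subset.refl _) (Finset.disjoint_empty_left _)
    Finset.sdiff_disjoint
  rw [Finset.sdiff_empty, Finset.card_sdiff_of_subset hV, hc, ← hS] at hS1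
  refine ⟨⟨V, S, ?_, ?_⟩, rfl, ⟨V1, hV, ?_⟩, hS1⟩
  · intro e he
    obtain ⟨a, ha, D, hD, -, h1, h2, h3⟩ := hS2 e he
    rw [h1, Finset.empty_union]
    exact Finset.insert_subset (hV ha) (hD.trans Finset.sdiff_subset)
  · intro e he
    obtain ⟨a, ha, D, hD, -, h1, h2, h3⟩ := hS2 e he
    rw [h2, Finset.card_empty]; omega
  · intro e he
    obtain ⟨a, ha, D, hD, -, h1, h2, h3⟩ := hS2 e he
    exact h3

theorem Smax_step {r : ℕ} (hr : 4 ≤ r) (n : ℕ) : r * Smax r n + n * Smax r n ≤ n * Smax r (n + 1) := by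
  obtain ⟨x, hx, hS⟩ := Smax_att r n
  obtain ⟨m, rfl⟩ : ∃ m, n = x + m := ⟨n - x, by omega⟩
  obtain ⟨k, rfl⟩ : ∃ k, r = k + 2 := ⟨r - 2, by omega⟩
  have e1 : x + m - x = m := by omega
  have h1 := le_Smax (r := k + 2) (n := x + m + 1) (x := x) (by omega)
  have h2 := le_Smax (r := k + 2) (n := x + m + 1) (x := x + 1) (by omega)
  have e2 : x + m + 1 - x = m + 1 := by omega
  have e3 : x + m + 1 - (x + 1) = m := by omega
  have e4 : k + 2 - 1 = k + 1 := rfl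
  rw [e2, e4, Nat.choose_succ_succ] at h1
  rw [e3, e4] at h2
  rw [e1, e4] at hS
  have h3 := Nat.choose_succ_right_eq m k
  have h4 : m.choose k * (m - k) ≤ m.choose k * m := Nat.mul_le_mul_left _ (by omega)
  have h5 : m.choose (k + 1) * (k + 1) ≤ m.choose k * m := by omega
  generalize Smax (k + 2) (x + m + 1) = T at *
  rw [hS]
  generalize m.choose k = c at *
  generalize m.choose (k + 1) = d at *
  have h1' := Nat.mul_le_mul_left m h1
  have h2' := Nat.mul_le_mul_left x h2
  have h5' := Nat.mul_le_mul_left x h5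
  nlinarith

theorem Smax_upper {r : ℕ} (hr : 4 ≤ r) (n : ℕ) : (r.factorial : ℝ) * Smax r n ≤ pir r * (n:ℝ) ^ r := by
  obtain ⟨x, hx, hS⟩ := Smax_att r n
  have hp := pir_pos (r := r) (by omega)
  rcases Nat.eq_zero_or_pos n with rfl | hn
  · have : x = 0 := by omega
    rw [hS, this]; simp; positivity
  · rw [hS]
    have := goodS_le hr ∅ hn hx
    refine this.trans (mul_le_mul_of_nonneg_right (gr_le (by omega) _ ?_) (by positivity))
    rw [div_le_one (by exact_mod_cast hn)]; exact_mod_cast hx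

theorem Smax_lower {r : ℕ} (hr : 4 ≤ r) (ε : ℝ) (hε : 0 < ε) : ∃ N : ℕ, ∀ n : ℕ, N ≤ n →
    (pir r - ε) * (n:ℝ) ^ r ≤ r.factorial * Smax r n := by
  have hr0 : (4:ℝ) ≤ r := by exact_mod_cast hr
  let g : ℝ → ℝ := fun s => (1 - r * s) * ((1 - 1 / r) - r * s) ^ (r - 1)
  have hg : Continuous g := by fun_prop
  have hg0 : g 0 = pir r := by simp [g, pir]
  have hev : ∀ᶠ n : ℕ in atTop, pir r - ε < g ((n:ℝ)⁻¹) := by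
    have : Tendsto (fun n : ℕ => g ((n:ℝ)⁻¹)) atTop (nhds (pir r)) := by
      rw [← hg0]
      exact (hg.tendsto 0).comp tendsto_inv_atTop_nhds_zero_nat
    exact this.eventually (lt_mem_nhds (by linarith))
  obtain ⟨N, hN⟩ := eventually_atTop.mp hev
  refine ⟨max N (2 * r), fun n hn => ?_⟩
  have h1 := hN n ((le_max_left _ _).trans hn)
  have h2 : 2 * r ≤ n := (le_max_right _ _).trans hn
  have hn0 : (0:ℝ) < n := by exact_mod_cast (by omega : 0 < n)
  have e3 : (n : ℝ) ^ r = n * (n : ℝ) ^ (r - 1) := by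
    rw [← pow_succ']; congr 1; omega
  have hgn : g ((n:ℝ)⁻¹) * (n:ℝ) ^ r = (n - r) * (n * (1 - 1 / r) - r) ^ (r - 1) := by
    have a : (n:ℝ) - r = (1 - r * (n:ℝ)⁻¹) * n := by field_simp
    have b : (n * (1 - 1 / r) - r : ℝ) = ((1 - 1 / r) - r * (n:ℝ)⁻¹) * n := by
      field_simp
    rw [a, b, mul_pow, e3]; ring
  refine le_trans (mul_le_mul_of_nonneg_right h1.le (by positivity)) ?_
  rw [hgn]
  have hx : n / r ≤ n := Nat.div_le_self _ _
  have hS := le_Smax (r := r) hx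
  have hSR : ((n / r : ℕ) : ℝ) * ((n - n / r).choose (r - 1) : ℕ) ≤ Smax r n := by exact_mod_cast hS
  have hx1 : ((n / r : ℕ) : ℝ) ≤ n / r := Nat.cast_div_le
  have hx2 : (n:ℝ) - r ≤ r * (n / r : ℕ) := by
    have a := Nat.div_add_mod n r
    have b := Nat.mod_lt n (show r > 0 by omega)
    have : n ≤ r * (n / r) + r := by omega
    have : (n:ℝ) ≤ r * (n / r : ℕ) + r := by exact_mod_cast this
    linarith
  have hdf := Nat.pow_sub_le_descFactorial (n - n / r) (r - 1)
  rw [Nat.descFactorial_eq_factorial_mul_choose] at hdf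
  have hdfR : (((n - n / r + 1 - (r - 1) : ℕ) : ℝ)) ^ (r - 1) ≤ (r - 1).factorial * ((n - n / r).choose (r - 1) : ℕ) := by
    exact_mod_cast hdf
  have hq : (n * (1 - 1 / r) - r : ℝ) ≤ ((n - n / r + 1 - (r - 1) : ℕ) : ℝ) := by
    have : n ≤ (n - n / r + 1 - (r - 1)) + n / r + r := by omega
    have : (n:ℝ) ≤ ((n - n / r + 1 - (r - 1) : ℕ) : ℝ) + (n / r : ℕ) + r := by exact_mod_cast this
    have e : (n * (1 - 1 / r) - r : ℝ) = n - n / r - r := by ring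
    rw [e]; linarith
  have hq0 : 0 ≤ (n * (1 - 1 / r) - r : ℝ) := by
    have h2R : 2 * (r:ℝ) ≤ n := by exact_mod_cast h2
    have : (1:ℝ) / r ≤ 1 / 4 := one_div_le_one_div_of_le (by norm_num) hr0
    nlinarith
  have hnr : (0:ℝ) ≤ n - r := by
    have h2R : 2 * (r:ℝ) ≤ n := by exact_mod_cast h2
    linarith
  calc (n - r : ℝ) * (n * (1 - 1 / r) - r) ^ (r - 1)
      ≤ (r * (n / r : ℕ)) * ((r - 1).factorial * ((n - n / r).choose (r - 1) : ℕ)) := by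
        apply mul_le_mul hx2 ((pow_le_pow_left₀ hq0 hq _).trans hdfR) (by positivity) (by positivity)
    _ = r.factorial * (((n / r : ℕ) : ℝ) * ((n - n / r).choose (r - 1) : ℕ)) := by rw [fact_r hr]; ring
    _ ≤ _ := mul_le_mul_of_nonneg_left hSR (by positivity)

theorem pow_shift (k : ℕ) (ε : ℝ) (hε : 0 < ε) : ∃ N : ℕ, ∀ m : ℕ, N ≤ m → ((m:ℝ) + 1) ^ k ≤ (1 + ε) * (m:ℝ) ^ k := by
  let g : ℝ → ℝ := fun s => (1 + s) ^ k
  have hg : Continuous g := by fun_prop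
  have hg0 : g 0 = 1 := by simp [g]
  have hev : ∀ᶠ n : ℕ in atTop, g ((n:ℝ)⁻¹) < 1 + ε := by
    have : Tendsto (fun n : ℕ => g ((n:ℝ)⁻¹)) atTop (nhds 1) := by
      rw [← hg0]
      exact (hg.tendsto 0).comp tendsto_inv_atTop_nhds_zero_nat
    exact this.eventually (gt_mem_nhds (by linarith))
  obtain ⟨N, hN⟩ := eventually_atTop.mp hev
  refine ⟨max N 1, fun n hn => ?_⟩
  have h1 := hN n ((le_max_left _ _).trans hn)
  have h2 : 1 ≤ n := (le_max_right _ _).trans hn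
  have hn0 : (0:ℝ) < n := by exact_mod_cast (by omega : 0 < n)
  have : (n:ℝ) + 1 = (1 + (n:ℝ)⁻¹) * n := by field_simp
  rw [this, mul_pow]
  exact mul_le_mul_of_nonneg_right h1.le (by positivity)

theorem Smax_mono {r : ℕ} (hr : 4 ≤ r) (n : ℕ) : Smax r n ≤ Smax r (n + 1) := by
  rcases Nat.eq_zero_or_pos n with rfl | hn
  · have : Smax r 0 = 0 := by
      obtain ⟨x, hx, h⟩ := Smax_att r 0
      have : x = 0 := by omega
      rw [h, this]; simp
    omega
  · have := Smax_step hr n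
    exact Nat.le_of_mul_le_mul_left (le_trans (Nat.le_add_left _ _) this) hn

/-- increments of `Smax` -/
theorem Sinc {r : ℕ} (hr : 4 ≤ r) (ε : ℝ) (hε : 0 < ε) : ∃ N : ℕ, ∀ m : ℕ, N ≤ m →
    (pir r - ε) * (m:ℝ) ^ (r - 1) ≤ (r - 1).factorial * ((Smax r (m + 1) : ℝ) - Smax r m) := by
  obtain ⟨N, hN⟩ := Smax_lower hr ε hε
  refine ⟨max N 1, fun m hm => ?_⟩
  have h1 := hN m ((le_max_left _ _).trans hm)
  have h2 : 1 ≤ m := (le_max_right _ _).trans hm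
  have hm0 : (0:ℝ) < m := by exact_mod_cast (by omega : 0 < m)
  have h3 : (r:ℝ) * Smax r m + m * Smax r m ≤ m * Smax r (m + 1) := by exact_mod_cast Smax_step hr m
  have e3 : (m : ℝ) ^ r = m * (m : ℝ) ^ (r - 1) := by
    rw [← pow_succ']; congr 1; omega
  have h4 : ((r - 1).factorial : ℝ) * (r * Smax r m) ≤ (r - 1).factorial * (m * ((Smax r (m + 1) : ℝ) - Smax r m)) :=
    mul_le_mul_of_nonneg_left (by linarith) (by positivity)
  rw [fact_r hr, e3] at h1
  have : (m:ℝ) * ((pir r - ε) * (m:ℝ) ^ (r - 1)) ≤ m * ((r - 1).factorial * ((Smax r (m + 1) : ℝ) - Smax r m)) := by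
    linarith
  exact le_of_mul_le_mul_left this hm0

theorem Sgap {r : ℕ} (hr : 4 ≤ r) (η : ℝ) (hη : 0 < η) : ∃ N : ℕ, ∀ m : ℕ, N ≤ m →
    (pir r - η) * ((m:ℝ) + 1) ^ (r - 1) + (r - 1).factorial ≤ (r - 1).factorial * ((Smax r (m + 1) : ℝ) - Smax r m) := by
  have hp := pir_pos (r := r) (by omega)
  have hp1 := pir_le_one hr
  obtain ⟨N1, h1⟩ := Sinc hr (η / 3) (by positivity)
  obtain ⟨N2, h2⟩ := pow_shift (r - 1) (η / 3) (by positivity)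
  obtain ⟨N3, h3⟩ := exists_nat_ge (((r - 1).factorial : ℝ) / (η / 3))
  refine ⟨max (max N1 1) (max N2 N3), fun m hm => ?_⟩
  have a1 := h1 m ((le_max_left _ _).trans ((le_max_left _ _).trans hm))
  have a2 := h2 m ((le_max_left _ _).trans ((le_max_right _ _).trans hm))
  have a4 : 1 ≤ m := (le_max_right _ _).trans ((le_max_left _ _).trans hm)
  have a3 : N3 ≤ m := ((le_max_right _ _).trans ((le_max_right _ _).trans hm))
  have hm1 : (1:ℝ) ≤ m := by exact_mod_cast a4
  have a5 : ((r - 1).factorial : ℝ) ≤ η / 3 * (m:ℝ) ^ (r - 1) := by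
    rw [div_le_iff₀ (by positivity)] at h3
    have b : (N3:ℝ) ≤ m := by exact_mod_cast a3
    have c : (m:ℝ) ≤ (m:ℝ) ^ (r - 1) := le_self_pow₀ hm1 (by omega)
    calc ((r - 1).factorial : ℝ) ≤ N3 * (η / 3) := h3
      _ ≤ (m:ℝ) ^ (r - 1) * (η / 3) := mul_le_mul_of_nonneg_right (b.trans c) (by positivity)
      _ = _ := mul_comm _ _
  set M := (m:ℝ) ^ (r - 1) with hM
  have hM0 : 0 < M := by positivity
  have a6 : (pir r - η) * ((m:ℝ) + 1) ^ (r - 1) ≤ (pir r - η) * M + η / 3 * M := by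
    rcases le_or_gt 0 (pir r - η) with h | h
    · have := mul_le_mul_of_nonneg_left a2 h
      have : (pir r - η) * (η / 3 * M) ≤ η / 3 * M := mul_le_of_le_one_left (by positivity) (by linarith)
      linarith
    · have : M ≤ ((m:ℝ) + 1) ^ (r - 1) := pow_le_pow_left₀ (by positivity) (by linarith) _
      have : (pir r - η) * ((m:ℝ) + 1) ^ (r - 1) ≤ (pir r - η) * M := mul_le_mul_of_nonpos_left this h.le
      have : 0 ≤ η / 3 * M := by positivity
      linarith
  linarith

/-- exact Turán theorem -/
theorem ETuran {r : ℕ} (hr : 4 ≤ r) : ∃ N : ℕ, ∀ H : HGraph r, ¬ (FF r).IsCopyIn H → N ≤ H.verts.card →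
    H.edges.card ≤ Smax r H.verts.card ∧ (H.edges.card = Smax r H.verts.card → Semibipartite r H) := by
  obtain ⟨η, hη, ND, hD⟩ := Dstab hr
  obtain ⟨NG, hG⟩ := Sgap hr η hη
  have hq : (0:ℝ) < (r - 1).factorial := by exact_mod_cast Nat.factorial_pos _
  obtain ⟨N1, hN1⟩ : ∃ N1, N1 = max ND NG := ⟨_, rfl⟩
  have key : ∀ m, N1 ≤ m → ∀ H : HGraph r, ¬ (FF r).IsCopyIn H → H.verts.card = m + 1 →
      Semibipartite r H ∨ ∃ G : HGraph r, ¬ (FF r).IsCopyIn G ∧ G.verts.card = m ∧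
        H.edges.card + 1 + Smax r m ≤ G.edges.card + Smax r (m + 1) := by
    intro m hm H hF hc
    by_cases hfull : ∀ v ∈ H.verts, full H η v
    · left
      exact hD H hF (by rw [hc]; have := le_max_left ND NG; omega) hfull
    · right
      push Not at hfull
      obtain ⟨v, hv, hnf⟩ := hfull
      refine ⟨H.induce (H.verts \ {v}), fun h => hF (copy_mono (induce_verts_sub _ _) (induce_edges_sub _ _) h), ?_, ?_⟩
      · rw [induce_verts, Finset.inter_eq_right.mpr Finset.sdiff_subset,
          Finset.card_sdiff_of_subset (Finset.singleton_subset_iff.mpr hv), hc]; simp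
      · have h1 := edges_remove H {v}
        rw [Finset.sum_singleton] at h1
        have h2 := hG m (by have := le_max_right ND NG; omega)
        unfold full at hnf
        rw [hc] at hnf
        push_cast at hnf
        push Not at hnf
        have h3 : ((r - 1).factorial : ℝ) * (H.deg v + 1) < (r - 1).factorial * ((Smax r (m + 1) : ℝ) - Smax r m) := by
          rw [mul_add, mul_one]; linarith
        have h4 := lt_of_mul_lt_mul_left h3 hq.le
        have h5 : (H.deg v : ℝ) + 1 + Smax r m < Smax r (m + 1) := by linarith
        have h6 : H.deg v + 1 + Smax r m < Smax r (m + 1) := by exact_mod_cast h5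
        omega
  have ind : ∀ j, ∀ H : HGraph r, ¬ (FF r).IsCopyIn H → H.verts.card = N1 + j →
      H.edges.card ≤ Smax r (N1 + j) + (N1.choose r - j) := by
    intro j
    induction j with
    | zero =>
      intro H hF hc
      have := edges_le H
      rw [hc] at this
      simp only [Nat.add_zero] at *
      omega
    | succ j ih =>
      intro H hF hc
      rcases key (N1 + j) (by omega) H hF (by omega) with h | ⟨G, hGF, hGc, hle⟩
      · have := sb_le hr h
        rw [hc] at this
        omega
      · have := ih G hGF hGc
        have e : N1 + (j + 1) = N1 + j + 1 := by omega
        rw [e]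
        omega
  refine ⟨N1 + N1.choose r + 1, fun H hF hn => ?_⟩
  obtain ⟨j, hj⟩ : ∃ j, H.verts.card = N1 + (j + 1) := ⟨H.verts.card - N1 - 1, by omega⟩
  have hjc : N1.choose r ≤ j := by omega
  have h1 := ind (j + 1) H hF hj
  rw [hj]
  refine ⟨by omega, fun heq => ?_⟩
  rcases key (N1 + j) (by omega) H hF (by omega) with h | ⟨G, hGF, hGc, hle⟩
  · exact h
  · have := ind j G hGF hGc
    have e : N1 + (j + 1) = N1 + j + 1 := by omega
    rw [e] at heq
    omega

theorem induce_mono {r : ℕ} {H K : HGraph r} (hV : H.verts ⊆ K.verts) (hE : H.edges ⊆ K.edges) {S T : Finset ℕ}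
    (hST : S ⊆ T) : (H.induce S).verts ⊆ (K.induce T).verts ∧ (H.induce S).edges ⊆ (K.induce T).edges := by
  constructor
  · rw [induce_verts, induce_verts]
    exact Finset.inter_subset_inter hV hST
  · intro e he
    rw [mem_induce] at he ⊢
    exact ⟨hE he.1, he.2.trans hST⟩

theorem induce_copy {r : ℕ} {F H K : HGraph r} (hV : H.verts ⊆ K.verts) (hE : H.edges ⊆ K.edges) {S T : Finset ℕ}
    (hST : S ⊆ T) (h : F.IsCopyIn (H.induce S)) : F.IsCopyIn (K.induce T) :=
  copy_mono (induce_mono hV hE hST).1 (induce_mono hV hE hST).2 h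

theorem copy_set {r : ℕ} {F H : HGraph r} (h : F.IsCopyIn H) :
    ∃ S ⊆ H.verts, S.card = F.verts.card ∧ F.IsCopyIn (H.induce S) := by
  obtain ⟨f, h1, h2, h3⟩ := h
  have hs : F.verts.image f ⊆ H.verts := by
    intro x hx
    obtain ⟨v, hv, rfl⟩ := Finset.mem_image.mp hx
    exact h2 v hv
  refine ⟨F.verts.image f, hs, Finset.card_image_of_injOn h1, f, h1, ?_, ?_⟩
  · intro v hv
    rw [induce_verts]
    exact Finset.mem_inter.mpr ⟨h2 v hv, Finset.mem_image_of_mem _ hv⟩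
  · intro e he
    rw [mem_induce]
    exact ⟨h3 e he, Finset.image_subset_image (F.edges_sub e he)⟩

theorem matching_zero {r : ℕ} (F H : HGraph r) : F.HasMatching H 0 :=
  ⟨fun _ => ∅, fun i => i.elim0, fun i => i.elim0, fun i => i.elim0⟩

theorem matching_add {r : ℕ} {F H : HGraph r} {A B : Finset ℕ} (hAB : Disjoint A B) {a b : ℕ}
    (hA : F.HasMatching (H.induce A) a) (hB : F.HasMatching (H.induce B) b) : F.HasMatching H (a + b) := by
  obtain ⟨S, s1, s2, s3⟩ := hA
  obtain ⟨T, t1, t2, t3⟩ := hB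
  have sA : ∀ i, S i ⊆ A := fun i => (s1 i).1.trans (by rw [induce_verts]; exact Finset.inter_subset_right)
  have tB : ∀ i, T i ⊆ B := fun i => (t1 i).1.trans (by rw [induce_verts]; exact Finset.inter_subset_right)
  refine ⟨Fin.addCases S T, ?_, ?_, ?_⟩
  · intro i
    refine Fin.addCases (fun i => ?_) (fun i => ?_) i
    · simp only [Fin.addCases_left]
      exact ⟨(s1 i).1.trans (induce_verts_sub _ _), (s1 i).2⟩
    · simp only [Fin.addCases_right]
      exact ⟨(t1 i).1.trans (induce_verts_sub _ _), (t1 i).2⟩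
  · intro i j
    refine Fin.addCases (fun i => ?_) (fun i => ?_) i <;> refine Fin.addCases (fun j => ?_) (fun j => ?_) j <;>
      simp only [Fin.addCases_left, Fin.addCases_right] <;> intro hij
    · exact s2 i j (fun h => hij (by rw [h]))
    · exact (hAB.mono_left (sA i)).mono_right (tB j)
    · exact ((hAB.mono_left (sA j)).mono_right (tB i)).symm
    · exact t2 i j (fun h => hij (by rw [h]))
  · intro i
    refine Fin.addCases (fun i => ?_) (fun i => ?_) i
    · simp only [Fin.addCases_left]
      exact induce_copy (induce_verts_sub _ _) (induce_edges_sub _ _) (Finset.Subset.refl _) (s3 i)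
    · simp only [Fin.addCases_right]
      exact induce_copy (induce_verts_sub _ _) (induce_edges_sub _ _) (Finset.Subset.refl _) (t3 i)

theorem matching_mono {r : ℕ} {F H K : HGraph r} (hV : H.verts ⊆ K.verts) (hE : H.edges ⊆ K.edges) {k : ℕ}
    (h : F.HasMatching H k) : F.HasMatching K k := by
  obtain ⟨S, s1, s2, s3⟩ := h
  exact ⟨S, fun i => ⟨(s1 i).1.trans hV, (s1 i).2⟩, s2, fun i => induce_copy hV hE (Finset.Subset.refl _) (s3 i)⟩

theorem matching_one {r : ℕ} {F H : HGraph r} (h : F.IsCopyIn H) : F.HasMatching H 1 := by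
  obtain ⟨S, h1, h2, h3⟩ := copy_set h
  exact ⟨fun _ => S, fun _ => ⟨h1, h2⟩, fun i j hij => absurd (Subsingleton.elim i j) hij, fun _ => h3⟩

theorem matching_union {r : ℕ} {F H : HGraph r} {k : ℕ} (h : F.HasMatching H k) :
    ∃ U ⊆ H.verts, U.card ≤ k * F.verts.card ∧ F.HasMatching (H.induce U) k := by
  obtain ⟨S, s1, s2, s3⟩ := h
  refine ⟨Finset.univ.biUnion S, ?_, ?_, S, ?_, s2, ?_⟩
  · exact Finset.biUnion_subset.mpr fun i _ => (s1 i).1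
  · have := Finset.card_biUnion_le_card_mul (Finset.univ : Finset (Fin k)) S F.verts.card (fun i _ => (s1 i).2.le)
    simpa using this
  · intro i
    refine ⟨?_, (s1 i).2⟩
    rw [induce_verts]
    exact Finset.subset_inter (s1 i).1 (Finset.subset_biUnion_of_mem S (Finset.mem_univ i))
  · intro i
    refine copy_mono ?_ ?_ (s3 i)
    · rw [induce_verts, induce_verts, induce_verts]
      exact Finset.subset_inter (Finset.inter_subset_inter (Finset.Subset.refl _) (Finset.subset_biUnion_of_mem S (Finset.mem_univ i))) Finset.inter_subset_right
    · intro e he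
      rw [mem_induce] at he
      rw [mem_induce, mem_induce]
      exact ⟨⟨he.1, he.2.trans (Finset.subset_biUnion_of_mem S (Finset.mem_univ i))⟩, he.2⟩

theorem matching_succ {r : ℕ} {F H : HGraph r} {S B : Finset ℕ} {k : ℕ} (hSB : Disjoint S B)
    (h : F.IsCopyIn (H.induce S)) (hB : F.HasMatching (H.induce B) k) : F.HasMatching H (k + 1) :=
  add_comm 1 k ▸ matching_add hSB (matching_one h) hB

theorem matching_cover {r : ℕ} {F : HGraph r} (s : ℕ) : ∀ {H : HGraph r}, ¬ F.HasMatching H (s + 1) →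
    ∃ W ⊆ H.verts, W.card ≤ s * F.verts.card ∧ ¬ F.IsCopyIn (H.induce (H.verts \ W)) := by
  induction s with
  | zero =>
    intro H h
    refine ⟨∅, by simp, by simp, fun hc => h (matching_one ?_)⟩
    exact copy_mono (induce_verts_sub _ _) (induce_edges_sub _ _) hc
  | succ s ih =>
    intro H h
    by_cases hF : F.IsCopyIn H
    · obtain ⟨S, h1, h2, h3⟩ := copy_set hF
      obtain ⟨W, w1, w2, w3⟩ := ih (H := H.induce (H.verts \ S)) (fun hm => h (matching_succ Finset.disjoint_sdiff h3 hm))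
      refine ⟨S ∪ W, Finset.union_subset h1 (w1.trans (induce_verts_sub _ _)), ?_, fun hc => w3 (copy_mono ?_ ?_ hc)⟩
      · have := Finset.card_union_le S W
        rw [add_mul, one_mul]; omega
      · rw [induce_verts, induce_verts, induce_verts]
        intro x hx
        simp only [Finset.mem_inter, Finset.mem_sdiff, Finset.mem_union] at hx ⊢
        tauto
      · intro e he
        rw [mem_induce] at he
        rw [mem_induce, mem_induce, induce_verts]
        refine ⟨⟨he.1, fun x hx => ?_⟩, fun x hx => ?_⟩ <;>
          · have := he.2 hx
            simp only [Finset.mem_inter, Finset.mem_sdiff, Finset.mem_union] at this ⊢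
            tauto
    · exact ⟨∅, by simp, by simp, fun hc => hF (copy_mono (induce_verts_sub _ _) (induce_edges_sub _ _) hc)⟩

theorem greedy {r : ℕ} {F H : HGraph r} {K : ℕ} (L : Finset ℕ) : L ⊆ H.verts →
    (∀ U ⊆ H.verts, U.card ≤ K → ∀ v ∈ L, v ∉ U → F.IsCopyIn (H.induce (H.verts \ U))) →
    ∀ U ⊆ H.verts, Disjoint U L → U.card + (F.verts.card + 1) * L.card ≤ K →
    F.HasMatching (H.induce (H.verts \ U)) L.card := by
  induction L using Finset.induction_on with
  | empty => intros; exact matching_zero _ _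
  | insert v L hv ih =>
    intro hL hp U hU hd hK
    rw [Finset.card_insert_of_notMem hv] at hK ⊢
    have hL' : L ⊆ H.verts := (Finset.subset_insert _ _).trans hL
    rw [Finset.disjoint_insert_right] at hd
    have hc : F.IsCopyIn (H.induce (H.verts \ (U ∪ L))) := by
      refine hp _ (Finset.union_subset hU hL') ?_ v (Finset.mem_insert_self _ _) ?_
      · have := Finset.card_union_le U L
        nlinarith
      · simp [hd.1, hv]
    obtain ⟨S, h1, h2, h3⟩ := copy_set hc
    rw [induce_verts] at h1
    have hS : S ⊆ H.verts \ (U ∪ L) := h1.trans Finset.inter_subset_right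
    have hSV : S ⊆ H.verts := hS.trans Finset.sdiff_subset
    have hm := ih hL' (fun U hU hK v hv => hp U hU hK v (Finset.mem_insert_of_mem hv)) (U ∪ S) (Finset.union_subset hU hSV) ?_ ?_
    · refine matching_succ (S := S) (B := H.verts \ (U ∪ S)) ?_ ?_ ?_
      · rw [Finset.disjoint_left]; intro x hx; simp [hx]
      · refine copy_mono ?_ ?_ h3
        · rw [induce_verts, induce_verts, induce_verts, induce_verts]
          intro x hx
          simp only [Finset.mem_inter, Finset.mem_sdiff, Finset.mem_union] at hx ⊢
          tauto
        · intro e he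
          rw [mem_induce, mem_induce] at he
          rw [mem_induce, mem_induce]
          refine ⟨⟨he.1.1, fun x hx => ?_⟩, he.2⟩
          have := he.1.2 hx
          simp only [Finset.mem_inter, Finset.mem_sdiff, Finset.mem_union] at this ⊢
          tauto
      · refine matching_mono ?_ ?_ hm
        · rw [induce_verts, induce_verts, induce_verts]
          intro x hx
          simp only [Finset.mem_inter, Finset.mem_sdiff, Finset.mem_union] at hx ⊢
          tauto
        · intro e he
          rw [mem_induce] at he
          rw [mem_induce, mem_induce]
          refine ⟨⟨he.1, fun x hx => ?_⟩, he.2⟩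
          have := he.2 hx
          simp only [Finset.mem_inter, Finset.mem_sdiff, Finset.mem_union] at this ⊢
          tauto
    · rw [Finset.disjoint_union_left]
      refine ⟨hd.2, ?_⟩
      rw [Finset.disjoint_left]; intro x hx hxL
      have := hS hx
      simp [hxL] at this
    · have := Finset.card_union_le U S
      rw [h2] at this
      nlinarith

/-- edges lost by a vertex -/
theorem deg_remove {r : ℕ} (hr : 4 ≤ r) (H : HGraph r) (U : Finset ℕ) (v : ℕ) (hv : v ∉ U) :
    H.deg v ≤ (H.induce (H.verts \ U)).deg v + U.card * H.verts.card ^ (r - 2) := by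
  unfold HGraph.deg
  have h : (H.edges.filter fun e => v ∈ e) ⊆ ((H.induce (H.verts \ U)).edges.filter fun e => v ∈ e) ∪
      U.biUnion (fun u => H.edges.filter fun e => ({u, v} : Finset ℕ) ⊆ e) := by
    intro e he
    rw [Finset.mem_filter] at he
    rw [Finset.mem_union]
    by_cases hd : Disjoint e U
    · left
      rw [Finset.mem_filter, mem_induce]
      refine ⟨⟨he.1, fun x hx => Finset.mem_sdiff.mpr ⟨H.edges_sub e he.1 hx, Finset.disjoint_left.mp hd hx⟩⟩, he.2⟩
    · right
      obtain ⟨u, hu, huU⟩ := Finset.not_disjoint_iff.mp hd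
      refine Finset.mem_biUnion.mpr ⟨u, huU, Finset.mem_filter.mpr ⟨he.1, ?_⟩⟩
      intro x hx
      rcases Finset.mem_insert.mp hx with rfl | hx
      · exact hu
      · rw [Finset.mem_singleton.mp hx]; exact he.2
  refine (Finset.card_le_card h).trans ((Finset.card_union_le _ _).trans (Nat.add_le_add_left ?_ _))
  refine Finset.card_biUnion_le_card_mul _ _ _ fun u hu => ?_
  have huv : u ≠ v := fun h => hv (h ▸ hu)
  have := cnt H.verts {u, v} r (H.edges.filter fun e => ({u, v} : Finset ℕ) ⊆ e) (fun e he => by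
    rw [Finset.mem_filter] at he
    exact ⟨H.edges_sub _ he.1, H.edges_card _ he.1, he.2⟩)
  rw [Finset.card_pair huv] at this
  exact this.trans (choose_le_pow' _ _)

theorem pir_lt_one {r : ℕ} (hr : 4 ≤ r) : pir r < 1 := by
  unfold pir
  have hr0 : (4:ℝ) ≤ r := by exact_mod_cast hr
  apply pow_lt_one₀
  · rw [sub_nonneg, div_le_one (by positivity)]; linarith
  · have : 0 < 1 / (r:ℝ) := by positivity
    linarith
  · omega

theorem one_sub_pow (y : ℝ) (h1 : y ≤ 1) (k : ℕ) : 1 - k * y ≤ (1 - y) ^ k := by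
  have := one_add_mul_le_pow (a := -y) (by linarith) k
  have e : 1 + -y = 1 - y := by ring
  rw [e] at this
  linarith

theorem greedy_prop {r : ℕ} (hr : 4 ≤ r) (δ : ℝ) (hδ : 0 < δ) : ∃ κ : ℝ, 0 < κ ∧ ∃ N : ℕ, ∀ H : HGraph r,
    N ≤ H.verts.card → ∀ t : ℕ, (t:ℝ) ≤ κ * H.verts.card → Smax r (H.verts.card - t) ≤ H.edges.card →
    ∀ U ⊆ H.verts, (U.card : ℝ) ≤ κ * H.verts.card → ∀ v ∈ H.verts, v ∉ U →
    (pir r + 2 * δ) * (H.verts.card : ℝ) ^ (r - 1) ≤ (r - 1).factorial * H.deg v →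
    (FF r).IsCopyIn (H.induce (H.verts \ U)) := by
  have hp := pir_pos (r := r) (by omega)
  have hp1 := pir_le_one hr
  obtain ⟨ε0, hε0, NB, hB⟩ := Bdeg hr δ hδ
  obtain ⟨ε, hε, hεε, hεp⟩ : ∃ ε : ℝ, 0 < ε ∧ ε ≤ ε0 ∧ ε ≤ pir r :=
    ⟨min ε0 (pir r), lt_min hε0 hp, min_le_left _ _, min_le_right _ _⟩
  obtain ⟨NS, hS⟩ := Smax_lower hr (ε / 4) (by positivity)
  have hq : (1:ℝ) ≤ (r - 1).factorial := by exact_mod_cast Nat.factorial_pos _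
  have hR : (1:ℝ) ≤ r.factorial := by exact_mod_cast Nat.factorial_pos _
  obtain ⟨κ, hκ, hκ1, hκ2, hκ3⟩ : ∃ κ : ℝ, 0 < κ ∧ κ ≤ 1 / 2 ∧ r.factorial * κ ≤ ε / 4 ∧ (r - 1).factorial * κ ≤ δ / 2 := by
    refine ⟨min (1 / 2) (min (ε / (4 * r.factorial)) (δ / (2 * (r - 1).factorial))), by positivity, min_le_left _ _, ?_, ?_⟩
    · calc (r.factorial : ℝ) * _ ≤ r.factorial * (ε / (4 * r.factorial)) :=
            mul_le_mul_of_nonneg_left ((min_le_right _ _).trans (min_le_left _ _)) (by positivity)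
        _ = ε / 4 := by field_simp
    · calc ((r - 1).factorial : ℝ) * _ ≤ (r - 1).factorial * (δ / (2 * (r - 1).factorial)) :=
            mul_le_mul_of_nonneg_left ((min_le_right _ _).trans (min_le_right _ _)) (by positivity)
        _ = δ / 2 := by field_simp
  refine ⟨κ, hκ, 2 * (NB + NS) + 1, ?_⟩
  intro H hn t ht he U hU hUc v hv hvU hd
  by_contra hF
  have hn0 : (0:ℝ) < H.verts.card := by exact_mod_cast (by omega : 0 < H.verts.card)
  have hhalf : κ * H.verts.card ≤ H.verts.card / 2 := by
    have := mul_le_mul_of_nonneg_right hκ1 hn0.le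
    linarith
  have hcard : (H.induce (H.verts \ U)).verts.card = H.verts.card - U.card := by
    rw [induce_verts, Finset.inter_eq_right.mpr Finset.sdiff_subset, Finset.card_sdiff_of_subset hU]
  have hUn : U.card ≤ H.verts.card := Finset.card_le_card hU
  have hU2 : 2 * U.card ≤ H.verts.card := by
    have : (2 * U.card : ℝ) ≤ H.verts.card := by linarith
    exact_mod_cast this
  have ht2 : 2 * t ≤ H.verts.card := by
    have : (2 * t : ℝ) ≤ H.verts.card := by linarith
    exact_mod_cast this
  have h1 := hS (H.verts.card - t) (by omega)
  have h2 := hB _ hF (by rw [hcard]; omega)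
  have h3 := edges_remove H U
  have hdl := deg_remove hr H U v hvU
  generalize hH' : H.induce (H.verts \ U) = H' at *
  have hsum : ((∑ v ∈ U, H.deg v : ℕ) : ℝ) ≤ U.card * (H.verts.card : ℝ) ^ (r - 1) := by
    push_cast
    rw [← nsmul_eq_mul]
    exact Finset.sum_le_card_nsmul _ _ _ fun v _ => deg_le_pow H v
  have h3' : (H.edges.card : ℝ) ≤ H'.edges.card + ((∑ v ∈ U, H.deg v : ℕ) : ℝ) := by exact_mod_cast h3
  have hdl' : (H.deg v : ℝ) ≤ H'.deg v + U.card * (H.verts.card : ℝ) ^ (r - 2) := by exact_mod_cast hdl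
  have hvs : v ∈ H'.verts := by
    rw [← hH', induce_verts]; simp [hv, hvU]
  have hnn : (H'.verts.card : ℝ) ≤ H.verts.card := by
    rw [hcard]; exact_mod_cast Nat.sub_le _ _
  have he' : (Smax r (H.verts.card - t) : ℝ) ≤ H.edges.card := by exact_mod_cast he
  rw [Nat.cast_sub (by omega)] at h1
  have e3 : (H.verts.card : ℝ) ^ r = H.verts.card * (H.verts.card : ℝ) ^ (r - 1) := by
    rw [← pow_succ']; congr 1; omega
  have e4 : (H.verts.card : ℝ) ^ (r - 1) = H.verts.card * (H.verts.card : ℝ) ^ (r - 2) := by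
    rw [← pow_succ']; congr 1; omega
  generalize (H.verts.card : ℝ) = n at *
  have hX : 0 < n ^ (r - 1) := by positivity
  have hY : 0 < n ^ r := by positivity
  have hZ : 0 < n ^ (r - 2) := by positivity
  have b1 : (U.card : ℝ) * n ^ (r - 1) ≤ κ * n ^ r := by
    have := mul_le_mul_of_nonneg_right hUc hX.le
    rw [e3]; linarith
  have b2 : (U.card : ℝ) * n ^ (r - 2) ≤ κ * n ^ (r - 1) := by
    have := mul_le_mul_of_nonneg_right hUc hZ.le
    rw [e4]; linarith
  have hrR : (r:ℝ) ≤ r.factorial := by exact_mod_cast Nat.self_le_factorial r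
  have hrκ : r * κ ≤ ε / 4 := (mul_le_mul_of_nonneg_right hrR hκ.le).trans hκ2
  have b3 : (1 - r * κ) * n ^ r ≤ (n - t) ^ r := by
    have a1 : (1 - κ) * n ≤ n - t := by linarith
    have a2 := pow_le_pow_left₀ (mul_nonneg (by linarith) hn0.le) a1 r
    rw [mul_pow] at a2
    have a3 := mul_le_mul_of_nonneg_right (one_sub_pow κ (by linarith) r) hY.le
    linarith
  have b4 : (pir r - ε / 2) * n ^ r ≤ (pir r - ε / 4) * (n - t) ^ r := by
    have a1 := mul_le_mul_of_nonneg_left b3 (by linarith : 0 ≤ pir r - ε / 4)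
    have a2 : (pir r - ε / 2) ≤ (pir r - ε / 4) * (1 - r * κ) := by
      have : 0 ≤ r * κ := by positivity
      have := mul_le_mul_of_nonneg_right (by linarith : pir r - ε / 4 ≤ 1) this
      linarith
    have a3 := mul_le_mul_of_nonneg_right a2 hY.le
    linarith
  have b5 : (r.factorial : ℝ) * (κ * n ^ r) ≤ ε / 4 * n ^ r := by
    have := mul_le_mul_of_nonneg_right hκ2 hY.le
    linarith
  have b6 : (r.factorial : ℝ) * Smax r (H.verts.card - t) ≤ r.factorial * (H'.edges.card + κ * n ^ r) :=
    mul_le_mul_of_nonneg_left (by linarith) (by positivity)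
  have b7 : (pir r - ε) * n ^ r ≤ r.factorial * H'.edges.card := by
    have : 0 < ε * n ^ r := by positivity
    linarith
  have c1 : (pir r - ε0) * (H'.verts.card : ℝ) ^ r ≤ r.factorial * H'.edges.card := by
    refine le_trans ?_ b7
    have a1 : (H'.verts.card : ℝ) ^ r ≤ n ^ r := pow_le_pow_left₀ (by positivity) hnn _
    have a2 := mul_le_mul_of_nonneg_left a1 (by linarith : 0 ≤ pir r - ε)
    have a3 := mul_le_mul_of_nonneg_right (by linarith : pir r - ε0 ≤ pir r - ε) (by positivity : 0 ≤ (H'.verts.card : ℝ) ^ r)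
    linarith
  have c2 := h2 c1 v hvs
  have a1 : (H'.verts.card : ℝ) ^ (r - 1) ≤ n ^ (r - 1) := pow_le_pow_left₀ (by positivity) hnn _
  have c3 := mul_le_mul_of_nonneg_left a1 (by linarith : 0 ≤ pir r + δ)
  have c4 : ((r - 1).factorial : ℝ) * H.deg v ≤ (r - 1).factorial * (H'.deg v + κ * n ^ (r - 1)) :=
    mul_le_mul_of_nonneg_left (by linarith) (by positivity)
  have c5 := mul_le_mul_of_nonneg_right hκ3 hX.le
  have : 0 < δ * n ^ (r - 1) := by positivity
  linarith

theorem Sinc_sum {r : ℕ} (hr : 4 ≤ r) (ε : ℝ) (hε : 0 < ε) (hεp : ε ≤ pir r) : ∃ N : ℕ, ∀ m : ℕ, N ≤ m → ∀ j : ℕ,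
    (r - 1).factorial * (Smax r m : ℝ) + j * ((pir r - ε) * (m:ℝ) ^ (r - 1)) ≤ (r - 1).factorial * (Smax r (m + j) : ℝ) := by
  obtain ⟨N, hN⟩ := Sinc hr ε hε
  refine ⟨N, fun m hm j => ?_⟩
  induction j with
  | zero => simp
  | succ j ih =>
    have h1 := hN (m + j) (by omega)
    have h2 : (m:ℝ) ^ (r - 1) ≤ ((m + j : ℕ) : ℝ) ^ (r - 1) := pow_le_pow_left₀ (by positivity) (by push_cast; linarith [Nat.cast_nonneg (α := ℝ) j]) _
    have h3 := mul_le_mul_of_nonneg_left h2 (by linarith : 0 ≤ pir r - ε)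
    have e : m + (j + 1) = m + j + 1 := by ring
    rw [e]
    push_cast
    linarith

theorem choose_gap (a k : ℕ) (s : ℕ) : s * a.choose k + a.choose (k + 1) ≤ (a + s).choose (k + 1) := by
  induction s with
  | zero => simp
  | succ s ih =>
    have h : (a + (s + 1)).choose (k + 1) = (a + s).choose k + (a + s).choose (k + 1) := Nat.choose_succ_succ _ _
    have h2 : a.choose k ≤ (a + s).choose k := Nat.choose_le_choose k (by omega)
    rw [h, add_mul, one_mul]; omega

theorem choose_low (a k : ℕ) (y : ℝ) (hy : 0 ≤ y) (h : y + k ≤ a) : y ^ k ≤ (k.factorial : ℝ) * a.choose k := by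
  have h1 : ((a + 1 - k : ℕ) ^ k : ℕ) ≤ a.descFactorial k := Nat.pow_sub_le_descFactorial a k
  have hk : k ≤ a := by
    have : (k:ℝ) ≤ a := by linarith
    exact_mod_cast this
  rw [Nat.descFactorial_eq_factorial_mul_choose] at h1
  have h2 : (((a + 1 - k : ℕ) : ℝ)) ^ k ≤ (k.factorial : ℝ) * a.choose k := by exact_mod_cast h1
  refine le_trans (pow_le_pow_left₀ hy ?_ _) h2
  rw [Nat.cast_sub (by omega)]; push_cast; linarith

theorem numeric {r : ℕ} (hr : 4 ≤ r) (M : ℕ) (hM : 1 ≤ M) (δ : ℝ) (hδ : 0 < δ) (hδp : δ ≤ pir r)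
    (hδM : pir r + 3 * M * δ < 1) : ∃ κ : ℝ, 0 < κ ∧ κ ≤ 1 / 2 ∧ ∃ N : ℕ, ∀ n : ℕ, N ≤ n → ∀ l s : ℕ, 1 ≤ s →
    ((l + s * M : ℕ) : ℝ) ≤ κ * n →
    (r - 1).factorial * (Smax r (n - l - s * M) : ℝ) + s * M * ((pir r + 2 * δ) * (n:ℝ) ^ (r - 1)) +
      (r - 1).factorial * ((n - l - s).choose r : ℝ) <
    (r - 1).factorial * (Smax r (n - l - s) : ℝ) + (r - 1).factorial * ((n - l).choose r : ℝ) := by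
  have hp := pir_pos (r := r) (by omega)
  have hp1 := pir_le_one hr
  have hr0 : (4:ℝ) ≤ r := by exact_mod_cast hr
  obtain ⟨N1, hN1⟩ := Sinc_sum hr (δ / 2) (by positivity) (by linarith)
  obtain ⟨κ, hκ, hκ1, hκ2⟩ : ∃ κ : ℝ, 0 < κ ∧ κ ≤ 1 / 2 ∧ 2 * r * κ ≤ δ / 2 := by
    refine ⟨min (1 / 2) (δ / (4 * r)), by positivity, min_le_left _ _, ?_⟩
    calc 2 * (r:ℝ) * _ ≤ 2 * r * (δ / (4 * r)) := mul_le_mul_of_nonneg_left (min_le_right _ _) (by positivity)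
      _ = δ / 2 := by field_simp; norm_num
  obtain ⟨N2, hN2⟩ := exists_nat_ge ((r:ℝ) / κ)
  refine ⟨κ, hκ, hκ1, max (2 * N1) (N2 + 1), ?_⟩
  intro n hn l s hs hls
  have hn1 : 2 * N1 ≤ n := (le_max_left _ _).trans hn
  have hn2 : N2 + 1 ≤ n := (le_max_right _ _).trans hn
  have hn0 : (0:ℝ) < n := by exact_mod_cast (by omega : 0 < n)
  have hrn : (r:ℝ) ≤ κ * n := by
    rw [div_le_iff₀ hκ] at hN2
    have : (N2:ℝ) ≤ n := by exact_mod_cast (by omega : N2 ≤ n)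
    have := mul_le_mul_of_nonneg_right this hκ.le
    linarith
  have hκn : κ * n ≤ n / 2 := by
    have := mul_le_mul_of_nonneg_right hκ1 hn0.le
    linarith
  have h2 : 2 * (l + s * M) ≤ n := by
    have : ((2 * (l + s * M) : ℕ) : ℝ) ≤ n := by
      rw [Nat.cast_mul]
      push_cast at hls ⊢
      linarith
    exact_mod_cast this
  obtain ⟨K, rfl⟩ : ∃ K, M = K + 1 := ⟨M - 1, by omega⟩
  have hsM : s * (K + 1) = s * K + s := by ring
  obtain ⟨m, hm⟩ : ∃ m, m = n - l - s * (K + 1) := ⟨_, rfl⟩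
  have e1 : n - l - s = m + s * K := by omega
  have e2 : n - l = m + s * K + s := by omega
  have hmn : (m:ℝ) = n - ((l + s * (K + 1) : ℕ) : ℝ) := by
    rw [hm, Nat.sub_sub, Nat.cast_sub (by omega)]
  have hm1 : (1 - κ) * n ≤ m := by rw [hmn]; linarith
  have hA := hN1 m (by omega) (s * K)
  have hB := choose_gap (m + s * K) (r - 1) s
  have hr1 : r - 1 + 1 = r := by omega
  rw [hr1] at hB
  have hr1' : ((r - 1 : ℕ) : ℝ) = r - 1 := by rw [Nat.cast_sub (by omega)]; simp
  have hC := choose_low (m + s * K) (r - 1) ((1 - 2 * κ) * n) (mul_nonneg (by linarith) hn0.le) (by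
    rw [hr1']; push_cast
    have : (0:ℝ) ≤ s * K := by positivity
    linarith)
  rw [← hm, e1, e2]
  have hX : 0 < (n:ℝ) ^ (r - 1) := by positivity
  rw [mul_pow] at hC
  have c1 : (1 - δ) ≤ (1 - 2 * κ) ^ (r - 1) := by
    have := one_sub_pow (2 * κ) (by linarith) (r - 1)
    rw [hr1'] at this
    linarith
  have c2 := mul_le_mul_of_nonneg_right c1 hX.le
  have c3 : (1 - δ / 2) ≤ (1 - κ) ^ (r - 1) := by
    have := one_sub_pow κ (by linarith) (r - 1)
    rw [hr1'] at this
    have : 0 ≤ r * κ := by positivity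
    linarith
  have c4 := mul_le_mul_of_nonneg_right c3 hX.le
  have c5 : (1 - δ / 2) * (n:ℝ) ^ (r - 1) ≤ (m:ℝ) ^ (r - 1) := by
    have a2 := pow_le_pow_left₀ (mul_nonneg (by linarith) hn0.le) hm1 (r - 1)
    rw [mul_pow] at a2
    linarith
  have c6 : (pir r - δ) * (n:ℝ) ^ (r - 1) ≤ (pir r - δ / 2) * (m:ℝ) ^ (r - 1) := by
    have a1 := mul_le_mul_of_nonneg_left c5 (by linarith : 0 ≤ pir r - δ / 2)
    have a2 : pir r - δ ≤ (pir r - δ / 2) * (1 - δ / 2) := by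
      have := mul_le_mul_of_nonneg_right (by linarith : pir r - δ / 2 ≤ 1) (by linarith : 0 ≤ δ / 2)
      linarith
    have a3 := mul_le_mul_of_nonneg_right a2 hX.le
    linarith
  have hB' : (s:ℝ) * ((m + s * K).choose (r - 1) : ℝ) + ((m + s * K).choose r : ℝ) ≤ ((m + s * K + s).choose r : ℝ) := by
    exact_mod_cast hB
  have hB2 := mul_le_mul_of_nonneg_left hB' (by positivity : (0:ℝ) ≤ (r - 1).factorial)
  have hs0 : (0:ℝ) < s := by exact_mod_cast hs
  have c7 := mul_le_mul_of_nonneg_left (c2.trans hC) hs0.le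
  have c8 := mul_le_mul_of_nonneg_left c6 (by positivity : (0:ℝ) ≤ s * K)
  push_cast at hA hδM ⊢
  generalize (n:ℝ) ^ (r - 1) = X at *
  have c9 : 0 < s * X * (1 - (pir r + 3 * ((K:ℝ) + 1) * δ)) := mul_pos (mul_pos hs0 hX) (by linarith)
  have : 0 ≤ s * X * δ := by positivity
  linarith

theorem meetL {r : ℕ} (H : HGraph r) (L : Finset ℕ) (hL : L ⊆ H.verts) :
    H.edges.card + (H.verts.card - L.card).choose r ≤ (H.induce (H.verts \ L)).edges.card + H.verts.card.choose r ∧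
    (H.edges.card + (H.verts.card - L.card).choose r = (H.induce (H.verts \ L)).edges.card + H.verts.card.choose r →
      ∀ e ∈ Finset.powersetCard r H.verts, ¬ Disjoint e L → e ∈ H.edges) := by
  have h1 := Finset.card_filter_add_card_filter_not (s := H.edges) (fun e => e ⊆ H.verts \ L)
  have h2 := Finset.card_filter_add_card_filter_not (s := Finset.powersetCard r H.verts) (fun e => e ⊆ H.verts \ L)
  have e1 : (H.edges.filter fun e => e ⊆ H.verts \ L) = (H.induce (H.verts \ L)).edges := by
    ext e; rw [Finset.mem_filter, mem_induce]
  have e2 : ((Finset.powersetCard r H.verts).filter fun e => e ⊆ H.verts \ L) = Finset.powersetCard r (H.verts \ L) := by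
    ext e
    simp only [Finset.mem_filter, Finset.mem_powersetCard]
    constructor
    · rintro ⟨⟨_, a⟩, b⟩; exact ⟨b, a⟩
    · rintro ⟨a, b⟩; exact ⟨⟨a.trans Finset.sdiff_subset, b⟩, a⟩
  have hsub : (H.edges.filter fun e => ¬ e ⊆ H.verts \ L) ⊆ ((Finset.powersetCard r H.verts).filter fun e => ¬ e ⊆ H.verts \ L) := by
    apply Finset.filter_subset_filter
    intro e he
    exact Finset.mem_powersetCard.mpr ⟨H.edges_sub _ he, H.edges_card _ he⟩
  rw [e1] at h1
  rw [e2, Finset.card_powersetCard, Finset.card_powersetCard, Finset.card_sdiff_of_subset hL] at h2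
  have h3 := Finset.card_le_card hsub
  refine ⟨by omega, fun heq e he hd => ?_⟩
  have h4 := Finset.eq_of_subset_of_card_le hsub (by omega)
  have : e ∈ (Finset.powersetCard r H.verts).filter fun e => ¬ e ⊆ H.verts \ L := by
    rw [Finset.mem_filter]
    refine ⟨he, fun hs => hd ?_⟩
    rw [Finset.disjoint_left]
    intro x hx hxL
    exact (Finset.mem_sdiff.mp (hs hx)).2 hxL
  rw [← h4] at this
  exact (Finset.mem_filter.mp this).1

theorem deg_induce_le {r : ℕ} (H : HGraph r) (S : Finset ℕ) (v : ℕ) : (H.induce S).deg v ≤ H.deg v :=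
  Finset.card_le_card (Finset.filter_subset_filter _ (induce_edges_sub H S))

theorem FF_pos {r : ℕ} (hr : 4 ≤ r) : 1 ≤ (FF r).verts.card :=
  Finset.card_pos.mpr ⟨1, (FF_verts hr 1).mpr (Or.inl ⟨le_refl _, by omega⟩)⟩

theorem MainUp {r : ℕ} (hr : 4 ≤ r) : ∃ N : ℕ, ∃ c : ℝ, 0 < c ∧ c ≤ 1 / 2 ∧ ∀ H : HGraph r, N ≤ H.verts.card →
    ∀ t : ℕ, (t:ℝ) ≤ c * H.verts.card → ¬ (FF r).HasMatching H (t + 1) →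
    Smax r (H.verts.card - t) + H.verts.card.choose r ≤ H.edges.card + (H.verts.card - t).choose r →
    ∃ L ⊆ H.verts, L.card = t ∧ Semibipartite r (H.induce (H.verts \ L)) ∧
      (H.induce (H.verts \ L)).edges.card = Smax r (H.verts.card - t) ∧
      Smax r (H.verts.card - t) + H.verts.card.choose r = H.edges.card + (H.verts.card - t).choose r ∧
      ∀ e ∈ Finset.powersetCard r H.verts, ¬ Disjoint e L → e ∈ H.edges := by
  classical
  have hp := pir_pos (r := r) (by omega)
  have hp1 := pir_lt_one hr
  obtain ⟨M, hM⟩ : ∃ M, M = (FF r).verts.card := ⟨_, rfl⟩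
  have hM1 : 1 ≤ M := hM ▸ FF_pos hr
  have hM0 : (1:ℝ) ≤ M := by exact_mod_cast hM1
  obtain ⟨δ, hδ, hδp, hδM⟩ : ∃ δ : ℝ, 0 < δ ∧ δ ≤ pir r ∧ pir r + 3 * M * δ < 1 := by
    have h1 : 0 < 1 - pir r := by linarith
    refine ⟨min (pir r) ((1 - pir r) / (6 * M)), by positivity, min_le_left _ _, ?_⟩
    have : 3 * (M:ℝ) * min (pir r) ((1 - pir r) / (6 * M)) ≤ 3 * M * ((1 - pir r) / (6 * M)) :=
      mul_le_mul_of_nonneg_left (min_le_right _ _) (by positivity)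
    have e : 3 * (M:ℝ) * ((1 - pir r) / (6 * M)) = (1 - pir r) / 2 := by field_simp; norm_num
    rw [e] at this
    linarith
  obtain ⟨κ1, hκ1, N1, hG⟩ := greedy_prop hr δ hδ
  obtain ⟨κ2, hκ2, hκ2h, N2, hNum⟩ := numeric hr M hM1 δ hδ hδp hδM
  obtain ⟨N3, hT⟩ := ETuran hr
  obtain ⟨κ, hκ, hκ1', hκ2'⟩ : ∃ κ : ℝ, 0 < κ ∧ κ ≤ κ1 ∧ κ ≤ κ2 := ⟨min κ1 κ2, lt_min hκ1 hκ2, min_le_left _ _, min_le_right _ _⟩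
  obtain ⟨N4, hN4⟩ := exists_nat_ge ((2 * M + 1) / (κ / 2))
  obtain ⟨c, hc, hcκ⟩ : ∃ c : ℝ, 0 < c ∧ c * (2 * M + 1) = κ / 2 := ⟨κ / 2 / (2 * M + 1), by positivity, by field_simp⟩
  have hcsm : c ≤ κ / 2 := by
    have := mul_le_mul_of_nonneg_left (by linarith : (1:ℝ) ≤ 2 * M + 1) hc.le
    linarith
  refine ⟨N1 + N2 + 2 * N3 + N4 + 1, c, hc, by linarith, ?_⟩
  intro H hn t ht hmat hge
  have hn0 : (0:ℝ) < H.verts.card := by exact_mod_cast (by omega : 0 < H.verts.card)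
  -- size budget
  have hbud : (((2 * M + 1) * (t + 1) : ℕ) : ℝ) ≤ κ * H.verts.card := by
    rw [div_le_iff₀ (by positivity)] at hN4
    have a1 : (N4:ℝ) ≤ H.verts.card := by exact_mod_cast (by omega : N4 ≤ H.verts.card)
    have a2 := mul_le_mul_of_nonneg_right a1 (by positivity : 0 ≤ κ / 2)
    have a3 := mul_le_mul_of_nonneg_right ht (by positivity : (0:ℝ) ≤ 2 * M + 1)
    have a4 : c * H.verts.card * (2 * M + 1) = κ / 2 * H.verts.card := by rw [← hcκ]; ring
    push_cast
    linarith
  have hb1 : ((t : ℕ) : ℝ) ≤ κ1 * H.verts.card := by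
    have a1 := mul_le_mul_of_nonneg_right hcsm hn0.le
    have a2 := mul_le_mul_of_nonneg_right hκ1' hn0.le
    have := mul_pos hκ hn0
    linarith
  have hbig : 2 * ((2 * M + 1) * (t + 1)) ≤ H.verts.card := by
    have a2 := mul_le_mul_of_nonneg_right (hκ2'.trans hκ2h) hn0.le
    have : (2:ℝ) * (((2 * M + 1) * (t + 1) : ℕ) : ℝ) ≤ H.verts.card := by linarith
    exact_mod_cast this
  have htM : t ≤ (2 * M + 1) * (t + 1) := by nlinarith
  have hch : (H.verts.card - t).choose r ≤ H.verts.card.choose r := Nat.choose_le_choose r (by omega)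
  have hSe : Smax r (H.verts.card - t) ≤ H.edges.card := by omega
  have hgr := hG H (by omega) t hb1 hSe
  obtain ⟨L, hLdef⟩ : ∃ L : Finset ℕ, L = H.verts.filter (fun v => (pir r + 2 * δ) * (H.verts.card : ℝ) ^ (r - 1) ≤ (r - 1).factorial * H.deg v) := ⟨_, rfl⟩
  have hLm : ∀ v, v ∈ L ↔ v ∈ H.verts ∧ (pir r + 2 * δ) * (H.verts.card : ℝ) ^ (r - 1) ≤ (r - 1).factorial * H.deg v := by
    intro v; rw [hLdef, Finset.mem_filter]
  have hLV : L ⊆ H.verts := fun v hv => ((hLm v).mp hv).1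
  have hprop : ∀ U ⊆ H.verts, U.card ≤ (2 * M + 1) * (t + 1) → ∀ v ∈ L, v ∉ U → (FF r).IsCopyIn (H.induce (H.verts \ U)) := by
    intro U hU hUc v hv hvU
    refine hgr U hU ?_ v (hLV hv) hvU ((hLm v).mp hv).2
    have a1 : (U.card : ℝ) ≤ (((2 * M + 1) * (t + 1) : ℕ) : ℝ) := by exact_mod_cast hUc
    have a2 := mul_le_mul_of_nonneg_right hκ1' hn0.le
    linarith
  have hLt : L.card ≤ t := by
    by_contra hlt
    push Not at hlt
    obtain ⟨L0, hL0, hL0c⟩ := Finset.exists_subset_card_eq (Nat.succ_le_of_lt hlt)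
    have := greedy (F := FF r) (K := (2 * M + 1) * (t + 1)) L0 (hL0.trans hLV) (fun U hU hK v hv => hprop U hU hK v (hL0 hv)) ∅ (by simp) (by simp) (by
      rw [← hM, hL0c, Finset.card_empty, Nat.zero_add]
      exact Nat.mul_le_mul_right _ (by omega))
    rw [hL0c] at this
    exact hmat (matching_mono (induce_verts_sub _ _) (induce_edges_sub _ _) this)
  obtain ⟨s, hs⟩ : ∃ s, t = L.card + s := ⟨t - L.card, by omega⟩
  -- H1
  have hv1 : (H.induce (H.verts \ L)).verts = H.verts \ L := by
    rw [induce_verts, Finset.inter_eq_right.mpr Finset.sdiff_subset]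
  have hc1 : (H.induce (H.verts \ L)).verts.card = H.verts.card - L.card := by
    rw [hv1, Finset.card_sdiff_of_subset hLV]
  have hmat1 : ¬ (FF r).HasMatching (H.induce (H.verts \ L)) (s + 1) := by
    intro hm
    obtain ⟨U, u1, u2, u3⟩ := matching_union hm
    rw [hv1] at u1
    have hUL : Disjoint U L := by
      rw [Finset.disjoint_left]; intro x hx; exact (Finset.mem_sdiff.mp (u1 hx)).2
    have hUV := u1.trans Finset.sdiff_subset
    have := greedy (F := FF r) (K := (2 * M + 1) * (t + 1)) L hLV hprop U hUV hUL (by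
      rw [← hM] at u2 ⊢
      have : (s + 1) * M ≤ (t + 1) * M := Nat.mul_le_mul_right _ (by omega)
      have : (M + 1) * L.card ≤ (M + 1) * (t + 1) := Nat.mul_le_mul_left _ (by omega)
      nlinarith)
    refine hmat ?_
    have e : t + 1 = (s + 1) + L.card := by omega
    rw [e]
    refine matching_add (A := U) (B := H.verts \ U) Finset.disjoint_sdiff ?_ this
    exact matching_mono (induce_mono (induce_verts_sub _ _) (induce_edges_sub _ _) (Finset.Subset.refl _)).1
      (induce_mono (induce_verts_sub _ _) (induce_edges_sub _ _) (Finset.Subset.refl _)).2 u3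
  obtain ⟨W, w1, w2, w3⟩ := matching_cover s hmat1
  rw [← hM] at w2
  obtain ⟨hm1, hm2⟩ := meetL H L hLV
  rcases Nat.eq_zero_or_pos s with hs0 | hs0
  · subst hs0
    have hLc : L.card = t := by omega
    have hF1 : ¬ (FF r).IsCopyIn (H.induce (H.verts \ L)) := fun hc => hmat1 (matching_one hc)
    obtain ⟨a1, a2⟩ := hT _ hF1 (by rw [hc1]; omega)
    rw [hc1, hLc] at a1 a2
    rw [hLc] at hm1 hm2
    refine ⟨L, hLV, hLc, a2 (by omega), by omega, by omega, hm2 (by omega)⟩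
  · exfalso
    have hsM : s * M ≤ (2 * M + 1) * (t + 1) := by
      have : s * M ≤ (t + 1) * M := Nat.mul_le_mul_right _ (by omega)
      nlinarith
    have hlsM : L.card + s * M ≤ (2 * M + 1) * (t + 1) := by
      have : s * M ≤ (t + 1) * M := Nat.mul_le_mul_right _ (by omega)
      nlinarith
    obtain ⟨W', ww1, ww2, ww3⟩ := Finset.exists_subsuperset_card_eq w1 w2 (by rw [hc1]; omega)
    have hnum := hNum H.verts.card (by omega) L.card s hs0 (by
      have a1 : ((L.card + s * M : ℕ) : ℝ) ≤ (((2 * M + 1) * (t + 1) : ℕ) : ℝ) := by exact_mod_cast hlsM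
      have a2 := mul_le_mul_of_nonneg_right hκ2' hn0.le
      linarith)
    generalize hH1 : H.induce (H.verts \ L) = H1 at *
    have hF2 : ¬ (FF r).IsCopyIn (H1.induce (H1.verts \ W')) := fun hc => w3 (induce_copy (Finset.Subset.refl _) (Finset.Subset.refl _) (Finset.sdiff_subset_sdiff (Finset.Subset.refl _) ww1) hc)
    have hc2 : (H1.induce (H1.verts \ W')).verts.card = H.verts.card - L.card - s * M := by
      rw [induce_verts, Finset.inter_eq_right.mpr Finset.sdiff_subset, Finset.card_sdiff_of_subset ww2, hc1, ww3]
    obtain ⟨a1, -⟩ := hT _ hF2 (by rw [hc2]; omega)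
    rw [hc2] at a1
    have a2 := edges_remove H1 W'
    have a3 : ((r - 1).factorial : ℝ) * ((∑ v ∈ W', H1.deg v : ℕ) : ℝ) ≤ s * M * ((pir r + 2 * δ) * (H.verts.card : ℝ) ^ (r - 1)) := by
      push_cast
      rw [Finset.mul_sum]
      have : ((s:ℝ) * M) = (W'.card : ℝ) := by rw [ww3]; push_cast; ring
      rw [this, ← nsmul_eq_mul]
      refine Finset.sum_le_card_nsmul _ _ _ fun v hv => ?_
      have hvL : v ∉ L := by
        have := ww2 hv
        rw [hv1] at this
        exact (Finset.mem_sdiff.mp this).2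
      have hvV : v ∈ H.verts := by
        have := ww2 hv
        rw [hv1] at this
        exact (Finset.mem_sdiff.mp this).1
      have hlt : ((r - 1).factorial : ℝ) * H.deg v < (pir r + 2 * δ) * (H.verts.card : ℝ) ^ (r - 1) := by
        by_contra hh
        exact hvL ((hLm v).mpr ⟨hvV, le_of_not_gt hh⟩)
      have : (H1.deg v : ℝ) ≤ H.deg v := by
        rw [← hH1]; exact_mod_cast deg_induce_le H _ v
      have := mul_le_mul_of_nonneg_left this (by positivity : (0:ℝ) ≤ (r - 1).factorial)
      linarith
    have hq : (0:ℝ) < (r - 1).factorial := by exact_mod_cast Nat.factorial_pos _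
    have e5 : H.verts.card - t = H.verts.card - L.card - s := by omega
    rw [e5] at hge
    have b1 : Smax r (H.verts.card - L.card - s) + (H.verts.card - L.card).choose r ≤
        Smax r (H.verts.card - L.card - s * M) + (∑ v ∈ W', H1.deg v) + (H.verts.card - L.card - s).choose r := by omega
    have b2 : (Smax r (H.verts.card - L.card - s) : ℝ) + ((H.verts.card - L.card).choose r : ℝ) ≤
        Smax r (H.verts.card - L.card - s * M) + ((∑ v ∈ W', H1.deg v : ℕ) : ℝ) + ((H.verts.card - L.card - s).choose r : ℝ) := by
      exact_mod_cast b1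
    have b3 := mul_le_mul_of_nonneg_left b2 hq.le
    simp only [mul_add] at b3
    clear b2 b1 hge hprop hLm hgr hT hNum hG hmat hmat1 hm1 hm2 hbud hb1 hch hSe hbig
    linarith only [b3, a3, hnum]

theorem meetL_eq {r : ℕ} (H : HGraph r) (L : Finset ℕ) (hL : L ⊆ H.verts)
    (hall : ∀ e ∈ Finset.powersetCard r H.verts, ¬ Disjoint e L → e ∈ H.edges) :
    (H.induce (H.verts \ L)).edges.card + H.verts.card.choose r = H.edges.card + (H.verts.card - L.card).choose r := by
  have h1 := Finset.card_filter_add_card_filter_not (s := H.edges) (fun e => e ⊆ H.verts \ L)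
  have h2 := Finset.card_filter_add_card_filter_not (s := Finset.powersetCard r H.verts) (fun e => e ⊆ H.verts \ L)
  have e1 : (H.edges.filter fun e => e ⊆ H.verts \ L) = (H.induce (H.verts \ L)).edges := by
    ext e; rw [Finset.mem_filter, mem_induce]
  have e2 : ((Finset.powersetCard r H.verts).filter fun e => e ⊆ H.verts \ L) = Finset.powersetCard r (H.verts \ L) := by
    ext e
    simp only [Finset.mem_filter, Finset.mem_powersetCard]
    constructor
    · rintro ⟨⟨_, a⟩, b⟩; exact ⟨b, a⟩
    · rintro ⟨a, b⟩; exact ⟨⟨a.trans Finset.sdiff_subset, b⟩, a⟩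
  have heq : (H.edges.filter fun e => ¬ e ⊆ H.verts \ L) = ((Finset.powersetCard r H.verts).filter fun e => ¬ e ⊆ H.verts \ L) := by
    ext e
    rw [Finset.mem_filter, Finset.mem_filter]
    refine and_congr_left fun hs => ⟨fun he => Finset.mem_powersetCard.mpr ⟨H.edges_sub _ he, H.edges_card _ he⟩, fun he => ?_⟩
    refine hall e he fun hd => hs fun x hx => ?_
    exact Finset.mem_sdiff.mpr ⟨(Finset.mem_powersetCard.mp he).1 hx, Finset.disjoint_left.mp hd hx⟩
  rw [e1] at h1
  rw [e2, Finset.card_powersetCard, Finset.card_powersetCard, Finset.card_sdiff_of_subset hL, ← heq] at h2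
  omega

theorem noMatch {r : ℕ} (hr : 4 ≤ r) (H : HGraph r) (L : Finset ℕ)
    (hs : Semibipartite r (H.induce (H.verts \ L))) : ¬ (FF r).HasMatching H (L.card + 1) := by
  rintro ⟨S, s1, s2, s3⟩
  have hx : ∀ i, ∃ x, x ∈ S i ∧ x ∈ L := by
    intro i
    by_contra hcon
    push Not at hcon
    refine semibip_free hr hs (induce_copy (Finset.Subset.refl _) (Finset.Subset.refl _) ?_ (s3 i))
    intro x hx
    exact Finset.mem_sdiff.mpr ⟨(s1 i).1 hx, hcon x hx⟩
  choose x hx1 hx2 using hx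
  have hinj : Function.Injective x := by
    intro i j hij
    by_contra hne
    exact Finset.disjoint_left.mp (s2 i j hne) (hx1 i) (hij ▸ hx1 j)
  have := Finset.card_le_card_of_injOn (s := (Finset.univ : Finset (Fin (L.card + 1)))) (t := L) x (fun i _ => hx2 i) hinj.injOn
  simp at this

theorem join_verts {r t : ℕ} (G : HGraph r) : ((completeOn r (Finset.range t)).join G).verts = Finset.range t ∪ G.verts := rfl

theorem mem_join {r t : ℕ} (hr : 4 ≤ r) (G : HGraph r) (e : Finset ℕ) :
    e ∈ ((completeOn r (Finset.range t)).join G).edges ↔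
      e ⊆ Finset.range t ∪ G.verts ∧ e.card = r ∧ (e ∈ G.edges ∨ ¬ Disjoint e (Finset.range t)) := by
  have hv : (completeOn r (Finset.range t)).verts = Finset.range t := rfl
  have he : ∀ e, e ∈ (completeOn r (Finset.range t)).edges ↔ e ⊆ Finset.range t ∧ e.card = r := by
    intro e
    unfold completeOn HGraph.ofEdges
    simp only [Finset.mem_filter, Finset.mem_powersetCard]
    tauto
  unfold HGraph.join HGraph.ofEdges
  simp only [Finset.mem_filter, Finset.mem_union, he, hv, Finset.mem_powersetCard, Finset.not_disjoint_iff_nonempty_inter]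
  constructor
  · rintro ⟨(⟨h1 | h1⟩ | h1), h2, h3⟩
    · refine ⟨h2, h3, Or.inr ?_⟩
      rw [Finset.inter_eq_left.mpr h1.1]
      exact Finset.card_pos.mp (by omega)
    · exact ⟨h2, h3, Or.inl (by assumption)⟩
    · exact ⟨h2, h3, Or.inr h1.2.1⟩
  · rintro ⟨h2, h3, h4⟩
    refine ⟨?_, h2, h3⟩
    rcases h4 with h4 | h4
    · exact Or.inl (Or.inr h4)
    · by_cases hG : (e ∩ G.verts).Nonempty
      · exact Or.inr ⟨⟨h2, h3⟩, h4, hG⟩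
      · refine Or.inl (Or.inl ⟨fun x hx => ?_, h3⟩)
        rcases Finset.mem_union.mp (h2 hx) with h | h
        · exact h
        · exact absurd ⟨x, Finset.mem_inter.mpr ⟨hx, h⟩⟩ hG

theorem joinStr {r t n : ℕ} (hr : 4 ≤ r) (htn : t ≤ n) (G : HGraph r) (hc : G.verts.card = n - t) (hd : Disjoint G.verts (Finset.range t))
    (hs : Semibipartite r G) (he : G.edges.card = Smax r (n - t)) :
    ((completeOn r (Finset.range t)).join G).verts.card = n ∧
    ¬ (FF r).HasMatching ((completeOn r (Finset.range t)).join G) (t + 1) ∧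
    Smax r (n - t) + n.choose r = ((completeOn r (Finset.range t)).join G).edges.card + (n - t).choose r := by
  have hmem := mem_join (t := t) hr G
  have hv := join_verts (t := t) G
  generalize (completeOn r (Finset.range t)).join G = J at *
  have hcard : J.verts.card = n := by
    rw [hv, Finset.card_union_of_disjoint hd.symm, Finset.card_range, hc]; omega
  have hsd : J.verts \ Finset.range t = G.verts := by
    rw [hv, Finset.union_sdiff_left]
    exact Finset.sdiff_eq_self_of_disjoint hd
  have hE : (J.induce (J.verts \ Finset.range t)).edges = G.edges := by
    ext e
    rw [mem_induce, hmem, hsd]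
    constructor
    · rintro ⟨⟨h1, h2, h3 | h3⟩, h4⟩
      · exact h3
      · exact absurd (hd.mono_left h4) h3
    · intro h
      have := G.edges_sub e h
      exact ⟨⟨this.trans Finset.subset_union_right, G.edges_card e h, Or.inl h⟩, this⟩
  have hV : (J.induce (J.verts \ Finset.range t)).verts = G.verts := by
    rw [induce_verts, Finset.inter_eq_right.mpr Finset.sdiff_subset, hsd]
  have hL : Finset.range t ⊆ J.verts := by rw [hv]; exact Finset.subset_union_left
  refine ⟨hcard, ?_, ?_⟩
  · have := noMatch hr J (Finset.range t) (by
      obtain ⟨V1, h1, h2⟩ := hs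
      exact ⟨V1, by rw [hV]; exact h1, by rw [hE]; exact h2⟩)
    rwa [Finset.card_range] at this
  · have := meetL_eq J (Finset.range t) hL (by
      intro e he hne
      rw [Finset.mem_powersetCard, hv] at he
      exact (hmem e).mpr ⟨he.1, he.2, Or.inr hne⟩)
    rw [hE, he, hcard, Finset.card_range] at this
    exact this

theorem iso_matching {r : ℕ} {F H J : HGraph r} {f : ℕ → ℕ} (hf : Set.BijOn f ↑H.verts ↑J.verts)
    (hE : ∀ e ∈ Finset.powersetCard r H.verts, (e ∈ H.edges ↔ e.image f ∈ J.edges)) {k : ℕ}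
    (h : F.HasMatching H k) : F.HasMatching J k := by
  obtain ⟨S, s1, s2, s3⟩ := h
  have inj : ∀ i, Set.InjOn f (S i) := fun i => hf.injOn.mono (Finset.coe_subset.mpr (s1 i).1)
  refine ⟨fun i => (S i).image f, fun i => ⟨?_, ?_⟩, fun i j hij => ?_, fun i => ?_⟩
  · intro x hx
    obtain ⟨y, hy, rfl⟩ := Finset.mem_image.mp hx
    exact hf.mapsTo ((s1 i).1 hy)
  · exact (Finset.card_image_of_injOn (inj i)).trans (s1 i).2
  · rw [Finset.disjoint_left]
    intro x hx hx2
    obtain ⟨y, hy, rfl⟩ := Finset.mem_image.mp hx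
    obtain ⟨z, hz, hzy⟩ := Finset.mem_image.mp hx2
    have := hf.injOn ((s1 j).1 hz) ((s1 i).1 hy) hzy
    exact Finset.disjoint_left.mp (s2 i j hij) hy (this ▸ hz)
  · obtain ⟨g, g1, g2, g3⟩ := s3 i
    rw [induce_verts] at g2
    refine ⟨f ∘ g, ?_, ?_, ?_⟩
    · refine hf.injOn.comp g1 fun v hv => ?_
      exact (Finset.mem_inter.mp (g2 v hv)).1
    · intro v hv
      rw [induce_verts]
      have := Finset.mem_inter.mp (g2 v hv)
      exact Finset.mem_inter.mpr ⟨hf.mapsTo this.1, Finset.mem_image_of_mem _ this.2⟩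
    · intro e he
      have h1 := g3 e he
      rw [mem_induce] at h1 ⊢
      rw [← Finset.image_image]
      refine ⟨(hE _ (Finset.mem_powersetCard.mpr ⟨H.edges_sub _ h1.1, H.edges_card _ h1.1⟩)).mp h1.1, Finset.image_subset_image h1.2⟩

theorem iso_edges {r : ℕ} {H J : HGraph r} {f : ℕ → ℕ} (hf : Set.BijOn f ↑H.verts ↑J.verts)
    (hE : ∀ e ∈ Finset.powersetCard r H.verts, (e ∈ H.edges ↔ e.image f ∈ J.edges)) :
    J.edges.card ≤ H.edges.card := by
  have hsub : J.edges ⊆ H.edges.image (fun e => e.image f) := by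
    intro e' he'
    have him : (H.verts.filter fun x => f x ∈ e').image f = e' := by
      ext y
      rw [Finset.mem_image]
      constructor
      · rintro ⟨x, hx, rfl⟩; exact (Finset.mem_filter.mp hx).2
      · intro hy
        obtain ⟨x, hx, rfl⟩ := hf.surjOn (J.edges_sub _ he' hy)
        exact ⟨x, Finset.mem_filter.mpr ⟨hx, hy⟩, rfl⟩
    refine Finset.mem_image.mpr ⟨H.verts.filter fun x => f x ∈ e', ?_, him⟩
    refine (hE _ (Finset.mem_powersetCard.mpr ⟨Finset.filter_subset _ _, ?_⟩)).mpr (by rw [him]; exact he')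
    have := Finset.card_image_of_injOn (s := H.verts.filter fun x => f x ∈ e') (f := f) (hf.injOn.mono (by
      intro x hx; exact (Finset.mem_filter.mp hx).1))
    rw [him, J.edges_card _ he'] at this
    exact this.symm
  exact (Finset.card_le_card hsub).trans Finset.card_image_le

theorem iso_card {r : ℕ} {H J : HGraph r} {f : ℕ → ℕ} (hf : Set.BijOn f ↑H.verts ↑J.verts) :
    H.verts.card = J.verts.card := by
  have : H.verts.image f = J.verts := by
    apply Finset.coe_injective
    rw [Finset.coe_image]; exact hf.image_eq
  rw [← this, Finset.card_image_of_injOn hf.injOn]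

/-- relabel a structured graph as a join -/
theorem str_iso {r t : ℕ} (hr : 4 ≤ r) (H : HGraph r) (L : Finset ℕ) (hL : L ⊆ H.verts) (hLc : L.card = t)
    (hs : Semibipartite r (H.induce (H.verts \ L)))
    (hall : ∀ e ∈ Finset.powersetCard r H.verts, ¬ Disjoint e L → e ∈ H.edges) :
    ∃ G : HGraph r, G.verts.card = H.verts.card - t ∧ Disjoint G.verts (Finset.range t) ∧ Semibipartite r G ∧
      G.edges.card = (H.induce (H.verts \ L)).edges.card ∧ H.Iso ((completeOn r (Finset.range t)).join G) := by
  have hv1 : (H.induce (H.verts \ L)).verts = H.verts \ L := by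
    rw [induce_verts, Finset.inter_eq_right.mpr Finset.sdiff_subset]
  have hmi : ∀ e, e ∈ (H.induce (H.verts \ L)).edges ↔ e ∈ H.edges ∧ e ⊆ H.verts \ L := fun e => mem_induce
  generalize H.induce (H.verts \ L) = H1 at *
  obtain ⟨a, ha⟩ : ∃ a : ℕ → ℕ, ∀ x, a x = x + t := ⟨fun x => x + t, fun _ => rfl⟩
  have hai : Function.Injective a := by intro x y h; rw [ha, ha] at h; omega
  have hii : Function.Injective (fun e : Finset ℕ => e.image a) := Finset.image_injective hai
  obtain ⟨g, hg1, hg2⟩ : ∃ g : ℕ → ℕ, (∀ x ∈ L, g x < t) ∧ Set.InjOn g ↑L := by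
    refine ⟨fun x => (L.filter fun y => y < x).card, fun x hx => ?_, fun x hx y hy hxy => ?_⟩
    · rw [← hLc]
      refine Finset.card_lt_card (Finset.filter_ssubset.mpr ⟨x, hx, lt_irrefl _⟩)
    · have key : ∀ x ∈ L, ∀ y ∈ L, x < y → (L.filter fun z => z < x).card < (L.filter fun z => z < y).card := by
        intro x hx y hy hxy
        refine Finset.card_lt_card ⟨fun z hz => ?_, fun hcon => ?_⟩
        · rw [Finset.mem_filter] at hz ⊢
          exact ⟨hz.1, hz.2.trans hxy⟩
        · have := hcon (Finset.mem_filter.mpr ⟨hx, hxy⟩)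
          exact lt_irrefl _ (Finset.mem_filter.mp this).2
      simp only at hxy
      rcases lt_trichotomy x y with h | h | h
      · have := key x hx y hy h; omega
      · exact h
      · have := key y hy x hx h; omega
  let G : HGraph r :=
    { verts := (H.verts \ L).image a
      edges := H1.edges.image (fun e => e.image a)
      edges_sub := by
        intro e he
        obtain ⟨e0, h0, rfl⟩ := Finset.mem_image.mp he
        exact Finset.image_subset_image ((hmi e0).mp h0).2
      edges_card := by
        intro e he
        obtain ⟨e0, h0, rfl⟩ := Finset.mem_image.mp he
        rw [Finset.card_image_of_injective _ hai]
        exact H1.edges_card _ h0 }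
  have hGv : G.verts = (H.verts \ L).image a := rfl
  have hGe : G.edges = H1.edges.image (fun e => e.image a) := rfl
  clear_value G
  have hGc : G.verts.card = H.verts.card - t := by
    rw [hGv, Finset.card_image_of_injective _ hai, Finset.card_sdiff_of_subset hL, hLc]
  have hGd : Disjoint G.verts (Finset.range t) := by
    rw [hGv, Finset.disjoint_left]
    intro x hx hx2
    obtain ⟨y, hy, rfl⟩ := Finset.mem_image.mp hx
    rw [ha, Finset.mem_range] at hx2; omega
  refine ⟨G, hGc, hGd, ?_, ?_, ?_⟩
  · obtain ⟨V1, h1, h2⟩ := hs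
    refine ⟨V1.image a, ?_, ?_⟩
    · rw [hGv]; rw [hv1] at h1; exact Finset.image_subset_image h1
    · intro e he
      rw [hGe] at he
      obtain ⟨e0, h0, rfl⟩ := Finset.mem_image.mp he
      rw [← Finset.image_inter _ _ hai, Finset.card_image_of_injective _ hai]
      exact h2 e0 h0
  · rw [hGe, Finset.card_image_of_injective _ hii]
  · obtain ⟨f, hf1, hf2⟩ : ∃ f : ℕ → ℕ, (∀ x ∈ L, f x = g x) ∧ ∀ x, x ∉ L → f x = a x :=
      ⟨fun x => if x ∈ L then g x else a x, fun x hx => by simp [hx], fun x hx => by simp [hx]⟩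
    have hflt : ∀ x, f x < t ↔ x ∈ L := by
      intro x
      by_cases hx : x ∈ L
      · rw [hf1 x hx]; exact ⟨fun _ => hx, fun _ => hg1 x hx⟩
      · rw [hf2 x hx, ha]; exact ⟨fun h => by omega, fun h => absurd h hx⟩
    have hinj : Set.InjOn f ↑H.verts := by
      intro x hx y hy hxy
      by_cases hxL : x ∈ L
      · have hyL : y ∈ L := by rw [← hflt, ← hxy, hflt]; exact hxL
        rw [hf1 x hxL, hf1 y hyL] at hxy
        exact hg2 hxL hyL hxy
      · have hyL : y ∉ L := by rw [← hflt, ← hxy, hflt]; exact hxL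
        rw [hf2 x hxL, hf2 y hyL] at hxy
        exact hai hxy
    have hmaps : ∀ x ∈ H.verts, f x ∈ Finset.range t ∪ G.verts := by
      intro x hx
      by_cases hxL : x ∈ L
      · exact Finset.mem_union_left _ (Finset.mem_range.mpr ((hflt x).mpr hxL))
      · rw [hf2 x hxL, hGv]
        exact Finset.mem_union_right _ (Finset.mem_image_of_mem _ (Finset.mem_sdiff.mpr ⟨hx, hxL⟩))
    refine ⟨f, ⟨?_, hinj, ?_⟩, ?_⟩
    · intro x hx
      rw [join_verts]; exact hmaps x hx
    · have := Finset.surjOn_of_injOn_of_card_le (s := H.verts) (t := Finset.range t ∪ G.verts) f (fun x hx => hmaps x hx) hinj (by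
        rw [Finset.card_union_of_disjoint hGd.symm, Finset.card_range, hGc]
        have := Finset.card_le_card hL
        omega)
      rw [join_verts]; exact this
    · intro e he
      rw [mem_join hr]
      obtain ⟨he1, he2⟩ := Finset.mem_powersetCard.mp he
      have hsub : e.image f ⊆ Finset.range t ∪ G.verts := by
        intro y hy
        obtain ⟨x, hx, rfl⟩ := Finset.mem_image.mp hy
        exact hmaps x (he1 hx)
      have hcd : (e.image f).card = r := by
        rw [Finset.card_image_of_injOn (hinj.mono (Finset.coe_subset.mpr he1)), he2]
      by_cases hd : Disjoint e L
      · have hea : e.image f = e.image a := Finset.image_congr fun x hx => hf2 x (Finset.disjoint_left.mp hd hx)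
        have hnd : Disjoint (e.image f) (Finset.range t) := by
          rw [Finset.disjoint_left]
          intro y hy hyt
          obtain ⟨x, hx, rfl⟩ := Finset.mem_image.mp hy
          exact Finset.disjoint_left.mp hd hx ((hflt x).mp (Finset.mem_range.mp hyt))
        constructor
        · intro h
          refine ⟨hsub, hcd, Or.inl ?_⟩
          rw [hea, hGe]
          refine Finset.mem_image.mpr ⟨e, (hmi e).mpr ⟨h, fun x hx => Finset.mem_sdiff.mpr ⟨he1 hx, Finset.disjoint_left.mp hd hx⟩⟩, rfl⟩
        · rintro ⟨-, -, h | h⟩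
          · rw [hea, hGe] at h
            obtain ⟨e0, h0, h00⟩ := Finset.mem_image.mp h
            have : e0 = e := hii h00
            rw [← this]; exact ((hmi e0).mp h0).1
          · exact absurd hnd h
      · refine ⟨fun _ => ⟨hsub, hcd, Or.inr ?_⟩, fun _ => hall e he hd⟩
        obtain ⟨x, hx, hxL⟩ := Finset.not_disjoint_iff.mp hd
        exact Finset.not_disjoint_iff.mpr ⟨f x, Finset.mem_image_of_mem _ hx, Finset.mem_range.mpr ((hflt x).mpr hxL)⟩

theorem final (r : ℕ) (hr : 4 ≤ r) :
    ∃ N₀ : ℕ, ∃ c : ℝ, 0 < c ∧ ∀ n : ℕ, N₀ ≤ n → ∀ t : ℕ, (t : ℝ) ≤ c * n →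
      ∀ H : HGraph r, IsExtremalMatchingFree r n t (FF r) H ↔
        ∃ G : HGraph r, G.verts.card = n - t ∧ Disjoint G.verts (Finset.range t) ∧
          Semibipartite r G ∧
          (∀ G' : HGraph r, G'.verts.card = n - t → Semibipartite r G' →
            G'.edges.card ≤ G.edges.card) ∧
          H.Iso ((completeOn r (Finset.range t)).join G) := by
  obtain ⟨N, c, hc, hc2, hup⟩ := MainUp hr
  refine ⟨N, c, hc, fun n hn t ht => ?_⟩
  have htn : t ≤ n := by
    have h1 := mul_le_mul_of_nonneg_right hc2 (Nat.cast_nonneg (α := ℝ) n)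
    have : (t:ℝ) ≤ n := by linarith [Nat.cast_nonneg (α := ℝ) n]
    exact_mod_cast this
  have hup' : ∀ H : HGraph r, H.verts.card = n → ¬ (FF r).HasMatching H (t + 1) →
      H.edges.card + (n - t).choose r ≤ Smax r (n - t) + n.choose r := by
    intro H hHn hm
    by_contra hcon
    obtain ⟨L, -, -, -, -, h, -⟩ := hup H (by rw [hHn]; exact hn) t (by rw [hHn]; exact ht) hm (by rw [hHn]; omega)
    rw [hHn] at h
    omega
  have hex : exMatchN r n t (FF r) + (n - t).choose r = Smax r (n - t) + n.choose r := by
    obtain ⟨G, g1, g2, g3⟩ := sb_ex hr (Finset.Ico t n)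
    have hcG : G.verts.card = n - t := by rw [g1, Nat.card_Ico]
    rw [Nat.card_Ico] at g3
    obtain ⟨j1, j2, j3⟩ := joinStr hr htn G hcG (by
      rw [g1, Finset.disjoint_left]; intro x hx; simp at hx ⊢; omega) g2 g3
    have hmax : IsGreatest {m | ∃ H : HGraph r, H.verts.card = n ∧ ¬ (FF r).HasMatching H (t+1) ∧ H.edges.card = m}
        ((completeOn r (Finset.range t)).join G).edges.card := by
      refine ⟨⟨_, j1, j2, rfl⟩, ?_⟩
      rintro m ⟨H, h1, h2, rfl⟩
      have := hup' H h1 h2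
      omega
    unfold exMatchN
    rw [hmax.csSup_eq]
    omega
  intro H
  constructor
  · rintro ⟨h1, h2, h3⟩
    obtain ⟨L, l1, l2, l3, l4, l5, l6⟩ := hup H (by rw [h1]; exact hn) t (by rw [h1]; exact ht) h2 (by rw [h1]; omega)
    obtain ⟨G, g1, g2, g3, g4, g5⟩ := str_iso hr H L l1 l2 l3 l6
    rw [h1] at g1 l4
    refine ⟨G, g1, g2, g3, fun G' h h' => ?_, g5⟩
    have := sb_le hr h'
    rw [h] at this
    omega
  · rintro ⟨G, g1, g2, g3, g4, f, hf, hE⟩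
    have he : G.edges.card = Smax r (n - t) := by
      refine le_antisymm (by have := sb_le hr g3; rwa [g1] at this) ?_
      obtain ⟨G', a1, a2, a3⟩ := sb_ex hr (Finset.range (n - t))
      have := g4 G' (by rw [a1, Finset.card_range]) a2
      rwa [a3, Finset.card_range] at this
    obtain ⟨j1, j2, j3⟩ := joinStr hr htn G g1 g2 g3 he
    have h1 : H.verts.card = n := (iso_card hf).trans j1
    have h2 : ¬ (FF r).HasMatching H (t + 1) := fun hm => j2 (iso_matching hf hE hm)
    refine ⟨h1, h2, ?_⟩
    have := hup' H h1 h2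
    have := iso_edges hf hE
    omega

/-- the density Corrádi–Hajnal theorem for the expansion of the
`r`-uniform matching of size two; `S_r(n−t)` is characterized as a maximum
semibipartite `r`-graph on `n − t` vertices. -/
theorem statement_13 (r : ℕ) (hr : 4 ≤ r) :
    ∃ N₀ : ℕ, ∃ c : ℝ, 0 < c ∧ ∀ n : ℕ, N₀ ≤ n → ∀ t : ℕ, (t : ℝ) ≤ c * n →
      ∀ H : HGraph r, IsExtremalMatchingFree r n t (matching2 r).expansion H ↔
        ∃ G : HGraph r, G.verts.card = n - t ∧ Disjoint G.verts (Finset.range t) ∧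
          Semibipartite r G ∧
          (∀ G' : HGraph r, G'.verts.card = n - t → Semibipartite r G' →
            G'.edges.card ≤ G.edges.card) ∧
          H.Iso ((completeOn r (Finset.range t)).join G) := by
  exact final r hr

end DensityCH
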